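/- Let (X,d,m) be an mm-space with supp m = X such that (X,d) is a non-branching geodesic space. (i) If (X,d,m) satisfies CD(0,N) locally for some N ∈ (1,∞), then it satisfies CD(0,N) globally. (ii) If (X,d,m) satisfies CD(K,∞) locally for some K ∈ ℝ, then it satisfies CD(K,∞) globally. -/

import Mathlib

open MeasureTheory Filter Set Topology ENNReal
open scoped Classical

noncomputable section

/-- A coupling of two measures. -/
def IsCoupling {α β : Type*} [MeasurableSpace α] [MeasurableSpace β]
    (q : Measure (α × β)) (μ : Measure α) (ν : Measure β) : Prop :=
  Measure.map Prod.fst q = μ ∧ Measure.map Prod.snd q = ν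

/-- Membership in the Wasserstein space `P₂`. -/
def MemP2 {α : Type*} [MetricSpace α] [MeasurableSpace α] (μ : Measure α) : Prop :=
  IsProbabilityMeasure μ ∧ ∃ x₀ : α, ∫⁻ x, edist x x₀ ^ 2 ∂μ < ∞

/-- The squared Kantorovich–Wasserstein distance. -/
def Wsq {α : Type*} [MetricSpace α] [MeasurableSpace α] (μ ν : Measure α) : ℝ≥0∞ :=
  ⨅ (q : Measure (α × α)) (_ : IsCoupling q μ ν), ∫⁻ p, edist p.1 p.2 ^ 2 ∂q

/-- The Kantorovich–Wasserstein distance `W₂`. -/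
def W2 {α : Type*} [MetricSpace α] [MeasurableSpace α] (μ ν : Measure α) : ℝ≥0∞ :=
  Wsq μ ν ^ (1/2 : ℝ)

/-- A `W₂`-geodesic parametrized by `[0,1]`. -/
def IsW2Geodesic {α : Type*} [MetricSpace α] [MeasurableSpace α] (μ : ℝ → Measure α) : Prop :=
  ∀ s ∈ Icc (0:ℝ) 1, ∀ t ∈ Icc (0:ℝ) 1,
    W2 (μ s) (μ t) = ENNReal.ofReal |s - t| * W2 (μ 0) (μ 1)

/-- Integrand of the Boltzmann entropy. -/
def entFun {α : Type*} [MeasurableSpace α] (μ m : Measure α) (x : α) : ℝ :=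
  (μ.rnDeriv m x).toReal * Real.log (μ.rnDeriv m x).toReal

/-- Boltzmann entropy `Ent(μ|m)`. -/
def Ent {α : Type*} [MeasurableSpace α] (μ m : Measure α) : EReal :=
  if μ ≪ m ∧ Integrable (fun x => max (entFun μ m x) 0) m then
    ((∫ x, max (entFun μ m x) 0 ∂m : ℝ) : EReal)
      - ((∫⁻ x, ENNReal.ofReal (-(entFun μ m x)) ∂m : ℝ≥0∞) : EReal)
  else ⊤

/-- The CD(K,∞) convexity inequality along some geodesic from `μ₀` to `μ₁`. -/
def CDinftyFor {α : Type*} [MetricSpace α] [MeasurableSpace α]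
    (K : ℝ) (m μ₀ μ₁ : Measure α) : Prop :=
  ∃ μ : ℝ → Measure α, μ 0 = μ₀ ∧ μ 1 = μ₁ ∧ IsW2Geodesic μ ∧
    ∀ t ∈ Icc (0:ℝ) 1,
      Ent (μ t) m ≤ ((1 - t : ℝ) : EReal) * Ent μ₀ m + ((t : ℝ) : EReal) * Ent μ₁ m
        - ((K/2 * (t * (1-t)) : ℝ) : EReal) * ((Wsq μ₀ μ₁ : ℝ≥0∞) : EReal)

/-- The curvature-dimension condition CD(K,∞). -/
def CDinfty {α : Type*} [MetricSpace α] [MeasurableSpace α] (K : ℝ) (m : Measure α) : Prop :=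
  ∀ μ₀ μ₁ : Measure α, MemP2 μ₀ → MemP2 μ₁ → CDinftyFor K m μ₀ μ₁

/-- Distortion coefficients `τ^{(t)}_{K,N}(θ)`. -/
def tauCoef (K N t θ : ℝ) : ℝ≥0∞ :=
  if 0 < K then
    if Real.pi * Real.sqrt ((N-1)/K) ≤ θ then ∞
    else ENNReal.ofReal (t ^ (1/N) *
      (Real.sin (Real.sqrt (K/(N-1)) * (t * θ)) / Real.sin (Real.sqrt (K/(N-1)) * θ)) ^ ((N-1)/N))
  else if K = 0 then ENNReal.ofReal t
  else ENNReal.ofReal (t ^ (1/N) *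
      (Real.sinh (Real.sqrt (-K/(N-1)) * (t * θ)) / Real.sinh (Real.sqrt (-K/(N-1)) * θ)) ^ ((N-1)/N))

/-- The CD(K,N) inequality along some geodesic/optimal coupling from `μ₀` to `μ₁`,
with distortion coefficients `coef`. -/
def CDForWith {α : Type*} [MetricSpace α] [MeasurableSpace α]
    (coef : ℝ → ℝ → ℝ≥0∞) (N : ℝ) (m μ₀ μ₁ : Measure α) : Prop :=
  ∃ (μ : ℝ → Measure α) (q : Measure (α × α)),
    μ 0 = μ₀ ∧ μ 1 = μ₁ ∧ IsW2Geodesic μ ∧ (∀ t ∈ Icc (0:ℝ) 1, μ t ≪ m) ∧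
    IsCoupling q μ₀ μ₁ ∧ (∫⁻ p, edist p.1 p.2 ^ 2 ∂q) = Wsq μ₀ μ₁ ∧
    ∀ t ∈ Icc (0:ℝ) 1,
      ∫⁻ x, ((μ t).rnDeriv m x) ^ (1 - 1/N : ℝ) ∂m ≥
      ∫⁻ p, coef (1-t) (dist p.1 p.2) * (μ₀.rnDeriv m p.1) ^ (-(1/N) : ℝ)
            + coef t (dist p.1 p.2) * (μ₁.rnDeriv m p.2) ^ (-(1/N) : ℝ) ∂q

def CDFor {α : Type*} [MetricSpace α] [MeasurableSpace α]
    (K N : ℝ) (m μ₀ μ₁ : Measure α) : Prop :=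
  CDForWith (fun t θ => tauCoef K N t θ) N m μ₀ μ₁

/-- The curvature-dimension condition CD(K,N). -/
def CD {α : Type*} [MetricSpace α] [MeasurableSpace α] (K N : ℝ) (m : Measure α) : Prop :=
  ∀ μ₀ μ₁ : Measure α, MemP2 μ₀ → MemP2 μ₁ → μ₀ ≪ m → μ₁ ≪ m → CDFor K N m μ₀ μ₁

/-- The support of a measure on a topological space. -/
def mmSupp {α : Type*} [TopologicalSpace α] [MeasurableSpace α] (μ : Measure α) : Set α :=
  {x | ∀ U ∈ nhds x, 0 < μ U}


/-- A constant-speed geodesic parametrized by `[0,1]`. -/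
def IsGeodCurve {α : Type*} [MetricSpace α] (γ : ℝ → α) : Prop :=
  ∀ s ∈ Icc (0:ℝ) 1, ∀ t ∈ Icc (0:ℝ) 1, dist (γ s) (γ t) = |s - t| * dist (γ 0) (γ 1)

/-- A geodesic metric space: any two points are joined by a constant-speed geodesic. -/
def GeodesicSpace (α : Type*) [MetricSpace α] : Prop :=
  ∀ x y : α, ∃ γ : ℝ → α, γ 0 = x ∧ γ 1 = y ∧ IsGeodCurve γ

/-- Non-branching: geodesics that coincide on `[0,1/2]` coincide on `[0,1]`. -/
def NonBranching (α : Type*) [MetricSpace α] : Prop :=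
  ∀ γ γ' : ℝ → α, IsGeodCurve γ → IsGeodCurve γ' →
    (∀ t ∈ Icc (0:ℝ) (1/2 : ℝ), γ t = γ' t) → ∀ t ∈ Icc (0:ℝ) 1, γ t = γ' t

/-- The local curvature-dimension condition CD(K,N): every point has a neighborhood `U`
such that the CD(K,N) inequality holds for all admissible measures supported in `U`. -/
def CDloc {α : Type*} [MetricSpace α] [MeasurableSpace α] (K N : ℝ) (m : Measure α) : Prop :=
  ∀ x : α, ∃ U ∈ nhds x, ∀ μ₀ μ₁ : Measure α, MemP2 μ₀ → MemP2 μ₁ → μ₀ ≪ m → μ₁ ≪ m →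
    μ₀ Uᶜ = 0 → μ₁ Uᶜ = 0 → CDFor K N m μ₀ μ₁

/-- The local curvature-dimension condition CD(K,∞). -/
def CDinftyLoc {α : Type*} [MetricSpace α] [MeasurableSpace α] (K : ℝ) (m : Measure α) : Prop :=
  ∀ x : α, ∃ U ∈ nhds x, ∀ μ₀ μ₁ : Measure α, MemP2 μ₀ → MemP2 μ₁ →
    μ₀ Uᶜ = 0 → μ₁ Uᶜ = 0 → CDinftyFor K m μ₀ μ₁

set_option linter.all false

/-- Weak convergence of a sequence of measures along the hyperfilter. -/
def WLim {Z : Type*} [TopologicalSpace Z] [MeasurableSpace Z] (μ : ℕ → Measure Z)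
    (ν : Measure Z) : Prop :=
  ∀ f : BoundedContinuousFunction Z NNReal,
    Tendsto (fun k => ∫⁻ x, f x ∂(μ k)) (hyperfilter ℕ : Filter ℕ) (𝓝 (∫⁻ x, f x ∂ν))

lemma hyper_le_atTop : (hyperfilter ℕ : Filter ℕ) ≤ atTop := Nat.hyperfilter_le_atTop

lemma exists_wlim {Z : Type*} [TopologicalSpace Z] [T2Space Z] [NormalSpace Z]
    [MeasurableSpace Z] [BorelSpace Z] (μ : ℕ → Measure Z) [∀ k, IsFiniteMeasure (μ k)]
    (M : NNReal) (hM : ∀ k, μ k univ = M) (ht : IsTightMeasureSet (range μ)) :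
    ∃ ν : Measure Z, IsFiniteMeasure ν ∧ ν univ = M ∧ WLim μ ν := by
  obtain ⟨u, -, u_pos, u_lim⟩ :
      ∃ u : ℕ → NNReal, StrictAnti u ∧ (∀ n, 0 < u n) ∧ Tendsto u atTop (𝓝 0) :=
    exists_seq_strictAnti_tendsto 0
  have A : ∀ n, ∃ (K : Set Z), IsCompact K ∧ ∀ k, μ k Kᶜ ≤ u n := by
    intro n
    rcases isTightMeasureSet_iff_exists_isCompact_measure_compl_le.1 ht (u n)
      (by norm_cast; exact u_pos n) with ⟨K, K_comp, hK⟩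
    exact ⟨K, K_comp, fun k => hK _ ⟨k, rfl⟩⟩
  choose K hK hKu using A
  have hc := isCompact_setOfPred_finiteMeasure_mass_eq_compl_isCompact_le M u_lim hK
    (Or.inl inferInstance)
  let ν : ℕ → FiniteMeasure Z := fun k => ⟨μ k, inferInstance⟩
  have hmem : ∀ k, ν k ∈ {μ : FiniteMeasure Z | μ.mass = M ∧ ∀ n, μ (K n)ᶜ ≤ u n} := by
    intro k
    refine ⟨?_, fun n => ?_⟩
    · have := hM k
      apply ENNReal.coe_injective
      rw [FiniteMeasure.ennreal_mass]; exact this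
    · have := hKu n k
      apply ENNReal.coe_le_coe.1
      rw [FiniteMeasure.ennreal_coeFn_eq_coeFn_toMeasure]
      exact this
  obtain ⟨a, ha, hlim⟩ := hc.ultrafilter_le_nhds ((hyperfilter ℕ).map ν)
    (by
      rw [Ultrafilter.coe_map, le_principal_iff, mem_map]
      exact univ_mem' hmem)
  refine ⟨a, inferInstance, ?_, ?_⟩
  · rw [← FiniteMeasure.ennreal_mass, ha.1]
  · have h2 : Tendsto ν (hyperfilter ℕ : Filter ℕ) (𝓝 a) := hlim
    exact FiniteMeasure.tendsto_iff_forall_lintegral_tendsto.1 h2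

lemma WLim.map {Z Y : Type*} [TopologicalSpace Z] [MeasurableSpace Z] [BorelSpace Z]
    [TopologicalSpace Y] [MeasurableSpace Y] [BorelSpace Y]
    {μ : ℕ → Measure Z} {ν : Measure Z} (h : WLim μ ν) {g : Z → Y} (hg : Continuous g) :
    WLim (fun k => (μ k).map g) (ν.map g) := by
  intro f
  have := h (f.compContinuous ⟨g, hg⟩)
  simp only [BoundedContinuousFunction.compContinuous_apply, ContinuousMap.coe_mk] at this
  have hf : Measurable fun x => (f x : ℝ≥0∞) := by
    have := f.continuous.measurable
    fun_prop
  simp_rw [lintegral_map hf hg.measurable]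
  exact this

lemma WLim.eq {Z : Type*} [TopologicalSpace Z] [HasOuterApproxClosed Z] [MeasurableSpace Z]
    [BorelSpace Z] {μ : ℕ → Measure Z} {ν ν' : Measure Z} [IsFiniteMeasure ν]
    (h : WLim μ ν) (h' : WLim μ ν') : ν = ν' := by
  apply ext_of_forall_lintegral_eq_of_IsFiniteMeasure
  intro f
  exact tendsto_nhds_unique (h f) (h' f)

lemma WLim.const {Z : Type*} [TopologicalSpace Z] [MeasurableSpace Z] (ν : Measure Z) :
    WLim (fun _ => ν) ν := fun _ => tendsto_const_nhds

/-- lower semicontinuity for continuous nonnegative integrands -/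
lemma WLim.lintegral_le {Z : Type*} [TopologicalSpace Z] [MeasurableSpace Z] [BorelSpace Z]
    {μ : ℕ → Measure Z} {ν : Measure Z} (h : WLim μ ν) (g : Z → NNReal) (hg : Continuous g)
    {c : ℕ → ℝ≥0∞} {c0 : ℝ≥0∞} (hc : Tendsto c (hyperfilter ℕ : Filter ℕ) (𝓝 c0))
    (hle : ∀ k, ∫⁻ x, g x ∂(μ k) ≤ c k) : ∫⁻ x, g x ∂ν ≤ c0 := by
  have key : ∀ n : ℕ, ∫⁻ x, (min (g x) n : NNReal) ∂ν ≤ c0 := by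
    intro n
    let f : BoundedContinuousFunction Z NNReal :=
      BoundedContinuousFunction.mkOfBound ⟨fun x => min (g x) n, by fun_prop⟩ n (fun x y => by
        rw [NNReal.dist_eq, abs_le]
        have h1 : ((min (g x) n : NNReal) : ℝ) ≤ n := by exact_mod_cast min_le_right (g x) n
        have h2 : ((min (g y) n : NNReal) : ℝ) ≤ n := by exact_mod_cast min_le_right (g y) n
        have h3 := (min (g x) n : NNReal).coe_nonneg
        have h4 := (min (g y) n : NNReal).coe_nonneg
        simp only [ContinuousMap.coe_mk]
        constructor <;> linarith)
    refine le_of_tendsto_of_tendsto (h f) hc (Eventually.of_forall fun k => ?_)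
    refine le_trans (lintegral_mono fun x => ?_) (hle k)
    exact ENNReal.coe_le_coe.2 (min_le_left _ _)
  have : ∫⁻ x, g x ∂ν = ⨆ n : ℕ, ∫⁻ x, (min (g x) n : NNReal) ∂ν := by
    rw [← lintegral_iSup]
    · congr 1; ext x
      apply le_antisymm
      · obtain ⟨n, hn⟩ := exists_nat_ge (g x)
        refine le_iSup_of_le n ?_
        rw [min_eq_left hn]
      · exact iSup_le fun n => ENNReal.coe_le_coe.2 (min_le_left _ _)
    · intro n
      have := hg.measurable
      fun_prop
    · intro a b hab x
      exact ENNReal.coe_le_coe.2 (min_le_min_left _ (by exact_mod_cast hab))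
  rw [this]
  exact iSup_le key

lemma WLim.conc {Z : Type*} [PseudoMetricSpace Z] [MeasurableSpace Z] [BorelSpace Z]
    {μ : ℕ → Measure Z} {ν : Measure Z} (h : WLim μ ν) {F : Set Z} (hF : IsClosed F)
    (hk : ∀ k, μ k Fᶜ = 0) : ν Fᶜ = 0 := by
  rcases F.eq_empty_or_nonempty with rfl | hne
  · simp only [compl_empty] at hk ⊢
    have h1 := h.lintegral_le (fun _ => 1) continuous_const (c := fun _ => 0) (c0 := 0)
      tendsto_const_nhds (fun k => by simp [hk k])
    simpa using h1
  have h1 := h.lintegral_le (fun x => Real.toNNReal (Metric.infDist x F))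
    (continuous_real_toNNReal.comp (Metric.continuous_infDist_pt F)) (c := fun _ => 0) (c0 := 0)
      tendsto_const_nhds (fun k => by
        rw [nonpos_iff_eq_zero]
        refine lintegral_eq_zero_of_ae_eq_zero ?_
        have : ∀ᵐ x ∂(μ k), x ∈ F := by rw [ae_iff]; exact hk k
        filter_upwards [this] with x hx
        simp [Metric.infDist_zero_of_mem hx])
  rw [nonpos_iff_eq_zero, lintegral_eq_zero_iff] at h1
  · have h2 : ∀ᵐ x ∂ν, x ∈ F := by
      filter_upwards [h1] with x hx
      simp only [Pi.zero_apply, ENNReal.coe_eq_zero, Real.toNNReal_eq_zero] at hx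
      rw [hF.mem_iff_infDist_zero hne]
      exact le_antisymm hx Metric.infDist_nonneg
    rw [ae_iff] at h2; exact h2
  · have := (Metric.continuous_infDist_pt F).measurable
    fun_prop

section coupling
open ProbabilityTheory

variable {α β γ : Type*} [MeasurableSpace α] [MeasurableSpace β] [MeasurableSpace γ]

lemma IsCoupling.mass {q : Measure (α × β)} {μ : Measure α} {ν : Measure β}
    (h : IsCoupling q μ ν) : q univ = μ univ := by
  rw [← h.1, Measure.map_apply measurable_fst MeasurableSet.univ, preimage_univ]

lemma IsCoupling.mass' {q : Measure (α × β)} {μ : Measure α} {ν : Measure β}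
    (h : IsCoupling q μ ν) : q univ = ν univ := by
  rw [← h.2, Measure.map_apply measurable_snd MeasurableSet.univ, preimage_univ]

lemma IsCoupling.finite {q : Measure (α × β)} {μ : Measure α} {ν : Measure β}
    [IsFiniteMeasure μ] (h : IsCoupling q μ ν) : IsFiniteMeasure q :=
  ⟨by rw [h.mass]; exact measure_lt_top _ _⟩

lemma IsCoupling.add {q q' : Measure (α × β)} {μ μ' : Measure α} {ν ν' : Measure β}
    (h : IsCoupling q μ ν) (h' : IsCoupling q' μ' ν') : IsCoupling (q + q') (μ + μ') (ν + ν') :=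
  ⟨by rw [Measure.map_add _ _ measurable_fst, h.1, h'.1],
    by rw [Measure.map_add _ _ measurable_snd, h.2, h'.2]⟩

lemma IsCoupling.sum {ι : Type*} {q : ι → Measure (α × β)} {μ : ι → Measure α}
    {ν : ι → Measure β} (h : ∀ i, IsCoupling (q i) (μ i) (ν i)) :
    IsCoupling (Measure.sum q) (Measure.sum μ) (Measure.sum ν) :=
  ⟨by rw [Measure.map_sum measurable_fst.aemeasurable]; simp_rw [(h _).1],
    by rw [Measure.map_sum measurable_snd.aemeasurable]; simp_rw [(h _).2]⟩

lemma IsCoupling.smul {q : Measure (α × β)} {μ : Measure α} {ν : Measure β}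
    (h : IsCoupling q μ ν) (c : ℝ≥0∞) : IsCoupling (c • q) (c • μ) (c • ν) :=
  ⟨by rw [Measure.map_smul, h.1], by rw [Measure.map_smul, h.2]⟩

lemma IsCoupling.swap {q : Measure (α × β)} {μ : Measure α} {ν : Measure β}
    (h : IsCoupling q μ ν) : IsCoupling (q.map Prod.swap) ν μ :=
  ⟨by rw [Measure.map_map measurable_fst measurable_swap]; exact h.2,
    by rw [Measure.map_map measurable_snd measurable_swap]; exact h.1⟩

/-- Gluing of plans. -/
lemma exists_glue [StandardBorelSpace γ] [Nonempty γ] (q₁ : Measure (α × β))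
    (q₂ : Measure (β × γ)) [IsFiniteMeasure q₁] [IsFiniteMeasure q₂]
    (h : q₁.map Prod.snd = q₂.map Prod.fst) :
    ∃ T : Measure (α × β × γ), T.map (fun p => (p.1, p.2.1)) = q₁ ∧ T.map Prod.snd = q₂ := by
  let κ : Kernel (α × β) γ := q₂.condKernel.comap Prod.snd measurable_snd
  let S : Measure ((α × β) × γ) := q₁ ⊗ₘ κ
  have hS1 : S.map Prod.fst = q₁ := by
    have := Measure.fst_compProd q₁ κ
    exact this
  have hS2 : S.map (fun p => (p.1.2, p.2)) = q₂ := by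
    have hd : q₂.fst ⊗ₘ q₂.condKernel = q₂ := q₂.disintegrate q₂.condKernel
    ext s hs
    rw [Measure.map_apply (by fun_prop) hs, Measure.compProd_apply ((by fun_prop : Measurable
      fun p : (α × β) × γ => (p.1.2, p.2)) hs)]
    conv_rhs => rw [← hd, Measure.compProd_apply hs, Measure.fst, ← h,
      lintegral_map (Kernel.measurable_kernel_prodMk_left hs) measurable_snd]
    rfl
  refine ⟨S.map MeasurableEquiv.prodAssoc, ?_, ?_⟩
  · rw [Measure.map_map (by fun_prop) (MeasurableEquiv.measurable _)]
    exact hS1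
  · rw [Measure.map_map (by fun_prop) (MeasurableEquiv.measurable _)]
    exact hS2

end coupling

section wsq
variable {X : Type*} [MetricSpace X] [MeasurableSpace X]

lemma Wsq_le {μ ν : Measure X} {q : Measure (X × X)} (h : IsCoupling q μ ν) :
    Wsq μ ν ≤ ∫⁻ p, edist p.1 p.2 ^ 2 ∂q := iInf₂_le q h

lemma Wsq_zero : Wsq (0 : Measure X) 0 = 0 := by
  have := Wsq_le (μ := (0 : Measure X)) (ν := 0) (q := 0) ⟨by simp, by simp⟩
  simpa using this

lemma W2_sq (μ ν : Measure X) : W2 μ ν ^ 2 = Wsq μ ν := by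
  rw [W2, ← ENNReal.rpow_natCast, ← ENNReal.rpow_mul]; norm_num

lemma W2_le_iff {μ ν μ' ν' : Measure X} {c : ℝ≥0∞} :
    W2 μ ν ≤ c * W2 μ' ν' ↔ Wsq μ ν ≤ c ^ 2 * Wsq μ' ν' := by
  rw [← W2_sq, ← W2_sq, ← mul_pow]
  exact ((ENNReal.pow_right_strictMono (n := 2) (by norm_num)).le_iff_le).symm


variable [SecondCountableTopology X] [BorelSpace X]

lemma meas_cost : Measurable fun p : X × X => edist p.1 p.2 ^ 2 :=
  (measurable_fst.edist measurable_snd).pow_const 2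

lemma cost_swap (q : Measure (X × X)) :
    ∫⁻ p, edist p.1 p.2 ^ 2 ∂(q.map Prod.swap) = ∫⁻ p, edist p.1 p.2 ^ 2 ∂q := by
  rw [lintegral_map meas_cost measurable_swap]
  simp [edist_comm]

lemma Wsq_symm (μ ν : Measure X) : Wsq μ ν = Wsq ν μ := by
  have h : ∀ μ ν : Measure X, Wsq μ ν ≤ Wsq ν μ := by
    intro μ ν
    refine le_iInf₂ fun q hq => ?_
    rw [← cost_swap]
    exact Wsq_le hq.swap
  exact le_antisymm (h _ _) (h _ _)

lemma W2_symm (μ ν : Measure X) : W2 μ ν = W2 ν μ := by rw [W2, W2, Wsq_symm]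

lemma Wsq_self (μ : Measure X) : Wsq μ μ = 0 := by
  have h : IsCoupling (μ.map (fun x => (x, x))) μ μ :=
    ⟨by rw [Measure.map_map (by fun_prop) (by fun_prop)]; exact Measure.map_id,
      by rw [Measure.map_map (by fun_prop) (by fun_prop)]; exact Measure.map_id⟩
  have := Wsq_le h
  rw [lintegral_map meas_cost (by fun_prop)] at this
  simpa using this

variable [CompleteSpace X]

lemma tight_single (μ : Measure X) [IsFiniteMeasure μ] : IsTightMeasureSet {μ} :=
  isTightMeasureSet_singleton

/-- limits of couplings -/
lemma coupling_limit {μ ν : ℕ → Measure X} {q : ℕ → Measure (X × X)}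
    [∀ k, IsFiniteMeasure (μ k)] (M : NNReal)
    (hq : ∀ k, IsCoupling (q k) (μ k) (ν k)) (hM : ∀ k, μ k univ = M)
    (hμ : IsTightMeasureSet (range μ)) (hν : IsTightMeasureSet (range ν))
    {c : ℕ → ℝ≥0∞} {c0 : ℝ≥0∞} (hc : Tendsto c (hyperfilter ℕ : Filter ℕ) (𝓝 c0))
    (hle : ∀ k, ∫⁻ p, edist p.1 p.2 ^ 2 ∂(q k) ≤ c k) :
    ∃ (μ' ν' : Measure X) (q' : Measure (X × X)), IsFiniteMeasure q' ∧ WLim μ μ' ∧ WLim ν ν' ∧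
      IsCoupling q' μ' ν' ∧ ∫⁻ p, edist p.1 p.2 ^ 2 ∂q' ≤ c0 := by
  haveI : ∀ k, IsFiniteMeasure (q k) := fun k => (hq k).finite
  have ht : IsTightMeasureSet (range q) := by
    apply IsTightMeasureSet.prodMk
    · refine hμ.subset ?_
      rintro _ ⟨_, ⟨k, rfl⟩, rfl⟩
      exact ⟨k, (hq k).1.symm⟩
    · refine hν.subset ?_
      rintro _ ⟨_, ⟨k, rfl⟩, rfl⟩
      exact ⟨k, (hq k).2.symm⟩
  obtain ⟨q', hfin, hmass, hlim⟩ := exists_wlim q M (fun k => by rw [(hq k).mass, hM k]) ht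
  refine ⟨q'.map Prod.fst, q'.map Prod.snd, q', hfin, ?_, ?_, ⟨rfl, rfl⟩, ?_⟩
  · have := hlim.map continuous_fst
    simp_rw [(hq _).1] at this; exact this
  · have := hlim.map continuous_snd
    simp_rw [(hq _).2] at this; exact this
  · have h1 := hlim.lintegral_le (fun p => nndist p.1 p.2 ^ 2) (by fun_prop) hc
      (fun k => by
        refine le_trans (le_of_eq ?_) (hle k)
        refine lintegral_congr fun p => ?_
        rw [edist_nndist]; push_cast; rfl)
    refine le_trans (le_of_eq ?_) h1
    refine lintegral_congr fun p => ?_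
    rw [edist_nndist]; push_cast; rfl

lemma exists_coupling {μ ν : Measure X} [IsFiniteMeasure μ] [IsFiniteMeasure ν]
    (h : μ univ = ν univ) : ∃ q, IsCoupling q μ ν := by
  by_cases h0 : μ univ = 0
  · have h1 : μ = 0 := Measure.measure_univ_eq_zero.1 h0
    have h2 : ν = 0 := Measure.measure_univ_eq_zero.1 (h ▸ h0)
    exact ⟨0, by simp [h1], by simp [h2]⟩
  · have htop : μ univ ≠ ∞ := measure_ne_top _ _
    refine ⟨(μ univ)⁻¹ • (μ.prod ν), ?_, ?_⟩
    · rw [Measure.map_smul, Measure.map_fst_prod, ← h, smul_smul,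
        ENNReal.inv_mul_cancel h0 htop, one_smul]
    · rw [Measure.map_smul, Measure.map_snd_prod, smul_smul,
        ENNReal.inv_mul_cancel h0 htop, one_smul]

lemma exists_opt {μ ν : Measure X} [IsFiniteMeasure μ] [IsFiniteMeasure ν]
    (h : μ univ = ν univ) :
    ∃ q, IsCoupling q μ ν ∧ ∫⁻ p, edist p.1 p.2 ^ 2 ∂q = Wsq μ ν := by
  by_cases htop : Wsq μ ν = ∞
  · obtain ⟨q, hq⟩ := exists_coupling h
    exact ⟨q, hq, le_antisymm (by rw [htop]; exact le_top) (Wsq_le hq)⟩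
  have : ∀ k : ℕ, ∃ q, IsCoupling q μ ν ∧
      ∫⁻ p, edist p.1 p.2 ^ 2 ∂q ≤ Wsq μ ν + ((k : ℝ≥0∞) + 1)⁻¹ := by
    intro k
    have hlt : Wsq μ ν < Wsq μ ν + ((k : ℝ≥0∞) + 1)⁻¹ := by
      apply ENNReal.lt_add_right htop
      simp [ENNReal.add_eq_top]
    rw [Wsq, iInf_lt_iff] at hlt
    obtain ⟨q, hlt⟩ := hlt
    rw [iInf_lt_iff] at hlt
    obtain ⟨hq, hlt⟩ := hlt
    exact ⟨q, hq, hlt.le⟩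
  choose q hq hle using this
  have hM : μ univ = ((μ univ).toNNReal : ℝ≥0∞) := by simp
  have hc : Tendsto (fun k : ℕ => Wsq μ ν + ((k : ℝ≥0∞) + 1)⁻¹) (hyperfilter ℕ : Filter ℕ)
      (𝓝 (Wsq μ ν + 0)) := by
    refine Tendsto.mono_left (Tendsto.const_add _ ?_) hyper_le_atTop
    have := (tendsto_add_atTop_iff_nat 1).2 ENNReal.tendsto_inv_nat_nhds_zero
    simpa using this
  obtain ⟨μ', ν', q', hfin, h1, h2, h3, h4⟩ := coupling_limit (q := q) (μ := fun _ => μ)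
    (ν := fun _ => ν) _ hq (fun _ => hM) (by rw [range_const]; exact tight_single μ)
      (by rw [range_const]; exact tight_single ν) hc hle
  have e1 := (WLim.const μ).eq h1
  have e2 := (WLim.const ν).eq h2
  subst e1 e2
  rw [add_zero] at h4
  exact ⟨q', h3, le_antisymm h4 (Wsq_le h3)⟩

lemma Wsq_add_le {μ ν μ' ν' : Measure X} [IsFiniteMeasure μ] [IsFiniteMeasure ν]
    [IsFiniteMeasure μ'] [IsFiniteMeasure ν'] (h : μ univ = ν univ) (h' : μ' univ = ν' univ) :
    Wsq (μ + μ') (ν + ν') ≤ Wsq μ ν + Wsq μ' ν' := by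
  obtain ⟨q, hq, hc⟩ := exists_opt h
  obtain ⟨q', hq', hc'⟩ := exists_opt h'
  refine (Wsq_le (hq.add hq')).trans ?_
  rw [lintegral_add_measure, hc, hc']

lemma Wsq_sum_le {ι : Type*} {μ ν : ι → Measure X} [∀ i, IsFiniteMeasure (μ i)]
    [∀ i, IsFiniteMeasure (ν i)] (h : ∀ i, μ i univ = ν i univ) :
    Wsq (Measure.sum μ) (Measure.sum ν) ≤ ∑' i, Wsq (μ i) (ν i) := by
  choose q hq hc using fun i => exists_opt (h i)
  refine (Wsq_le (IsCoupling.sum hq)).trans ?_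
  rw [lintegral_sum_measure]
  simp_rw [hc]; exact le_rfl

lemma Wsq_eq_top_of_mass {μ ν : Measure X} (h : μ univ ≠ ν univ) : Wsq μ ν = ∞ := by
  rw [Wsq, iInf₂_eq_top]
  intro q hq
  exact absurd (hq.mass.symm.trans hq.mass') h

/-- triangle inequality -/
lemma W2_triangle (μ ν ρ : Measure X) [IsFiniteMeasure μ] [IsFiniteMeasure ν]
    [IsFiniteMeasure ρ] : W2 μ ρ ≤ W2 μ ν + W2 ν ρ := by
  by_cases h1 : μ univ = ν univ
  swap
  · simp [W2, Wsq_eq_top_of_mass h1]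
  by_cases h2 : ν univ = ρ univ
  swap
  · simp [W2, Wsq_eq_top_of_mass h2]
  obtain ⟨q, hq, hc⟩ := exists_opt h1
  obtain ⟨q', hq', hc'⟩ := exists_opt h2
  haveI := hq.finite
  haveI := hq'.finite
  rcases isEmpty_or_nonempty X with hX | hX
  · have e1 : μ = 0 := Measure.eq_zero_of_isEmpty μ
    have e2 : ρ = 0 := Measure.eq_zero_of_isEmpty ρ
    rw [e1, e2, W2, Wsq_zero]; simp
  obtain ⟨T, hT1, hT2⟩ := exists_glue q q' (by rw [hq.2, hq'.1])
  have hcpl : IsCoupling (T.map fun p => (p.1, p.2.2)) μ ρ := by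
    constructor
    · rw [Measure.map_map (by fun_prop) (by fun_prop), ← hq.1, ← hT1,
        Measure.map_map (by fun_prop) (by fun_prop)]; rfl
    · rw [Measure.map_map (by fun_prop) (by fun_prop), ← hq'.2, ← hT2,
        Measure.map_map (by fun_prop) (by fun_prop)]; rfl
  have h3 := Wsq_le hcpl
  rw [lintegral_map meas_cost (by fun_prop)] at h3
  have h4 := ENNReal.lintegral_Lp_add_le (μ := T) (f := fun p => edist p.1 p.2.1)
    (g := fun p => edist p.2.1 p.2.2) (by fun_prop) (by fun_prop) (p := 2) (by norm_num)
  simp only [W2]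
  have e1 : ∫⁻ p, (edist p.1 p.2.1) ^ (2:ℝ) ∂T = Wsq μ ν := by
    rw [← hc, ← hT1, lintegral_map meas_cost (by fun_prop)]; norm_num
  have e2 : ∫⁻ p, (edist p.2.1 p.2.2) ^ (2:ℝ) ∂T = Wsq ν ρ := by
    rw [← hc', ← hT2, lintegral_map meas_cost (by fun_prop)]; norm_num
  rw [e1, e2] at h4
  refine le_trans ?_ h4
  gcongr
  refine h3.trans (lintegral_mono fun p => ?_)
  simp only [Pi.add_apply]
  rw [ENNReal.rpow_ofNat]
  gcongr
  exact edist_triangle _ _ _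

end wsq

section geom
variable {X : Type*} [MetricSpace X]

lemma geod_rescale {γ : ℝ → X} (h : IsGeodCurve γ) {r : ℝ} (h0 : 0 ≤ r) (h1 : r ≤ 1) :
    IsGeodCurve (fun u => γ (r * u)) := by
  intro s hs t ht
  have m : ∀ u ∈ Icc (0:ℝ) 1, r * u ∈ Icc (0:ℝ) 1 := fun u hu =>
    ⟨mul_nonneg h0 hu.1, mul_le_one₀ h1 hu.1 hu.2⟩
  have e1 := h _ (m s hs) _ (m t ht)
  have e2 := h _ (m 0 ⟨le_rfl, zero_le_one⟩) _ (m 1 ⟨zero_le_one, le_rfl⟩)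
  simp only
  rw [e1, e2, ← mul_sub, abs_mul, abs_of_nonneg h0, mul_zero, mul_one, zero_sub, abs_neg,
    abs_of_nonneg h0]
  ring

lemma nb_ext (hnb : NonBranching X) {γ γ' : ℝ → X} (h : IsGeodCurve γ) (h' : IsGeodCurve γ')
    {t : ℝ} (ht : 0 < t) (heq : ∀ s ∈ Icc (0:ℝ) t, γ s = γ' s) :
    ∀ s ∈ Icc (0:ℝ) 1, γ s = γ' s := by
  have key : ∀ n : ℕ, ∀ s ∈ Icc (0:ℝ) 1, s ≤ 2 ^ n * t → γ s = γ' s := by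
    intro n
    induction n with
    | zero => intro s hs hst; exact heq s ⟨hs.1, by simpa using hst⟩
    | succ n ih =>
      intro s hs hst
      have hpos : 0 < 2 ^ (n+1) * t := by positivity
      set r := min (2 ^ (n+1) * t) 1 with hr
      have hr0 : 0 < r := lt_min hpos one_pos
      have hr1 : r ≤ 1 := min_le_right _ _
      have := hnb _ _ (geod_rescale h hr0.le hr1) (geod_rescale h' hr0.le hr1) (by
        intro u hu
        apply ih
        · exact ⟨mul_nonneg hr0.le hu.1, mul_le_one₀ hr1 hu.1 (by linarith [hu.2])⟩
        · have : r * u ≤ (2 ^ (n+1) * t) * (1/2) :=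
            mul_le_mul (min_le_left _ _) hu.2 hu.1 hpos.le
          rw [pow_succ] at this; linarith) (s / r) ⟨div_nonneg hs.1 hr0.le, by
            rw [div_le_one hr0]; exact le_min hst hs.2⟩
      simp only [mul_div_cancel₀ s hr0.ne'] at this
      exact this
  intro s hs
  obtain ⟨n, hn⟩ := exists_nat_gt (1 / t)
  apply key n s hs
  have h2 : (n : ℝ) ≤ 2 ^ n := by exact_mod_cast Nat.lt_two_pow_self.le
  have h3 : 1 ≤ 2 ^ n * t := by
    rw [div_lt_iff₀ ht] at hn
    nlinarith
  linarith [hs.2]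

/-- concatenation of geodesics -/
def gconcat (t : ℝ) (g h : ℝ → X) (s : ℝ) : X := if s ≤ t then g (s / t) else h ((s - t) / (1 - t))

lemma gconcat_geod {t : ℝ} (ht0 : 0 < t) (ht1 : t < 1) {g h : ℝ → X} (hg : IsGeodCurve g)
    (hh : IsGeodCurve h) (hgh : g 1 = h 0) {D : ℝ} (hD : dist (g 0) (h 1) = D)
    (h1 : dist (g 0) (g 1) = t * D) (h2 : dist (h 0) (h 1) = (1 - t) * D) :
    IsGeodCurve (gconcat t g h) := by
  have e0 : gconcat t g h 0 = g 0 := by simp [gconcat, ht0.le]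
  have e1 : gconcat t g h 1 = h 1 := by
    have : (1 - t) ≠ 0 := by linarith
    simp [gconcat, not_le.2 ht1, div_self this]
  have hle : ∀ s ∈ Icc (0:ℝ) 1, ∀ r ∈ Icc (0:ℝ) 1, s ≤ r →
      dist (gconcat t g h s) (gconcat t g h r) ≤ (r - s) * D := by
    intro s hs r hr hsr
    have t1 : 0 < 1 - t := by linarith
    by_cases c1 : r ≤ t
    · have c2 : s ≤ t := hsr.trans c1
      simp only [gconcat, c1, c2, if_true]
      rw [hg _ ⟨div_nonneg hs.1 ht0.le, (div_le_one ht0).2 c2⟩ _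
        ⟨div_nonneg hr.1 ht0.le, (div_le_one ht0).2 c1⟩, h1, ← sub_div, abs_div, abs_of_pos ht0,
        abs_sub_comm, abs_of_nonneg (by linarith)]
      apply le_of_eq; field_simp
    · by_cases c2 : s ≤ t
      · simp only [gconcat, c1, c2, if_true, if_false]
        have a1 := hg (s/t) ⟨div_nonneg hs.1 ht0.le, (div_le_one ht0).2 c2⟩ 1
          ⟨zero_le_one, le_rfl⟩
        push Not at c1
        have a2 := hh 0 ⟨le_rfl, zero_le_one⟩ ((r-t)/(1-t)) ⟨div_nonneg (by linarith) t1.le,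
          (div_le_one t1).2 (by linarith [hr.2])⟩
        have a3 := dist_triangle (g (s/t)) (g 1) (h ((r-t)/(1-t)))
        rw [a1, hgh, a2, ← hgh, h1, hgh, h2] at a3
        have b1 : |s/t - 1| * (t * D) = (t - s) * D := by
          rw [abs_sub_comm, abs_of_nonneg (by rw [sub_nonneg, div_le_one ht0]; exact c2)]
          field_simp
        have b2 : |0 - (r-t)/(1-t)| * ((1-t) * D) = (r - t) * D := by
          rw [zero_sub, abs_neg, abs_of_nonneg (div_nonneg (by linarith) t1.le)]
          field_simp
        rw [b1, b2] at a3
        linarith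
      · simp only [gconcat, c1, c2, if_false]
        push Not at c1 c2
        rw [hh _ ⟨div_nonneg (by linarith) t1.le, (div_le_one t1).2 (by linarith [hs.2])⟩ _
          ⟨div_nonneg (by linarith) t1.le, (div_le_one t1).2 (by linarith [hr.2])⟩, h2,
          ← sub_div, abs_div, abs_of_pos t1, abs_sub_comm, abs_of_nonneg (by linarith)]
        apply le_of_eq; field_simp; ring
  have heq : ∀ s ∈ Icc (0:ℝ) 1, ∀ r ∈ Icc (0:ℝ) 1, s ≤ r →
      dist (gconcat t g h s) (gconcat t g h r) = (r - s) * D := by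
    intro s hs r hr hsr
    refine le_antisymm (hle s hs r hr hsr) ?_
    have a1 := hle 0 ⟨le_rfl, zero_le_one⟩ s hs hs.1
    have a2 := hle r hr 1 ⟨zero_le_one, le_rfl⟩ hr.2
    have a3 := dist_triangle4 (gconcat t g h 0) (gconcat t g h s) (gconcat t g h r)
      (gconcat t g h 1)
    have a4 : dist (gconcat t g h 0) (gconcat t g h 1) = D := by rw [e0, e1, hD]
    linarith
  intro s hs r hr
  have a4 : dist (gconcat t g h 0) (gconcat t g h 1) = D := by rw [e0, e1, hD]
  rw [a4]
  rcases le_total s r with c | c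
  · rw [heq s hs r hr c, abs_sub_comm, abs_of_nonneg (by linarith)]
  · rw [dist_comm, heq r hr s hs c, abs_of_nonneg (by linarith)]

lemma nb_unique (hgeo : GeodesicSpace X) (hnb : NonBranching X) {t D : ℝ} (ht0 : 0 < t)
    (ht1 : t < 1) {x z y y' : X} (h1 : dist x z = t * D) (h2 : dist z y = (1 - t) * D)
    (h3 : dist z y' = (1 - t) * D) (h4 : dist x y = D) (h5 : dist x y' = D) : y = y' := by
  obtain ⟨g, g0, g1, hg⟩ := hgeo x z
  obtain ⟨h, h0, h1', hh⟩ := hgeo z y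
  obtain ⟨k, k0, k1, hk⟩ := hgeo z y'
  have c1 := gconcat_geod ht0 ht1 hg hh (by rw [g1, h0]) (D := D) (by rw [g0, h1', h4])
    (by rw [g0, g1, h1]) (by rw [h0, h1', h2])
  have c2 := gconcat_geod ht0 ht1 hg hk (by rw [g1, k0]) (D := D) (by rw [g0, k1, h5])
    (by rw [g0, g1, h1]) (by rw [k0, k1, h3])
  have := nb_ext hnb c1 c2 ht0 (fun s hs => by simp [gconcat, hs.2]) 1 ⟨zero_le_one, le_rfl⟩
  have hne : (1 - t) ≠ 0 := by linarith
  simpa [gconcat, not_le.2 ht1, div_self hne, h1', k1] using this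

lemma swap_le {t : ℝ} (ht0 : 0 < t) (ht1 : t < 1) {x z y x' y' : X}
    (h1 : dist x z = t * dist x y) (h2 : dist z y = (1 - t) * dist x y)
    (h3 : dist x' z = t * dist x' y') (h4 : dist z y' = (1 - t) * dist x' y') :
    dist x y' ^ 2 + dist x' y ^ 2 ≤ dist x y ^ 2 + dist x' y' ^ 2
      - 2 * t * (1 - t) * (dist x y - dist x' y') ^ 2 ∧
    dist x y' ≤ t * dist x y + (1 - t) * dist x' y' ∧
    dist x' y ≤ t * dist x' y' + (1 - t) * dist x y := by
  have a1 : dist x y' ≤ t * dist x y + (1 - t) * dist x' y' := by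
    rw [← h1, ← h4]; exact dist_triangle _ _ _
  have a2 : dist x' y ≤ t * dist x' y' + (1 - t) * dist x y := by
    rw [← h3, ← h2]; exact dist_triangle _ _ _
  refine ⟨?_, a1, a2⟩
  have b1 := pow_le_pow_left₀ dist_nonneg a1 2
  have b2 := pow_le_pow_left₀ dist_nonneg a2 2
  nlinarith

lemma swap_eq (hgeo : GeodesicSpace X) (hnb : NonBranching X) {t : ℝ} (ht0 : 0 < t) (ht1 : t < 1)
    {x z y x' y' : X}
    (h1 : dist x z = t * dist x y) (h2 : dist z y = (1 - t) * dist x y)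
    (h3 : dist x' z = t * dist x' y') (h4 : dist z y' = (1 - t) * dist x' y')
    (h : dist x y' ^ 2 + dist x' y ^ 2 = dist x y ^ 2 + dist x' y' ^ 2) : x = x' ∧ y = y' := by
  obtain ⟨a, a1, a2⟩ := swap_le ht0 ht1 h1 h2 h3 h4
  have hpos : 0 < 2 * t * (1 - t) := by
    have : 0 < 1 - t := by linarith
    positivity
  have hD : dist x y = dist x' y' := by
    have : (dist x y - dist x' y') ^ 2 ≤ 0 := by nlinarith [sq_nonneg (dist x y - dist x' y')]
    have := pow_eq_zero_iff (two_ne_zero) |>.1 (le_antisymm this (sq_nonneg _))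
    linarith
  have b1 : dist x y' ≤ dist x y := by rw [← hD] at a1; linarith
  have b2 : dist x' y ≤ dist x y := by rw [← hD] at a2; linarith
  rw [← hD] at h h3 h4
  have c0 := dist_nonneg (x := x) (y := y')
  have c1 := dist_nonneg (x := x') (y := y)
  have c2 : dist x y' = dist x y := by
    refine le_antisymm b1 (abs_le_of_sq_le_sq' ?_ c0).2
    nlinarith [pow_le_pow_left₀ c1 b2 2]
  have c3 : dist x' y = dist x y := by
    refine le_antisymm b2 (abs_le_of_sq_le_sq' ?_ c1).2
    nlinarith [pow_le_pow_left₀ c0 b1 2]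
  constructor
  · have e1 : dist y z = (1 - t) * dist x y := by rw [dist_comm, h2]
    refine nb_unique hgeo hnb (t := 1 - t) (D := dist x y) (x := y) (z := z) (by linarith)
      (by linarith) e1 ?_ ?_ (dist_comm _ _) (by rw [dist_comm, c3])
    · rw [dist_comm, h1]; ring
    · rw [dist_comm, h3]; ring
  · exact nb_unique hgeo hnb ht0 ht1 h1 h2 h4 rfl c2

end geom

section TP
variable {X : Type*} [MetricSpace X] [MeasurableSpace X] [SecondCountableTopology X] [BorelSpace X]
  [CompleteSpace X]

structure IsTPlan (t : ℝ) (T : Measure (X × X × X)) (μ ζ ν : Measure X) : Prop where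
  m1 : T.map (fun p => p.1) = μ
  m2 : T.map (fun p => p.2.1) = ζ
  m3 : T.map (fun p => p.2.2) = ν
  ex : ∀ᵐ p ∂T, dist p.1 p.2.1 = t * dist p.1 p.2.2 ∧ dist p.2.1 p.2.2 = (1 - t) * dist p.1 p.2.2
  co : ∫⁻ p, edist p.1 p.2.2 ^ 2 ∂T = Wsq μ ν

lemma three_alg {t a b D : ℝ} (ht0 : 0 < t) (ht1 : t < 1) (ha : 0 ≤ a) (hb : 0 ≤ b) (hD0 : 0 ≤ D)
    (hD : D ≤ a + b) :
    D ^ 2 ≤ t⁻¹ * a ^ 2 + (1 - t)⁻¹ * b ^ 2 ∧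
    (D ^ 2 = t⁻¹ * a ^ 2 + (1 - t)⁻¹ * b ^ 2 → a = t * D ∧ b = (1 - t) * D) := by
  have h1 : 0 < 1 - t := by linarith
  have key : t⁻¹ * a ^ 2 + (1 - t)⁻¹ * b ^ 2 - (a + b) ^ 2
      = ((1 - t) * a - t * b) ^ 2 * (t⁻¹ * (1 - t)⁻¹) := by field_simp; ring
  have hp : 0 < t⁻¹ * (1 - t)⁻¹ := by positivity
  have h2 : D ^ 2 ≤ (a + b) ^ 2 := by gcongr
  have h3 := mul_nonneg (sq_nonneg ((1 - t) * a - t * b)) hp.le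
  refine ⟨by linarith, fun h => ?_⟩
  have h4 : ((1 - t) * a - t * b) ^ 2 * (t⁻¹ * (1 - t)⁻¹) = 0 := by linarith
  have h5 : (1 - t) * a - t * b = 0 := by
    rcases mul_eq_zero.1 h4 with h | h
    · exact pow_eq_zero_iff (two_ne_zero) |>.1 h
    · exact absurd h hp.ne'
  have h6 : D ^ 2 = (a + b) ^ 2 := by rw [h4] at key; linarith
  have h7 : D = a + b := by
    rwa [sq_eq_sq₀ hD0 (by positivity)] at h6
  constructor <;> · rw [h7]; linarith

lemma exists_tplan {t : ℝ} (ht0 : 0 < t) (ht1 : t < 1) {μ ζ ν : Measure X} [IsFiniteMeasure μ]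
    [IsFiniteMeasure ζ] [IsFiniteMeasure ν] (hW : Wsq μ ν ≠ ∞)
    (h1 : Wsq μ ζ ≤ ENNReal.ofReal t ^ 2 * Wsq μ ν)
    (h2 : Wsq ζ ν ≤ ENNReal.ofReal (1 - t) ^ 2 * Wsq μ ν) : ∃ T, IsTPlan t T μ ζ ν := by
  rcases isEmpty_or_nonempty X with hX | hX
  · exact ⟨0, Subsingleton.elim _ _, Subsingleton.elim _ _, Subsingleton.elim _ _, by simp, by
      have : μ = 0 := Subsingleton.elim _ _
      have : ν = 0 := Subsingleton.elim _ _
      simp [*, Wsq_zero]⟩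
  have f1 : Wsq μ ζ ≠ ∞ := ne_top_of_le_ne_top (by finiteness) h1
  have f2 : Wsq ζ ν ≠ ∞ := ne_top_of_le_ne_top (by finiteness) h2
  have e1 : μ univ = ζ univ := by by_contra h; exact f1 (Wsq_eq_top_of_mass h)
  have e2 : ζ univ = ν univ := by by_contra h; exact f2 (Wsq_eq_top_of_mass h)
  obtain ⟨q1, c1, o1⟩ := exists_opt e1
  obtain ⟨q2, c2, o2⟩ := exists_opt e2
  haveI := c1.finite
  haveI := c2.finite
  obtain ⟨T, t1, t2⟩ := exists_glue q1 q2 (by rw [c1.2, c2.1])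
  have m1 : T.map (fun p => p.1) = μ := by
    rw [← c1.1, ← t1, Measure.map_map (by fun_prop) (by fun_prop)]; rfl
  have m2 : T.map (fun p => p.2.1) = ζ := by
    rw [← c1.2, ← t1, Measure.map_map (by fun_prop) (by fun_prop)]; rfl
  have m3 : T.map (fun p => p.2.2) = ν := by
    rw [← c2.2, ← t2, Measure.map_map (by fun_prop) (by fun_prop)]; rfl
  have hcp : IsCoupling (T.map (fun p => (p.1, p.2.2))) μ ν :=
    ⟨by rw [← m1, Measure.map_map (by fun_prop) (by fun_prop)]; rfl,
     by rw [← m3, Measure.map_map (by fun_prop) (by fun_prop)]; rfl⟩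
  have hle := Wsq_le hcp
  rw [lintegral_map meas_cost (by fun_prop)] at hle
  have i1 : ∫⁻ p, edist p.1 p.2.1 ^ 2 ∂T = Wsq μ ζ := by
    rw [← o1, ← t1, lintegral_map meas_cost (by fun_prop)]
  have i2 : ∫⁻ p, edist p.2.1 p.2.2 ^ 2 ∂T = Wsq ζ ν := by
    rw [← o2, ← t2, lintegral_map meas_cost (by fun_prop)]
  have h1t : 0 < 1 - t := by linarith
  have toR : ∀ x y z : X, ENNReal.ofReal t⁻¹ * edist x y ^ 2 + ENNReal.ofReal (1 - t)⁻¹ * edist y z ^ 2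
      = ENNReal.ofReal (t⁻¹ * dist x y ^ 2 + (1 - t)⁻¹ * dist y z ^ 2) := by
    intro x y z
    rw [ENNReal.ofReal_add (by positivity) (by positivity), ENNReal.ofReal_mul (by positivity),
      ENNReal.ofReal_mul (by positivity), edist_dist, edist_dist, ENNReal.ofReal_pow dist_nonneg,
      ENNReal.ofReal_pow dist_nonneg]
  have toR' : ∀ x y : X, edist x y ^ 2 = ENNReal.ofReal (dist x y ^ 2) := by
    intro x y
    rw [edist_dist, ENNReal.ofReal_pow dist_nonneg]
  have ub : ∫⁻ p, (ENNReal.ofReal t⁻¹ * edist p.1 p.2.1 ^ 2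
      + ENNReal.ofReal (1 - t)⁻¹ * edist p.2.1 p.2.2 ^ 2) ∂T ≤ Wsq μ ν := by
    rw [lintegral_add_left (by fun_prop), lintegral_const_mul _ (by fun_prop),
      lintegral_const_mul _ (by fun_prop), i1, i2]
    calc _ ≤ ENNReal.ofReal t⁻¹ * (ENNReal.ofReal t ^ 2 * Wsq μ ν) +
        ENNReal.ofReal (1 - t)⁻¹ * (ENNReal.ofReal (1 - t) ^ 2 * Wsq μ ν) := by gcongr
      _ = ENNReal.ofReal (t + (1 - t)) * Wsq μ ν := by
        rw [← mul_assoc, ← mul_assoc, ← add_mul, ← ENNReal.ofReal_pow (by positivity),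
          ← ENNReal.ofReal_pow (by positivity), ← ENNReal.ofReal_mul (by positivity),
          ← ENNReal.ofReal_mul (by positivity), ENNReal.ofReal_add (by positivity) (by positivity)]
        congr 4 <;> field_simp
      _ = _ := by simp
  have pw : ∀ p : X × X × X, edist p.1 p.2.2 ^ 2 ≤ ENNReal.ofReal t⁻¹ * edist p.1 p.2.1 ^ 2
      + ENNReal.ofReal (1 - t)⁻¹ * edist p.2.1 p.2.2 ^ 2 := by
    intro p
    rw [toR, toR']
    exact ENNReal.ofReal_le_ofReal (three_alg ht0 ht1 dist_nonneg dist_nonneg dist_nonneg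
      (dist_triangle _ _ _)).1
  have hco : ∫⁻ p, edist p.1 p.2.2 ^ 2 ∂T = Wsq μ ν :=
    le_antisymm ((lintegral_mono pw).trans ub) hle
  refine ⟨T, m1, m2, m3, ?_, hco⟩
  have := ae_eq_of_ae_le_of_lintegral_le (Eventually.of_forall pw) (by rw [hco]; exact hW)
    (by fun_prop) (by rw [hco]; exact ub)
  filter_upwards [this] with p hp
  rw [toR, toR', ENNReal.ofReal_eq_ofReal_iff (by positivity) (by positivity)] at hp
  exact (three_alg ht0 ht1 dist_nonneg dist_nonneg dist_nonneg (dist_triangle _ _ _)).2 hp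

lemma sub_lift {Y Z : Type*} [MeasurableSpace Y] [MeasurableSpace Z] {g : Y → Z} (hg : Measurable g)
    (T : Measure Y) [IsFiniteMeasure T] {σ : Measure Z} (h : σ ≤ T.map g) :
    ∃ T' ≤ T, T'.map g = σ := by
  have : IsFiniteMeasure (T.map g) := inferInstance
  have hσ : IsFiniteMeasure σ := ⟨(h univ).trans_lt (measure_lt_top _ _)⟩
  have hle := Measure.rnDeriv_le_one_of_le h
  have hac : σ ≪ T.map g := Measure.absolutelyContinuous_of_le h
  refine ⟨T.withDensity (fun y => σ.rnDeriv (T.map g) (g y)), ?_, ?_⟩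
  · have := ae_of_ae_map hg.aemeasurable hle
    conv_rhs => rw [← withDensity_one (μ := T)]
    exact withDensity_mono this
  · conv_rhs => rw [← Measure.withDensity_rnDeriv_eq _ _ hac]
    ext s hs
    rw [Measure.map_apply hg hs, withDensity_apply _ (hg hs), withDensity_apply _ hs,
      setLIntegral_map hs (Measure.measurable_rnDeriv _ _) hg]

set_option maxHeartbeats 1000000 in
lemma tplan_sing (hgeo : GeodesicSpace X) (hnb : NonBranching X) {t : ℝ} (ht0 : 0 < t) (ht1 : t < 1)
    {μ₁ ζ₁ ν₁ μ₂ ζ₂ ν₂ : Measure X} [IsFiniteMeasure μ₁] [IsFiniteMeasure μ₂]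
    {T₁ T₂ : Measure (X × X × X)}
    (h₁ : IsTPlan t T₁ μ₁ ζ₁ ν₁) (h₂ : IsTPlan t T₂ μ₂ ζ₂ ν₂)
    (hf : Wsq μ₁ ν₁ + Wsq μ₂ ν₂ ≠ ∞)
    (hW : Wsq μ₁ ν₁ + Wsq μ₂ ν₂ ≤ Wsq (μ₁ + μ₂) (ν₁ + ν₂))
    (hs : μ₁ ⟂ₘ μ₂ ∨ ν₁ ⟂ₘ ν₂) : ζ₁ ⟂ₘ ζ₂ := by
  rcases isEmpty_or_nonempty X with hX | hX
  · rw [Subsingleton.elim ζ₁ 0]; exact Measure.MutuallySingular.zero_left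
  haveI : IsFiniteMeasure T₁ := ⟨by
    have := congrArg (fun μ => μ univ) h₁.m1
    simp only [Measure.map_apply measurable_fst MeasurableSet.univ, preimage_univ] at this
    rw [this]; exact measure_lt_top _ _⟩
  haveI : IsFiniteMeasure T₂ := ⟨by
    have := congrArg (fun μ => μ univ) h₂.m1
    simp only [Measure.map_apply measurable_fst MeasurableSet.univ, preimage_univ] at this
    rw [this]; exact measure_lt_top _ _⟩
  haveI : IsFiniteMeasure ζ₁ := by rw [← h₁.m2]; infer_instance
  haveI : IsFiniteMeasure ζ₂ := by rw [← h₂.m2]; infer_instance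
  rw [Measure.mutuallySingular_iff_disjoint, disjoint_iff_inf_le]
  set σ := ζ₁ ⊓ ζ₂ with hσ
  obtain ⟨S₁, l₁, s₁⟩ := sub_lift (g := fun p : X × X × X => p.2.1) (by fun_prop) T₁ (σ := σ)
    (by rw [h₁.m2]; exact inf_le_left)
  obtain ⟨S₂, l₂, s₂⟩ := sub_lift (g := fun p : X × X × X => p.2.1) (by fun_prop) T₂ (σ := σ)
    (by rw [h₂.m2]; exact inf_le_right)
  haveI : IsFiniteMeasure S₁ := isFiniteMeasure_of_le _ l₁
  haveI : IsFiniteMeasure S₂ := isFiniteMeasure_of_le _ l₂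
  obtain ⟨Q₁, d₁⟩ : ∃ Q, Q + S₁ = T₁ := ⟨_, Measure.sub_add_cancel_of_le l₁⟩
  obtain ⟨Q₂, d₂⟩ : ∃ Q, Q + S₂ = T₂ := ⟨_, Measure.sub_add_cancel_of_le l₂⟩
  obtain ⟨Γ, g1, g2⟩ := exists_glue (S₁.map (fun p => ((p.1, p.2.2), p.2.1)))
    (S₂.map (fun p => (p.2.1, (p.1, p.2.2))))
    (by rw [Measure.map_map (by fun_prop) (by fun_prop), Measure.map_map (by fun_prop) (by fun_prop)]
        exact s₁.trans s₂.symm)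
  -- exactness
  have x1 : ∀ᵐ w ∂Γ, dist w.1.1 w.2.1 = t * dist w.1.1 w.1.2 ∧
      dist w.2.1 w.1.2 = (1 - t) * dist w.1.1 w.1.2 := by
    have a1 := ae_mono l₁ h₁.ex
    have a2 : ∀ᵐ w ∂(S₁.map (fun p : X × X × X => ((p.1, p.2.2), p.2.1))),
        dist w.1.1 w.2 = t * dist w.1.1 w.1.2 ∧ dist w.2 w.1.2 = (1 - t) * dist w.1.1 w.1.2 := by
      rw [ae_map_iff (by fun_prop)]
      · exact a1
      · apply MeasurableSet.inter <;> exact measurableSet_eq_fun (by fun_prop) (by fun_prop)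
    rw [← g1] at a2
    exact ae_of_ae_map (by fun_prop) a2
  have x2 : ∀ᵐ w ∂Γ, dist w.2.2.1 w.2.1 = t * dist w.2.2.1 w.2.2.2 ∧
      dist w.2.1 w.2.2.2 = (1 - t) * dist w.2.2.1 w.2.2.2 := by
    have a1 := ae_mono l₂ h₂.ex
    have a2 : ∀ᵐ w ∂(S₂.map (fun p : X × X × X => (p.2.1, (p.1, p.2.2)))),
        dist w.2.1 w.1 = t * dist w.2.1 w.2.2 ∧ dist w.1 w.2.2 = (1 - t) * dist w.2.1 w.2.2 := by
      rw [ae_map_iff (by fun_prop)]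
      · exact a1
      · apply MeasurableSet.inter <;> exact measurableSet_eq_fun (by fun_prop) (by fun_prop)
    rw [← g2] at a2
    exact ae_of_ae_map (by fun_prop) a2
  have k1 : ∀ f : X × X × X → X, Measurable f →
      Γ.map (fun w => f (w.1.1, w.2.1, w.1.2)) = S₁.map f := by
    intro f hf
    have := congrArg (Measure.map (fun w : (X × X) × X => f (w.1.1, w.2, w.1.2))) g1
    rw [Measure.map_map (by fun_prop) (by fun_prop), Measure.map_map (by fun_prop) (by fun_prop)] at this
    exact this
  have k2 : ∀ f : X × X × X → X, Measurable f →
      Γ.map (fun w => f (w.2.2.1, w.2.1, w.2.2.2)) = S₂.map f := by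
    intro f hf
    have := congrArg (Measure.map (fun w : X × (X × X) => f (w.2.1, w.1, w.2.2))) g2
    rw [Measure.map_map (by fun_prop) (by fun_prop), Measure.map_map (by fun_prop) (by fun_prop)] at this
    exact this
  have c1 : ∫⁻ w, edist w.1.1 w.1.2 ^ 2 ∂Γ = ∫⁻ p, edist p.1 p.2.2 ^ 2 ∂S₁ := by
    have := congrArg (fun μ => ∫⁻ w, edist w.1.1 w.1.2 ^ 2 ∂μ) g1
    rwa [lintegral_map (by fun_prop) (by fun_prop), lintegral_map (by fun_prop) (by fun_prop)] at this
  have c2 : ∫⁻ w, edist w.2.2.1 w.2.2.2 ^ 2 ∂Γ = ∫⁻ p, edist p.1 p.2.2 ^ 2 ∂S₂ := by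
    have := congrArg (fun μ => ∫⁻ w, edist w.2.1 w.2.2 ^ 2 ∂μ) g2
    rwa [lintegral_map (by fun_prop) (by fun_prop), lintegral_map (by fun_prop) (by fun_prop)] at this
  -- competitor
  have cp : IsCoupling (Q₁.map (fun p => (p.1, p.2.2)) + Q₂.map (fun p => (p.1, p.2.2))
      + (Γ.map (fun w => (w.1.1, w.2.2.2)) + Γ.map (fun w => (w.2.2.1, w.1.2)))) (μ₁ + μ₂) (ν₁ + ν₂) := by
    have hfst : ∀ {Y : Type _} [MeasurableSpace Y] (P : Measure Y) (f g : Y → X), Measurable f →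
        Measurable g → (P.map (fun y => (f y, g y))).map Prod.fst = P.map f := fun P f g hf hg => by
      rw [Measure.map_map measurable_fst (hf.prodMk hg)]; rfl
    have hsnd : ∀ {Y : Type _} [MeasurableSpace Y] (P : Measure Y) (f g : Y → X), Measurable f →
        Measurable g → (P.map (fun y => (f y, g y))).map Prod.snd = P.map g := fun P f g hf hg => by
      rw [Measure.map_map measurable_snd (hf.prodMk hg)]; rfl
    constructor
    · rw [Measure.map_add _ _ measurable_fst, Measure.map_add _ _ measurable_fst,
        Measure.map_add _ _ measurable_fst, hfst _ _ _ (by fun_prop) (by fun_prop),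
        hfst _ _ _ (by fun_prop) (by fun_prop), hfst _ _ _ (by fun_prop) (by fun_prop),
        hfst _ _ _ (by fun_prop) (by fun_prop),
        k1 (fun p => p.1) (by fun_prop), k2 (fun p => p.1) (by fun_prop), ← h₁.m1, ← h₂.m1]
      conv_rhs => rw [← d₁, ← d₂, Measure.map_add _ _ (by fun_prop), Measure.map_add _ _ (by fun_prop)]
      abel
    · rw [Measure.map_add _ _ measurable_snd, Measure.map_add _ _ measurable_snd,
        Measure.map_add _ _ measurable_snd, hsnd _ _ _ (by fun_prop) (by fun_prop),
        hsnd _ _ _ (by fun_prop) (by fun_prop), hsnd _ _ _ (by fun_prop) (by fun_prop),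
        hsnd _ _ _ (by fun_prop) (by fun_prop),
        k1 (fun p => p.2.2) (by fun_prop), k2 (fun p => p.2.2) (by fun_prop), ← h₁.m3, ← h₂.m3]
      conv_rhs => rw [← d₁, ← d₂, Measure.map_add _ _ (by fun_prop), Measure.map_add _ _ (by fun_prop)]
      abel
  have hle := hW.trans (Wsq_le cp)
  rw [lintegral_add_measure, lintegral_add_measure, lintegral_add_measure,
    lintegral_map meas_cost (by fun_prop), lintegral_map meas_cost (by fun_prop),
    lintegral_map meas_cost (by fun_prop), lintegral_map meas_cost (by fun_prop)] at hle
  have w1 : Wsq μ₁ ν₁ = ∫⁻ p, edist p.1 p.2.2 ^ 2 ∂Q₁ + ∫⁻ p, edist p.1 p.2.2 ^ 2 ∂S₁ := by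
    rw [← lintegral_add_measure, d₁, h₁.co]
  have w2 : Wsq μ₂ ν₂ = ∫⁻ p, edist p.1 p.2.2 ^ 2 ∂Q₂ + ∫⁻ p, edist p.1 p.2.2 ^ 2 ∂S₂ := by
    rw [← lintegral_add_measure, d₂, h₂.co]
  rw [w1, w2] at hle hf
  have hle2 : ∫⁻ p, edist p.1 p.2.2 ^ 2 ∂S₁ + ∫⁻ p, edist p.1 p.2.2 ^ 2 ∂S₂ ≤
      ∫⁻ w, edist w.1.1 w.2.2.2 ^ 2 ∂Γ + ∫⁻ w, edist w.2.2.1 w.1.2 ^ 2 ∂Γ := by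
    have hfin : ∫⁻ p, edist p.1 p.2.2 ^ 2 ∂Q₁ + ∫⁻ p, edist p.1 p.2.2 ^ 2 ∂Q₂ ≠ ∞ := by
      refine ne_top_of_le_ne_top hf ?_
      gcongr <;> exact le_self_add
    rw [add_add_add_comm] at hle
    exact (ENNReal.add_le_add_iff_left hfin).1 hle
  have hS : ∫⁻ p, edist p.1 p.2.2 ^ 2 ∂S₁ + ∫⁻ p, edist p.1 p.2.2 ^ 2 ∂S₂ ≠ ∞ := by
    refine ne_top_of_le_ne_top hf ?_
    gcongr <;> exact le_add_self
  rw [← c1, ← c2, ← lintegral_add_left (by fun_prop), ← lintegral_add_left (by fun_prop)] at hle2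
  rw [← c1, ← c2, ← lintegral_add_left (by fun_prop)] at hS
  have toR : ∀ x y z w : X, edist x y ^ 2 + edist z w ^ 2 = ENNReal.ofReal (dist x y ^ 2 + dist z w ^ 2) := by
    intro x y z w
    rw [ENNReal.ofReal_add (by positivity) (by positivity), ENNReal.ofReal_pow dist_nonneg,
      ENNReal.ofReal_pow dist_nonneg, edist_dist, edist_dist]
  have hpw : (fun w : (X × X) × X × (X × X) => edist w.1.1 w.2.2.2 ^ 2 + edist w.2.2.1 w.1.2 ^ 2) ≤ᵐ[Γ]
      fun w => edist w.1.1 w.1.2 ^ 2 + edist w.2.2.1 w.2.2.2 ^ 2 := by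
    filter_upwards [x1, x2] with w y1 y2
    rw [toR, toR]
    apply ENNReal.ofReal_le_ofReal
    have := (swap_le ht0 ht1 y1.1 y1.2 y2.1 y2.2).1
    have h1t : 0 < 1 - t := by linarith
    have : 0 ≤ 2 * t * (1 - t) * (dist w.1.1 w.1.2 - dist w.2.2.1 w.2.2.2) ^ 2 := by positivity
    linarith
  have heq := ae_eq_of_ae_le_of_lintegral_le hpw (ne_top_of_le_ne_top hS (lintegral_mono_ae hpw))
    (by fun_prop) hle2
  have fin : ∀ᵐ w ∂Γ, w.1.1 = w.2.2.1 ∧ w.1.2 = w.2.2.2 := by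
    filter_upwards [x1, x2, heq] with w y1 y2 y3
    rw [toR, toR, ENNReal.ofReal_eq_ofReal_iff (by positivity) (by positivity)] at y3
    exact swap_eq hgeo hnb ht0 ht1 y1.1 y1.2 y2.1 y2.2 y3
  have fz : ∀ {a b : Measure X}, a ⟂ₘ b → ∀ c, c ≤ a → c ≤ b → c = 0 := by
    intro a b hab c ca cb
    rw [Measure.mutuallySingular_iff_disjoint] at hab
    exact le_bot_iff.1 (hab ca cb)
  have hS0 : S₁ univ = 0 := by
    rcases hs with hs | hs
    · have e : S₁.map (fun p => p.1) = S₂.map (fun p => p.1) := by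
        rw [← k1 _ (by fun_prop), ← k2 _ (by fun_prop)]
        apply Measure.map_congr
        filter_upwards [fin] with w hw using hw.1
      have z := fz hs (S₁.map (fun p => p.1)) (by rw [← h₁.m1]; exact Measure.map_mono l₁ (by fun_prop))
        (by rw [e, ← h₂.m1]; exact Measure.map_mono l₂ (by fun_prop))
      have := congrArg (fun μ => μ univ) z
      simpa [Measure.map_apply measurable_fst MeasurableSet.univ] using this
    · have e : S₁.map (fun p => p.2.2) = S₂.map (fun p => p.2.2) := by
        rw [← k1 _ (by fun_prop), ← k2 _ (by fun_prop)]
        apply Measure.map_congr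
        filter_upwards [fin] with w hw using hw.2
      have z := fz hs (S₁.map (fun p => p.2.2)) (by rw [← h₁.m3]; exact Measure.map_mono l₁ (by fun_prop))
        (by rw [e, ← h₂.m3]; exact Measure.map_mono l₂ (by fun_prop))
      have := congrArg (fun μ => μ univ) z
      rw [Measure.map_apply (by fun_prop) MeasurableSet.univ] at this
      simpa using this
  have : σ = 0 := by
    rw [← s₁, Measure.measure_univ_eq_zero.1 hS0, Measure.map_zero]
  rw [this]; exact bot_le

end TP

structure UProp (U U' : ℝ → ℝ) : Prop where
  zero : U 0 = 0
  conv : ConvexOn ℝ (Ici 0) U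
  cont : Continuous U
  mix : ∀ l > 0, ∃ C ≥ 0, ∀ a ≥ 0, ∀ b ≥ 0, U (a + b) ≤ U a + U b + l * (1 + a) + C * b
  low : ∀ l > 0, ∃ C ≥ 0, ∀ b ≥ 0, -l - C * b ≤ U b
  tang : ∀ s > 0, ∀ r ≥ 0, U s + U' s * (r - s) ≤ U r
  contd : ContinuousOn U' (Ioi 0)
  d0 : Tendsto (fun δ => δ * U' δ) (𝓝[>] 0) (𝓝 0)
  dinf : ∀ ε > 0, ∀ᶠ M in atTop, -ε ≤ U' M

lemma UProp.sup {U U' : ℝ → ℝ} (hU : UProp U U') {a b : ℝ} (ha : 0 ≤ a) (hb : 0 ≤ b) :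
    U a + U b ≤ U (a + b) := by
  rcases eq_or_lt_of_le ha with rfl | ha'
  · simp [hU.zero]
  have hs : 0 < a + b := by linarith
  have hm1 : a + b ∈ Ici (0:ℝ) := hs.le
  have hm2 : (0:ℝ) ∈ Ici (0:ℝ) := by simp
  have h1 := hU.conv.2 hm1 hm2 (show 0 ≤ a / (a + b) by positivity)
    (show 0 ≤ b / (a + b) by positivity) (by field_simp)
  have h2 := hU.conv.2 hm1 hm2 (show 0 ≤ b / (a + b) by positivity)
    (show 0 ≤ a / (a + b) by positivity) (by field_simp; ring)
  simp only [smul_eq_mul, mul_zero, add_zero, hU.zero] at h1 h2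
  rw [div_mul_cancel₀ _ hs.ne'] at h1 h2
  have h3 : a / (a + b) * U (a + b) + b / (a + b) * U (a + b) = U (a + b) := by field_simp
  linarith

lemma UProp.scale {U U' : ℝ → ℝ} (hU : UProp U U') {a l : ℝ} (ha : 0 ≤ a) (hl : 0 ≤ l) (hl1 : l ≤ 1) :
    U (l * a) ≤ l * U a := by
  have hm1 : a ∈ Ici (0:ℝ) := ha
  have hm2 : (0:ℝ) ∈ Ici (0:ℝ) := by simp
  have h1 := hU.conv.2 hm1 hm2 hl (show 0 ≤ 1 - l by linarith) (by ring)
  simpa [hU.zero] using h1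

lemma UProp.le_max {U U' : ℝ → ℝ} (hU : UProp U U') {g f : ℝ} (hg : 0 ≤ g) (h : g ≤ f) :
    U g ≤ max (U f) 0 := by
  rcases eq_or_lt_of_le hg with rfl | hg'
  · simp [hU.zero]
  have hf : 0 < f := by linarith
  have := hU.scale (a := f) (l := g / f) hf.le (by positivity) (by rw [div_le_one hf]; exact h)
  rw [div_mul_cancel₀ _ hf.ne'] at this
  refine this.trans ?_
  have h0 : g / f ≤ 1 := by rw [div_le_one hf]; exact h
  have h1 : 0 ≤ g / f := by positivity
  rcases le_total 0 (U f) with h2 | h2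
  · rw [max_eq_left h2]; nlinarith
  · rw [max_eq_right h2]; nlinarith

section DN
variable {α : Type*} [MeasurableSpace α]

def dn (m ν : Measure α) (x : α) : ℝ := (ν.rnDeriv m x).toReal

variable {m : Measure α} [SigmaFinite m]

lemma dn_nonneg (ν : Measure α) (x : α) : 0 ≤ dn m ν x := ENNReal.toReal_nonneg

lemma dn_meas (ν : Measure α) : Measurable (dn m ν) := (Measure.measurable_rnDeriv _ _).ennreal_toReal

lemma dn_int (ν : Measure α) [IsFiniteMeasure ν] : Integrable (dn m ν) m :=
  Measure.integrable_toReal_rnDeriv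

lemma dn_integral {ν : Measure α} [IsFiniteMeasure ν] (h : ν ≪ m) : ∫ x, dn m ν x ∂m = ν.real univ :=
  Measure.integral_toReal_rnDeriv h

lemma dn_ofReal (ν : Measure α) [IsFiniteMeasure ν] :
    ∀ᵐ x ∂m, ENNReal.ofReal (dn m ν x) = ν.rnDeriv m x := by
  filter_upwards [Measure.rnDeriv_lt_top ν m] with x h1 using ENNReal.ofReal_toReal h1.ne

lemma dn_add (μ ν : Measure α) [IsFiniteMeasure μ] [IsFiniteMeasure ν] :
    ∀ᵐ x ∂m, dn m (μ + ν) x = dn m μ x + dn m ν x := by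
  filter_upwards [Measure.rnDeriv_add' μ ν m, Measure.rnDeriv_lt_top μ m, Measure.rnDeriv_lt_top ν m]
    with x h1 h2 h3
  rw [dn, h1, Pi.add_apply, ENNReal.toReal_add h2.ne h3.ne]; rfl

lemma dn_zero : ∀ᵐ x ∂m, dn m (0 : Measure α) x = 0 := by
  filter_upwards [Measure.rnDeriv_zero m] with x h1
  simp [dn, h1]

lemma dn_smul (ν : Measure α) [IsFiniteMeasure ν] (c : NNReal) :
    ∀ᵐ x ∂m, dn m (c • ν) x = c * dn m ν x := by
  filter_upwards [Measure.rnDeriv_smul_left' ν m c] with x h1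
  rw [dn, h1, Pi.smul_apply, ENNReal.smul_def, smul_eq_mul, ENNReal.toReal_mul]; rfl

lemma dn_le {μ ν : Measure α} [IsFiniteMeasure ν] (h : μ ≤ ν) :
    ∀ᵐ x ∂m, dn m μ x ≤ dn m ν x := by
  haveI := isFiniteMeasure_of_le _ h
  have := Measure.sub_add_cancel_of_le h
  have h2 := dn_add (m := m) (ν - μ) μ
  rw [this] at h2
  filter_upwards [h2] with x h3
  rw [h3]; linarith [dn_nonneg (m := m) (ν - μ) x]

lemma dn_off {ν : Measure α} [IsFiniteMeasure ν] {G : Set α} (hG : MeasurableSet G) (h : ν Gᶜ = 0) :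
    ∀ᵐ x ∂m, x ∉ G → dn m ν x = 0 := by
  have h1 : ∫⁻ x in Gᶜ, ν.rnDeriv m x ∂m = 0 :=
    le_antisymm ((Measure.setLIntegral_rnDeriv_le _).trans h.le) bot_le
  rw [lintegral_eq_zero_iff (Measure.measurable_rnDeriv _ _)] at h1
  have h2 := (ae_restrict_iff' hG.compl).1 h1
  filter_upwards [h2] with x hx hxG
  rw [dn, hx hxG]; simp

lemma dn_sing {μ ν : Measure α} [IsFiniteMeasure μ] [IsFiniteMeasure ν] (h : μ ⟂ₘ ν) :
    ∀ᵐ x ∂m, dn m μ x = 0 ∨ dn m ν x = 0 := by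
  obtain ⟨s, hs, h1, h2⟩ := h
  filter_upwards [dn_off (m := m) (ν := μ) hs.compl (by rwa [compl_compl]),
    dn_off (m := m) (ν := ν) hs h2] with x a b
  by_cases hx : x ∈ s
  · left; exact a (by simpa using hx)
  · right; exact b hx

lemma dn_sum {ι : Type*} [Countable ι] (ζ : ι → Measure α) [IsFiniteMeasure (Measure.sum ζ)]
    (hac : ∀ i, ζ i ≪ m) :
    ∀ᵐ x ∂m, HasSum (fun i => dn m (ζ i) x) (dn m (Measure.sum ζ) x) := by
  haveI : ∀ i, IsFiniteMeasure (ζ i) := fun i => isFiniteMeasure_of_le _ (Measure.le_sum ζ i)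
  have e : Measure.sum ζ = m.withDensity (∑' i, (ζ i).rnDeriv m) := by
    rw [withDensity_tsum fun i => Measure.measurable_rnDeriv _ _]
    congr 1; funext i
    exact (Measure.withDensity_rnDeriv_eq _ _ (hac i)).symm
  have hm : Measurable (∑' i, (ζ i).rnDeriv m) := by
    have : (∑' i, (ζ i).rnDeriv m) = fun x => ∑' i, (ζ i).rnDeriv m x := by
      funext x; exact tsum_apply (Pi.summable.2 fun _ => ENNReal.summable)
    rw [this]; exact Measurable.ennreal_tsum fun i => Measure.measurable_rnDeriv _ _
  have h1 := Measure.rnDeriv_withDensity m hm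
  rw [← e] at h1
  filter_upwards [h1, Measure.rnDeriv_lt_top (Measure.sum ζ) m] with x h2 h3
  have h4 : (Measure.sum ζ).rnDeriv m x = ∑' i, (ζ i).rnDeriv m x := by
    rw [h2]; exact tsum_apply (Pi.summable.2 fun _ => ENNReal.summable)
  unfold dn
  rw [h4] at h3 ⊢
  rw [ENNReal.tsum_toReal_eq (fun i => ENNReal.ne_top_of_tsum_ne_top h3.ne i)]
  exact ENNReal.hasSum_toReal h3.ne

/-- integrated functional -/
def eU (U : ℝ → ℝ) (m ν : Measure α) : ℝ := ∫ x, U (dn m ν x) ∂m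

def UI (U : ℝ → ℝ) (m ν : Measure α) : Prop := ν ≪ m ∧ Integrable (fun x => U (dn m ν x)) m

def LB (U : ℝ → ℝ) (m ν : Measure α) : Prop := ∃ h : α → ℝ, Integrable h m ∧
  ∀ᵐ x ∂m, ∀ g, 0 ≤ g → g ≤ dn m ν x → - h x ≤ U g

variable {U U' : ℝ → ℝ}

lemma UProp.meas (hU : UProp U U') (ν : Measure α) : Measurable (fun x => U (dn m ν x)) :=
  hU.cont.measurable.comp (dn_meas ν)

lemma UI.zero (hU : UProp U U') : UI U m (0 : Measure α) := by
  refine ⟨Measure.AbsolutelyContinuous.zero _, ?_⟩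
  refine (integrable_zero α ℝ m).congr ?_
  filter_upwards [dn_zero (m := m)] with x hx
  simp [hx, hU.zero]

lemma eU_zero (hU : UProp U U') : eU U m (0 : Measure α) = 0 := by
  rw [eU, integral_congr_ae (g := fun _ => (0:ℝ))]
  · simp
  filter_upwards [dn_zero (m := m)] with x hx
  simp [hx, hU.zero]

lemma LB.of_finite (hU : UProp U U') {ν : Measure α} [IsFiniteMeasure ν] {G : Set α} (hG : MeasurableSet G)
    (hm : m G ≠ ∞) (h : ν Gᶜ = 0) : LB U m ν := by
  obtain ⟨C, hC, hl⟩ := hU.low 1 one_pos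
  refine ⟨fun x => G.indicator (fun _ => 1) x + C * dn m ν x,
    ((integrable_indicator_iff hG).2 ?_).add ((dn_int ν).const_mul C), ?_⟩
  · exact integrableOn_const hm
  filter_upwards [dn_off (m := m) hG h] with x hx g g0 g1
  by_cases hxG : x ∈ G
  · simp only [indicator_of_mem hxG]
    have := hl g g0
    have : C * g ≤ C * dn m ν x := by gcongr
    linarith
  · rw [hx hxG] at g1
    have : g = 0 := le_antisymm g1 g0
    simp [hxG, hx hxG, this, hU.zero]

lemma LB.mono (hU : UProp U U') {μ ν : Measure α} [IsFiniteMeasure ν] (h : LB U m ν) (hle : μ ≤ ν) : LB U m μ := by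
  obtain ⟨h, hi, hb⟩ := h
  refine ⟨h, hi, ?_⟩
  filter_upwards [hb, dn_le (m := m) hle] with x h1 h2 g g0 g1
  exact h1 g g0 (g1.trans h2)

lemma UI.mono (hU : UProp U U') {μ ν : Measure α} [IsFiniteMeasure ν] (h : UI U m ν) (hb : LB U m ν) (hle : μ ≤ ν) :
    UI U m μ := by
  obtain ⟨g, gi, hb⟩ := hb
  refine ⟨(Measure.absolutelyContinuous_of_le hle).trans h.1, ?_⟩
  refine Integrable.mono' (gi.abs.add h.2.abs) (hU.meas μ).aestronglyMeasurable ?_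
  filter_upwards [hb, dn_le (m := m) hle] with x h1 h2
  have a1 := h1 _ (dn_nonneg μ x) h2
  have a2 := hU.le_max (dn_nonneg (m := m) μ x) h2
  rw [Real.norm_eq_abs, abs_le]
  simp only [Pi.add_apply]
  constructor
  · linarith [le_abs_self (g x), abs_nonneg (U (dn m ν x))]
  · refine a2.trans (max_le ?_ (by positivity))
    linarith [le_abs_self (U (dn m ν x)), abs_nonneg (g x)]

lemma eU_sup (hU : UProp U U') {μ ν : Measure α} [IsFiniteMeasure μ] [IsFiniteMeasure ν] (h1 : UI U m μ) (h2 : UI U m ν)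
    (h3 : UI U m (μ + ν)) : eU U m μ + eU U m ν ≤ eU U m (μ + ν) := by
  rw [eU, eU, eU, ← integral_add h1.2 h2.2]
  refine integral_mono_ae (h1.2.add h2.2) h3.2 ?_
  filter_upwards [dn_add (m := m) μ ν] with x hx
  rw [hx]
  exact hU.sup (dn_nonneg _ _) (dn_nonneg _ _)

lemma eU_add_sing (hU : UProp U U') {μ ν : Measure α} [IsFiniteMeasure μ] [IsFiniteMeasure ν] (h1 : UI U m μ)
    (h2 : UI U m ν) (h : μ ⟂ₘ ν) : UI U m (μ + ν) ∧ eU U m (μ + ν) = eU U m μ + eU U m ν := by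
  have key : (fun x => U (dn m μ x) + U (dn m ν x)) =ᵐ[m] fun x => U (dn m (μ + ν) x) := by
    filter_upwards [dn_add (m := m) μ ν, dn_sing (m := m) h] with x hx hs
    rw [hx]
    rcases hs with hs | hs <;> simp [hs, hU.zero]
  refine ⟨⟨h1.1.add_left h2.1, (h1.2.add h2.2).congr key⟩, ?_⟩
  rw [eU, ← integral_congr_ae key, integral_add h1.2 h2.2]; rfl

lemma eU_low (hU : UProp U U') (l : ℝ) (hl : 0 < l) : ∃ C ≥ 0, ∀ (ν : Measure α) [IsFiniteMeasure ν] (G : Set α),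
    MeasurableSet G → m G ≠ ∞ → ν Gᶜ = 0 → UI U m ν →
    - l * m.real G - C * ν.real univ ≤ eU U m ν := by
  obtain ⟨C, hC, hb⟩ := hU.low l hl
  refine ⟨C, hC, ?_⟩
  intro ν _ G hG hm hν hui
  have i1 : Integrable (fun x => G.indicator (fun _ => -l) x - C * dn m ν x) m :=
    ((integrable_indicator_iff hG).2 (integrableOn_const hm)).sub ((dn_int ν).const_mul C)
  have : ∫ x, (G.indicator (fun _ => -l) x - C * dn m ν x) ∂m ≤ eU U m ν := by
    refine integral_mono_ae i1 hui.2 ?_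
    filter_upwards [dn_off (m := m) hG hν] with x hx
    by_cases hxG : x ∈ G
    · simp only [indicator_of_mem hxG]; exact hb _ (dn_nonneg _ _)
    · simp [hxG, hx hxG, hU.zero]
  rw [integral_sub ((integrable_indicator_iff hG).2 (integrableOn_const hm))
    ((dn_int ν).const_mul C), integral_const_mul, dn_integral hui.1, integral_indicator hG] at this
  simpa [mul_comm] using this

lemma eU_mix (hU : UProp U U') (l : ℝ) (hl : 0 < l) : ∃ C ≥ 0, ∀ (μ ν : Measure α) [IsFiniteMeasure μ]
    [IsFiniteMeasure ν] (G : Set α),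
    MeasurableSet G → m G ≠ ∞ → μ Gᶜ = 0 → ν Gᶜ = 0 → UI U m μ → UI U m ν →
    UI U m (μ + ν) ∧ eU U m (μ + ν) ≤ eU U m μ + eU U m ν + l * (m.real G + μ.real univ)
      + C * ν.real univ := by
  obtain ⟨C, hC, hb⟩ := hU.mix l hl
  refine ⟨C, hC, ?_⟩
  intro μ ν _ _ G hG hm hμ hν h1 h2
  have ig : Integrable (fun x => G.indicator (fun _ => l) x) m :=
    (integrable_indicator_iff hG).2 (integrableOn_const hm)
  have i1 : Integrable (fun x => U (dn m μ x) + U (dn m ν x) +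
      (G.indicator (fun _ => l) x + l * dn m μ x) + C * dn m ν x) m :=
    ((h1.2.add h2.2).add (ig.add ((dn_int μ).const_mul l))).add ((dn_int ν).const_mul C)
  have ub : ∀ᵐ x ∂m, U (dn m (μ + ν) x) ≤ U (dn m μ x) + U (dn m ν x) +
      (G.indicator (fun _ => l) x + l * dn m μ x) + C * dn m ν x := by
    filter_upwards [dn_off (m := m) hG hμ, dn_off (m := m) hG hν, dn_add (m := m) μ ν] with x a1 a2 a3
    rw [a3]
    by_cases hxG : x ∈ G
    · simp only [indicator_of_mem hxG]
      have := hb _ (dn_nonneg (m := m) μ x) _ (dn_nonneg (m := m) ν x)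
      linarith
    · simp [hxG, a1 hxG, a2 hxG, hU.zero]
  have lb : ∀ᵐ x ∂m, U (dn m μ x) + U (dn m ν x) ≤ U (dn m (μ + ν) x) := by
    filter_upwards [dn_add (m := m) μ ν] with x hx
    rw [hx]
    exact hU.sup (dn_nonneg _ _) (dn_nonneg _ _)
  have hi : Integrable (fun x => U (dn m (μ + ν) x)) m := by
    refine integrable_of_le_of_le (hU.meas _).aestronglyMeasurable lb ub (h1.2.add h2.2) i1
  refine ⟨⟨h1.1.add_left h2.1, hi⟩, ?_⟩
  have := integral_mono_ae hi i1 ub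
  have j1 : ∫ x, (U (dn m μ x) + U (dn m ν x) + (G.indicator (fun _ => l) x + l * dn m μ x)
      + C * dn m ν x) ∂m = (∫ x, (U (dn m μ x) + U (dn m ν x) + (G.indicator (fun _ => l) x + l * dn m μ x)) ∂m)
      + ∫ x, C * dn m ν x ∂m :=
    integral_add ((h1.2.add h2.2).add (ig.add ((dn_int μ).const_mul l))) ((dn_int ν).const_mul C)
  have j2 : ∫ x, (U (dn m μ x) + U (dn m ν x) + (G.indicator (fun _ => l) x + l * dn m μ x)) ∂m
      = (∫ x, (U (dn m μ x) + U (dn m ν x)) ∂m) + ∫ x, (G.indicator (fun _ => l) x + l * dn m μ x) ∂m :=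
    integral_add (h1.2.add h2.2) (ig.add ((dn_int μ).const_mul l))
  rw [j1, j2, integral_add h1.2 h2.2,
    integral_add ig ((dn_int μ).const_mul l), integral_const_mul, integral_const_mul,
    dn_integral h1.1, dn_integral h2.1, integral_indicator hG] at this
  simp only [integral_const, MeasurableSet.univ, measureReal_restrict_apply, univ_inter, smul_eq_mul] at this
  unfold eU
  linarith

lemma eU_smul (hU : UProp U U') {ν : Measure α} [IsFiniteMeasure ν] (h : UI U m ν) (hb : LB U m ν) (c : NNReal)
    (hc : c ≤ 1) : UI U m (c • ν) ∧ eU U m (c • ν) ≤ c * eU U m ν := by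
  have hle : c • ν ≤ ν := by
    intro s
    rw [Measure.smul_apply, ENNReal.smul_def, smul_eq_mul]
    exact mul_le_of_le_one_left bot_le (by exact_mod_cast hc)
  have hui := UI.mono hU h hb hle
  refine ⟨hui, ?_⟩
  rw [eU, eU, ← integral_const_mul]
  refine integral_mono_ae hui.2 (h.2.const_mul _) ?_
  filter_upwards [dn_smul (m := m) ν c] with x hx
  rw [hx]
  exact hU.scale (dn_nonneg _ _) c.2 (by exact_mod_cast hc)

end DN

lemma log_tang {s r : ℝ} (hs : 0 < s) (hr : 0 ≤ r) :
    s * Real.log s + (1 + Real.log s) * (r - s) ≤ r * Real.log r := by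
  rcases eq_or_lt_of_le hr with rfl | hr
  · simp; nlinarith
  have h := Real.log_le_sub_one_of_pos (show 0 < s / r by positivity)
  rw [Real.log_div hs.ne' hr.ne'] at h
  have h2 : r * (Real.log s - Real.log r) ≤ r * (s / r - 1) := by gcongr
  have h3 : r * (s / r - 1) = s - r := by field_simp
  nlinarith

lemma log_mix (l : ℝ) (hl : 0 < l) : ∃ C ≥ 0, ∀ u ≥ 0, Real.log (1 + u) ≤ l * u + C := by
  refine ⟨max 0 (-Real.log l + l - 1), le_max_left _ _, fun u hu => ?_⟩
  have h := Real.log_le_sub_one_of_pos (show 0 < l * (1 + u) by positivity)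
  rw [Real.log_mul hl.ne' (by positivity)] at h
  have := le_max_right 0 (-Real.log l + l - 1)
  linarith

lemma UProp_log : UProp (fun r => r * Real.log r) (fun s => 1 + Real.log s) where
  zero := by simp
  conv := Real.convexOn_mul_log
  cont := Real.continuous_mul_log
  mix := by
    intro l hl
    obtain ⟨C, hC, h⟩ := log_mix l hl
    refine ⟨C + 1, by linarith, fun a ha b hb => ?_⟩
    rcases eq_or_lt_of_le hb with rfl | hb
    · simp; nlinarith
    rcases eq_or_lt_of_le ha with rfl | ha
    · simp; nlinarith
    have h1 := h (a / b) (by positivity)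
    have e1 : Real.log (1 + a / b) = Real.log (a + b) - Real.log b := by
      rw [← Real.log_div (by positivity) (by positivity)]; congr 1; field_simp; ring
    have h2 := Real.log_le_sub_one_of_pos (show 0 < (a + b) / a by positivity)
    rw [Real.log_div (by positivity) ha.ne'] at h2
    have h3 : a * (Real.log (a + b) - Real.log a) ≤ a * ((a + b) / a - 1) := by gcongr
    have h4 : a * ((a + b) / a - 1) = b := by field_simp; ring
    rw [e1] at h1
    have h5 : b * (Real.log (a + b) - Real.log b) ≤ b * (l * (a / b) + C) := by gcongr
    have h6 : b * (l * (a / b) + C) = l * a + C * b := by field_simp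
    nlinarith
  low := by
    intro l hl
    refine ⟨|1 + Real.log l|, abs_nonneg _, fun b hb => ?_⟩
    have h1 := log_tang hl hb
    have h2 := neg_abs_le (1 + Real.log l)
    have h3 : -|1 + Real.log l| * b ≤ (1 + Real.log l) * b := by gcongr
    nlinarith
  tang := fun s hs r hr => log_tang hs hr
  contd := by
    refine continuousOn_const.add (Real.continuousOn_log.mono ?_)
    intro x hx; exact (ne_of_gt hx)
  d0 := by
    have h1 : Tendsto (fun δ : ℝ => δ + δ * Real.log δ) (𝓝[>] 0) (𝓝 (0 + 0)) := by
      refine Tendsto.add (tendsto_id.mono_left nhdsWithin_le_nhds) ?_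
      have := (Real.continuous_mul_log.tendsto 0)
      simp only [zero_mul] at this
      exact this.mono_left nhdsWithin_le_nhds
    simp only [add_zero] at h1
    refine h1.congr fun δ => by ring
  dinf := by
    intro ε hε
    filter_upwards [eventually_ge_atTop 1] with M hM
    have := Real.log_nonneg hM
    linarith

lemma rpow_tang {θ : ℝ} (h0 : 0 < θ) (h1 : θ < 1) {s r : ℝ} (hs : 0 < s) (hr : 0 ≤ r) :
    r ^ θ ≤ s ^ θ + θ * s ^ (θ - 1) * (r - s) := by
  have h := rpow_one_add_le_one_add_mul_self (s := r / s - 1) (p := θ)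
    (by have : 0 ≤ r / s := by positivity
        linarith) h0.le h1.le
  rw [add_sub_cancel, Real.div_rpow hr hs.le] at h
  have hsp : 0 < s ^ θ := Real.rpow_pos_of_pos hs _
  rw [div_le_iff₀ hsp] at h
  rw [Real.rpow_sub hs, Real.rpow_one]
  calc r ^ θ ≤ _ := h
    _ = _ := by field_simp

lemma UProp_pow {θ : ℝ} (h0 : 0 < θ) (h1 : θ < 1) :
    UProp (fun r => - r ^ θ) (fun s => - (θ * s ^ (θ - 1))) where
  zero := by simp [Real.zero_rpow h0.ne']
  conv := (Real.concaveOn_rpow h0.le h1.le).neg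
  cont := (Real.continuous_rpow_const h0.le).neg
  mix := by
    intro l hl
    obtain ⟨s, hs, hsl⟩ : ∃ s > 0, s ^ θ ≤ l :=
      ⟨l ^ θ⁻¹, by positivity, by rw [← Real.rpow_mul hl.le, inv_mul_cancel₀ h0.ne', Real.rpow_one]⟩
    refine ⟨θ * s ^ (θ - 1), by positivity, fun a ha b hb => ?_⟩
    have h2 := rpow_tang h0 h1 hs hb
    have h3 : a ^ θ ≤ (a + b) ^ θ := Real.rpow_le_rpow ha (by linarith) h0.le
    have h4 : 0 ≤ θ * s ^ (θ - 1) * s := by positivity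
    have h5 : 0 ≤ l * a := by positivity
    nlinarith
  low := by
    intro l hl
    obtain ⟨s, hs, hsl⟩ : ∃ s > 0, s ^ θ ≤ l :=
      ⟨l ^ θ⁻¹, by positivity, by rw [← Real.rpow_mul hl.le, inv_mul_cancel₀ h0.ne', Real.rpow_one]⟩
    refine ⟨θ * s ^ (θ - 1), by positivity, fun b hb => ?_⟩
    have h2 := rpow_tang h0 h1 hs hb
    have h4 : 0 ≤ θ * s ^ (θ - 1) * s := by positivity
    nlinarith
  tang := fun s hs r hr => by
    have := rpow_tang h0 h1 hs hr
    nlinarith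
  contd := by
    refine (continuousOn_const.mul ?_).neg
    intro x hx
    exact (Real.continuousAt_rpow_const x _ (Or.inl (ne_of_gt hx))).continuousWithinAt
  d0 := by
    have h2 : Tendsto (fun δ : ℝ => - θ * δ ^ θ) (𝓝[>] 0) (𝓝 (- θ * 0 ^ θ)) :=
      (((Real.continuous_rpow_const h0.le).tendsto 0).const_mul _).mono_left nhdsWithin_le_nhds
    rw [Real.zero_rpow h0.ne', mul_zero] at h2
    refine h2.congr' ?_
    filter_upwards [self_mem_nhdsWithin] with δ hδ
    have hδ' : (0:ℝ) < δ := hδ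
    rw [Real.rpow_sub hδ', Real.rpow_one]; field_simp
  dinf := by
    intro ε hε
    have h2 : Tendsto (fun s : ℝ => - (θ * s ^ (θ - 1))) atTop (𝓝 (-(θ * 0))) := by
      have := (tendsto_rpow_neg_atTop (show 0 < 1 - θ by linarith)).const_mul θ
      simp only [neg_sub] at this
      exact this.neg
    simp only [mul_zero, neg_zero] at h2
    filter_upwards [h2.eventually (lt_mem_nhds (show -ε < 0 by linarith))] with M hM using hM.le

section Abs
variable {α : Type*} [MeasurableSpace α] {m : Measure α} {U U' : ℝ → ℝ} {ι : Type*}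

lemma UProp.sup_sum (hU : UProp U U') (f : ι → ℝ) (hf : ∀ i, 0 ≤ f i) (s : Finset ι) :
    ∑ i ∈ s, U (f i) ≤ U (∑ i ∈ s, f i) := by
  induction s using Finset.induction_on with
  | empty => simp [hU.zero]
  | insert a s ha ih =>
    rw [Finset.sum_insert ha, Finset.sum_insert ha]
    have := hU.sup (hf a) (Finset.sum_nonneg fun i (_ : i ∈ s) => hf i)
    linarith

lemma UProp.sum_disj (hU : UProp U U') (f : ι → ℝ) (hd : ∀ i j, i ≠ j → f i = 0 ∨ f j = 0)
    (s : Finset ι) : ∑ i ∈ s, U (f i) = U (∑ i ∈ s, f i) := by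
  induction s using Finset.induction_on with
  | empty => simp [hU.zero]
  | insert a s ha ih =>
    rw [Finset.sum_insert ha, Finset.sum_insert ha, ih]
    by_cases h : f a = 0
    · simp [h, hU.zero]
    · have : ∑ i ∈ s, f i = 0 := Finset.sum_eq_zero fun i hi => by
        rcases hd a i (by rintro rfl; exact ha hi) with h' | h'
        · exact absurd h' h
        · exact h'
      simp [this, hU.zero]

lemma sum_dct [Countable ι] (hU : UProp U U') {f : ι → α → ℝ} {F h : α → ℝ} (hf0 : ∀ i x, 0 ≤ f i x)
    (hfm : ∀ i, Measurable (f i)) (hs : ∀ᵐ x ∂m, HasSum (fun i => f i x) (F x))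
    (hF : Integrable (fun x => U (F x)) m) (hi : Integrable h m)
    (hb : ∀ᵐ x ∂m, ∀ g, 0 ≤ g → g ≤ F x → - h x ≤ U g) :
    Tendsto (fun s : Finset ι => ∫ x, U (∑ i ∈ s, f i x) ∂m) atTop (𝓝 (∫ x, U (F x) ∂m)) := by
  refine tendsto_integral_filter_of_dominated_convergence (fun x => |h x| + |U (F x)|) ?_ ?_
    (hi.abs.add hF.abs) ?_
  · refine Eventually.of_forall fun s => ?_
    exact (hU.cont.measurable.comp (Finset.measurable_sum s fun i _ => hfm i)).aestronglyMeasurable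
  · refine Eventually.of_forall fun s => ?_
    filter_upwards [hs, hb] with x h1 h2
    have g0 : 0 ≤ ∑ i ∈ s, f i x := Finset.sum_nonneg fun i _ => hf0 i x
    have g1 : ∑ i ∈ s, f i x ≤ F x := sum_le_hasSum s (fun i _ => hf0 i x) h1
    have a1 := h2 _ g0 g1
    have a2 := hU.le_max g0 g1
    rw [Real.norm_eq_abs, abs_le]
    constructor
    · linarith [le_abs_self (h x), abs_nonneg (U (F x))]
    · refine a2.trans (max_le ?_ (by positivity))
      linarith [le_abs_self (U (F x)), abs_nonneg (h x)]
  · filter_upwards [hs] with x h1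
    exact (hU.cont.tendsto _).comp h1

lemma fatou_real {β : Type*} {l : Filter β} [l.NeBot] [l.IsCountablyGenerated] {g : β → α → ℝ}
    {G h : α → ℝ} {c : β → ℝ} {c0 : ℝ}
    (hgm : ∀ s, Measurable (g s)) (hGm : AEStronglyMeasurable G m) (hgi : ∀ s, Integrable (g s) m)
    (hi : Integrable h m)
    (hb : ∀ s, ∀ᵐ x ∂m, - h x ≤ g s x) (hlim : ∀ᵐ x ∂m, Tendsto (fun s => g s x) l (𝓝 (G x)))
    (hc : Tendsto c l (𝓝 c0)) (hle : ∀ s, ∫ x, g s x ∂m ≤ c s) :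
    Integrable G m ∧ ∫ x, G x ∂m ≤ c0 := by
  have hGh : ∀ᵐ x ∂m, ENNReal.ofReal (G x + h x) = liminf (fun s => ENNReal.ofReal (g s x + h x)) l := by
    filter_upwards [hlim] with x hx
    refine (Tendsto.liminf_eq ?_).symm
    exact (ENNReal.continuous_ofReal.tendsto _).comp (hx.add_const _)
  have step : ∫⁻ x, ENNReal.ofReal (G x + h x) ∂m ≤ ENNReal.ofReal (c0 + ∫ x, h x ∂m) := by
    rw [lintegral_congr_ae hGh]
    refine (lintegral_liminf_le' fun s =>
      ((hgm s).aemeasurable.add hi.aemeasurable).ennreal_ofReal).trans ?_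
    have h2 : Tendsto (fun s => ENNReal.ofReal (c s + ∫ x, h x ∂m)) l
        (𝓝 (ENNReal.ofReal (c0 + ∫ x, h x ∂m))) :=
      (ENNReal.continuous_ofReal.tendsto _).comp (hc.add_const _)
    rw [← h2.liminf_eq]
    refine liminf_le_liminf (Eventually.of_forall fun s => ?_)
    rw [← ofReal_integral_eq_lintegral_ofReal ((hgi s).add hi)]
    · apply ENNReal.ofReal_le_ofReal
      have := integral_add (hgi s) hi
      simp only [Pi.add_apply] at this ⊢
      rw [this]; linarith [hle s]
    · filter_upwards [hb s] with x hx
      simp only [Pi.zero_apply, Pi.add_apply]; linarith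
  have hcs : ∀ s, 0 ≤ c s + ∫ x, h x ∂m := by
    intro s
    have h1 : 0 ≤ ∫ x, (g s x + h x) ∂m := integral_nonneg_of_ae (by
      filter_upwards [hb s] with x hx
      simp only [Pi.zero_apply]; linarith)
    rw [integral_add (hgi s) hi] at h1
    linarith [hle s]
  have hc0 : 0 ≤ c0 + ∫ x, h x ∂m := ge_of_tendsto' (hc.add_const _) hcs
  have hG0 : ∀ᵐ x ∂m, 0 ≤ G x + h x := by
    rcases isEmpty_or_nonempty β with hβ | hβ
    · exact absurd (Filter.filter_eq_bot_of_isEmpty l) (NeBot.ne inferInstance)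
    obtain ⟨u, hu⟩ := Filter.exists_seq_tendsto l
    filter_upwards [hlim, ae_all_iff.2 fun n : ℕ => hb (u n)] with x h1 h2
    have := ge_of_tendsto' (h1.comp hu) (fun n => h2 n)
    linarith
  have hIntg : Integrable (fun x => G x + h x) m := by
    refine ⟨hGm.add hi.aestronglyMeasurable, ?_⟩
    rw [hasFiniteIntegral_iff_ofReal hG0]
    exact step.trans_lt ENNReal.ofReal_lt_top
  have hGi : Integrable G m := by
    have := hIntg.sub hi
    refine this.congr (Eventually.of_forall fun x => by simp)
  refine ⟨hGi, ?_⟩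
  rw [← ofReal_integral_eq_lintegral_ofReal hIntg hG0, ENNReal.ofReal_le_ofReal_iff hc0,
    integral_add hGi hi] at step
  linarith
end Abs

section SI
variable {X : Type*} [MetricSpace X] [MeasurableSpace X] [SecondCountableTopology X] [BorelSpace X]
  [CompleteSpace X]

lemma opt_restrict {ν₀ ν₁ : Measure X} {q : Measure (X × X)} (hq : IsCoupling q ν₀ ν₁)
    (ho : ∫⁻ p, edist p.1 p.2 ^ 2 ∂q = Wsq ν₀ ν₁) (hf : Wsq ν₀ ν₁ ≠ ∞) {E : Set (X × X)}
    (hE : MeasurableSet E) :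
    ∫⁻ p, edist p.1 p.2 ^ 2 ∂(q.restrict E) =
      Wsq ((q.restrict E).map Prod.fst) ((q.restrict E).map Prod.snd) := by
  refine le_antisymm ?_ (Wsq_le ⟨rfl, rfl⟩)
  refine le_iInf₂ fun q' hq' => ?_
  have hc : IsCoupling (q' + q.restrict Eᶜ) ν₀ ν₁ := by
    have := hq'.add (q' := q.restrict Eᶜ) ⟨rfl, rfl⟩
    rwa [← Measure.map_add _ _ measurable_fst, ← Measure.map_add _ _ measurable_snd,
      Measure.restrict_add_restrict_compl hE, hq.1, hq.2] at this
  have h1 := Wsq_le hc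
  rw [← ho, lintegral_add_measure, ← lintegral_add_compl _ hE] at h1
  refine (ENNReal.add_le_add_iff_right ?_).1 h1
  refine ne_top_of_le_ne_top hf ?_
  rw [← ho]
  exact lintegral_mono' Measure.restrict_le_self le_rfl

/-- rectangle partition data -/
structure RPart (ι : Type*) (q : Measure (X × X)) where
  A : ι → Set X
  B : ι → Set X
  mA : ∀ i, MeasurableSet (A i)
  mB : ∀ i, MeasurableSet (B i)
  dj : ∀ i j, i ≠ j → Disjoint (A i) (A j) ∨ Disjoint (B i) (B j)
  cov : ∀ᵐ p ∂q, ∃ i, p ∈ A i ×ˢ B i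

variable {ι : Type*} {q : Measure (X × X)}

def RPart.r (P : RPart ι q) (i : ι) : Measure (X × X) := q.restrict (P.A i ×ˢ P.B i)
def RPart.a (P : RPart ι q) (i : ι) : Measure X := (P.r i).map Prod.fst
def RPart.b (P : RPart ι q) (i : ι) : Measure X := (P.r i).map Prod.snd

lemma RPart.sum_q [Countable ι] (P : RPart ι q) : Measure.sum P.r = q := by
  have h1 : q.restrict (⋃ i, P.A i ×ˢ P.B i) = Measure.sum P.r := by
    rw [Measure.restrict_iUnion]
    · rfl
    · intro i j hij
      rw [Function.onFun, Set.disjoint_prod]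
      exact P.dj i j hij
    · exact fun i => (P.mA i).prod (P.mB i)
  rw [← h1, Measure.restrict_eq_self_of_ae_mem]
  filter_upwards [P.cov] with p hp
  simpa using hp

lemma RPart.fin_q [IsFiniteMeasure q] (P : RPart ι q) (i : ι) : IsFiniteMeasure (P.r i) := by
  unfold RPart.r; infer_instance
lemma RPart.fin_a [IsFiniteMeasure q] (P : RPart ι q) (i : ι) : IsFiniteMeasure (P.a i) := by
  haveI := P.fin_q i; unfold RPart.a; infer_instance
lemma RPart.fin_b [IsFiniteMeasure q] (P : RPart ι q) (i : ι) : IsFiniteMeasure (P.b i) := by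
  haveI := P.fin_q i; unfold RPart.b; infer_instance

lemma RPart.cpl (P : RPart ι q) (i : ι) : IsCoupling (P.r i) (P.a i) (P.b i) := ⟨rfl, rfl⟩

lemma RPart.mass_eq (P : RPart ι q) (i : ι) : P.a i univ = P.b i univ :=
  (P.cpl i).mass.symm.trans (P.cpl i).mass'

lemma RPart.sum_a [Countable ι] (P : RPart ι q) : Measure.sum P.a = q.map Prod.fst := by
  conv_rhs => rw [← P.sum_q, Measure.map_sum measurable_fst.aemeasurable]
  rfl
lemma RPart.sum_b [Countable ι] (P : RPart ι q) : Measure.sum P.b = q.map Prod.snd := by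
  conv_rhs => rw [← P.sum_q, Measure.map_sum measurable_snd.aemeasurable]
  rfl

lemma RPart.a_off (P : RPart ι q) (i : ι) : P.a i (P.A i)ᶜ = 0 := by
  rw [RPart.a, Measure.map_apply measurable_fst (P.mA i).compl, RPart.r,
    Measure.restrict_apply (measurable_fst (P.mA i).compl)]
  convert measure_empty (μ := q)
  ext p; simp; tauto
lemma RPart.b_off (P : RPart ι q) (i : ι) : P.b i (P.B i)ᶜ = 0 := by
  rw [RPart.b, Measure.map_apply measurable_snd (P.mB i).compl, RPart.r,
    Measure.restrict_apply (measurable_snd (P.mB i).compl)]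
  convert measure_empty (μ := q)
  ext p; simp; tauto

lemma sing_of_disj {μ ν : Measure X} {A B : Set X} (hA : MeasurableSet A) (h : Disjoint A B)
    (h1 : μ Aᶜ = 0) (h2 : ν Bᶜ = 0) : μ ⟂ₘ ν := by
  refine ⟨Aᶜ, hA.compl, h1, ?_⟩
  rw [compl_compl]
  exact measure_mono_null h.subset_compl_right h2

lemma RPart.sing (P : RPart ι q) {i j : ι} (h : i ≠ j) : P.a i ⟂ₘ P.a j ∨ P.b i ⟂ₘ P.b j := by
  rcases P.dj i j h with h | h
  · exact Or.inl (sing_of_disj (P.mA i) h (P.a_off i) (P.a_off j))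
  · exact Or.inr (sing_of_disj (P.mB i) h (P.b_off i) (P.b_off j))

lemma RPart.a_le [Countable ι] (P : RPart ι q) (i : ι) : P.a i ≤ q.map Prod.fst := by
  rw [← P.sum_a]; exact Measure.le_sum _ i
lemma RPart.b_le [Countable ι] (P : RPart ι q) (i : ι) : P.b i ≤ q.map Prod.snd := by
  rw [← P.sum_b]; exact Measure.le_sum _ i

variable {ν₀ ν₁ : Measure X} [IsFiniteMeasure ν₀] [IsFiniteMeasure ν₁]

lemma RPart.tsum_W [Countable ι] (P : RPart ι q) (hq : IsCoupling q ν₀ ν₁)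
    (ho : ∫⁻ p, edist p.1 p.2 ^ 2 ∂q = Wsq ν₀ ν₁) (hf : Wsq ν₀ ν₁ ≠ ∞) :
    ∑' i, Wsq (P.a i) (P.b i) = Wsq ν₀ ν₁ := by
  have : ∀ i, Wsq (P.a i) (P.b i) = ∫⁻ p, edist p.1 p.2 ^ 2 ∂(P.r i) := fun i =>
    (opt_restrict hq ho hf ((P.mA i).prod (P.mB i))).symm
  simp_rw [this]
  rw [← lintegral_sum_measure, P.sum_q, ho]

lemma RPart.W_add (P : RPart ι q) (hq : IsCoupling q ν₀ ν₁)
    (ho : ∫⁻ p, edist p.1 p.2 ^ 2 ∂q = Wsq ν₀ ν₁) (hf : Wsq ν₀ ν₁ ≠ ∞) {i j : ι} (h : i ≠ j) :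
    Wsq (P.a i) (P.b i) + Wsq (P.a j) (P.b j) = Wsq (P.a i + P.a j) (P.b i + P.b j) := by
  have e : ∀ i, Wsq (P.a i) (P.b i) = ∫⁻ p, edist p.1 p.2 ^ 2 ∂(P.r i) := fun i =>
    (opt_restrict hq ho hf ((P.mA i).prod (P.mB i))).symm
  have := opt_restrict hq ho hf (((P.mA i).prod (P.mB i)).union ((P.mA j).prod (P.mB j)))
  rw [Measure.restrict_union (by rw [Set.disjoint_prod]; exact P.dj i j h) ((P.mA j).prod (P.mB j)),
    Measure.map_add _ _ measurable_fst, Measure.map_add _ _ measurable_snd, lintegral_add_measure] at this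
  rw [e, e]; exact this

lemma S_inf (hgeo : GeodesicSpace X) (hnb : NonBranching X) {m : Measure X} [SigmaFinite m]
    {U U' : ℝ → ℝ} (hU : UProp U U') (K : ℝ) [Countable ι] (P : RPart ι q) (hq : IsCoupling q ν₀ ν₁)
    (ho : ∫⁻ p, edist p.1 p.2 ^ 2 ∂q = Wsq ν₀ ν₁) (hf : Wsq ν₀ ν₁ ≠ ∞) {t : ℝ} (ht0 : 0 < t)
    (ht1 : t < 1) {ζ : ι → Measure X} (hfin : ∀ i, IsFiniteMeasure (ζ i))
    (h1 : ∀ i, Wsq (P.a i) (ζ i) ≤ ENNReal.ofReal t ^ 2 * Wsq (P.a i) (P.b i))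
    (h2 : ∀ i, Wsq (ζ i) (P.b i) ≤ ENNReal.ofReal (1 - t) ^ 2 * Wsq (P.a i) (P.b i))
    (hui : ∀ i, UI U m (ζ i))
    (he : ∀ i, eU U m (ζ i) ≤ (1 - t) * eU U m (P.a i) + t * eU U m (P.b i)
      - K / 2 * (t * (1 - t)) * (Wsq (P.a i) (P.b i)).toReal)
    (u0 : UI U m ν₀) (u1 : UI U m ν₁) (b0 : LB U m ν₀) (b1 : LB U m ν₁) (bt : LB U m (Measure.sum ζ)) :
    UI U m (Measure.sum ζ) ∧ eU U m (Measure.sum ζ) ≤ (1 - t) * eU U m ν₀ + t * eU U m ν₁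
      - K / 2 * (t * (1 - t)) * (Wsq ν₀ ν₁).toReal := by
  haveI := hq.finite
  haveI := P.fin_a
  haveI := P.fin_b
  have hWi : ∀ i, Wsq (P.a i) (P.b i) ≠ ∞ := fun i =>
    ENNReal.ne_top_of_tsum_ne_top (by rw [P.tsum_W hq ho hf]; exact hf) i
  have mass : ∀ i, P.a i univ = ζ i univ := by
    intro i
    by_contra h
    have := h1 i
    rw [Wsq_eq_top_of_mass h, top_le_iff] at this
    exact ENNReal.mul_ne_top (by finiteness) (hWi i) this
  haveI : IsFiniteMeasure (Measure.sum ζ) := by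
    constructor
    rw [Measure.sum_apply _ MeasurableSet.univ]
    simp_rw [← mass]
    rw [← Measure.sum_apply _ MeasurableSet.univ, P.sum_a, hq.1]
    exact measure_lt_top _ _
  choose T hT using fun i => exists_tplan ht0 ht1 (hWi i) (h1 i) (h2 i)
  have sing : ∀ i j, i ≠ j → ζ i ⟂ₘ ζ j := fun i j hij =>
    tplan_sing hgeo hnb ht0 ht1 (hT i) (hT j) (ENNReal.add_ne_top.2 ⟨hWi i, hWi j⟩)
      (P.W_add hq ho hf hij).le (P.sing hij)
  have s0 : Measure.sum P.a = ν₀ := by rw [P.sum_a, hq.1]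
  have s1 : Measure.sum P.b = ν₁ := by rw [P.sum_b, hq.2]
  have ua : ∀ i, UI U m (P.a i) := fun i => UI.mono hU u0 b0 (by rw [← hq.1]; exact P.a_le i)
  have ub : ∀ i, UI U m (P.b i) := fun i => UI.mono hU u1 b1 (by rw [← hq.2]; exact P.b_le i)
  obtain ⟨k0, i0, l0⟩ := b0
  obtain ⟨k1, i1, l1⟩ := b1
  obtain ⟨kt, it, lt⟩ := bt
  have HS0 : ∀ᵐ x ∂m, HasSum (fun i => dn m (P.a i) x) (dn m ν₀ x) := by
    haveI : IsFiniteMeasure (Measure.sum P.a) := by rw [s0]; infer_instance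
    have := dn_sum (m := m) P.a (fun i => (ua i).1)
    rwa [s0] at this
  have HS1 : ∀ᵐ x ∂m, HasSum (fun i => dn m (P.b i) x) (dn m ν₁ x) := by
    haveI : IsFiniteMeasure (Measure.sum P.b) := by rw [s1]; infer_instance
    have := dn_sum (m := m) P.b (fun i => (ub i).1)
    rwa [s1] at this
  have HSt := dn_sum (m := m) ζ (fun i => (hui i).1)
  have T0 := sum_dct hU (fun i x => dn_nonneg (m := m) (P.a i) x) (fun i => dn_meas _) HS0 u0.2 i0 l0
  have T1 := sum_dct hU (fun i x => dn_nonneg (m := m) (P.b i) x) (fun i => dn_meas _) HS1 u1.2 i1 l1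
  have TW : Tendsto (fun s : Finset ι => ∑ i ∈ s, (Wsq (P.a i) (P.b i)).toReal) atTop
      (𝓝 (Wsq ν₀ ν₁).toReal) := by
    have hh := P.tsum_W hq ho hf
    have := ENNReal.hasSum_toReal (f := fun i => Wsq (P.a i) (P.b i)) (by rw [hh]; exact hf)
    rwa [← ENNReal.tsum_toReal_eq hWi, hh] at this
  have up : ∀ {p : ι → Measure X} {ν : Measure X} {k : X → ℝ} (_ : ∀ i, UI U m (p i)) (_ : UI U m ν)
      (_ : ∀ᵐ x ∂m, HasSum (fun i => dn m (p i) x) (dn m ν x)) (_ : Integrable k m)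
      (_ : ∀ᵐ x ∂m, ∀ g, 0 ≤ g → g ≤ dn m ν x → - k x ≤ U g) (s : Finset ι),
      ∑ i ∈ s, eU U m (p i) ≤ ∫ x, U (∑ i ∈ s, dn m (p i) x) ∂m := by
    intro p ν k up uν hs ki kl s
    unfold eU
    rw [← integral_finset_sum s fun i _ => (up i).2]
    refine integral_mono (integrable_finset_sum s fun i _ => (up i).2) ?_
      (fun x => hU.sup_sum _ (fun i => dn_nonneg _ _) s)
    refine integrable_of_le_of_le
      (hU.cont.measurable.comp (Finset.measurable_sum s fun i _ => dn_meas _)).aestronglyMeasurable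
      (g₁ := fun x => - k x) (g₂ := fun x => max (U (dn m ν x)) 0) ?_ ?_ ki.neg (uν.2.pos_part)
    · filter_upwards [hs, kl] with x h1 h2
      exact h2 _ (Finset.sum_nonneg fun i _ => dn_nonneg _ _) (sum_le_hasSum s (fun i _ => dn_nonneg _ _) h1)
    · filter_upwards [hs] with x h1
      exact hU.le_max (Finset.sum_nonneg fun i _ => dn_nonneg _ _) (sum_le_hasSum s (fun i _ => dn_nonneg _ _) h1)
  have dj : ∀ᵐ x ∂m, ∀ i j, i ≠ j → dn m (ζ i) x = 0 ∨ dn m (ζ j) x = 0 := by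
    rw [ae_all_iff]; intro i
    rw [ae_all_iff]; intro j
    by_cases hij : i = j
    · exact Eventually.of_forall fun x h => absurd hij h
    · filter_upwards [dn_sing (m := m) (sing i j hij)] with x hx _ using hx
  have ints : ∀ s : Finset ι, Integrable (fun x => ∑ i ∈ s, U (dn m (ζ i) x)) m := fun s =>
    integrable_finset_sum s fun i _ => (hui i).2
  have fin := fatou_real (m := m) (l := (atTop : Filter (Finset ι)))
    (g := fun s x => ∑ i ∈ s, U (dn m (ζ i) x)) (G := fun x => U (dn m (Measure.sum ζ) x)) (h := kt)
    (c := fun s => (1 - t) * (∫ x, U (∑ i ∈ s, dn m (P.a i) x) ∂m) + t * (∫ x, U (∑ i ∈ s, dn m (P.b i) x) ∂m)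
      - K / 2 * (t * (1 - t)) * ∑ i ∈ s, (Wsq (P.a i) (P.b i)).toReal)
    (c0 := (1 - t) * eU U m ν₀ + t * eU U m ν₁ - K / 2 * (t * (1 - t)) * (Wsq ν₀ ν₁).toReal)
    (fun s => Finset.measurable_sum s fun i _ => hU.meas _) (hU.meas _).aestronglyMeasurable ints it
    ?_ ?_ (((T0.const_mul _).add (T1.const_mul _)).sub (TW.const_mul _)) ?_
  · refine ⟨⟨?_, fin.1⟩, fin.2⟩
    intro s hs
    rw [Measure.sum_apply_of_countable, ENNReal.tsum_eq_zero]
    exact fun i => (hui i).1 hs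
  · intro s
    filter_upwards [dj, lt, HSt] with x hx h3 h4
    rw [hU.sum_disj _ hx]
    exact h3 _ (Finset.sum_nonneg fun i _ => dn_nonneg _ _) (sum_le_hasSum s (fun i _ => dn_nonneg _ _) h4)
  · filter_upwards [dj, HSt] with x hx h4
    simp_rw [hU.sum_disj _ hx]
    exact (hU.cont.tendsto _).comp h4
  · intro s
    rw [integral_finset_sum s fun i _ => (hui i).2]
    have a0 := up ua u0 HS0 i0 l0 s
    have a1 := up ub u1 HS1 i1 l1 s
    have h1t : 0 ≤ 1 - t := by linarith
    calc ∑ i ∈ s, ∫ x, U (dn m (ζ i) x) ∂m ≤ ∑ i ∈ s, ((1 - t) * eU U m (P.a i) + t * eU U m (P.b i)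
      - K / 2 * (t * (1 - t)) * (Wsq (P.a i) (P.b i)).toReal) := Finset.sum_le_sum fun i _ => he i
      _ = (1 - t) * ∑ i ∈ s, eU U m (P.a i) + t * ∑ i ∈ s, eU U m (P.b i)
        - K / 2 * (t * (1 - t)) * ∑ i ∈ s, (Wsq (P.a i) (P.b i)).toReal := by
          rw [Finset.sum_sub_distrib, Finset.sum_add_distrib, Finset.mul_sum, Finset.mul_sum, Finset.mul_sum]
      _ ≤ _ := by gcongr

end SI

section P8
variable {X : Type*} [MetricSpace X] [MeasurableSpace X] [SecondCountableTopology X] [BorelSpace X]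
  [CompleteSpace X]

lemma exists_rpart (q : Measure (X × X)) (V W : ℕ → Set X) (hV : ∀ n, MeasurableSet (V n))
    (hW : ∀ n, MeasurableSet (W n)) (hc : ∀ᵐ p ∂q, ∃ n, p ∈ V n ×ˢ W n) :
    ∃ P : RPart (ℕ × Finset ℕ × Finset ℕ) q, ∀ i, P.A i ⊆ V i.1 ∧ P.B i ⊆ W i.1 := by
  have hm : ∀ (V : ℕ → Set X), (∀ n, MeasurableSet (V n)) → ∀ n (S : Finset ℕ),
      MeasurableSet {x | x ∈ V n ∧ ∀ k < n, (x ∈ V k ↔ k ∈ S)} := by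
    intro V hV n S
    have : {x | x ∈ V n ∧ ∀ k < n, (x ∈ V k ↔ k ∈ S)} =
        V n ∩ ⋂ k, {x | k < n → (x ∈ V k ↔ k ∈ S)} := by ext x; simp
    rw [this]
    refine (hV n).inter (MeasurableSet.iInter fun k => ?_)
    by_cases h : k < n
    · by_cases h2 : k ∈ S
      · simpa [h, h2] using hV k
      · have : {x | k < n → (x ∈ V k ↔ k ∈ S)} = (V k)ᶜ := by ext x; simp [h, h2]
        rw [this]; exact (hV k).compl
    · simp [h]
  have hcm : ∀ (c : Prop) (E : Set X), MeasurableSet E → MeasurableSet {x | x ∈ E ∧ c} := by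
    intro c E hE
    by_cases h : c <;> simp [h, hE]
  let c : (ℕ × Finset ℕ × Finset ℕ) → Prop := fun i => (∀ k ∈ i.2.1, k < i.1) ∧
    (∀ k ∈ i.2.2, k < i.1) ∧ Disjoint i.2.1 i.2.2
  refine ⟨{ A := fun i => {x | (x ∈ {x | x ∈ V i.1 ∧ ∀ k < i.1, (x ∈ V k ↔ k ∈ i.2.1)}) ∧ c i}
            B := fun i => {x | (x ∈ {x | x ∈ W i.1 ∧ ∀ k < i.1, (x ∈ W k ↔ k ∈ i.2.2)}) ∧ c i}
            mA := fun i => hcm _ _ (hm V hV _ _)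
            mB := fun i => hcm _ _ (hm W hW _ _)
            dj := ?_
            cov := ?_ }, ?_⟩
  · rintro ⟨n, S, S'⟩ ⟨n', T, T'⟩ hne
    by_contra hcon
    push Not at hcon
    rw [Set.not_disjoint_iff, Set.not_disjoint_iff] at hcon
    obtain ⟨⟨x, ⟨⟨x1, x2⟩, x3⟩, ⟨⟨x4, x5⟩, x6⟩⟩, ⟨y, ⟨⟨y1, y2⟩, y3⟩, ⟨⟨y4, y5⟩, y6⟩⟩⟩ := hcon
    simp only at x1 x2 x4 x5 y1 y2 y4 y5
    rcases lt_trichotomy n n' with h | h | h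
    · exact Finset.disjoint_left.1 x6.2.2 ((x5 n h).1 x1) ((y5 n h).1 y1)
    · subst h
      apply hne
      have e1 : S = T := by
        ext k
        constructor
        · intro hk
          exact (x5 k (x3.1 k hk)).1 ((x2 k (x3.1 k hk)).2 hk)
        · intro hk
          exact (x2 k (x6.1 k hk)).1 ((x5 k (x6.1 k hk)).2 hk)
      have e2 : S' = T' := by
        ext k
        constructor
        · intro hk
          exact (y5 k (x3.2.1 k hk)).1 ((y2 k (x3.2.1 k hk)).2 hk)
        · intro hk
          exact (y2 k (x6.2.1 k hk)).1 ((y5 k (x6.2.1 k hk)).2 hk)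
      rw [e1, e2]
    · exact Finset.disjoint_left.1 x3.2.2 ((x2 n' h).1 x4) ((y2 n' h).1 y4)
  · filter_upwards [hc] with p hp
    let n := Nat.find hp
    have hn : p ∈ V n ×ˢ W n := Nat.find_spec hp
    have hl : ∀ k < n, p ∉ V k ×ˢ W k := fun k hk => Nat.find_min hp hk
    refine ⟨(n, (Finset.range n).filter (fun k => p.1 ∈ V k),
      (Finset.range n).filter (fun k => p.2 ∈ W k)), ?_⟩
    have hcc : c (n, (Finset.range n).filter (fun k => p.1 ∈ V k),
      (Finset.range n).filter (fun k => p.2 ∈ W k)) := by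
      refine ⟨fun k hk => ?_, fun k hk => ?_, ?_⟩
      · simp at hk; exact hk.1
      · simp at hk; exact hk.1
      · rw [Finset.disjoint_left]
        intro k h1 h2
        simp at h1 h2
        exact hl k h1.1 ⟨h1.2, h2.2⟩
    refine ⟨⟨⟨hn.1, fun k hk => ?_⟩, hcc⟩, ⟨⟨hn.2, fun k hk => ?_⟩, hcc⟩⟩
    · simp only [Finset.mem_filter, Finset.mem_range]; exact ⟨fun h => ⟨hk, h⟩, fun h => h.2⟩
    · simp only [Finset.mem_filter, Finset.mem_range]; exact ⟨fun h => ⟨hk, h⟩, fun h => h.2⟩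
  · exact fun i => ⟨fun x hx => hx.1.1, fun x hx => hx.1.1⟩

lemma exists_rpart' (q : Measure (X × X)) (Q : Set X → Set X → Prop) (hQ0 : Q ∅ ∅) (E : Set (X × X))
    (hE : ∀ᵐ p ∂q, p ∈ E)
    (h : ∀ p ∈ E, ∃ V W, p.1 ∈ V ∧ p.2 ∈ W ∧ IsOpen V ∧ IsOpen W ∧ Q V W) :
    ∃ P : RPart (ℕ × Finset ℕ × Finset ℕ) q, ∀ i, ∃ V W, P.A i ⊆ V ∧ P.B i ⊆ W ∧ Q V W := by
  choose! V W h1 h2 h3 h4 h5 using h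
  obtain ⟨s, hsE, hsc, hs⟩ := TopologicalSpace.countable_cover_nhdsWithin (s := E)
    (f := fun p => V p ×ˢ W p) (fun p hp => mem_nhdsWithin_of_mem_nhds
      (((h3 p hp).prod (h4 p hp)).mem_nhds ⟨h1 p hp, h2 p hp⟩))
  rcases s.eq_empty_or_nonempty with rfl | hne
  · obtain ⟨P, hP⟩ := exists_rpart q (fun _ => ∅) (fun _ => ∅) (fun _ => MeasurableSet.empty)
      (fun _ => MeasurableSet.empty) (by
        filter_upwards [hE] with p hp
        have := hs hp
        simp at this)
    exact ⟨P, fun i => ⟨∅, ∅, (hP i).1, (hP i).2, hQ0⟩⟩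
  · obtain ⟨f, rfl⟩ := hsc.exists_eq_range hne
    have hf : ∀ n, f n ∈ E := fun n => hsE ⟨n, rfl⟩
    obtain ⟨P, hP⟩ := exists_rpart q (fun n => V (f n)) (fun n => W (f n))
      (fun n => (h3 _ (hf n)).measurableSet) (fun n => (h4 _ (hf n)).measurableSet) (by
        filter_upwards [hE] with p hp
        have := hs hp
        simpa using this)
    exact ⟨P, fun i => ⟨_, _, (hP i).1, (hP i).2, h5 _ (hf i.1)⟩⟩

lemma IsTPlan.conc {t : ℝ} {T : Measure (X × X × X)} {μ ζ ν : Measure X} (hT : IsTPlan t T μ ζ ν)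
    {A B C : Set X} (mA : MeasurableSet A) (mB : MeasurableSet B) (mC : MeasurableSet C)
    (hA : μ Aᶜ = 0) (hB : ν Bᶜ = 0)
    (h : ∀ x ∈ A, ∀ z ∈ B, ∀ y, dist x y = t * dist x z → dist y z = (1 - t) * dist x z → y ∈ C) :
    ζ Cᶜ = 0 := by
  rw [← hT.m2, Measure.map_apply (by fun_prop) mC.compl]
  have a : ∀ᵐ p ∂T, p.1 ∈ A := by
    rw [← hT.m1, Measure.map_apply (by fun_prop) mA.compl] at hA
    exact hA
  have b : ∀ᵐ p ∂T, p.2.2 ∈ B := by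
    rw [← hT.m3, Measure.map_apply (by fun_prop) mB.compl] at hB
    exact hB
  have : ∀ᵐ p ∂T, p.2.1 ∈ C := by
    filter_upwards [a, b, hT.ex] with p h1 h2 h3
    exact h _ h1 _ h2 _ h3.1 h3.2
  exact this

/-- convexity along some geodesic -/
def CC (U : ℝ → ℝ) (m : Measure X) (K : ℝ) (ν₀ ν₁ : Measure X) : Prop :=
  ∃ μ : ℝ → Measure X, μ 0 = ν₀ ∧ μ 1 = ν₁ ∧ (∀ t ∈ Icc (0:ℝ) 1, IsFiniteMeasure (μ t)) ∧
    (∀ s ∈ Icc (0:ℝ) 1, ∀ t ∈ Icc (0:ℝ) 1,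
      Wsq (μ s) (μ t) ≤ ENNReal.ofReal |s - t| ^ 2 * Wsq ν₀ ν₁) ∧
    ∀ t ∈ Icc (0:ℝ) 1, UI U m (μ t) ∧ eU U m (μ t) ≤ (1 - t) * eU U m ν₀ + t * eU U m ν₁
      - K / 2 * (t * (1 - t)) * (Wsq ν₀ ν₁).toReal

lemma cc_glue (hgeo : GeodesicSpace X) (hnb : NonBranching X) {m : Measure X} [SigmaFinite m]
    {U U' : ℝ → ℝ} (hU : UProp U U') (K : ℝ) {ι : Type*} [Countable ι] {q : Measure (X × X)}
    {ν₀ ν₁ : Measure X} [IsFiniteMeasure ν₀] [IsFiniteMeasure ν₁]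
    (P : RPart ι q) (hq : IsCoupling q ν₀ ν₁)
    (ho : ∫⁻ p, edist p.1 p.2 ^ 2 ∂q = Wsq ν₀ ν₁) (hf : Wsq ν₀ ν₁ ≠ ∞)
    (u0 : UI U m ν₀) (u1 : UI U m ν₁) (b0 : LB U m ν₀) (b1 : LB U m ν₁)
    (hb : ∀ t ∈ Ioo (0:ℝ) 1, ∀ (β : Measure X) [IsFiniteMeasure β], (∃ T, IsTPlan t T ν₀ β ν₁) → LB U m β)
    (hcc : ∀ i, CC U m K (P.a i) (P.b i)) : CC U m K ν₀ ν₁ := by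
  haveI := hq.finite
  haveI := P.fin_a
  haveI := P.fin_b
  choose μ m0 m1 mf mW me using hcc
  have hWi : ∀ i, Wsq (P.a i) (P.b i) ≠ ∞ := fun i =>
    ENNReal.ne_top_of_tsum_ne_top (by rw [P.tsum_W hq ho hf]; exact hf) i
  have s0 : Measure.sum P.a = ν₀ := by rw [P.sum_a, hq.1]
  have s1 : Measure.sum P.b = ν₁ := by rw [P.sum_b, hq.2]
  have z0 : (0:ℝ) ∈ Icc (0:ℝ) 1 := by simp
  have z1 : (1:ℝ) ∈ Icc (0:ℝ) 1 := by simp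
  have mass : ∀ i, ∀ s ∈ Icc (0:ℝ) 1, ∀ t ∈ Icc (0:ℝ) 1, μ i s univ = μ i t univ := by
    intro i s hs t ht
    by_contra h
    have := mW i s hs t ht
    rw [Wsq_eq_top_of_mass h, top_le_iff] at this
    exact ENNReal.mul_ne_top (by finiteness) (hWi i) this
  have e0 : Measure.sum (fun i => μ i 0) = ν₀ := by rw [← s0]; congr 1; funext i; exact m0 i
  have e1 : Measure.sum (fun i => μ i 1) = ν₁ := by rw [← s1]; congr 1; funext i; exact m1 i
  have ff : ∀ t ∈ Icc (0:ℝ) 1, IsFiniteMeasure (Measure.sum fun i => μ i t) := by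
    intro t ht
    constructor
    rw [Measure.sum_apply _ MeasurableSet.univ]
    simp_rw [fun i => mass i t ht 0 z0]
    rw [← Measure.sum_apply _ MeasurableSet.univ, e0]
    exact measure_lt_top _ _
  have wW : ∀ s ∈ Icc (0:ℝ) 1, ∀ t ∈ Icc (0:ℝ) 1,
      Wsq (Measure.sum fun i => μ i s) (Measure.sum fun i => μ i t) ≤ ENNReal.ofReal |s - t| ^ 2 * Wsq ν₀ ν₁ := by
    intro s hs t ht
    haveI := fun i => mf i s hs
    haveI := fun i => mf i t ht
    refine (Wsq_sum_le (fun i => mass i s hs t ht)).trans ?_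
    rw [← P.tsum_W hq ho hf, ← ENNReal.tsum_mul_left]
    exact ENNReal.tsum_le_tsum fun i => mW i s hs t ht
  refine ⟨fun t => Measure.sum fun i => μ i t, e0, e1, ff, wW, ?_⟩
  intro t ht
  rcases eq_or_lt_of_le ht.1 with rfl | h0
  · simp only [e0]; exact ⟨u0, by simp⟩
  rcases eq_or_lt_of_le ht.2 with rfl | h1
  · simp only [e1]; exact ⟨u1, by simp⟩
  haveI := ff t ht
  have w1 := wW 0 z0 t ht
  have w2 := wW t ht 1 z1
  simp only [e0] at w1
  simp only [e1] at w2
  have a1 : |0 - t| = t := by rw [abs_sub_comm, sub_zero, abs_of_pos h0]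
  have a2 : |t - 1| = 1 - t := by rw [abs_sub_comm, abs_of_pos (by linarith)]
  rw [a1] at w1; rw [a2] at w2
  refine S_inf hgeo hnb hU K P hq ho hf h0 h1 (fun i => mf i t ht) (fun i => ?_) (fun i => ?_)
    (fun i => (me i t ht).1) (fun i => (me i t ht).2) u0 u1 b0 b1 ?_
  · have := mW i 0 z0 t ht
    rwa [a1, m0] at this
  · have := mW i t ht 1 z1
    rwa [a2, m1] at this
  · exact hb t ⟨h0, h1⟩ _ (exists_tplan h0 h1 hf w1 w2)

lemma CC.swap {U : ℝ → ℝ} {m : Measure X} {K : ℝ} {ν₀ ν₁ : Measure X} (h : CC U m K ν₀ ν₁) :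
    CC U m K ν₁ ν₀ := by
  obtain ⟨μ, m0, m1, mf, mW, me⟩ := h
  have hm : ∀ t ∈ Icc (0:ℝ) 1, 1 - t ∈ Icc (0:ℝ) 1 := fun t ht => ⟨by linarith [ht.2], by linarith [ht.1]⟩
  refine ⟨fun t => μ (1 - t), by simp [m1], by simp [m0], fun t ht => mf _ (hm t ht), ?_, ?_⟩
  · intro s hs t ht
    have := mW _ (hm s hs) _ (hm t ht)
    rw [Wsq_symm ν₁ ν₀]
    have e : |1 - s - (1 - t)| = |s - t| := by rw [abs_sub_comm]; congr 1; ring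
    rwa [e] at this
  · intro t ht
    have := me _ (hm t ht)
    rw [Wsq_symm ν₁ ν₀]
    refine ⟨this.1, this.2.trans (le_of_eq (by ring))⟩

end P8

section P9
variable {X : Type*} [MetricSpace X] [MeasurableSpace X] [SecondCountableTopology X] [BorelSpace X]
  [CompleteSpace X]

lemma WLim.integral {μ : ℕ → Measure X} {ν : Measure X} [∀ k, IsFiniteMeasure (μ k)] [IsFiniteMeasure ν]
    (h : WLim μ ν) (g : X → ℝ) (hg : Continuous g) (C : ℝ) (hC : ∀ x, |g x| ≤ C) :
    Tendsto (fun k => ∫ x, g x ∂(μ k)) (hyperfilter ℕ : Filter ℕ) (𝓝 (∫ x, g x ∂ν)) := by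
  have hb : ∀ x, 0 ≤ g x + C := fun x => by linarith [neg_le_of_abs_le (hC x)]
  let f : BoundedContinuousFunction X NNReal := BoundedContinuousFunction.mkOfBound
    ⟨fun x => (g x + C).toNNReal, by fun_prop⟩ (2 * C) (fun x y => by
      simp only [ContinuousMap.coe_mk]
      rw [NNReal.dist_eq, Real.coe_toNNReal _ (hb x), Real.coe_toNNReal _ (hb y)]
      have h1 := abs_le.1 (hC x)
      have h2 := abs_le.1 (hC y)
      rw [abs_le]; constructor <;> linarith)
  have hf : ∀ x, ((f x : NNReal) : ℝ) = g x + C := fun x => Real.coe_toNNReal _ (hb x)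
  have t1 := h f
  have t2 := h (BoundedContinuousFunction.const X 1)
  have e : ∀ (ρ : Measure X) [IsFiniteMeasure ρ], ∫ x, g x ∂ρ = (∫⁻ x, f x ∂ρ).toReal -
      C * (∫⁻ x, (BoundedContinuousFunction.const X (1:NNReal)) x ∂ρ).toReal := by
    intro ρ _
    have e1 : (∫⁻ x, f x ∂ρ).toReal = ∫ x, (g x + C) ∂ρ := by
      rw [integral_eq_lintegral_of_nonneg_ae (Eventually.of_forall hb)
        (by fun_prop : Continuous fun x => g x + C).aestronglyMeasurable]
      congr 1
    have gi : Integrable g ρ := Integrable.of_bound hg.aestronglyMeasurable C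
      (Eventually.of_forall fun x => by simpa using hC x)
    rw [e1, integral_add gi (integrable_const C)]
    simp [Measure.real]; ring
  have fin : ∀ (ρ : Measure X) [IsFiniteMeasure ρ] (f : BoundedContinuousFunction X NNReal),
      ∫⁻ x, f x ∂ρ ≠ ∞ := fun ρ _ f => (BoundedContinuousFunction.lintegral_lt_top_of_nnreal ρ f).ne
  simp_rw [e (μ _)]
  rw [e ν]
  exact ((ENNReal.tendsto_toReal (fin ν _)).comp t1).sub
    (((ENNReal.tendsto_toReal (fin ν _)).comp t2).const_mul C)

lemma exists_cont_seq (ρ : Measure X) [IsFiniteMeasure ρ] (s : X → ℝ) (hs : Measurable s) (B : ℝ)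
    (hB : ∀ x, |s x| ≤ B) : ∃ g : ℕ → X → ℝ, (∀ n, Continuous (g n)) ∧
      ∀ᵐ x ∂ρ, Tendsto (fun n => g n x) atTop (𝓝 (s x)) := by
  have hL : MemLp s 1 ρ := MemLp.of_bound hs.aestronglyMeasurable B (Eventually.of_forall hB)
  choose g hg hg' using fun n : ℕ => hL.exists_boundedContinuous_eLpNorm_sub_le (by simp)
    (ε := ENNReal.ofReal (1 / ((n:ℝ) + 1))) (by simp; positivity)
  have : TendstoInMeasure ρ (fun n => (g n : X → ℝ)) atTop s := by
    refine tendstoInMeasure_of_tendsto_eLpNorm one_ne_zero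
      (fun n => (g n).continuous.aestronglyMeasurable) hs.aestronglyMeasurable ?_
    have h1 : Tendsto (fun n : ℕ => ENNReal.ofReal (1 / ((n:ℝ) + 1))) atTop (𝓝 0) := by
      have := (ENNReal.continuous_ofReal.tendsto 0).comp tendsto_one_div_add_atTop_nhds_zero_nat
      simpa [Function.comp_def] using this
    refine tendsto_of_tendsto_of_tendsto_of_le_of_le tendsto_const_nhds h1 (fun _ => bot_le) (fun n => ?_)
    rw [eLpNorm_sub_comm]; exact hg n
  obtain ⟨ns, _, h⟩ := this.exists_seq_tendsto_ae
  exact ⟨fun n => g (ns n), fun n => (g _).continuous, h⟩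

def clp (δ M r : ℝ) : ℝ := max δ (min M r)

lemma clp_mem {δ M : ℝ} (h : δ ≤ M) (r : ℝ) : clp δ M r ∈ Icc δ M :=
  ⟨le_max_left _ _, max_le h (min_le_left _ _)⟩
lemma clp_idem {δ M : ℝ} (h : δ ≤ M) (r : ℝ) : clp δ M (clp δ M r) = clp δ M r := by
  have := clp_mem h r
  rw [clp, min_eq_right this.2, max_eq_right this.1]
lemma clp_cont (δ M : ℝ) : Continuous (clp δ M) := by unfold clp; fun_prop

lemma psi_cont {U U' : ℝ → ℝ} (hU : UProp U U') {δ M : ℝ} (hδ : 0 < δ) (h : δ ≤ M) :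
    Continuous (fun r => U' (clp δ M r)) :=
  hU.contd.comp_continuous (clp_cont δ M) (fun r => lt_of_lt_of_le hδ (clp_mem h r).1)

lemma psi_bdd {U U' : ℝ → ℝ} (hU : UProp U U') {δ M : ℝ} (hδ : 0 < δ) (h : δ ≤ M) :
    ∃ B, ∀ r, |U' (clp δ M r)| ≤ B ∧ |U (clp δ M r) - clp δ M r * U' (clp δ M r)| ≤ B := by
  have c1 : ContinuousOn U' (Icc δ M) := hU.contd.mono fun x hx => lt_of_lt_of_le hδ hx.1
  obtain ⟨B1, h1⟩ := isCompact_Icc.exists_bound_of_continuousOn c1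
  obtain ⟨B2, h2⟩ := isCompact_Icc.exists_bound_of_continuousOn
    (hU.cont.continuousOn.sub (continuousOn_id.mul c1))
  exact ⟨max B1 B2, fun r => ⟨(h1 _ (clp_mem h r)).trans (le_max_left _ _),
    (h2 _ (clp_mem h r)).trans (le_max_right _ _)⟩⟩

variable {m : Measure X} [SigmaFinite m] {U U' : ℝ → ℝ}

lemma lsc1 (hU : UProp U U') {F : Set X} (hF : IsClosed F) (hmF : m F ≠ ∞) {βk : ℕ → Measure X}
    {β : Measure X} [∀ k, IsFiniteMeasure (βk k)] [IsFiniteMeasure β] (hl : WLim βk β)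
    (hk : ∀ k, βk k Fᶜ = 0) (hui : ∀ k, (βk k ≪ m ∨ ∀ s > 0, U' s ≤ 0) ∧ Integrable (fun x => U (dn m (βk k) x)) m) {c : ℕ → ℝ} {c0 : ℝ}
    (hc : Tendsto c (hyperfilter ℕ : Filter ℕ) (𝓝 c0)) (hle : ∀ k, eU U m (βk k) ≤ c k)
    {δ M : ℝ} (hδ : 0 < δ) (hδM : δ ≤ M) (s : X → ℝ) (hs : Continuous s) :
    ∫ x in F, (U (clp δ M (s x)) - clp δ M (s x) * U' (clp δ M (s x))) ∂m
      + ∫ x, U' (clp δ M (s x)) ∂β ≤ c0 := by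
  obtain ⟨B, hB⟩ := psi_bdd hU hδ hδM
  have cψ : Continuous (fun x => U' (clp δ M (s x))) := (psi_cont hU hδ hδM).comp hs
  have ccl : Continuous (fun x => clp δ M (s x)) := (clp_cont δ M).comp hs
  have cφ : Continuous (fun x => U (clp δ M (s x)) - clp δ M (s x) * U' (clp δ M (s x))) :=
    (hU.cont.comp ccl).sub (ccl.mul cψ)
  haveI : IsFiniteMeasure (m.restrict F) := ⟨by simpa using hmF.lt_top⟩
  have iφ : IntegrableOn (fun x => U (clp δ M (s x)) - clp δ M (s x) * U' (clp δ M (s x))) F m :=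
    Integrable.of_bound cφ.aestronglyMeasurable B (Eventually.of_forall fun x => (hB _).2)
  refine le_of_tendsto_of_tendsto ((hl.integral _ cψ B (fun x => (hB _).1)).const_add _) hc
    (Eventually.of_forall fun k => ?_)
  refine le_trans ?_ (hle k)
  have e1 : ∫ x, U' (clp δ M (s x)) ∂(βk k) ≤ ∫ x, dn m (βk k) x * U' (clp δ M (s x)) ∂m := by
    have e0 : ∫ x, U' (clp δ M (s x)) ∂(m.withDensity ((βk k).rnDeriv m)) = ∫ x, dn m (βk k) x * U' (clp δ M (s x)) ∂m := by
      rw [integral_withDensity_eq_integral_toReal_smul (Measure.measurable_rnDeriv _ _)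
        (Measure.rnDeriv_lt_top _ _)]
      rfl
    rcases (hui k).1 with hac | hneg
    · refine le_of_eq ?_
      rw [← e0, Measure.withDensity_rnDeriv_eq _ _ hac]
    · have i0 : Integrable (fun x => U' (clp δ M (s x))) (βk k) :=
        Integrable.of_bound cψ.aestronglyMeasurable B (Eventually.of_forall fun x => (hB _).1)
      have dec := (βk k).haveLebesgueDecomposition_add m
      rw [dec] at i0
      conv_lhs => rw [dec]
      rw [integral_add_measure i0.left_of_add_measure i0.right_of_add_measure, e0]
      have : ∫ x, U' (clp δ M (s x)) ∂((βk k).singularPart m) ≤ 0 :=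
        integral_nonpos fun x => hneg _ (lt_of_lt_of_le hδ (clp_mem hδM (s x)).1)
      linarith
  have i2 : Integrable (fun x => dn m (βk k) x * U' (clp δ M (s x))) m :=
    (dn_int (βk k)).mul_bdd (c := B) cψ.aestronglyMeasurable (Eventually.of_forall fun x => (hB _).1)
  show ∫ x in F, (U (clp δ M (s x)) - clp δ M (s x) * U' (clp δ M (s x))) ∂m
      + ∫ x, U' (clp δ M (s x)) ∂(βk k) ≤ _
  refine (add_le_add_right e1 _).trans ?_
  rw [← integral_indicator hF.measurableSet,
    ← integral_add ((integrable_indicator_iff hF.measurableSet).2 iφ) i2]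
  refine integral_mono_ae (((integrable_indicator_iff hF.measurableSet).2 iφ).add i2) (hui k).2 ?_
  filter_upwards [dn_off (m := m) hF.measurableSet (hk k)] with x hx
  have hp := lt_of_lt_of_le hδ (clp_mem hδM (s x)).1
  by_cases hxF : x ∈ F
  · have := hU.tang _ hp (dn m (βk k) x) (dn_nonneg _ _)
    simp only [Set.indicator_of_mem hxF]
    nlinarith
  · simp [hxF, hx hxF, hU.zero]

lemma lsc2 (hU : UProp U U') {F : Set X} (hF : IsClosed F) (hmF : m F ≠ ∞) {βk : ℕ → Measure X}
    {β : Measure X} [∀ k, IsFiniteMeasure (βk k)] [IsFiniteMeasure β] (hl : WLim βk β)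
    (hk : ∀ k, βk k Fᶜ = 0) (hui : ∀ k, (βk k ≪ m ∨ ∀ s > 0, U' s ≤ 0) ∧ Integrable (fun x => U (dn m (βk k) x)) m) {c : ℕ → ℝ} {c0 : ℝ}
    (hc : Tendsto c (hyperfilter ℕ : Filter ℕ) (𝓝 c0)) (hle : ∀ k, eU U m (βk k) ≤ c k)
    {δ M : ℝ} (hδ : 0 < δ) (hδM : δ ≤ M) (s : X → ℝ) (hs : Measurable s) :
    ∫ x in F, (U (clp δ M (s x)) - clp δ M (s x) * U' (clp δ M (s x))) ∂m
      + ∫ x, U' (clp δ M (s x)) ∂β ≤ c0 := by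
  obtain ⟨B, hB⟩ := psi_bdd hU hδ hδM
  haveI : IsFiniteMeasure (m.restrict F) := ⟨by simpa using hmF.lt_top⟩
  obtain ⟨g, gc, gl⟩ := exists_cont_seq (m.restrict F + β) (fun x => clp δ M (s x))
    ((clp_cont δ M).measurable.comp hs) M (fun x => by
      have := clp_mem hδM (s x)
      rw [abs_of_pos (by linarith [this.1])]; exact this.2)
  have cψ := psi_cont hU hδ hδM
  have ccl := clp_cont δ M
  have cφ : Continuous (fun r => U (clp δ M r) - clp δ M r * U' (clp δ M r)) :=
    (hU.cont.comp ccl).sub (ccl.mul cψ)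
  have gl1 : ∀ᵐ x ∂(m.restrict F), Tendsto (fun n => g n x) atTop (𝓝 (clp δ M (s x))) :=
    (Measure.absolutelyContinuous_of_le (Measure.le_add_right le_rfl)).ae_le gl
  have gl2 : ∀ᵐ x ∂β, Tendsto (fun n => g n x) atTop (𝓝 (clp δ M (s x))) :=
    (Measure.absolutelyContinuous_of_le (Measure.le_add_left le_rfl)).ae_le gl
  have t1 : Tendsto (fun n => ∫ x in F, (U (clp δ M (g n x)) - clp δ M (g n x) * U' (clp δ M (g n x))) ∂m)
      atTop (𝓝 (∫ x in F, (U (clp δ M (s x)) - clp δ M (s x) * U' (clp δ M (s x))) ∂m)) := by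
    refine tendsto_integral_of_dominated_convergence (fun _ => B)
      (fun n => (cφ.comp (gc n)).aestronglyMeasurable) (integrable_const _)
      (fun n => Eventually.of_forall fun x => (hB _).2) ?_
    filter_upwards [gl1] with x hx
    have := (cφ.tendsto _).comp hx
    simp only [clp_idem hδM] at this
    exact this
  have t2 : Tendsto (fun n => ∫ x, U' (clp δ M (g n x)) ∂β) atTop (𝓝 (∫ x, U' (clp δ M (s x)) ∂β)) := by
    refine tendsto_integral_of_dominated_convergence (fun _ => B)
      (fun n => (cψ.comp (gc n)).aestronglyMeasurable) (integrable_const _)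
      (fun n => Eventually.of_forall fun x => (hB _).1) ?_
    filter_upwards [gl2] with x hx
    have := (cψ.tendsto _).comp hx
    simp only [clp_idem hδM] at this
    exact this
  exact le_of_tendsto' (t1.add t2) fun n => lsc1 hU hF hmF hl hk hui hc hle hδ hδM (g n) (gc n)

lemma UProp.mono' (hU : UProp U U') {a b : ℝ} (ha : 0 < a) (hab : a ≤ b) : U' a ≤ U' b := by
  rcases eq_or_lt_of_le hab with rfl | h
  · rfl
  have h1 := hU.tang a ha b (by linarith)
  have h2 := hU.tang b (by linarith) a ha.le
  by_contra hc
  push Not at hc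
  nlinarith

lemma UProp.tang_clp (hU : UProp U U') {δ M f : ℝ} (hδ : 0 < δ) (h1 : δ ≤ 1) (h2 : 1 ≤ M) (hf : 0 ≤ f) :
    U 1 + U' 1 * (f - 1) ≤ U (clp δ M f) + U' (clp δ M f) * (f - clp δ M f) := by
  have hδM := h1.trans h2
  have hc := clp_mem hδM f
  have t := hU.tang 1 one_pos (clp δ M f) (by linarith [hc.1])
  have : (U' (clp δ M f) - U' 1) * (f - clp δ M f) ≥ 0 := by
    by_cases a1 : f < δ
    · have : clp δ M f = δ := by unfold clp; rw [min_eq_right (by linarith), max_eq_left a1.le]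
      rw [this]
      exact mul_nonneg_of_nonpos_of_nonpos (by linarith [hU.mono' hδ h1]) (by linarith)
    · by_cases a2 : M < f
      · have : clp δ M f = M := by unfold clp; rw [min_eq_left a2.le, max_eq_right hδM]
        rw [this]
        exact mul_nonneg (by linarith [hU.mono' one_pos h2]) (by linarith)
      · have : clp δ M f = f := by
          unfold clp; rw [min_eq_right (by linarith), max_eq_right (by linarith)]
        rw [this]; simp
  nlinarith

lemma lsc3 (hU : UProp U U') {F : Set X} (hF : IsClosed F) (hmF : m F ≠ ∞) {βk : ℕ → Measure X}
    {β : Measure X} [∀ k, IsFiniteMeasure (βk k)] [IsFiniteMeasure β] (hl : WLim βk β)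
    (hk : ∀ k, βk k Fᶜ = 0) (hui : ∀ k, (βk k ≪ m ∨ ∀ s > 0, U' s ≤ 0) ∧ Integrable (fun x => U (dn m (βk k) x)) m) {c : ℕ → ℝ} {c0 : ℝ}
    (hc : Tendsto c (hyperfilter ℕ : Filter ℕ) (𝓝 c0)) (hle : ∀ k, eU U m (βk k) ≤ c k) :
    β Fᶜ = 0 ∧ Integrable (fun x => U (dn m β x)) m ∧ eU U m β ≤ c0 ∧
      ∃ C, ∀ n : ℕ, U' (n + 1) * (β.singularPart m).real univ ≤ C := by
  have hβF : β Fᶜ = 0 := hl.conc hF hk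
  refine ⟨hβF, ?_⟩
  haveI : IsFiniteMeasure (m.restrict F) := ⟨by simpa using hmF.lt_top⟩
  set f := dn m β with hfd
  set σ := (β.singularPart m).real univ with hσ
  have hσ0 : 0 ≤ σ := measureReal_nonneg
  obtain ⟨S, hS, hS1, hS2⟩ := Measure.mutuallySingular_singularPart β m
  have hfm : Measurable f := dn_meas β
  have hfi : Integrable f m := dn_int β
  have hfF := dn_off (m := m) hF.measurableSet hβF
  have hSae : ∀ᵐ x ∂m, x ∈ S := hS2
  have hSae' : ∀ᵐ x ∂(β.singularPart m), x ∉ S := by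
    have : ∀ᵐ x ∂(β.singularPart m), x ∈ Sᶜ := by
      rw [ae_iff]; simpa using hS1
    exact this
  let g : ℕ → X → ℝ := fun n x => U (clp (1 / ((n:ℝ) + 1)) (n + 1) (f x)) +
    U' (clp (1 / ((n:ℝ) + 1)) (n + 1) (f x)) * (f x - clp (1 / ((n:ℝ) + 1)) (n + 1) (f x))
  have hδ : ∀ n : ℕ, 0 < 1 / ((n:ℝ) + 1) := fun n => by positivity
  have hδ1 : ∀ n : ℕ, 1 / ((n:ℝ) + 1) ≤ 1 := fun n => by
    rw [div_le_one (by positivity)]; linarith [n.cast_nonneg (α := ℝ)]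
  have hM1 : ∀ n : ℕ, (1:ℝ) ≤ n + 1 := fun n => by linarith [n.cast_nonneg (α := ℝ)]
  have gint : ∀ n, Integrable (g n) (m.restrict F) ∧ ∫ x in F, g n x ∂m + U' (n + 1) * σ ≤ c0 := by
    intro n
    have hδM := (hδ1 n).trans (hM1 n)
    obtain ⟨B, hB⟩ := psi_bdd hU (hδ n) hδM
    have cψ := psi_cont hU (hδ n) hδM
    have ccl := clp_cont (1 / ((n:ℝ) + 1)) (n + 1)
    have cφ : Continuous (fun r => U (clp (1 / ((n:ℝ) + 1)) (n + 1) r) -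
      clp (1 / ((n:ℝ) + 1)) (n + 1) r * U' (clp (1 / ((n:ℝ) + 1)) (n + 1) r)) :=
      (hU.cont.comp ccl).sub (ccl.mul cψ)
    let s : X → ℝ := fun x => if x ∈ S then f x else n + 1
    have hsm : Measurable s := Measurable.ite hS hfm measurable_const
    have key := lsc2 hU hF hmF hl hk hui hc hle (hδ n) hδM s hsm
    have e1 : ∫ x in F, (U (clp (1 / ((n:ℝ) + 1)) (n + 1) (s x)) - clp (1 / ((n:ℝ) + 1)) (n + 1) (s x) *
        U' (clp (1 / ((n:ℝ) + 1)) (n + 1) (s x))) ∂m =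
        ∫ x in F, (U (clp (1 / ((n:ℝ) + 1)) (n + 1) (f x)) - clp (1 / ((n:ℝ) + 1)) (n + 1) (f x) *
        U' (clp (1 / ((n:ℝ) + 1)) (n + 1) (f x))) ∂m := by
      refine integral_congr_ae ?_
      filter_upwards [ae_restrict_of_ae hSae] with x hx
      simp only [s, if_pos hx]
    have e2 : ∫ x, U' (clp (1 / ((n:ℝ) + 1)) (n + 1) (s x)) ∂β = U' (n + 1) * σ +
        ∫ x in F, f x * U' (clp (1 / ((n:ℝ) + 1)) (n + 1) (f x)) ∂m := by
      have hm1 : AEStronglyMeasurable (fun x => U' (clp (1 / ((n:ℝ) + 1)) (n + 1) (s x))) β :=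
        (cψ.measurable.comp hsm).aestronglyMeasurable
      have i0 : Integrable (fun x => U' (clp (1 / ((n:ℝ) + 1)) (n + 1) (s x))) β :=
        Integrable.of_bound hm1 B (Eventually.of_forall fun x => (hB _).1)
      have dec := β.haveLebesgueDecomposition_add m
      rw [dec] at i0
      conv_lhs => rw [dec]
      rw [integral_add_measure i0.left_of_add_measure i0.right_of_add_measure]
      congr 1
      · rw [integral_congr_ae (g := fun _ => U' (n + 1))]
        · simp [hσ, mul_comm]
        · filter_upwards [hSae'] with x hx
          simp only [s, if_neg hx]
          congr 1
          unfold clp; rw [min_self, max_eq_right hδM]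
      · rw [integral_withDensity_eq_integral_toReal_smul (Measure.measurable_rnDeriv _ _)
          (Measure.rnDeriv_lt_top _ _), ← integral_indicator hF.measurableSet]
        refine integral_congr_ae ?_
        filter_upwards [hSae, hfF] with x h1 h2
        show f x • _ = _
        by_cases hx : x ∈ F
        · simp [hx, s, h1]
        · simp only [Set.indicator_of_notMem hx]
          rw [hfd, h2 hx]; simp
    rw [e1, e2] at key
    have iφ : IntegrableOn (fun x => U (clp (1 / ((n:ℝ) + 1)) (n + 1) (f x)) -
        clp (1 / ((n:ℝ) + 1)) (n + 1) (f x) * U' (clp (1 / ((n:ℝ) + 1)) (n + 1) (f x))) F m :=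
      Integrable.of_bound (cφ.measurable.comp hfm).aestronglyMeasurable B
        (Eventually.of_forall fun x => (hB _).2)
    have iψ : IntegrableOn (fun x => f x * U' (clp (1 / ((n:ℝ) + 1)) (n + 1) (f x))) F m :=
      (hfi.mul_bdd (c := B) (cψ.measurable.comp hfm).aestronglyMeasurable
        (Eventually.of_forall fun x => (hB _).1)).integrableOn
    have e3 : g n = fun x => (U (clp (1 / ((n:ℝ) + 1)) (n + 1) (f x)) -
        clp (1 / ((n:ℝ) + 1)) (n + 1) (f x) * U' (clp (1 / ((n:ℝ) + 1)) (n + 1) (f x))) +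
        f x * U' (clp (1 / ((n:ℝ) + 1)) (n + 1) (f x)) := by
      funext x; simp only [g]; ring
    have e4 := integral_add iφ iψ
    rw [e3]
    refine ⟨iφ.add iψ, ?_⟩
    rw [e4]; linarith
  have hgm : ∀ n, Measurable (g n) := by
    intro n
    have cψ := psi_cont hU (hδ n) ((hδ1 n).trans (hM1 n))
    have ccl := clp_cont (1 / ((n:ℝ) + 1)) (n + 1)
    exact ((hU.cont.comp ccl).measurable.comp hfm).add ((cψ.measurable.comp hfm).mul
      (hfm.sub (ccl.measurable.comp hfm)))
  let h : X → ℝ := fun x => -(U 1 + U' 1 * (f x - 1))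
  have hi : Integrable h (m.restrict F) :=
    ((integrable_const (U 1)).add (((hfi.integrableOn (s := F)).sub (integrable_const 1)).const_mul (U' 1))).neg
  have hb : ∀ n x, - h x ≤ g n x := fun n x => by
    simp only [h, neg_neg]
    exact hU.tang_clp (hδ n) (hδ1 n) (hM1 n) (dn_nonneg _ _)
  have lim : ∀ x, Tendsto (fun n => g n x) atTop (𝓝 (U (f x))) := by
    intro x
    rcases eq_or_lt_of_le (dn_nonneg (m := m) β x) with h0 | h0
    · have h0 : f x = 0 := h0.symm
      have e : ∀ n, g n x = U (1 / ((n:ℝ) + 1)) - (1 / ((n:ℝ) + 1)) * U' (1 / ((n:ℝ) + 1)) := by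
        intro n
        have : clp (1 / ((n:ℝ) + 1)) (n + 1) (f x) = 1 / ((n:ℝ) + 1) := by
          unfold clp; rw [h0, min_eq_right (by positivity), max_eq_left (hδ n).le]
        simp only [g, this]; rw [h0]; ring
      simp_rw [e]
      have l0 := tendsto_one_div_add_atTop_nhds_zero_nat (𝕜 := ℝ)
      have l1 : Tendsto (fun n : ℕ => 1 / ((n:ℝ) + 1)) atTop (𝓝[>] 0) :=
        tendsto_nhdsWithin_iff.2 ⟨l0, Eventually.of_forall fun n => hδ n⟩
      have := ((hU.cont.tendsto 0).comp l0).sub (hU.d0.comp l1)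
      rw [h0]
      simpa using this
    · have h0 : 0 < f x := h0
      refine tendsto_const_nhds.congr' ?_
      have l0 := tendsto_one_div_add_atTop_nhds_zero_nat (𝕜 := ℝ)
      filter_upwards [l0.eventually (gt_mem_nhds h0), tendsto_natCast_atTop_atTop.eventually_ge_atTop (f x)]
        with n h1 h2
      have : clp (1 / ((n:ℝ) + 1)) (n + 1) (f x) = f x := by
        unfold clp; rw [min_eq_right (by linarith), max_eq_right h1.le]
      simp only [g, this]; ring
  have main : ∀ ε > 0, Integrable (fun x => U (f x)) (m.restrict F) ∧ ∫ x in F, U (f x) ∂m ≤ c0 + ε * σ := by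
    intro ε hε
    have ev := (tendsto_natCast_atTop_atTop.atTop_add tendsto_const_nhds :
      Tendsto (fun n : ℕ => (n:ℝ) + 1) atTop atTop).eventually (hU.dinf ε hε)
    obtain ⟨n0, hn0⟩ := eventually_atTop.1 ev
    refine fatou_real (l := atTop) (g := fun n : ℕ => g (n + n0)) (c := fun _ => c0 + ε * σ) (fun n => hgm _)
      (hU.cont.measurable.comp hfm).aestronglyMeasurable (fun n => (gint _).1) hi
      (fun n => Eventually.of_forall (hb _)) (Eventually.of_forall fun x =>
        (lim x).comp (tendsto_add_atTop_nat n0)) tendsto_const_nhds (fun n => ?_)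
    have h1 := (gint (n + n0)).2
    have h2 := hn0 (n + n0) (by omega)
    have h3 := mul_le_mul_of_nonneg_right h2 hσ0
    linarith
  have off : (fun x => U (f x)) =ᵐ[m] F.indicator (fun x => U (f x)) := by
    filter_upwards [hfF] with x hx
    by_cases hxF : x ∈ F
    · simp [hxF]
    · have : f x = 0 := hx hxF
      simp [hxF, this, hU.zero]
  refine ⟨?_, ?_, c0 + ∫ x in F, h x ∂m, fun n => ?_⟩
  · exact ((integrable_indicator_iff hF.measurableSet).2 (main 1 one_pos).1).congr off.symm
  · have : eU U m β = ∫ x in F, U (f x) ∂m := by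
      rw [eU, ← integral_indicator hF.measurableSet]; exact integral_congr_ae off
    rw [this]
    by_contra hcon
    push Not at hcon
    have := (main ((∫ x in F, U (f x) ∂m - c0) / (2 * (σ + 1))) (by
      apply div_pos <;> linarith)).2
    have h4 : (∫ x in F, U (f x) ∂m - c0) / (2 * (σ + 1)) * σ ≤ (∫ x in F, U (f x) ∂m - c0) / 2 := by
      rw [div_mul_eq_mul_div, div_le_div_iff₀ (by positivity) (by positivity)]
      nlinarith
    linarith
  · have h1 := (gint n).2
    have h2 : ∫ x in F, - h x ∂m ≤ ∫ x in F, g n x ∂m := integral_mono hi.neg (gint n).1 (hb n)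
    rw [integral_neg] at h2
    linarith

end P9

section P10
variable {X : Type*} [MetricSpace X] [MeasurableSpace X] [SecondCountableTopology X] [BorelSpace X]
  [CompleteSpace X]

/-- tightness of bounded-entropy families -/
def TightP (U : ℝ → ℝ) (m : Measure X) : Prop :=
  ∀ (F : Set X), IsClosed F → Bornology.IsBounded F → m F ≠ ∞ → ∀ (β : ℕ → Measure X) (C : ℝ),
    (∀ k, IsFiniteMeasure (β k)) → (∀ k, β k Fᶜ = 0) → (∀ k, UI U m (β k)) → (∀ k, eU U m (β k) ≤ C) →
    IsTightMeasureSet (range β)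

lemma tight_proper [ProperSpace X] (U : ℝ → ℝ) (m : Measure X) : TightP U m := by
  intro F hF hb _ β C _ hβ _ _
  rw [isTightMeasureSet_iff_exists_isCompact_measure_compl_le]
  intro ε _
  refine ⟨F, Metric.isCompact_of_isClosed_isBounded hF hb, ?_⟩
  rintro _ ⟨k, rfl⟩
  rw [hβ k]; exact bot_le

lemma tight_log (m : Measure X) [SigmaFinite m] : TightP (fun r => r * Real.log r) m := by
  intro F hF _ hm β C _ hβ hui he
  have hU := UProp_log
  haveI : IsFiniteMeasure (m.restrict F) := ⟨by simpa using hm.lt_top⟩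
  have key : ∀ k (R : ℝ), 1 < R → ∀ E : Set X, MeasurableSet E → (β k).real E ≤ R * (m.restrict F).real E +
      (C + m.real F) / Real.log R := by
    intro k R hR E hE
    have lR := Real.log_pos hR
    have e0 : (β k).real E = ∫ x in E, dn m (β k) x ∂m := (Measure.setIntegral_toReal_rnDeriv (hui k).1 E).symm
    have i1 : Integrable (F.indicator (fun _ => (1:ℝ))) m :=
      (integrable_indicator_iff hF.measurableSet).2 (integrableOn_const hm)
    have i2 : Integrable (fun x => (dn m (β k) x * Real.log (dn m (β k) x) + F.indicator (fun _ => (1:ℝ)) x)) m :=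
      (hui k).2.add i1
    have pos : ∀ᵐ x ∂m, 0 ≤ dn m (β k) x * Real.log (dn m (β k) x) + F.indicator (fun _ => (1:ℝ)) x := by
      filter_upwards [dn_off (m := m) hF.measurableSet (hβ k)] with x hx
      by_cases hxF : x ∈ F
      · have := hU.tang 1 one_pos _ (dn_nonneg (m := m) (β k) x)
        simp at this
        simp only [Set.indicator_of_mem hxF]
        linarith [dn_nonneg (m := m) (β k) x]
      · simp [hxF, hx hxF]
    have pw : ∀ᵐ x ∂m, dn m (β k) x ≤ R * F.indicator (fun _ => (1:ℝ)) x +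
        (dn m (β k) x * Real.log (dn m (β k) x) + F.indicator (fun _ => (1:ℝ)) x) / Real.log R := by
      filter_upwards [dn_off (m := m) hF.measurableSet (hβ k), pos] with x hx hp
      by_cases hxF : x ∈ F
      · simp only [Set.indicator_of_mem hxF] at hp ⊢
        by_cases hr : dn m (β k) x ≤ R
        · have := div_nonneg hp lR.le
          linarith
        · push Not at hr
          have h1 := Real.log_le_log (by linarith) hr.le
          have h2 : dn m (β k) x ≤ (dn m (β k) x * Real.log (dn m (β k) x) + 1) / Real.log R := by
            rw [le_div_iff₀ lR]
            have := mul_le_mul_of_nonneg_left h1 (dn_nonneg (m := m) (β k) x)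
            linarith
          linarith
      · simp [hxF, hx hxF]
    rw [e0]
    calc ∫ x in E, dn m (β k) x ∂m ≤ ∫ x in E, (R * F.indicator (fun _ => (1:ℝ)) x +
        (dn m (β k) x * Real.log (dn m (β k) x) + F.indicator (fun _ => (1:ℝ)) x) / Real.log R) ∂m :=
          setIntegral_mono_ae (dn_int _).integrableOn ((i1.const_mul R).add (i2.div_const _)).integrableOn pw
      _ = ∫ x in E, R * F.indicator (fun _ => (1:ℝ)) x ∂m + ∫ x in E, (dn m (β k) x * Real.log (dn m (β k) x)
          + F.indicator (fun _ => (1:ℝ)) x) / Real.log R ∂m :=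
          integral_add (i1.const_mul R).integrableOn (i2.div_const _).integrableOn
      _ ≤ R * (m.restrict F).real E + (C + m.real F) / Real.log R := by
        gcongr
        · rw [integral_const_mul, integral_indicator hF.measurableSet, Measure.restrict_restrict hF.measurableSet]
          simp [Measure.real, Measure.restrict_apply hE, inter_comm]
        · refine (setIntegral_le_integral (i2.div_const _) (pos.mono fun x hx => div_nonneg hx lR.le)).trans ?_
          rw [integral_div]
          gcongr
          have j : ∫ x, (dn m (β k) x * Real.log (dn m (β k) x) + F.indicator (fun _ => (1:ℝ)) x) ∂m
            = eU (fun r => r * Real.log r) m (β k) + ∫ x, F.indicator (fun _ => (1:ℝ)) x ∂m := integral_add (hui k).2 i1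
          rw [j, integral_indicator hF.measurableSet]
          simp
          exact he k
  rw [isTightMeasureSet_iff_exists_isCompact_measure_compl_le]
  intro ε hε
  by_cases hεt : ε = ∞
  · exact ⟨∅, isCompact_empty, fun _ _ => by rw [hεt]; exact le_top⟩
  have hε' : 0 < ε.toReal := ENNReal.toReal_pos hε.ne' hεt
  obtain ⟨R, hR1, hR⟩ : ∃ R, 1 < R ∧ (C + m.real F) / Real.log R ≤ ε.toReal / 2 := by
    have : Tendsto (fun R => (C + m.real F) / Real.log R) atTop (𝓝 0) :=
      tendsto_const_nhds.div_atTop Real.tendsto_log_atTop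
    exact ((eventually_gt_atTop 1).and (this.eventually (ge_mem_nhds (by positivity)))).exists
  obtain ⟨Q, hQ, hQ'⟩ := isTightMeasureSet_iff_exists_isCompact_measure_compl_le.1 (tight_single (m.restrict F))
    (ENNReal.ofReal (ε.toReal / (2 * R))) (by rw [ENNReal.ofReal_pos]; positivity)
  refine ⟨Q, hQ, ?_⟩
  rintro _ ⟨k, rfl⟩
  have h1 := hQ' _ rfl
  have h2 : (m.restrict F).real Qᶜ ≤ ε.toReal / (2 * R) :=
    ENNReal.toReal_le_of_le_ofReal (by positivity) h1
  have h3 := key k R hR1 Qᶜ hQ.isClosed.measurableSet.compl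
  have h4 : R * (m.restrict F).real Qᶜ ≤ ε.toReal / 2 := by
    calc _ ≤ R * (ε.toReal / (2 * R)) := by gcongr
      _ = _ := by field_simp
  have h5 : (β k).real Qᶜ ≤ ε.toReal := by linarith
  rw [Measure.real, ENNReal.toReal_le_toReal (measure_ne_top _ _) hεt] at h5
  exact h5

/-! ### real-valued transport cost -/

def wr (μ ν : Measure X) : ℝ := (Wsq μ ν).toReal

lemma wr_nonneg (μ ν : Measure X) : 0 ≤ wr μ ν := ENNReal.toReal_nonneg
lemma wr_symm (μ ν : Measure X) : wr μ ν = wr ν μ := by rw [wr, wr, Wsq_symm]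

lemma edist_sq (x y : X) : edist x y ^ 2 = ENNReal.ofReal (dist x y ^ 2) := by
  rw [edist_dist, ENNReal.ofReal_pow dist_nonneg]

section mapl
variable {Y : Type*} [MeasurableSpace Y] {T : Measure Y} [IsFiniteMeasure T] {f g : Y → X} {D : ℝ}

lemma dist_int (hf : Measurable f) (hg : Measurable g)
    (hD : ∀ᵐ y ∂T, dist (f y) (g y) ≤ D) : Integrable (fun y => dist (f y) (g y) ^ 2) T := by
  refine Integrable.of_bound ((hf.dist hg).pow_const 2).aestronglyMeasurable (D ^ 2) ?_
  filter_upwards [hD] with y hy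
  rw [Real.norm_eq_abs, abs_of_nonneg (by positivity)]
  gcongr

lemma Wsq_map_le (hf : Measurable f) (hg : Measurable g) :
    Wsq (T.map f) (T.map g) ≤ ∫⁻ y, edist (f y) (g y) ^ 2 ∂T := by
  have h : IsCoupling (T.map (fun y => (f y, g y))) (T.map f) (T.map g) :=
    ⟨by rw [Measure.map_map (by fun_prop) (by fun_prop)]; rfl,
      by rw [Measure.map_map (by fun_prop) (by fun_prop)]; rfl⟩
  have := Wsq_le h
  rwa [lintegral_map meas_cost (by fun_prop)] at this

lemma lint_dist (hf : Measurable f) (hg : Measurable g) (hD : ∀ᵐ y ∂T, dist (f y) (g y) ≤ D) :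
    ∫⁻ y, edist (f y) (g y) ^ 2 ∂T = ENNReal.ofReal (∫ y, dist (f y) (g y) ^ 2 ∂T) := by
  simp_rw [edist_sq]
  exact (ofReal_integral_eq_lintegral_ofReal (dist_int hf hg hD)
    (Eventually.of_forall fun y => by positivity)).symm

lemma Wsq_map_fin (hf : Measurable f) (hg : Measurable g) (hD : ∀ᵐ y ∂T, dist (f y) (g y) ≤ D) :
    Wsq (T.map f) (T.map g) ≠ ∞ := by
  refine ne_top_of_le_ne_top ?_ (Wsq_map_le hf hg)
  rw [lint_dist hf hg hD]; exact ENNReal.ofReal_ne_top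

lemma wr_map (hf : Measurable f) (hg : Measurable g) (hD : ∀ᵐ y ∂T, dist (f y) (g y) ≤ D) :
    wr (T.map f) (T.map g) ≤ ∫ y, dist (f y) (g y) ^ 2 ∂T := by
  have := Wsq_map_le (T := T) hf hg
  rw [lint_dist hf hg hD] at this
  exact ENNReal.toReal_le_of_le_ofReal (integral_nonneg fun y => by positivity) this
end mapl

lemma coupling_ae {q : Measure (X × X)} {μ ν : Measure X} (hq : IsCoupling q μ ν) {A B : Set X}
    (mA : MeasurableSet A) (mB : MeasurableSet B) (hA : μ Aᶜ = 0) (hB : ν Bᶜ = 0) :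
    ∀ᵐ p ∂q, p.1 ∈ A ∧ p.2 ∈ B := by
  rw [← hq.1, Measure.map_apply measurable_fst mA.compl] at hA
  rw [← hq.2, Measure.map_apply measurable_snd mB.compl] at hB
  have a : ∀ᵐ p ∂q, p.1 ∈ A := hA
  have b : ∀ᵐ p ∂q, p.2 ∈ B := hB
  exact a.and b

lemma wr_bound {μ ν : Measure X} [IsFiniteMeasure μ] [IsFiniteMeasure ν] (hM : μ univ = ν univ) {A B : Set X}
    (mA : MeasurableSet A) (mB : MeasurableSet B) (hA : μ Aᶜ = 0) (hB : ν Bᶜ = 0) {D : ℝ}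
    (hD : ∀ x ∈ A, ∀ y ∈ B, dist x y ≤ D) : Wsq μ ν ≠ ∞ ∧ wr μ ν ≤ D ^ 2 * μ.real univ := by
  obtain ⟨q, hq⟩ := exists_coupling hM
  haveI := hq.finite
  have hb : ∀ᵐ p ∂q, dist p.1 p.2 ≤ D := by
    filter_upwards [coupling_ae hq mA mB hA hB] with p hp using hD _ hp.1 _ hp.2
  have h1 := Wsq_map_fin (T := q) measurable_fst measurable_snd hb
  have h2 := wr_map (T := q) measurable_fst measurable_snd hb
  rw [hq.1, hq.2] at h1 h2
  refine ⟨h1, h2.trans ?_⟩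
  have : ∫ y, dist y.1 y.2 ^ 2 ∂q ≤ ∫ _, D ^ 2 ∂q := by
    refine integral_mono_ae (dist_int measurable_fst measurable_snd hb) (integrable_const _) ?_
    filter_upwards [hb] with p hp
    gcongr
  refine this.trans (le_of_eq ?_)
  simp only [integral_const, smul_eq_mul, Measure.real, hq.mass]; ring

lemma exists_opt_real {μ ν : Measure X} [IsFiniteMeasure μ] [IsFiniteMeasure ν] (hM : μ univ = ν univ)
    {A B : Set X} (mA : MeasurableSet A) (mB : MeasurableSet B) (hA : μ Aᶜ = 0) (hB : ν Bᶜ = 0) {D : ℝ}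
    (hD : ∀ x ∈ A, ∀ y ∈ B, dist x y ≤ D) : ∃ q, IsCoupling q μ ν ∧ IsFiniteMeasure q ∧
      (∀ᵐ p ∂q, p.1 ∈ A ∧ p.2 ∈ B) ∧ (∫⁻ p, edist p.1 p.2 ^ 2 ∂q = Wsq μ ν) ∧
      ∫ p, dist p.1 p.2 ^ 2 ∂q = wr μ ν := by
  obtain ⟨q, hq, ho⟩ := exists_opt hM
  haveI := hq.finite
  have h0 := coupling_ae hq mA mB hA hB
  refine ⟨q, hq, hq.finite, h0, ho, ?_⟩
  have hb : ∀ᵐ p ∂q, dist p.1 p.2 ≤ D := by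
    filter_upwards [h0] with p hp using hD _ hp.1 _ hp.2
  rw [wr, ← ho, lint_dist measurable_fst measurable_snd hb, ENNReal.toReal_ofReal]
  exact integral_nonneg fun y => by positivity

lemma wr_add {μ ν μ' ν' : Measure X} [IsFiniteMeasure μ] [IsFiniteMeasure ν]
    [IsFiniteMeasure μ'] [IsFiniteMeasure ν'] (h : Wsq μ ν ≠ ∞) (h' : Wsq μ' ν' ≠ ∞) :
    wr (μ + μ') (ν + ν') ≤ wr μ ν + wr μ' ν' := by
  have e : ∀ {μ ν : Measure X}, Wsq μ ν ≠ ∞ → μ univ = ν univ := fun h => by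
    by_contra hc; exact h (Wsq_eq_top_of_mass hc)
  have := Wsq_add_le (e h) (e h')
  rw [wr, wr, wr, ← ENNReal.toReal_add h h']
  exact ENNReal.toReal_mono (ENNReal.add_ne_top.2 ⟨h, h'⟩) this

lemma wr_tri {μ ν ρ : Measure X} [IsFiniteMeasure μ] [IsFiniteMeasure ν] [IsFiniteMeasure ρ]
    (h1 : Wsq μ ν ≠ ∞) (h2 : Wsq ν ρ ≠ ∞) : √(wr μ ρ) ≤ √(wr μ ν) + √(wr ν ρ) := by
  have e : ∀ μ ν : Measure X, √(wr μ ν) = (W2 μ ν).toReal := by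
    intro μ ν
    rw [wr, W2, ← ENNReal.toReal_rpow, Real.sqrt_eq_rpow]
  have f : ∀ {μ ν : Measure X}, Wsq μ ν ≠ ∞ → W2 μ ν ≠ ∞ := fun h => by
    unfold W2; exact ENNReal.rpow_ne_top_of_nonneg (by norm_num) h
  rw [e, e, e, ← ENNReal.toReal_add (f h1) (f h2)]
  exact ENNReal.toReal_mono (ENNReal.add_ne_top.2 ⟨f h1, f h2⟩) (W2_triangle μ ν ρ)

end P10

section P11
variable {X : Type*} [MetricSpace X] [MeasurableSpace X] [SecondCountableTopology X] [BorelSpace X]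
  [CompleteSpace X]

/-- uniform measure of given mass -/
lemma unif_exists {m : Measure X} [SigmaFinite m] {U U' : ℝ → ℝ} (hU : UProp U U') {B : Set X}
    (mB : MeasurableSet B) (h0 : m B ≠ 0) (h1 : m B ≠ ∞) (M : ℝ≥0∞) (hM : M ≠ ∞) :
    ∃ ν : Measure X, IsFiniteMeasure ν ∧ ν univ = M ∧ UI U m ν ∧ ν Bᶜ = 0 ∧
      eU U m ν = m.real B * U (M.toReal / m.real B) := by
  have hc : M / m B ≠ ∞ := (ENNReal.div_lt_top hM h0).ne
  set c : NNReal := (M / m B).toNNReal with hcd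
  have hcc : (c : ℝ≥0∞) = M / m B := ENNReal.coe_toNNReal hc
  haveI : IsFiniteMeasure (m.restrict B) := ⟨by simpa using h1.lt_top⟩
  have hd : ∀ᵐ x ∂m, U (dn m (c • m.restrict B) x) = B.indicator (fun _ => U c) x := by
    filter_upwards [dn_smul (m := m) (m.restrict B) c, Measure.rnDeriv_restrict_self m mB] with x h2 h3
    rw [h2, dn, h3]
    by_cases hx : x ∈ B <;> simp [hx, hU.zero]
  have hi : Integrable (B.indicator (fun _ => U c)) m :=
    (integrable_indicator_iff mB).2 (integrableOn_const h1)
  refine ⟨c • m.restrict B, inferInstance, ?_, ⟨?_, ?_⟩, ?_, ?_⟩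
  · rw [Measure.smul_apply, ENNReal.smul_def, smul_eq_mul, hcc, Measure.restrict_apply_univ]
    exact ENNReal.div_mul_cancel h0 h1
  · exact (Measure.absolutelyContinuous_of_le Measure.restrict_le_self).smul_left c
  · exact hi.congr (hd.mono fun x hx => hx.symm)
  · rw [Measure.smul_apply, Measure.restrict_apply mB.compl]; simp
  · rw [eU, integral_congr_ae hd, integral_indicator mB]
    simp only [integral_const, MeasurableSet.univ, measureReal_restrict_apply, univ_inter, smul_eq_mul]
    congr 2
    rw [Measure.real, ← ENNReal.toReal_div, ← hcc]; simp

/-- competitors for the three-step problem -/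
def Comp3 (U : ℝ → ℝ) (m : Measure X) (F : Set X) (α β : Measure X) (c : ℝ) : Prop :=
  ∃ ν₁ ν₂ : Measure X, IsFiniteMeasure ν₁ ∧ IsFiniteMeasure ν₂ ∧ UI U m ν₁ ∧ UI U m ν₂ ∧
    ν₁ Fᶜ = 0 ∧ ν₂ Fᶜ = 0 ∧ Wsq α ν₁ ≠ ∞ ∧ Wsq ν₁ ν₂ ≠ ∞ ∧ Wsq ν₂ β ≠ ∞ ∧
    3 * (wr α ν₁ + wr ν₁ ν₂ + wr ν₂ β) ≤ c

lemma Wsq_add_fin {μ ν μ' ν' : Measure X} [IsFiniteMeasure μ] [IsFiniteMeasure ν]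
    [IsFiniteMeasure μ'] [IsFiniteMeasure ν'] (h : Wsq μ ν ≠ ∞) (h' : Wsq μ' ν' ≠ ∞) :
    Wsq (μ + μ') (ν + ν') ≠ ∞ := by
  have e : ∀ {μ ν : Measure X}, Wsq μ ν ≠ ∞ → μ univ = ν univ := fun h => by
    by_contra hc; exact h (Wsq_eq_top_of_mass hc)
  exact ne_top_of_le_ne_top (ENNReal.add_ne_top.2 ⟨h, h'⟩) (Wsq_add_le (e h) (e h'))

variable {m : Measure X} [SigmaFinite m] {U U' : ℝ → ℝ} {F : Set X}

lemma Comp3.add (hU : UProp U U') (mF : MeasurableSet F) (hF : m F ≠ ∞) {α β α' β' : Measure X}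
    [IsFiniteMeasure α] [IsFiniteMeasure β]
    [IsFiniteMeasure α'] [IsFiniteMeasure β'] {c c' : ℝ} (h : Comp3 U m F α β c) (h' : Comp3 U m F α' β' c') :
    Comp3 U m F (α + α') (β + β') (c + c') := by
  obtain ⟨a, b, fa, fb, ua, ub, oa, ob, w1, w2, w3, hc⟩ := h
  obtain ⟨a', b', fa', fb', ua', ub', oa', ob', w1', w2', w3', hc'⟩ := h'
  obtain ⟨C, -, hm⟩ := eU_mix (m := m) hU 1 one_pos
  refine ⟨a + a', b + b', inferInstance, inferInstance, (hm a a' F mF hF oa oa' ua ua').1,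
    (hm b b' F mF hF ob ob' ub ub').1, by simp [oa, oa'], by simp [ob, ob'],
    Wsq_add_fin w1 w1', Wsq_add_fin w2 w2', Wsq_add_fin w3 w3', ?_⟩
  have := wr_add w1 w1'
  have := wr_add w2 w2'
  have := wr_add w3 w3'
  linarith

lemma Comp3.zero (hU : UProp U U') : Comp3 U m F 0 0 0 := by
  refine ⟨0, 0, inferInstance, inferInstance, UI.zero hU, UI.zero hU, by simp, by simp, ?_⟩
  simp [wr, Wsq_self]

lemma Comp3.sum (hU : UProp U U') (mF : MeasurableSet F) (hF : m F ≠ ∞) {ι : Type*} (S : Finset ι)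
    (α β : ι → Measure X) [∀ i, IsFiniteMeasure (α i)] [∀ i, IsFiniteMeasure (β i)] (c : ι → ℝ)
    (h : ∀ i, Comp3 U m F (α i) (β i) (c i)) :
    Comp3 U m F (∑ i ∈ S, α i) (∑ i ∈ S, β i) (∑ i ∈ S, c i) := by
  induction S using Finset.induction_on with
  | empty => simpa using Comp3.zero hU
  | insert a s ha ih =>
    rw [Finset.sum_insert ha, Finset.sum_insert ha, Finset.sum_insert ha]
    exact Comp3.add hU mF hF (h a) ih

lemma mmSupp_pos (hs : mmSupp m = univ) {V : Set X} (hV : IsOpen V) {z : X} (hz : z ∈ V) : m V ≠ 0 := by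
  have : z ∈ mmSupp m := by rw [hs]; trivial
  exact (this V (hV.mem_nhds hz)).ne'

lemma comp3_piece (hU : UProp U U') (hs : mmSupp m = univ) (mF : MeasurableSet F)
    {α β : Measure X} [IsFiniteMeasure α] [IsFiniteMeasure β] {s : ℝ} (hF : m F ≠ ∞)
    {a b z₁ z₂ : X} {r : Measure (X × X)} [IsFiniteMeasure r] (hr : IsCoupling r α β) (s0 : 0 < s)
    (h1 : 3 * dist a z₁ = dist a b) (h2 : 3 * dist z₁ z₂ = dist a b) (h3 : 3 * dist z₂ b = dist a b)
    (b1 : Metric.ball z₁ s ⊆ F) (b2 : Metric.ball z₂ s ⊆ F)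
    (ha : α (Metric.ball a s)ᶜ = 0) (hb : β (Metric.ball b s)ᶜ = 0)
    (hi : Integrable (fun p => (dist p.1 p.2 + 8 * s) ^ 2) r) :
    Comp3 U m F α β (∫ p, (dist p.1 p.2 + 8 * s) ^ 2 ∂r) := by
  have fin : ∀ {z}, Metric.ball z s ⊆ F → m (Metric.ball z s) ≠ ∞ := fun h => ne_top_of_le_ne_top hF (measure_mono h)
  have mb : ∀ {z : X}, MeasurableSet (Metric.ball z s) := fun {z} => Metric.isOpen_ball.measurableSet
  have tr : ∀ {z w : X}, 3 * dist z w = dist a b → ∀ x ∈ Metric.ball z s, ∀ y ∈ Metric.ball w s,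
      dist x y ≤ dist a b / 3 + 2 * s := by
    intro z w h x hx y hy
    have := dist_triangle4 x z w y
    rw [Metric.mem_ball] at hx hy
    rw [dist_comm] at hy
    linarith
  obtain ⟨ν₁, f1, M1, u1, o1, -⟩ := unif_exists (m := m) hU (mb (z := z₁))
    (mmSupp_pos hs Metric.isOpen_ball (Metric.mem_ball_self s0)) (fin b1) (α univ) (measure_ne_top _ _)
  obtain ⟨ν₂, f2, M2, u2, o2, -⟩ := unif_exists (m := m) hU (mb (z := z₂))
    (mmSupp_pos hs Metric.isOpen_ball (Metric.mem_ball_self s0)) (fin b2) (α univ) (measure_ne_top _ _)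
  have Mb : α univ = β univ := hr.mass.symm.trans hr.mass'
  obtain ⟨w1, e1⟩ := wr_bound (μ := α) (ν := ν₁) M1.symm mb mb ha o1 (tr h1)
  obtain ⟨w2, e2⟩ := wr_bound (μ := ν₁) (ν := ν₂) (M1.trans M2.symm) mb mb o1 o2 (tr h2)
  obtain ⟨w3, e3⟩ := wr_bound (μ := ν₂) (ν := β) (M2.trans Mb) mb mb o2 hb (tr h3)
  refine ⟨ν₁, ν₂, f1, f2, u1, u2, measure_mono_null (compl_subset_compl.2 b1) o1,
    measure_mono_null (compl_subset_compl.2 b2) o2, w1, w2, w3, ?_⟩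
  have R1 : ν₁.real univ = α.real univ := by simp [Measure.real, M1]
  have R2 : ν₂.real univ = α.real univ := by simp [Measure.real, M2]
  rw [R1] at e2; rw [R2] at e3
  have hlow : (dist a b + 6 * s) ^ 2 * α.real univ ≤ ∫ p, (dist p.1 p.2 + 8 * s) ^ 2 ∂r := by
    have : ∫ p, (dist a b + 6 * s) ^ 2 ∂r ≤ ∫ p, (dist p.1 p.2 + 8 * s) ^ 2 ∂r := by
      refine integral_mono_ae (integrable_const _) hi ?_
      filter_upwards [coupling_ae hr mb mb ha hb] with p hp
      have h1 := hp.1; have h2 := hp.2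
      rw [Metric.mem_ball] at h1 h2
      have := dist_triangle4 a p.1 p.2 b
      rw [dist_comm a p.1] at this
      show (dist a b + 6 * s) ^ 2 ≤ (dist p.1 p.2 + 8 * s) ^ 2
      gcongr ?_ ^ 2
      linarith
    simp only [integral_const, smul_eq_mul, Measure.real, hr.mass] at this ⊢
    linarith
  have : 9 * (dist a b / 3 + 2 * s) ^ 2 = (dist a b + 6 * s) ^ 2 := by ring
  nlinarith [this, hlow, e1, e2, e3]

lemma thirds (hgeo : GeodesicSpace X) (a b : X) : ∃ z₁ z₂, 3 * dist a z₁ = dist a b ∧ 3 * dist z₁ z₂ = dist a b ∧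
    3 * dist z₂ b = dist a b := by
  obtain ⟨γ, g0, g1, hg⟩ := hgeo a b
  refine ⟨γ (1/3), γ (2/3), ?_, ?_, ?_⟩
  · have := hg 0 (by norm_num) (1/3) (by norm_num)
    rw [g0, g1] at this
    rw [this, abs_of_neg (by norm_num)]; ring
  · have := hg (1/3) (by norm_num) (2/3) (by norm_num)
    rw [g0, g1] at this
    rw [this, abs_of_neg (by norm_num)]; ring
  · have := hg (2/3) (by norm_num) 1 (by norm_num)
    rw [g0, g1] at this
    rw [this, abs_of_neg (by norm_num)]; ring

lemma competitor (hgeo : GeodesicSpace X) (hU : UProp U U') (hs : mmSupp m = univ) (mF : MeasurableSet F)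
    (hF : m F ≠ ∞) {α β : Measure X} [IsFiniteMeasure α] [IsFiniteMeasure β] (hM : α univ = β univ)
    (ua : UI U m α) {A B : Set X} (mA : MeasurableSet A) (mB : MeasurableSet B)
    (hA : α Aᶜ = 0) (hB : β Bᶜ = 0) {D s0 : ℝ} (hD : ∀ x ∈ A, ∀ y ∈ B, dist x y ≤ D) (hD0 : 0 ≤ D)
    (hs0 : 0 < s0) (hAF : A ⊆ F)
    (hz : ∀ a ∈ A, ∀ b ∈ B, ∀ z, (3 * dist a z = dist a b ∧ 3 * dist z b ≤ 2 * dist a b ∨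
      3 * dist z b = dist a b ∧ 3 * dist a z ≤ 2 * dist a b) →
      Metric.ball z s0 ⊆ F) {ε : ℝ} (hε : 0 < ε) :
    Comp3 U m F α β (wr α β + ε) := by
  obtain ⟨q, hq, fq, hae, -, hIntg⟩ := exists_opt_real hM mA mB hA hB hD
  set M := q.real univ with hMd
  obtain ⟨s, hs1, hs2, hs3⟩ : ∃ s, 0 < s ∧ s ≤ s0 ∧ (16 * s * D + 64 * s ^ 2) * M ≤ ε / 2 := by
    have : Tendsto (fun s : ℝ => (16 * s * D + 64 * s ^ 2) * M) (𝓝[>] 0) (𝓝 0) := by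
      have : Continuous (fun s : ℝ => (16 * s * D + 64 * s ^ 2) * M) := by fun_prop
      have := this.tendsto 0
      simp at this
      exact this.mono_left nhdsWithin_le_nhds
    have e1 := this.eventually (ge_mem_nhds (show (0:ℝ) < ε / 2 by positivity))
    have e2 : ∀ᶠ s : ℝ in 𝓝[>] 0, 0 < s := self_mem_nhdsWithin
    have e3 : ∀ᶠ s : ℝ in 𝓝[>] 0, s ≤ s0 := (ge_mem_nhds hs0).filter_mono nhdsWithin_le_nhds
    obtain ⟨s, h1, h2, h3⟩ := (e1.and (e2.and e3)).exists
    exact ⟨s, h2, h3, h1⟩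
  obtain ⟨P, hP⟩ := exists_rpart' q (fun V W => (V = ∅ ∧ W = ∅) ∨ ∃ a ∈ A, ∃ b ∈ B, V = Metric.ball a s ∧
    W = Metric.ball b s) (Or.inl ⟨rfl, rfl⟩) (A ×ˢ B) hae (by
      intro p hp
      exact ⟨_, _, Metric.mem_ball_self hs1, Metric.mem_ball_self hs1, Metric.isOpen_ball, Metric.isOpen_ball,
        Or.inr ⟨p.1, hp.1, p.2, hp.2, rfl, rfl⟩⟩)
  haveI := P.fin_q
  haveI := P.fin_a
  haveI := P.fin_b
  have hbd : ∀ᵐ p ∂q, dist p.1 p.2 ≤ D := by filter_upwards [hae] with p hp using hD _ hp.1 _ hp.2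
  have hi : Integrable (fun p => (dist p.1 p.2 + 8 * s) ^ 2) q := by
    refine Integrable.of_bound (by fun_prop) ((D + 8 * s) ^ 2) ?_
    filter_upwards [hbd] with p hp
    rw [Real.norm_eq_abs, abs_of_nonneg (by positivity)]
    gcongr
  have hpc : ∀ i, Comp3 U m F (P.a i) (P.b i) (∫ p, (dist p.1 p.2 + 8 * s) ^ 2 ∂(P.r i)) := by
    intro i
    have hii : Integrable (fun p => (dist p.1 p.2 + 8 * s) ^ 2) (P.r i) := hi.restrict
    obtain ⟨V, W, hV, hW, h⟩ := hP i
    have oa := measure_mono_null (compl_subset_compl.2 hV) (P.a_off i)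
    have ob := measure_mono_null (compl_subset_compl.2 hW) (P.b_off i)
    rcases h with ⟨rfl, rfl⟩ | ⟨a, ha, b, hb, rfl, rfl⟩
    · have e1 : P.a i = 0 := by simpa using oa
      have e2 : P.b i = 0 := by simpa using ob
      have e3 : P.r i = 0 := by
        have := (P.cpl i).mass
        rw [e1] at this; simpa using this
      rw [e1, e2, e3, integral_zero_measure]; exact Comp3.zero hU
    · obtain ⟨z1, z2, t1, t2, t3⟩ := thirds hgeo a b
      refine comp3_piece hU hs mF hF (P.cpl i) hs1 t1 t2 t3 ?_ ?_ oa ob hii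
      · refine (Metric.ball_subset_ball hs2).trans (hz a ha b hb z1 (Or.inl ⟨t1, ?_⟩))
        have := dist_triangle z1 z2 b; linarith
      · refine (Metric.ball_subset_ball hs2).trans (hz a ha b hb z2 (Or.inr ⟨t3, ?_⟩))
        have := dist_triangle a z1 z2; linarith
  -- finite part
  have hfs : ∑' i, P.r i univ ≠ ∞ := by
    rw [← Measure.sum_apply _ MeasurableSet.univ, P.sum_q]; exact measure_ne_top _ _
  have hlim := ENNReal.tendsto_tsum_compl_atTop_zero hfs
  have hpos : (0:ℝ≥0∞) < ENNReal.ofReal (ε / (2 * (3 * D ^ 2 + 1))) := by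
    rw [ENNReal.ofReal_pos]; positivity
  obtain ⟨S, hS⟩ := (hlim.eventually (ge_mem_nhds hpos)).exists
  set q' : Measure (X × X) := Measure.sum (fun i : {x // x ∉ S} => P.r i) with hq'
  have hsplit : ∑ i ∈ S, P.r i + q' = q := by
    have := Measure.sum_add_sum_compl (S : Set _) P.r
    rw [P.sum_q] at this
    refine Eq.trans ?_ this
    congr 1
    exact (Measure.sum_coe_finset S P.r).symm
  have hq'M : q'.real univ ≤ ε / (2 * (3 * D ^ 2 + 1)) := by
    refine ENNReal.toReal_le_of_le_ofReal (by positivity) ?_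
    rw [hq', Measure.sum_apply _ MeasurableSet.univ]; exact hS
  have hq'le : q' ≤ q := by rw [← hsplit]; exact Measure.le_add_left le_rfl
  have hSle : ∑ i ∈ S, P.r i ≤ q := by conv_rhs => rw [← hsplit]
                                       exact Measure.le_add_right le_rfl
  haveI : IsFiniteMeasure q' := isFiniteMeasure_of_le _ hq'le
  set α' := q'.map Prod.fst with hα'
  set β' := q'.map Prod.snd with hβ'
  have hα'le : α' ≤ α := by rw [← hq.1]; exact Measure.map_mono hq'le measurable_fst
  have hβ'le : β' ≤ β := by rw [← hq.2]; exact Measure.map_mono hq'le measurable_snd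
  have oa' : α' Aᶜ = 0 := le_antisymm ((hα'le _).trans hA.le) bot_le
  have ob' : β' Bᶜ = 0 := le_antisymm ((hβ'le _).trans hB.le) bot_le
  have hFc : ∀ {μ : Measure X}, μ Aᶜ = 0 → μ Fᶜ = 0 := fun h => measure_mono_null (compl_subset_compl.2 hAF) h
  have ua' : UI U m α' := UI.mono hU ua (LB.of_finite hU mF hF (hFc hA)) hα'le
  have hcp' : IsCoupling q' α' β' := ⟨rfl, rfl⟩
  have c2 : Comp3 U m F α' β' (3 * D ^ 2 * q'.real univ) := by
    obtain ⟨w, e⟩ := wr_bound (μ := α') (ν := β') (hcp'.mass.symm.trans hcp'.mass') mA mB oa' ob' hD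
    refine ⟨α', α', inferInstance, inferInstance, ua', ua', hFc oa', hFc oa', by simp [Wsq_self], by simp [Wsq_self], w, ?_⟩
    have : α'.real univ = q'.real univ := by simp [Measure.real, hcp'.mass]
    rw [this] at e
    have z : wr α' α' = 0 := by simp [wr, Wsq_self]
    rw [z]; linarith
  have c1 := Comp3.sum hU mF hF S P.a P.b _ hpc
  haveI : IsFiniteMeasure (∑ i ∈ S, P.a i) := inferInstance
  haveI : IsFiniteMeasure (∑ i ∈ S, P.b i) := inferInstance
  have c3 := Comp3.add hU mF hF c1 c2
  have ea : ∑ i ∈ S, P.a i + α' = α := by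
    conv_rhs => rw [← hq.1, ← hsplit, Measure.map_add _ _ measurable_fst, Measure.map_finset_sum measurable_fst.aemeasurable]
    rfl
  have eb : ∑ i ∈ S, P.b i + β' = β := by
    conv_rhs => rw [← hq.2, ← hsplit, Measure.map_add _ _ measurable_snd, Measure.map_finset_sum measurable_snd.aemeasurable]
    rfl
  rw [ea, eb] at c3
  obtain ⟨n1, n2, f1, f2, u1, u2, o1, o2, w1, w2, w3, hc⟩ := c3
  refine ⟨n1, n2, f1, f2, u1, u2, o1, o2, w1, w2, w3, hc.trans ?_⟩
  rw [← integral_finset_sum_measure (fun i _ => (show Integrable _ (P.r i) from hi.restrict))]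
  have b1 : ∫ p, (dist p.1 p.2 + 8 * s) ^ 2 ∂(∑ i ∈ S, P.r i) ≤ ∫ p, (dist p.1 p.2 + 8 * s) ^ 2 ∂q :=
    integral_mono_measure hSle (Eventually.of_forall fun p => by positivity) hi
  have id : Integrable (fun p : X × X => dist p.1 p.2 ^ 2) q := dist_int measurable_fst measurable_snd hbd
  have b2 : ∫ p, (dist p.1 p.2 + 8 * s) ^ 2 ∂q ≤ wr α β + (16 * s * D + 64 * s ^ 2) * M := by
    have : ∫ p, (dist p.1 p.2 + 8 * s) ^ 2 ∂q ≤ ∫ p, (dist p.1 p.2 ^ 2 + (16 * s * D + 64 * s ^ 2)) ∂q := by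
      refine integral_mono_ae hi (id.add (integrable_const _)) ?_
      filter_upwards [hbd] with p hp
      show (dist p.1 p.2 + 8 * s) ^ 2 ≤ dist p.1 p.2 ^ 2 + (16 * s * D + 64 * s ^ 2)
      nlinarith [mul_le_mul_of_nonneg_left hp hs1.le]
    rw [integral_add id (integrable_const _), hIntg] at this
    simp only [integral_const, smul_eq_mul] at this
    linarith
  have b3 : 3 * D ^ 2 * q'.real univ ≤ ε / 2 := by
    calc _ ≤ (3 * D ^ 2 + 1) * (ε / (2 * (3 * D ^ 2 + 1))) := by gcongr; linarith
      _ = ε / 2 := by field_simp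
  linarith

end P11

section P12
variable {X : Type*} [MetricSpace X] [MeasurableSpace X] [SecondCountableTopology X] [BorelSpace X]
  [CompleteSpace X]
variable {m : Measure X} [SigmaFinite m] {U U' : ℝ → ℝ} {F : Set X}

/-- existence of a good approximate midpoint -/
def MidP (U : ℝ → ℝ) (m : Measure X) (K : ℝ) (F : Set X) (α β : Measure X) : Prop :=
  ∃ n : Measure X, IsFiniteMeasure n ∧ n Fᶜ = 0 ∧ UI U m n ∧ Wsq α n ≠ ∞ ∧ Wsq n β ≠ ∞ ∧
    wr α n ≤ wr α β / 4 ∧ wr n β ≤ wr α β / 4 ∧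
    eU U m n ≤ eU U m α / 2 + eU U m β / 2 - K / 8 * wr α β

lemma MidP.swap {K : ℝ} {α β : Measure X} (h : MidP U m K F α β) : MidP U m K F β α := by
  obtain ⟨n, a, b, c, d, e, f, g, i⟩ := h
  refine ⟨n, a, b, c, by rwa [Wsq_symm], by rwa [Wsq_symm], ?_, ?_, ?_⟩
  · rwa [wr_symm, wr_symm β]
  · rwa [wr_symm, wr_symm β]
  · rw [wr_symm]; linarith

lemma CC.mid {K : ℝ} {α β : Measure X} [IsFiniteMeasure α] [IsFiniteMeasure β] (h : CC U m K α β)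
    (hf : Wsq α β ≠ ∞) {A B : Set X} (mA : MeasurableSet A) (mB : MeasurableSet B) (mF : MeasurableSet F)
    (hA : α Aᶜ = 0) (hB : β Bᶜ = 0)
    (hz : ∀ x ∈ A, ∀ z ∈ B, ∀ y, dist x y = 1/2 * dist x z → y ∈ F) : MidP U m K F α β := by
  obtain ⟨μ, m0, m1, mf, mW, me⟩ := h
  have hh : (1/2 : ℝ) ∈ Icc (0:ℝ) 1 := by norm_num
  have w1 := mW 0 (by simp) (1/2) hh
  have w2 := mW (1/2) hh 1 (by simp)
  rw [m0] at w1; rw [m1] at w2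
  have e1 : |(0:ℝ) - 1/2| = 1/2 := by norm_num [abs_of_neg]
  have e2 : |(1/2:ℝ) - 1| = 1/2 := by norm_num [abs_of_neg]
  rw [e1] at w1; rw [e2] at w2
  have hfin : ENNReal.ofReal (1/2) ^ 2 * Wsq α β ≠ ∞ := ENNReal.mul_ne_top (by simp) hf
  have hv : (ENNReal.ofReal (1/2) ^ 2 * Wsq α β).toReal = wr α β / 4 := by
    rw [ENNReal.toReal_mul, ENNReal.toReal_pow, ENNReal.toReal_ofReal (by norm_num), wr]; ring
  haveI := mf _ hh
  refine ⟨μ (1/2), mf _ hh, ?_, (me _ hh).1, ne_top_of_le_ne_top hfin w1, ne_top_of_le_ne_top hfin w2, ?_, ?_, ?_⟩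
  · obtain ⟨T, hT⟩ := exists_tplan (t := 1/2) (by norm_num) (by norm_num) hf w1 (by norm_num at w2 ⊢; exact w2)
    exact hT.conc mA mB mF hA hB (fun x hx z hz' y h1 _ => hz x hx z hz' y h1)
  · rw [← hv]; exact ENNReal.toReal_mono hfin w1
  · rw [← hv]; exact ENNReal.toReal_mono hfin w2
  · have := (me _ hh).2
    refine this.trans (le_of_eq ?_)
    rw [wr]; ring

section half
variable {Y : Type*} [MeasurableSpace Y]

lemma half_step (hU : UProp U U') (mF : MeasurableSet F) (hF : m F ≠ ∞) {T : Measure Y} [IsFiniteMeasure T]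
    {f0 f1 f2 f3 : Y → X} (h0 : Measurable f0) (h1 : Measurable f1) (h2 : Measurable f2) (h3 : Measurable f3)
    {G : Set Y} (mG : MeasurableSet G) {D δ c K l C : ℝ}
    (hD : ∀ᵐ y ∂T, dist (f0 y) (f1 y) ≤ D ∧ dist (f1 y) (f2 y) ≤ D ∧ dist (f2 y) (f3 y) ≤ D ∧ dist (f0 y) (f2 y) ≤ D)
    (u1 : UI U m (T.map f1)) (o1 : T.map f1 Fᶜ = 0)
    (hmin : ∀ n : Measure X, IsFiniteMeasure n → UI U m n → n Fᶜ = 0 → Wsq (T.map f0) n ≠ ∞ → Wsq n (T.map f2) ≠ ∞ →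
      3 * (wr (T.map f0) n + wr n (T.map f2) + wr (T.map f2) (T.map f3)) ≤ c → eU U m (T.map f1) ≤ eU U m n + δ)
    (hc : 3 * (∫ y, dist (f0 y) (f1 y) ^ 2 ∂T + ∫ y, dist (f1 y) (f2 y) ^ 2 ∂T + ∫ y, dist (f2 y) (f3 y) ^ 2 ∂T) ≤ c)
    (hmid : MidP U m K F ((T.restrict G).map f0) ((T.restrict G).map f2))
    (hl : 0 ≤ l)
    (hC : ∀ (μ ν : Measure X) [IsFiniteMeasure μ] [IsFiniteMeasure ν] (G : Set X),
      MeasurableSet G → m G ≠ ∞ → μ Gᶜ = 0 → ν Gᶜ = 0 → UI U m μ → UI U m ν →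
      UI U m (μ + ν) ∧ eU U m (μ + ν) ≤ eU U m μ + eU U m ν + l * (m.real G + μ.real univ) + C * ν.real univ) :
    eU U m ((T.restrict G).map f1) ≤ eU U m ((T.restrict G).map f0) / 2 + eU U m ((T.restrict G).map f2) / 2
      - K / 8 * wr ((T.restrict G).map f0) ((T.restrict G).map f2) + δ + l * (m.real F + T.real univ)
      + C * T.real Gᶜ := by
  obtain ⟨n, fn, on, un, w1, w2, c1, c2, en⟩ := hmid
  have sp : ∀ {f : Y → X}, Measurable f → T.map f = (T.restrict G).map f + (T.restrict Gᶜ).map f := by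
    intro f hf
    rw [← Measure.map_add _ _ hf, Measure.restrict_add_restrict_compl mG]
  have hg : (T.restrict G).map f1 ≤ T.map f1 := Measure.map_mono Measure.restrict_le_self h1
  have hb : (T.restrict Gᶜ).map f1 ≤ T.map f1 := Measure.map_mono Measure.restrict_le_self h1
  have lb := LB.of_finite (m := m) hU mF hF o1
  have ug := UI.mono hU u1 lb hg
  have ub := UI.mono hU u1 lb hb
  have ob : (T.restrict Gᶜ).map f1 Fᶜ = 0 := le_antisymm ((hb _).trans o1.le) bot_le
  have hDb : ∀ S, ∀ᵐ y ∂(T.restrict S), dist (f0 y) (f1 y) ≤ D ∧ dist (f1 y) (f2 y) ≤ D ∧ dist (f2 y) (f3 y) ≤ D ∧ dist (f0 y) (f2 y) ≤ D :=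
    fun S => ae_restrict_of_ae hD
  have s1 := eU_sup hU ug ub (by rw [← sp h1]; exact u1)
  rw [← sp h1] at s1
  obtain ⟨un', en'⟩ := hC n ((T.restrict Gᶜ).map f1) F mF hF on ob un ub
  have wf1 := Wsq_map_fin (T := T.restrict Gᶜ) h0 h1 ((hDb Gᶜ).mono fun y hy => hy.1)
  have wf2 := Wsq_map_fin (T := T.restrict Gᶜ) h1 h2 ((hDb Gᶜ).mono fun y hy => hy.2.1)
  have wb1 := wr_map (T := T.restrict Gᶜ) h0 h1 ((hDb Gᶜ).mono fun y hy => hy.1)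
  have wb2 := wr_map (T := T.restrict Gᶜ) h1 h2 ((hDb Gᶜ).mono fun y hy => hy.2.1)
  have wb3 := wr_map (T := T) h2 h3 (hD.mono fun y hy => hy.2.2.1)
  have wg := wr_map (T := T.restrict G) h0 h2 ((hDb G).mono fun y hy => hy.2.2.2)
  have i1 := dist_int (T := T) h0 h1 (hD.mono fun y hy => hy.1)
  have i2 := dist_int (T := T) h1 h2 (hD.mono fun y hy => hy.2.1)
  have i02 := dist_int (T := T) h0 h2 (hD.mono fun y hy => hy.2.2.2)
  have wg' : ∫ y in G, dist (f0 y) (f2 y) ^ 2 ∂T ≤ 2 * (∫ y in G, dist (f0 y) (f1 y) ^ 2 ∂T + ∫ y in G, dist (f1 y) (f2 y) ^ 2 ∂T) := by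
    rw [← integral_add i1.integrableOn i2.integrableOn, ← integral_const_mul]
    refine integral_mono i02.integrableOn ((i1.add i2).const_mul 2).integrableOn ?_
    intro y
    show dist (f0 y) (f2 y) ^ 2 ≤ 2 * (dist (f0 y) (f1 y) ^ 2 + dist (f1 y) (f2 y) ^ 2)
    have := dist_triangle (f0 y) (f1 y) (f2 y)
    have : dist (f0 y) (f2 y) ^ 2 ≤ (dist (f0 y) (f1 y) + dist (f1 y) (f2 y)) ^ 2 := by gcongr
    nlinarith [sq_nonneg (dist (f0 y) (f1 y) - dist (f1 y) (f2 y))]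
  have a1 := integral_add_compl mG i1
  have a2 := integral_add_compl mG i2
  have k1 := wr_add w1 wf1
  have k2 := wr_add w2 wf2
  have k1' := Wsq_add_fin w1 wf1
  have k2' := Wsq_add_fin w2 wf2
  rw [← sp h0] at k1 k1'
  rw [← sp h2] at k2 k2'
  have fin := hmin _ inferInstance un' (by simp [on, ob]) k1' k2' (by linarith)
  have mn : n.real univ ≤ T.real univ := by
    have e : n univ = (T.restrict G).map f0 univ := by
      by_contra hcn
      exact w1 (Wsq_eq_top_of_mass (fun h => hcn h.symm))
    rw [Measure.real, e, Measure.map_apply h0 MeasurableSet.univ, preimage_univ, Measure.restrict_apply_univ]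
    exact measureReal_mono (subset_univ _)
  have mb : ((T.restrict Gᶜ).map f1).real univ = T.real Gᶜ := by
    rw [Measure.real, Measure.map_apply h1 MeasurableSet.univ, preimage_univ, Measure.restrict_apply_univ]; rfl
  rw [mb] at en'
  have := mul_le_mul_of_nonneg_left mn hl
  nlinarith
end half

lemma alg4 {a b c D L : ℝ} (hL : 0 < L) (ha : 0 ≤ a) (hb : 0 ≤ b) (hc : 0 ≤ c) (hD0 : 0 ≤ D) (hD : D ≤ a + b + c)
    (hDL : D ≤ 1.072 * L) (h : 0.4 * L < a) : 0.008 * L ^ 2 ≤ 3 * (a ^ 2 + b ^ 2 + c ^ 2) - D ^ 2 := by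
  rcases le_total a D with h1 | h1
  · have h2 : (D - a) ^ 2 ≤ (b + c) ^ 2 := by
      have : 0 ≤ D - a := by linarith
      gcongr; linarith
    have h3 : (b + c) ^ 2 ≤ 2 * (b ^ 2 + c ^ 2) := by nlinarith [sq_nonneg (b - c)]
    have h4 : (0.128 * L) ^ 2 ≤ (3 * a - D) ^ 2 := by
      gcongr; linarith
    nlinarith
  · have h2 : D ^ 2 ≤ a ^ 2 := by gcongr
    have h3 : (0.4 * L) ^ 2 ≤ a ^ 2 := by gcongr
    nlinarith [sq_nonneg b, sq_nonneg c]

lemma alg4' {a b c D L : ℝ} (hL : 0 < L) (ha : 0 ≤ a) (hb : 0 ≤ b) (hc : 0 ≤ c) (hD0 : 0 ≤ D) (hD : D ≤ a + b + c)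
    (hDL : D ≤ 1.072 * L) (h : ¬ (a ≤ 0.4 * L ∧ b ≤ 0.4 * L ∧ c ≤ 0.4 * L)) :
    0.008 * L ^ 2 ≤ 3 * (a ^ 2 + b ^ 2 + c ^ 2) - D ^ 2 := by
  by_cases h1 : a ≤ 0.4 * L
  · by_cases h2 : b ≤ 0.4 * L
    · have h3 : 0.4 * L < c := by
        by_contra h3; exact h ⟨h1, h2, not_lt.1 h3⟩
      have := alg4 hL hc ha hb hD0 (by linarith) hDL h3
      linarith
    · have := alg4 hL hb ha hc hD0 (by linarith) hDL (not_le.1 h2)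
      linarith
  · exact alg4 hL ha hb hc hD0 hD hDL (not_le.1 h1)

/-- quantitative geodesic algebra -/
lemma alg_pv {p v w κ B : ℝ} (hp : 0 ≤ p) (hv : 0 ≤ v) (hκ : 0 ≤ κ)
    (h1 : (3/2) * p ^ 2 + 3 * v ^ 2 ≤ w + κ) (h2 : w - κ ≤ (p + v) ^ 2) (hB : w + κ ≤ B ^ 2) (hB0 : 0 ≤ B) :
    |p ^ 2 - 4/9 * w| ≤ 2 * κ + 2 * B * √κ ∧ |v ^ 2 - w / 9| ≤ 2 * κ + 2 * B * √κ := by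
  set a := p + v with ha
  set b := p - 2 * v with hb
  have e : (3/2) * p ^ 2 + 3 * v ^ 2 = a ^ 2 + b ^ 2 / 2 := by rw [ha, hb]; ring
  have hb2 : b ^ 2 ≤ 4 * κ := by nlinarith
  have hs : √κ ^ 2 = κ := Real.sq_sqrt hκ
  have hs0 : 0 ≤ √κ := Real.sqrt_nonneg κ
  have hbb : |b| ≤ 2 * √κ := by
    apply abs_le_of_sq_le_sq
    · nlinarith
    · positivity
  have haB : |a| ≤ B := abs_le_of_sq_le_sq (by nlinarith [sq_nonneg b]) hB0
  have hab : |a * b| ≤ B * (2 * √κ) := by rw [abs_mul]; gcongr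
  have ha2 : |a ^ 2 - w| ≤ κ := by rw [abs_le]; constructor <;> nlinarith [sq_nonneg b]
  have ep : p = 2/3 * a + 1/3 * b := by rw [ha, hb]; ring
  have ev : v = 1/3 * a - 1/3 * b := by rw [ha, hb]; ring
  rw [abs_le] at hab ha2
  have hBs : 0 ≤ B * √κ := by positivity
  constructor
  · rw [ep, abs_le]; constructor <;> nlinarith [sq_nonneg b]
  · rw [ev, abs_le]; constructor <;> nlinarith [sq_nonneg b]

end P12

section P13
variable {X : Type*} [MetricSpace X] [MeasurableSpace X] [SecondCountableTopology X] [BorelSpace X]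
  [CompleteSpace X]
variable {m : Measure X} [SigmaFinite m] {U U' : ℝ → ℝ} {F : Set X}

lemma mass_of_fin {μ ν : Measure X} (h : Wsq μ ν ≠ ∞) : μ univ = ν univ := by
  by_contra hc; exact h (Wsq_eq_top_of_mass hc)

/-- target conclusion of the near minimization -/
def Cls (U : ℝ → ℝ) (m : Measure X) (F : Set X) (α β : Measure X) (c : ℝ) (ν₁ ν₂ : Measure X) : Prop :=
  IsFiniteMeasure ν₁ ∧ IsFiniteMeasure ν₂ ∧ UI U m ν₁ ∧ UI U m ν₂ ∧
    ν₁ Fᶜ = 0 ∧ ν₂ Fᶜ = 0 ∧ Wsq α ν₁ ≠ ∞ ∧ Wsq ν₁ ν₂ ≠ ∞ ∧ Wsq ν₂ β ≠ ∞ ∧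
    3 * (wr α ν₁ + wr ν₁ ν₂ + wr ν₂ β) ≤ c

lemma near_min (hU : UProp U U') (mF : MeasurableSet F) (hF : m F ≠ ∞) {α β : Measure X}
    {c δ : ℝ} (h : Comp3 U m F α β c) (hδ : 0 < δ) :
    ∃ ν₁ ν₂, Cls U m F α β c ν₁ ν₂ ∧ ∀ n₁ n₂, Cls U m F α β c n₁ n₂ →
      eU U m ν₁ + eU U m ν₂ ≤ eU U m n₁ + eU U m n₂ + δ := by
  obtain ⟨C, hC, hlow⟩ := eU_low (m := m) hU 1 one_pos
  set S : Set ℝ := {e | ∃ ν₁ ν₂, Cls U m F α β c ν₁ ν₂ ∧ e = eU U m ν₁ + eU U m ν₂} with hS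
  have hbd : BddBelow S := by
    refine ⟨2 * (-1 * m.real F - C * α.real univ), ?_⟩
    rintro _ ⟨ν₁, ν₂, ⟨f1, f2, u1, u2, o1, o2, w1, w2, w3, -⟩, rfl⟩
    have a1 := hlow ν₁ F mF hF o1 u1
    have a2 := hlow ν₂ F mF hF o2 u2
    have M1 : ν₁.real univ = α.real univ := by simp [Measure.real, mass_of_fin w1]
    have M2 : ν₂.real univ = α.real univ := by simp [Measure.real, mass_of_fin w1, mass_of_fin w2]
    rw [M1] at a1; rw [M2] at a2
    linarith
  have hne : S.Nonempty := by
    obtain ⟨n1, n2, h⟩ := h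
    exact ⟨_, n1, n2, h, rfl⟩
  obtain ⟨_, ⟨ν₁, ν₂, hc, rfl⟩, hlt⟩ := exists_lt_of_csInf_lt hne (show sInf S < sInf S + δ by linarith)
  refine ⟨ν₁, ν₂, hc, fun n₁ n₂ hn => ?_⟩
  have := csInf_le hbd ⟨n₁, n₂, hn, rfl⟩
  linarith

lemma key_plan [Nonempty X] (hU : UProp U U') (mF : MeasurableSet F) (hF : m F ≠ ∞) {α β : Measure X}
    [IsFiniteMeasure α] [IsFiniteMeasure β] {D : ℝ} (hD : ∀ x ∈ F, ∀ y ∈ F, dist x y ≤ D)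
    (hα : α Fᶜ = 0) (hβ : β Fᶜ = 0)
    {c δ : ℝ} (h : Comp3 U m F α β c) (hδ : 0 < δ) :
    ∃ T : Measure (X × X × X × X), IsFiniteMeasure T ∧ T.map (fun p => p.1) = α ∧
      T.map (fun p => p.2.2.2) = β ∧
      (∀ᵐ p ∂T, p.1 ∈ F ∧ p.2.1 ∈ F ∧ p.2.2.1 ∈ F ∧ p.2.2.2 ∈ F) ∧
      3 * (∫ p, dist p.1 p.2.1 ^ 2 ∂T + ∫ p, dist p.2.1 p.2.2.1 ^ 2 ∂T + ∫ p, dist p.2.2.1 p.2.2.2 ^ 2 ∂T) ≤ c ∧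
      Cls U m F α β c (T.map (fun p => p.2.1)) (T.map (fun p => p.2.2.1)) ∧
      ∀ n₁ n₂, Cls U m F α β c n₁ n₂ →
      eU U m (T.map (fun p => p.2.1)) + eU U m (T.map (fun p => p.2.2.1)) ≤ eU U m n₁ + eU U m n₂ + δ := by
  obtain ⟨ν₁, ν₂, hcl, hmin⟩ := near_min hU mF hF h hδ
  obtain ⟨f1, f2, u1, u2, o1, o2, w1, w2, w3, hc⟩ := id hcl
  obtain ⟨q1, hq1, fq1, ae1, -, e1⟩ := exists_opt_real (mass_of_fin w1) mF mF hα o1 hD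
  obtain ⟨q2, hq2, fq2, ae2, -, e2⟩ := exists_opt_real (mass_of_fin w2) mF mF o1 o2 hD
  obtain ⟨q3, hq3, fq3, ae3, -, e3⟩ := exists_opt_real (mass_of_fin w3) mF mF o2 hβ hD
  obtain ⟨T', hT1, hT2⟩ := exists_glue q2 q3 (by rw [hq2.2, hq3.1])
  have hT'f : T'.map (fun p => p.1) = ν₁ := by
    rw [← hq2.1, ← hT1, Measure.map_map (by fun_prop) (by fun_prop)]; rfl
  haveI : IsFiniteMeasure T' := by
    constructor
    have := congrArg (fun μ => μ univ) hT'f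
    simp only [Measure.map_apply (measurable_fst : Measurable (fun p : X × X × X => p.1)) MeasurableSet.univ,
      preimage_univ] at this
    rw [this]; exact measure_lt_top _ _
  obtain ⟨T, hT3, hT4⟩ := exists_glue q1 T' (by rw [hq1.2]; exact hT'f.symm)
  have g1 : T.map (fun p => (p.1, p.2.1)) = q1 := hT3
  have g2 : T.map (fun p => (p.2.1, p.2.2.1)) = q2 := by
    rw [← hT1, ← hT4, Measure.map_map (by fun_prop) (by fun_prop)]; rfl
  have g3 : T.map (fun p => (p.2.2.1, p.2.2.2)) = q3 := by
    rw [← hT2, ← hT4, Measure.map_map (by fun_prop) (by fun_prop)]; rfl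
  have k0 : T.map (fun p => p.1) = α := by
    rw [← hq1.1, ← g1, Measure.map_map (by fun_prop) (by fun_prop)]; rfl
  have k1 : T.map (fun p => p.2.1) = ν₁ := by
    rw [← hq1.2, ← g1, Measure.map_map (by fun_prop) (by fun_prop)]; rfl
  have k2 : T.map (fun p => p.2.2.1) = ν₂ := by
    rw [← hq2.2, ← g2, Measure.map_map (by fun_prop) (by fun_prop)]; rfl
  have k3 : T.map (fun p => p.2.2.2) = β := by
    rw [← hq3.2, ← g3, Measure.map_map (by fun_prop) (by fun_prop)]; rfl
  have mm : Measurable (fun p : X × X => dist p.1 p.2 ^ 2) := by fun_prop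
  have i1 : ∫ p, dist p.1 p.2.1 ^ 2 ∂T = wr α ν₁ := by
    rw [← e1, ← g1, integral_map (by fun_prop) mm.aestronglyMeasurable]
  have i2 : ∫ p, dist p.2.1 p.2.2.1 ^ 2 ∂T = wr ν₁ ν₂ := by
    rw [← e2, ← g2, integral_map (by fun_prop) mm.aestronglyMeasurable]
  have i3 : ∫ p, dist p.2.2.1 p.2.2.2 ^ 2 ∂T = wr ν₂ β := by
    rw [← e3, ← g3, integral_map (by fun_prop) mm.aestronglyMeasurable]
  refine ⟨T, ?_, k0, k3, ?_, ?_, ?_, ?_⟩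
  · constructor
    have := congrArg (fun μ => μ univ) k0
    simp only [Measure.map_apply (measurable_fst : Measurable (fun p : X × X × X × X => p.1)) MeasurableSet.univ,
      preimage_univ] at this
    rw [this]; exact measure_lt_top _ _
  · have fm : MeasurableSet {p : X × X | p.1 ∈ F ∧ p.2 ∈ F} := mF.prod mF
    rw [← g1, ae_map_iff (by fun_prop) fm] at ae1
    rw [← g3, ae_map_iff (by fun_prop) fm] at ae3
    filter_upwards [ae1, ae3] with p h1 h2
    exact ⟨h1.1, h1.2, h2.1, h2.2⟩
  · rw [i1, i2, i3]; exact hc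
  · rw [k1, k2]; exact hcl
  · rw [k1, k2]; exact hmin

end P13

section P14
variable {X : Type*} [MetricSpace X] [MeasurableSpace X] [SecondCountableTopology X] [BorelSpace X]
  [CompleteSpace X]
variable {m : Measure X} [SigmaFinite m] {U U' : ℝ → ℝ}

/-- local transport convexity at scale `L` -/
def TP (U : ℝ → ℝ) (m : Measure X) (K : ℝ) (x : X) (L : ℝ) : Prop :=
  ∀ ν₀ ν₁ : Measure X, IsFiniteMeasure ν₀ → IsFiniteMeasure ν₁ → ν₀ univ = ν₁ univ →
    ν₀ (Metric.closedBall x (L / 100))ᶜ = 0 → ν₁ (Metric.closedBall x L)ᶜ = 0 → UI U m ν₀ → UI U m ν₁ →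
    CC U m K ν₀ ν₁

lemma map_off {Y : Type*} [MeasurableSpace Y] {T : Measure Y} {f : Y → X} (hf : Measurable f) {E : Set X}
    (mE : MeasurableSet E) : T.map f Eᶜ = 0 ↔ ∀ᵐ y ∂T, f y ∈ E := by
  rw [Measure.map_apply hf mE.compl]; rfl

lemma real_map_univ {Y : Type*} [MeasurableSpace Y] {T : Measure Y} {f : Y → X} (hf : Measurable f) :
    (T.map f).real univ = T.real univ := by
  rw [Measure.real, Measure.map_apply hf MeasurableSet.univ, preimage_univ]; rfl

set_option maxHeartbeats 2000000 in
lemma key_approx (hgeo : GeodesicSpace X) (hU : UProp U U') (hs : mmSupp m = univ) {K : ℝ} {x0 y0 : X} {L : ℝ}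
    (hL : 0 < L) (hxy : dist x0 y0 ≤ 1.07 * L) (T0 : TP U m K x0 (0.9 * L)) (T1 : TP U m K y0 (0.9 * L))
    {F : Set X} (hFd : F = Metric.closedBall x0 (0.85 * L) ∪ Metric.closedBall y0 (0.85 * L)) (hF : m F ≠ ∞)
    {α β : Measure X} [IsFiniteMeasure α] [IsFiniteMeasure β] (hM : α univ = β univ)
    (ua : UI U m α) (ub : UI U m β) (hA : α (Metric.closedBall x0 (L / 1000))ᶜ = 0)
    (hB : β (Metric.closedBall y0 (L / 1000))ᶜ = 0) {η : ℝ} (hη : 0 < η) :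
    ∃ n : Measure X, IsFiniteMeasure n ∧ n Fᶜ = 0 ∧ UI U m n ∧ Wsq α n ≠ ∞ ∧ Wsq n β ≠ ∞ ∧
      wr α n ≤ 4/9 * wr α β + η ∧ wr n β ≤ wr α β / 9 + η ∧
      eU U m n ≤ 1/3 * eU U m α + 2/3 * eU U m β - K / 9 * wr α β + η := by
  haveI : Nonempty X := ⟨x0⟩
  have mc : ∀ (x : X) r, MeasurableSet (Metric.closedBall x r) := fun x r => Metric.isClosed_closedBall.measurableSet
  have mF : MeasurableSet F := by rw [hFd]; exact (mc _ _).union (mc _ _)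
  have hx0F : ∀ x, dist x x0 ≤ 0.85 * L → x ∈ F := fun x hx => by rw [hFd]; exact Or.inl hx
  have hy0F : ∀ x, dist x y0 ≤ 0.85 * L → x ∈ F := fun x hx => by rw [hFd]; exact Or.inr hx
  have hAF : Metric.closedBall x0 (L / 1000) ⊆ F := fun x hx => hx0F x (le_trans hx (by linarith))
  have hBF : Metric.closedBall y0 (L / 1000) ⊆ F := fun x hx => hy0F x (le_trans hx (by linarith))
  have hαF := measure_mono_null (compl_subset_compl.2 hAF) hA
  have hβF := measure_mono_null (compl_subset_compl.2 hBF) hB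
  have hDF : ∀ x ∈ F, ∀ y ∈ F, dist x y ≤ 3 * L := by
    have : ∀ x ∈ F, ∃ c, (c = x0 ∨ c = y0) ∧ dist x c ≤ 0.85 * L := by
      intro x hx
      rw [hFd] at hx
      rcases hx with hx | hx
      · exact ⟨x0, Or.inl rfl, hx⟩
      · exact ⟨y0, Or.inr rfl, hx⟩
    intro x hx y hy
    obtain ⟨c, hc, h1⟩ := this x hx
    obtain ⟨d, hd, h2⟩ := this y hy
    have h3 := dist_triangle4 x c d y
    rw [dist_comm d] at h3
    have h4 : dist c d ≤ 1.07 * L := by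
      rcases hc with rfl | rfl <;> rcases hd with rfl | rfl
      · rw [dist_self]; positivity
      · exact hxy
      · rw [dist_comm]; exact hxy
      · rw [dist_self]; positivity
    linarith
  have hD0 : ∀ x ∈ Metric.closedBall x0 (L / 1000), ∀ y ∈ Metric.closedBall y0 (L / 1000), dist x y ≤ 1.072 * L := by
    intro x hx y hy
    rw [Metric.mem_closedBall] at hx hy
    have h3 := dist_triangle4 x x0 y0 y
    rw [dist_comm y0] at h3
    linarith
  have hcomp : ∀ ε > 0, Comp3 U m F α β (wr α β + ε) := by
    intro ε hε
    refine competitor hgeo hU hs mF hF hM ua (mc _ _) (mc _ _) hA hB hD0 (by positivity)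
      (show 0 < 0.1 * L by positivity) hAF ?_ hε
    intro a ha b hb z hz w hw
    have h1 := hD0 a ha b hb
    rw [Metric.mem_closedBall] at ha hb
    rw [Metric.mem_ball] at hw
    rcases hz with ⟨hz, -⟩ | ⟨hz, -⟩
    · apply hx0F
      have := dist_triangle4 w z a x0
      rw [dist_comm z a] at this
      linarith
    · apply hy0F
      have := dist_triangle4 w z b y0
      linarith
  set w := wr α β with hw
  have hw0 : 0 ≤ w := wr_nonneg _ _
  set V := m.real F with hV
  have hV0 : 0 ≤ V := measureReal_nonneg
  set M := α.real univ with hMd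
  have hM0 : 0 ≤ M := measureReal_nonneg
  set l := η / (20 * (V + M + 1)) with hl
  have hl0 : 0 < l := by positivity
  have hlVM : l * (V + M) ≤ η / 20 := by
    rw [hl, div_mul_eq_mul_div, div_le_div_iff₀ (by positivity) (by positivity)]
    nlinarith
  have hlV : l * V ≤ η / 20 := le_trans (by gcongr; linarith) hlVM
  obtain ⟨C, hC0, hC⟩ := eU_mix (m := m) hU l hl0
  obtain ⟨C', hC'0, hC'⟩ := eU_low (m := m) hU l hl0
  -- choose ε
  let τh : ℝ → ℝ := fun ε => ε / (0.008 * L ^ 2)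
  let κ : ℝ → ℝ := fun ε => ε + (1.072 * L) ^ 2 * τh ε
  let R : ℝ → ℝ := fun ε => 2 * κ ε + 2 * (w + κ ε + 1) * √(κ ε)
  have cτ : Continuous τh := by fun_prop
  have cκ : Continuous κ := by fun_prop
  have cR : Continuous R := by fun_prop
  obtain ⟨ε, hε, g1, g2⟩ : ∃ ε > 0, |K| / 4 * R ε + (3 * C + C') * τh ε + τh ε / M * |eU U m β| ≤ η / 4 ∧
      R ε + (3 * L) ^ 2 * τh ε ≤ η := by
    have c1 : Continuous (fun ε => |K| / 4 * R ε + (3 * C + C') * τh ε + τh ε / M * |eU U m β|) := by fun_prop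
    have c2 : Continuous (fun ε => R ε + (3 * L) ^ 2 * τh ε) := by fun_prop
    have z1 := c1.tendsto 0
    have z2 := c2.tendsto 0
    simp only [R, κ, τh, zero_div, mul_zero, zero_mul, add_zero, Real.sqrt_zero] at z1 z2
    have e1 := z1.eventually (ge_mem_nhds (show (0:ℝ) < η / 4 by positivity))
    have e2 := z2.eventually (ge_mem_nhds hη)
    have e3 := (e1.and e2).filter_mono (nhdsWithin_le_nhds (s := Ioi (0:ℝ)))
    obtain ⟨ε, h1, h2⟩ := (e3.and self_mem_nhdsWithin).exists
    exact ⟨ε, h2, h1.1, h1.2⟩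
  obtain ⟨T, fT, k0, k3, aeF, hcost, hcl, hmin⟩ := key_plan hU mF hF hDF hαF hβF (hcomp ε hε) (show 0 < η / 20 by positivity)
  have h0 : Measurable (fun p : X × X × X × X => p.1) := by fun_prop
  have h1 : Measurable (fun p : X × X × X × X => p.2.1) := by fun_prop
  have h2 : Measurable (fun p : X × X × X × X => p.2.2.1) := by fun_prop
  have h3 : Measurable (fun p : X × X × X × X => p.2.2.2) := by fun_prop
  set f0 := (fun p : X × X × X × X => p.1) with hf0
  set f1 := (fun p : X × X × X × X => p.2.1) with hf1
  set f2 := (fun p : X × X × X × X => p.2.2.1) with hf2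
  set f3 := (fun p : X × X × X × X => p.2.2.2) with hf3
  have ae0 : ∀ᵐ p ∂T, f0 p ∈ Metric.closedBall x0 (L / 1000) := by
    rw [← map_off h0 (mc _ _), k0]; exact hA
  have ae3 : ∀ᵐ p ∂T, f3 p ∈ Metric.closedBall y0 (L / 1000) := by
    rw [← map_off h3 (mc _ _), k3]; exact hB
  have bb : ∀ i j : X × X × X × X → X, (∀ᵐ p ∂T, i p ∈ F ∧ j p ∈ F) → ∀ᵐ p ∂T, dist (i p) (j p) ≤ 3 * L :=
    fun i j h => h.mono fun p hp => hDF _ hp.1 _ hp.2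
  have b01 := bb f0 f1 (aeF.mono fun p hp => ⟨hp.1, hp.2.1⟩)
  have b12 := bb f1 f2 (aeF.mono fun p hp => ⟨hp.2.1, hp.2.2.1⟩)
  have b23 := bb f2 f3 (aeF.mono fun p hp => ⟨hp.2.2.1, hp.2.2.2⟩)
  have b02 := bb f0 f2 (aeF.mono fun p hp => ⟨hp.1, hp.2.2.1⟩)
  have b13 := bb f1 f3 (aeF.mono fun p hp => ⟨hp.2.1, hp.2.2.2⟩)
  have b03 := bb f0 f3 (aeF.mono fun p hp => ⟨hp.1, hp.2.2.2⟩)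
  have i01 := dist_int (T := T) h0 h1 b01
  have i12 := dist_int (T := T) h1 h2 b12
  have i23 := dist_int (T := T) h2 h3 b23
  have i03 := dist_int (T := T) h0 h3 b03
  have i02 := dist_int (T := T) h0 h2 b02
  have i13 := dist_int (T := T) h1 h3 b13
  obtain ⟨G, hGd⟩ : ∃ G : Set (X × X × X × X), G = {p | dist (f0 p) (f1 p) ≤ 0.4 * L ∧ dist (f1 p) (f2 p) ≤ 0.4 * L ∧ dist (f2 p) (f3 p) ≤ 0.4 * L} := ⟨_, rfl⟩
  have mG : MeasurableSet G := by
    rw [hGd]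
    refine (measurableSet_le (h0.dist h1) measurable_const).inter
      ((measurableSet_le (h1.dist h2) measurable_const).inter (measurableSet_le (h2.dist h3) measurable_const))
  -- Markov
  have hτ : T.real Gᶜ ≤ τh ε := by
    have hw' : w ≤ ∫ p, dist (f0 p) (f3 p) ^ 2 ∂T := by
      have := wr_map (T := T) h0 h3 b03
      rwa [k0, k3] at this
    have is : Integrable (fun p => 3 * (dist (f0 p) (f1 p) ^ 2 + dist (f1 p) (f2 p) ^ 2 + dist (f2 p) (f3 p) ^ 2) - dist (f0 p) (f3 p) ^ 2) T :=
      (((i01.add i12).add i23).const_mul 3).sub i03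
    have j1 : ∫ p, (3 * (dist (f0 p) (f1 p) ^ 2 + dist (f1 p) (f2 p) ^ 2 + dist (f2 p) (f3 p) ^ 2) - dist (f0 p) (f3 p) ^ 2) ∂T
        = ∫ p, 3 * (dist (f0 p) (f1 p) ^ 2 + dist (f1 p) (f2 p) ^ 2 + dist (f2 p) (f3 p) ^ 2) ∂T - ∫ p, dist (f0 p) (f3 p) ^ 2 ∂T :=
      integral_sub (((i01.add i12).add i23).const_mul 3) i03
    have j2 : ∫ p, (dist (f0 p) (f1 p) ^ 2 + dist (f1 p) (f2 p) ^ 2 + dist (f2 p) (f3 p) ^ 2) ∂T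
        = ∫ p, (dist (f0 p) (f1 p) ^ 2 + dist (f1 p) (f2 p) ^ 2) ∂T + ∫ p, dist (f2 p) (f3 p) ^ 2 ∂T :=
      integral_add (i01.add i12) i23
    rw [integral_const_mul, j2, integral_add i01 i12] at j1
    have j3 : ∫ p, Gᶜ.indicator (fun _ => 0.008 * L ^ 2) p ∂T ≤
        ∫ p, (3 * (dist (f0 p) (f1 p) ^ 2 + dist (f1 p) (f2 p) ^ 2 + dist (f2 p) (f3 p) ^ 2) - dist (f0 p) (f3 p) ^ 2) ∂T := by
      refine integral_mono_ae ((integrable_const _).indicator mG.compl) is ?_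
      filter_upwards [ae0, ae3] with p hp0 hp3
      have d03 := hD0 _ hp0 _ hp3
      have tr := dist_triangle4 (f0 p) (f1 p) (f2 p) (f3 p)
      by_cases hp : p ∈ G
      · simp only [indicator_of_notMem (show p ∉ Gᶜ from fun h => h hp)]
        have : dist (f0 p) (f3 p) ^ 2 ≤ (dist (f0 p) (f1 p) + dist (f1 p) (f2 p) + dist (f2 p) (f3 p)) ^ 2 := by gcongr
        nlinarith [sq_nonneg (dist (f0 p) (f1 p) - dist (f1 p) (f2 p)), sq_nonneg (dist (f1 p) (f2 p) - dist (f2 p) (f3 p)),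
          sq_nonneg (dist (f0 p) (f1 p) - dist (f2 p) (f3 p))]
      · simp only [indicator_of_mem (show p ∈ Gᶜ from hp)]
        exact alg4' hL dist_nonneg dist_nonneg dist_nonneg dist_nonneg tr d03 (by rw [hGd] at hp; exact hp)
    rw [integral_indicator mG.compl] at j3
    simp only [integral_const, MeasurableSet.univ, measureReal_restrict_apply, univ_inter, smul_eq_mul] at j3
    show _ ≤ ε / (0.008 * L ^ 2)
    rw [le_div_iff₀ (by positivity)]
    linarith
  have hG0 : 0 ≤ T.real Gᶜ := measureReal_nonneg
  have hκ0 : 0 ≤ κ ε := by simp only [κ, τh]; positivity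
  have hεκ : ε + (1.072 * L) ^ 2 * T.real Gᶜ ≤ κ ε := by
    show _ ≤ ε + (1.072 * L) ^ 2 * τh ε
    gcongr
  have hTM : T.real univ = M := by rw [← real_map_univ (T := T) h0, k0]
  have sp : ∀ {f : X × X × X × X → X}, Measurable f → T.map f = (T.restrict G).map f + (T.restrict Gᶜ).map f := by
    intro f hf
    rw [← Measure.map_add _ _ hf, Measure.restrict_add_restrict_compl mG]
  have rG : ∀ {Q : X × X × X × X → Prop}, (∀ᵐ p ∂T, Q p) → ∀ᵐ p ∂T.restrict G, Q p := fun h => ae_restrict_of_ae h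
  have rB : ∀ {Q : X × X × X × X → Prop}, (∀ᵐ p ∂T, Q p) → ∀ᵐ p ∂T.restrict Gᶜ, Q p := fun h => ae_restrict_of_ae h
  have aeG : ∀ᵐ p ∂T.restrict G, p ∈ G := ae_restrict_mem mG
  have hmapF : ∀ {f : X × X × X × X → X} (hf : Measurable f) {S : Measure (X × X × X × X)}, (∀ᵐ p ∂S, f p ∈ F) → S.map f Fᶜ = 0 :=
    fun hf S h => (map_off hf mF).2 h
  have F0 : ∀ᵐ p ∂T, f0 p ∈ F := aeF.mono fun p hp => hp.1
  have F1 : ∀ᵐ p ∂T, f1 p ∈ F := aeF.mono fun p hp => hp.2.1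
  have F2 : ∀ᵐ p ∂T, f2 p ∈ F := aeF.mono fun p hp => hp.2.2.1
  have F3 : ∀ᵐ p ∂T, f3 p ∈ F := aeF.mono fun p hp => hp.2.2.2
  obtain ⟨fn1, fn2, un1, un2, on1, on2, wn1, wn2, wn3, cn⟩ := id hcl
  have uiS : ∀ {f : X × X × X × X → X} (hf : Measurable f), UI U m (T.map f) → T.map f Fᶜ = 0 → ∀ S ≤ T, UI U m (S.map f) := by
    intro f hf h hz S hS
    exact h.mono hU (LB.of_finite hU mF hF hz) (Measure.map_mono hS hf)
  have leG : T.restrict G ≤ T := Measure.restrict_le_self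
  have leB : T.restrict Gᶜ ≤ T := Measure.restrict_le_self
  have u0' : UI U m (T.map f0) := by rw [k0]; exact ua
  have u3' : UI U m (T.map f3) := by rw [k3]; exact ub
  have u0 := uiS h0 u0' (hmapF h0 F0) _ leG
  have u1 := uiS h1 un1 on1 _ leG
  have u2 := uiS h2 un2 on2 _ leG
  have u3 := uiS h3 u3' (hmapF h3 F3) _ leG
  have u0b := uiS h0 u0' (hmapF h0 F0) _ leB
  have u3b := uiS h3 u3' (hmapF h3 F3) _ leB
  have mas : ∀ {f g : X × X × X × X → X} (hf : Measurable f) (hg : Measurable g) (S : Measure (X × X × X × X)),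
      S.map f univ = S.map g univ := by
    intro f g hf hg S
    rw [Measure.map_apply hf MeasurableSet.univ, Measure.map_apply hg MeasurableSet.univ]; rfl
  have hmid02 : MidP U m K F ((T.restrict G).map f0) ((T.restrict G).map f2) := by
    have o0 : (T.restrict G).map f0 (Metric.closedBall x0 (L / 1000))ᶜ = 0 := (map_off h0 (mc _ _)).2 (rG ae0)
    have o2 : (T.restrict G).map f2 (Metric.closedBall x0 (0.85 * L))ᶜ = 0 := by
      refine (map_off h2 (mc _ _)).2 ?_
      filter_upwards [rG ae0, aeG] with p hp hg
      rw [hGd] at hg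
      obtain ⟨g1, g2, g3⟩ := hg
      rw [Metric.mem_closedBall] at hp ⊢
      have := dist_triangle4 (f2 p) (f1 p) (f0 p) x0
      rw [dist_comm (f2 p) (f1 p), dist_comm (f1 p) (f0 p)] at this
      linarith
    refine CC.mid (T0 _ _ inferInstance inferInstance (mas h0 h2 _) ?_ ?_ u0 u2) (Wsq_map_fin h0 h2 (rG b02)) (mc _ _) (mc _ _) mF o0 o2 ?_
    · exact measure_mono_null (compl_subset_compl.2 (Metric.closedBall_subset_closedBall (by linarith))) o0
    · exact measure_mono_null (compl_subset_compl.2 (Metric.closedBall_subset_closedBall (by linarith))) o2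
    · intro x hx z hz y hy
      rw [Metric.mem_closedBall] at hx hz
      apply hx0F
      have t1 := dist_triangle_right x z x0
      have t2 := dist_triangle_left y x0 x
      linarith
  have hmid31 : MidP U m K F ((T.restrict G).map f3) ((T.restrict G).map f1) := by
    have o0 : (T.restrict G).map f3 (Metric.closedBall y0 (L / 1000))ᶜ = 0 := (map_off h3 (mc _ _)).2 (rG ae3)
    have o2 : (T.restrict G).map f1 (Metric.closedBall y0 (0.85 * L))ᶜ = 0 := by
      refine (map_off h1 (mc _ _)).2 ?_
      filter_upwards [rG ae3, aeG] with p hp hg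
      rw [hGd] at hg
      obtain ⟨g1, g2, g3⟩ := hg
      rw [Metric.mem_closedBall] at hp ⊢
      have := dist_triangle4 (f1 p) (f2 p) (f3 p) y0
      linarith
    have b31 : ∀ᵐ p ∂T.restrict G, dist (f3 p) (f1 p) ≤ 3 * L := by
      filter_upwards [rG b13] with p hp
      rwa [dist_comm]
    refine CC.mid (T1 _ _ inferInstance inferInstance (mas h3 h1 _) ?_ ?_ u3 u1) (Wsq_map_fin h3 h1 b31) (mc _ _) (mc _ _) mF o0 o2 ?_
    · exact measure_mono_null (compl_subset_compl.2 (Metric.closedBall_subset_closedBall (by linarith))) o0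
    · exact measure_mono_null (compl_subset_compl.2 (Metric.closedBall_subset_closedBall (by linarith))) o2
    · intro x hx z hz y hy
      rw [Metric.mem_closedBall] at hx hz
      apply hy0F
      have t1 := dist_triangle_right x z y0
      have t2 := dist_triangle_left y y0 x
      linarith
  have S1 := half_step hU mF hF (T := T) h0 h1 h2 h3 mG (D := 3 * L) (δ := η / 20) (c := w + ε) (K := K) (l := l) (C := C)
    (by filter_upwards [b01, b12, b23, b02] with p q1 q2 q3 q4 using ⟨q1, q2, q3, q4⟩) un1 on1
    (by
      intro n fn un on w1 w2 hh
      rw [k0] at w1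
      rw [k0, k3] at hh
      have := hmin n (T.map f2) ⟨fn, fn2, un, un2, on, on2, w1, w2, wn3, hh⟩
      linarith) hcost hmid02 hl0.le hC
  have S2 := half_step hU mF hF (T := T) h3 h2 h1 h0 mG (D := 3 * L) (δ := η / 20) (c := w + ε) (K := K) (l := l) (C := C)
    (by
      filter_upwards [b01, b12, b23, b13] with p q1 q2 q3 q4
      rw [dist_comm (f3 p) (f2 p), dist_comm (f2 p) (f1 p), dist_comm (f1 p) (f0 p), dist_comm (f3 p) (f1 p)]
      exact ⟨q3, q2, q1, q4⟩) un2 on2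
    (by
      intro n fn un on w1 w2 hh
      rw [k3] at w1
      rw [k0, k3] at hh
      have := hmin (T.map f1) n ⟨fn1, fn, un1, un, on1, on, wn1, by rwa [Wsq_symm], by rwa [Wsq_symm], ?_⟩
      · linarith
      · rw [wr_symm _ n, wr_symm n β, wr_symm α]; linarith)
    (by
      have e1 : ∀ a b : X, dist a b ^ 2 = dist b a ^ 2 := fun a b => by rw [dist_comm]
      simp only [e1 (f3 _) (f2 _), e1 (f2 _) (f1 _), e1 (f1 _) (f0 _)]
      linarith) hmid31 hl0.le hC
  rw [hTM] at S1 S2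
  -- entropies of the ends
  have mB : ∀ {f : X × X × X × X → X} (hf : Measurable f), ((T.restrict Gᶜ).map f).real univ = T.real Gᶜ := by
    intro f hf
    rw [real_map_univ hf, measureReal_restrict_apply MeasurableSet.univ, univ_inter]
  have E0 : eU U m ((T.restrict G).map f0) ≤ eU U m α + η / 20 + C' * T.real Gᶜ := by
    have a1 := eU_sup hU u0 u0b (by rw [← sp h0, k0]; exact ua)
    have a2 := hC' ((T.restrict Gᶜ).map f0) F mF hF (hmapF h0 (rB F0)) u0b
    rw [← sp h0, k0] at a1
    rw [mB h0] at a2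
    linarith
  have E3 : eU U m ((T.restrict G).map f3) ≤ eU U m β + η / 20 + C' * T.real Gᶜ := by
    have a1 := eU_sup hU u3 u3b (by rw [← sp h3, k3]; exact ub)
    have a2 := hC' ((T.restrict Gᶜ).map f3) F mF hF (hmapF h3 (rB F3)) u3b
    rw [← sp h3, k3] at a1
    rw [mB h3] at a2
    linarith
  -- distances
  have q01 := wr_map (T := T.restrict G) h0 h1 (rG b01)
  have W02 := wr_map (T := T.restrict G) h0 h2 (rG b02)
  have W13 := wr_map (T := T.restrict G) h1 h3 (rG b13)
  have W23 := wr_map (T := T.restrict G) h2 h3 (rG b23)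
  have le2 : ∀ a b c : X, dist a c ^ 2 ≤ 2 * (dist a b ^ 2 + dist b c ^ 2) := by
    intro a b c
    have h := dist_triangle a b c
    have : dist a c ^ 2 ≤ (dist a b + dist b c) ^ 2 := by gcongr
    nlinarith [sq_nonneg (dist a b - dist b c)]
  have I02 : ∫ p, dist (f0 p) (f2 p) ^ 2 ∂(T.restrict G) ≤ 2 * (∫ p, dist (f0 p) (f1 p) ^ 2 ∂(T.restrict G) + ∫ p, dist (f1 p) (f2 p) ^ 2 ∂(T.restrict G)) := by
    rw [← integral_add i01.restrict i12.restrict, ← integral_const_mul]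
    exact integral_mono i02.restrict ((i01.restrict.add i12.restrict).const_mul 2) (fun p => le2 _ _ _)
  have I13 : ∫ p, dist (f1 p) (f3 p) ^ 2 ∂(T.restrict G) ≤ 2 * (∫ p, dist (f1 p) (f2 p) ^ 2 ∂(T.restrict G) + ∫ p, dist (f2 p) (f3 p) ^ 2 ∂(T.restrict G)) := by
    rw [← integral_add i12.restrict i23.restrict, ← integral_const_mul]
    exact integral_mono i13.restrict ((i12.restrict.add i23.restrict).const_mul 2) (fun p => le2 _ _ _)
  have r01 : ∫ p, dist (f0 p) (f1 p) ^ 2 ∂(T.restrict G) ≤ ∫ p, dist (f0 p) (f1 p) ^ 2 ∂T :=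
    setIntegral_le_integral i01 (ae_of_all _ fun p => by positivity)
  have r12 : ∫ p, dist (f1 p) (f2 p) ^ 2 ∂(T.restrict G) ≤ ∫ p, dist (f1 p) (f2 p) ^ 2 ∂T :=
    setIntegral_le_integral i12 (ae_of_all _ fun p => by positivity)
  have r23 : ∫ p, dist (f2 p) (f3 p) ^ 2 ∂(T.restrict G) ≤ ∫ p, dist (f2 p) (f3 p) ^ 2 ∂T :=
    setIntegral_le_integral i23 (ae_of_all _ fun p => by positivity)
  have hcost' : 3 * (∫ p, dist (f0 p) (f1 p) ^ 2 ∂T + ∫ p, dist (f1 p) (f2 p) ^ 2 ∂T + ∫ p, dist (f2 p) (f3 p) ^ 2 ∂T) ≤ w + ε := hcost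
  have x02 := Wsq_map_fin (T := T.restrict G) h0 h2 (rG b02)
  have x23 := Wsq_map_fin (T := T.restrict G) h2 h3 (rG b23)
  have x01 := Wsq_map_fin (T := T.restrict G) h0 h1 (rG b01)
  have x13 := Wsq_map_fin (T := T.restrict G) h1 h3 (rG b13)
  have x03 := Wsq_map_fin (T := T.restrict G) h0 h3 (rG b03)
  have lowW : w ≤ wr ((T.restrict G).map f0) ((T.restrict G).map f3) + (1.072 * L) ^ 2 * T.real Gᶜ := by
    obtain ⟨a1, a2⟩ := wr_bound (mas h0 h3 (T.restrict Gᶜ)) (mc _ _) (mc _ _) ((map_off h0 (mc _ _)).2 (rB ae0))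
      ((map_off h3 (mc _ _)).2 (rB ae3)) hD0
    have a3 := wr_add x03 a1
    rw [← sp h0, ← sp h3, k0, k3] at a3
    rw [mB h0] at a2
    linarith
  have hwn := wr_nonneg (X := X)
  have sqs : ∀ a b : Measure X, √(wr a b) ^ 2 = wr a b := fun a b => Real.sq_sqrt (hwn a b)
  have t1 := wr_tri x02 x23
  have t2 := wr_tri x01 x13
  have hBB : w + κ ε ≤ (w + κ ε + 1) ^ 2 := by nlinarith
  have hRd : R ε = 2 * κ ε + 2 * (w + κ ε + 1) * √(κ ε) := rfl
  have hε0 : 0 ≤ (1.072 * L) ^ 2 * T.real Gᶜ := by positivity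
  obtain ⟨A1, A2⟩ := alg_pv (p := √(wr ((T.restrict G).map f0) ((T.restrict G).map f2)))
    (v := √(wr ((T.restrict G).map f2) ((T.restrict G).map f3))) (w := w) (κ := κ ε) (B := w + κ ε + 1)
    (Real.sqrt_nonneg _) (Real.sqrt_nonneg _) hκ0 (by rw [sqs, sqs]; linarith)
    (by
      have : √(wr ((T.restrict G).map f0) ((T.restrict G).map f3)) ^ 2 ≤
        (√(wr ((T.restrict G).map f0) ((T.restrict G).map f2)) + √(wr ((T.restrict G).map f2) ((T.restrict G).map f3))) ^ 2 := by
        gcongr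
      rw [sqs] at this
      linarith) hBB (by linarith)
  obtain ⟨A3, A4⟩ := alg_pv (p := √(wr ((T.restrict G).map f1) ((T.restrict G).map f3)))
    (v := √(wr ((T.restrict G).map f0) ((T.restrict G).map f1))) (w := w) (κ := κ ε) (B := w + κ ε + 1)
    (Real.sqrt_nonneg _) (Real.sqrt_nonneg _) hκ0 (by rw [sqs, sqs]; linarith)
    (by
      have : √(wr ((T.restrict G).map f0) ((T.restrict G).map f3)) ^ 2 ≤
        (√(wr ((T.restrict G).map f1) ((T.restrict G).map f3)) + √(wr ((T.restrict G).map f0) ((T.restrict G).map f1))) ^ 2 := by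
        gcongr; linarith
      rw [sqs] at this
      linarith) hBB (by linarith)
  rw [sqs, ← hRd] at A1 A2 A3
  -- the output
  set c : NNReal := (T Gᶜ).toNNReal / (T univ).toNNReal with hc
  have hTle : T Gᶜ ≤ T univ := measure_mono (subset_univ _)
  have hTfin : T univ ≠ ∞ := measure_ne_top _ _
  have hTu : T univ = β univ := by rw [← k3, Measure.map_apply h3 MeasurableSet.univ, preimage_univ]
  have hc1 : c ≤ 1 := by
    rw [hc]
    apply div_le_one_of_le₀ _ bot_le
    exact ENNReal.toNNReal_mono hTfin hTle
  have hcr : (c : ℝ) = T.real Gᶜ / M := by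
    rw [hc, ← hTM]; rfl
  have hcm : (c • β) univ = T Gᶜ := by
    rw [Measure.smul_apply, ENNReal.smul_def, smul_eq_mul, ← hTu]
    by_cases h0 : T univ = 0
    · rw [h0, mul_zero]; rw [h0] at hTle; exact (le_antisymm hTle bot_le).symm
    · rw [← ENNReal.coe_toNNReal hTfin, ← ENNReal.coe_mul, hc, div_mul_cancel₀, ENNReal.coe_toNNReal]
      · exact measure_ne_top _ _
      · rw [ne_eq, ENNReal.toNNReal_eq_zero_iff]; push Not; exact ⟨h0, hTfin⟩
  obtain ⟨uc, ec⟩ := eU_smul hU ub (LB.of_finite hU mF hF hβF) c hc1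
  have hcF : (c • β) Fᶜ = 0 := by rw [Measure.smul_apply, hβF, smul_zero]
  haveI : IsFiniteMeasure (c • β) := ⟨by rw [hcm]; exact measure_lt_top _ _⟩
  obtain ⟨un, en⟩ := hC ((T.restrict G).map f2) (c • β) F mF hF (hmapF h2 (rG F2)) hcF u2 uc
  have hmcb : ∀ {f : X × X × X × X → X} (hf : Measurable f), (T.restrict Gᶜ).map f univ = (c • β) univ := by
    intro f hf
    rw [hcm, Measure.map_apply hf MeasurableSet.univ, preimage_univ, Measure.restrict_apply MeasurableSet.univ, univ_inter]
  obtain ⟨z1, z2⟩ := wr_bound (hmcb h0) mF mF (hmapF h0 (rB F0)) hcF hDF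
  obtain ⟨z3, z4⟩ := wr_bound (hmcb h3) mF mF (hmapF h3 (rB F3)) hcF hDF
  rw [mB h0] at z2
  rw [mB h3, wr_symm] at z4
  rw [Wsq_symm] at z3
  have v1 := wr_add x02 z1
  have v2 := wr_add x23 z3
  have v3 := Wsq_add_fin x02 z1
  have v4 := Wsq_add_fin x23 z3
  rw [← sp h0, k0] at v1 v3
  rw [← sp h3, k3] at v2 v4
  have hτL : (3 * L) ^ 2 * T.real Gᶜ ≤ (3 * L) ^ 2 * τh ε := by gcongr
  refine ⟨_, inferInstance, ?_, un, v3, v4, ?_, ?_, ?_⟩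
  · rw [Measure.add_apply, hmapF h2 (rG F2), hcF, add_zero]
  · have := (abs_le.1 A1).2; linarith
  · have := (abs_le.1 A2).2; linarith
  · have mcβ : (c • β).real univ = T.real Gᶜ := by simp only [Measure.real, hcm]
    have mg2 : ((T.restrict G).map f2).real univ ≤ M := by
      rw [real_map_univ h2, measureReal_restrict_apply MeasurableSet.univ, univ_inter, ← hTM]
      exact measureReal_mono (subset_univ _)
    rw [mcβ] at en
    have b1 : l * (m.real F + ((T.restrict G).map f2).real univ) ≤ η / 20 := le_trans (by gcongr) hlVM
    have b2 : (c:ℝ) * eU U m β ≤ τh ε / M * |eU U m β| := by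
      refine (mul_le_mul_of_nonneg_left (le_abs_self _) (NNReal.coe_nonneg c)).trans ?_
      rw [hcr]; gcongr
    have hK1 : ∀ k x : ℝ, |x| ≤ R ε → -(k * x) ≤ |k| * R ε := by
      intro k x hx
      calc -(k * x) ≤ |k * x| := neg_le_abs _
        _ = |k| * |x| := abs_mul _ _
        _ ≤ _ := by gcongr
    have k1 := hK1 K _ A1
    have k2 := hK1 K _ A3
    have e5 : (3 * C + C') * T.real Gᶜ ≤ (3 * C + C') * τh ε := by gcongr
    rw [wr_symm ((T.restrict G).map f3)] at S2
    linarith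
end P14

section P15
variable {X : Type*} [MetricSpace X] [MeasurableSpace X] [SecondCountableTopology X] [BorelSpace X]
  [CompleteSpace X]
variable {m : Measure X} [SigmaFinite m] {U U' : ℝ → ℝ}

lemma tendsto_inv_hyper : Tendsto (fun k : ℕ => 1 / ((k:ℝ) + 1)) (hyperfilter ℕ : Filter ℕ) (𝓝 0) :=
  tendsto_one_div_add_atTop_nhds_zero_nat.mono_left hyper_le_atTop

/-- weak limit of transport estimates -/
lemma wsq_lim {μ ν : ℕ → Measure X} [∀ k, IsFiniteMeasure (μ k)] [∀ k, IsFiniteMeasure (ν k)] (M : NNReal)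
    (hM : ∀ k, μ k univ = M) (hμν : ∀ k, μ k univ = ν k univ)
    (hμ : IsTightMeasureSet (range μ)) (hν : IsTightMeasureSet (range ν))
    {c : ℕ → ℝ≥0∞} {c0 : ℝ≥0∞} (hc : Tendsto c (hyperfilter ℕ : Filter ℕ) (𝓝 c0))
    (hle : ∀ k, Wsq (μ k) (ν k) ≤ c k) {μ' ν' : Measure X} [IsFiniteMeasure μ'] [IsFiniteMeasure ν']
    (h1 : WLim μ μ') (h2 : WLim ν ν') : Wsq μ' ν' ≤ c0 := by
  choose q hq hq' using fun k => exists_opt (hμν k)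
  obtain ⟨a, b, q', fq, l1, l2, hc', hle'⟩ := coupling_limit M hq hM hμ hν hc (fun k => (hq' k).le.trans (hle k))
  haveI : IsFiniteMeasure a := by rw [← hc'.1]; infer_instance
  haveI : IsFiniteMeasure b := by rw [← hc'.2]; infer_instance
  rw [h1.eq l1, h2.eq l2]
  exact (Wsq_le hc').trans hle'

lemma key_lim (hgeo : GeodesicSpace X) (hU : UProp U U') (htp : TightP U m) (hs : mmSupp m = univ) {K : ℝ} {x0 y0 : X} {L : ℝ}
    (hL : 0 < L) (hxy : dist x0 y0 ≤ 1.07 * L) (T0 : TP U m K x0 (0.9 * L)) (T1 : TP U m K y0 (0.9 * L))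
    {F : Set X} (hFd : F = Metric.closedBall x0 (0.85 * L) ∪ Metric.closedBall y0 (0.85 * L)) (hF : m F ≠ ∞)
    {α β : Measure X} [IsFiniteMeasure α] [IsFiniteMeasure β] (hM : α univ = β univ)
    (ua : UI U m α) (ub : UI U m β) (hA : α (Metric.closedBall x0 (L / 1000))ᶜ = 0)
    (hB : β (Metric.closedBall y0 (L / 1000))ᶜ = 0) :
    ∃ n : Measure X, IsFiniteMeasure n ∧ n Fᶜ = 0 ∧ Integrable (fun x => U (dn m n x)) m ∧
      Wsq α n ≤ ENNReal.ofReal (4/9 * wr α β) ∧ Wsq n β ≤ ENNReal.ofReal (wr α β / 9) ∧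
      eU U m n ≤ 1/3 * eU U m α + 2/3 * eU U m β - K / 9 * wr α β ∧
      ∃ C, ∀ k : ℕ, U' (k + 1) * (n.singularPart m).real univ ≤ C := by
  have hFc : IsClosed F := by rw [hFd]; exact Metric.isClosed_closedBall.union Metric.isClosed_closedBall
  have hFb : Bornology.IsBounded F := by rw [hFd]; exact Metric.isBounded_closedBall.union Metric.isBounded_closedBall
  have hpos : ∀ k : ℕ, 0 < 1 / ((k:ℝ) + 1) := fun k => by positivity
  choose n fn on un w1 w2 c1 c2 en using fun k : ℕ => key_approx hgeo hU hs hL hxy T0 T1 hFd hF hM ua ub hA hB (hpos k)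
  have ht : IsTightMeasureSet (range n) := by
    refine htp F hFc hFb hF n (1/3 * eU U m α + 2/3 * eU U m β - K / 9 * wr α β + 1) fn on un fun k => ?_
    have : 1 / ((k:ℝ) + 1) ≤ 1 := by rw [div_le_one (by positivity)]; linarith [k.cast_nonneg (α := ℝ)]
    linarith [en k]
  have hmn : ∀ k, n k univ = ((α univ).toNNReal : ℝ≥0∞) := fun k => by
    rw [ENNReal.coe_toNNReal (measure_ne_top _ _)]; exact (mass_of_fin (w1 k)).symm
  obtain ⟨n', fn', mn', hl⟩ := exists_wlim n _ hmn ht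
  obtain ⟨o, i, e, hC⟩ := lsc3 hU hFc hF hl on (fun k => ⟨Or.inl (un k).1, (un k).2⟩)
    (c := fun k : ℕ => 1/3 * eU U m α + 2/3 * eU U m β - K / 9 * wr α β + 1 / ((k:ℝ) + 1))
    (c0 := 1/3 * eU U m α + 2/3 * eU U m β - K / 9 * wr α β)
    (by simpa using tendsto_inv_hyper.const_add (1/3 * eU U m α + 2/3 * eU U m β - K / 9 * wr α β)) en
  refine ⟨n', fn', o, i, ?_, ?_, e, hC⟩
  · refine wsq_lim (μ := fun _ => α) (ν := n) (α univ).toNNReal (fun _ => (ENNReal.coe_toNNReal (measure_ne_top _ _)).symm)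
      (fun k => mass_of_fin (w1 k)) (by rw [range_const]; exact tight_single _) ht
      (c := fun k : ℕ => ENNReal.ofReal (4/9 * wr α β + 1 / ((k:ℝ) + 1))) ?_ ?_ (WLim.const α) hl
    · refine (ENNReal.continuous_ofReal.tendsto _).comp ?_
      simpa using tendsto_inv_hyper.const_add (4/9 * wr α β)
    · intro k
      rw [← ENNReal.ofReal_toReal (w1 k)]
      exact ENNReal.ofReal_le_ofReal (c1 k)
  · refine wsq_lim (μ := n) (ν := fun _ => β) (α univ).toNNReal hmn
      (fun k => mass_of_fin (w2 k)) ht (by rw [range_const]; exact tight_single _)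
      (c := fun k : ℕ => ENNReal.ofReal (wr α β / 9 + 1 / ((k:ℝ) + 1))) ?_ ?_ hl (WLim.const β)
    · refine (ENNReal.continuous_ofReal.tendsto _).comp ?_
      simpa using tendsto_inv_hyper.const_add (wr α β / 9)
    · intro k
      rw [← ENNReal.ofReal_toReal (w2 k)]
      exact ENNReal.ofReal_le_ofReal (c2 k)

/-- the two-thirds point property -/
def KeyP (U : ℝ → ℝ) (m : Measure X) (K : ℝ) : Prop :=
  ∀ (x0 y0 : X) (L : ℝ), 0 < L → dist x0 y0 ≤ 1.07 * L → TP U m K x0 (0.9 * L) → TP U m K y0 (0.9 * L) →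
    m (Metric.closedBall x0 (0.85 * L) ∪ Metric.closedBall y0 (0.85 * L)) ≠ ∞ →
    ∀ α β : Measure X, IsFiniteMeasure α → IsFiniteMeasure β → α univ = β univ → UI U m α → UI U m β →
      α (Metric.closedBall x0 (L / 1000))ᶜ = 0 → β (Metric.closedBall y0 (L / 1000))ᶜ = 0 →
      ∃ n : Measure X, IsFiniteMeasure n ∧ UI U m n ∧
        Wsq α n ≤ ENNReal.ofReal (4/9 * wr α β) ∧ Wsq n β ≤ ENNReal.ofReal (wr α β / 9) ∧
        eU U m n ≤ 1/3 * eU U m α + 2/3 * eU U m β - K / 9 * wr α β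

lemma keyP_log (hgeo : GeodesicSpace X) (hs : mmSupp m = univ) (K : ℝ) : KeyP (fun r => r * Real.log r) m K := by
  intro x0 y0 L hL hxy T0 T1 hF α β fa fb hM ua ub hA hB
  obtain ⟨n, fn, on, i, w1, w2, e, C, hC⟩ := key_lim hgeo UProp_log (tight_log m) hs hL hxy T0 T1 rfl hF hM ua ub hA hB
  refine ⟨n, fn, ⟨?_, i⟩, w1, w2, e⟩
  have h0 : (n.singularPart m).real univ = 0 := by
    by_contra h
    have hp : 0 < (n.singularPart m).real univ := lt_of_le_of_ne measureReal_nonneg (Ne.symm h)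
    have t : Tendsto (fun k : ℕ => (1 + Real.log ((k:ℝ) + 1)) * (n.singularPart m).real univ) atTop atTop := by
      refine Tendsto.atTop_mul_const hp ?_
      exact tendsto_atTop_add_const_left _ _ (Real.tendsto_log_atTop.comp
        (tendsto_atTop_add_const_right _ _ tendsto_natCast_atTop_atTop))
    obtain ⟨k, hk⟩ := (t.eventually_gt_atTop C).exists
    exact absurd (hC k) (not_le.2 hk)
  have h1 : n.singularPart m = 0 := by
    rw [← Measure.measure_univ_eq_zero]
    rwa [measureReal_eq_zero_iff] at h0
  rw [Measure.haveLebesgueDecomposition_add n m, h1, zero_add]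
  exact withDensity_absolutelyContinuous _ _
end P15

section P16
variable {X : Type*} [MetricSpace X] [MeasurableSpace X] [SecondCountableTopology X] [BorelSpace X]
  [CompleteSpace X]
variable {m : Measure X} [SigmaFinite m] {U U' : ℝ → ℝ}

lemma tight_of_compact {F : Set X} (hF : IsCompact F) (β : ℕ → Measure X) (h : ∀ k, β k Fᶜ = 0) :
    IsTightMeasureSet (range β) := by
  rw [isTightMeasureSet_iff_exists_isCompact_measure_compl_le]
  intro ε _
  refine ⟨F, hF, ?_⟩
  rintro _ ⟨k, rfl⟩
  rw [h k]; exact bot_le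

lemma ac_part (n : Measure X) [IsFiniteMeasure n] : ∃ a : Measure X, IsFiniteMeasure a ∧ n.singularPart m + a = n ∧ a ≪ m ∧
    (fun x => dn m a x) =ᵐ[m] fun x => dn m n x := by
  have h := Measure.haveLebesgueDecomposition_add n m
  have hle : m.withDensity (n.rnDeriv m) ≤ n := Measure.withDensity_rnDeriv_le n m
  refine ⟨m.withDensity (n.rnDeriv m), ⟨(hle univ).trans_lt (measure_lt_top _ _)⟩, h.symm, withDensity_absolutelyContinuous _ _, ?_⟩
  filter_upwards [Measure.rnDeriv_withDensity m (Measure.measurable_rnDeriv n m)] with x hx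
  unfold dn
  rw [hx]

lemma pow_new {θ : ℝ} (h0 : 0 < θ) (h1 : θ < 1) (a b : Measure X) [IsFiniteMeasure a] [IsFiniteMeasure b]
    (ia : Integrable (fun x => -(dn m a x) ^ θ) m) (ib : Integrable (fun x => -(dn m b x) ^ θ) m) :
    Integrable (fun x => -(dn m (a + b) x) ^ θ) m ∧ eU (fun r => -r ^ θ) m (a + b) ≤ eU (fun r => -r ^ θ) m a ∧
    (eU (fun r => -r ^ θ) m (a + b) = eU (fun r => -r ^ θ) m a → eU (fun r => -r ^ θ) m b = 0) := by
  have hU := UProp_pow h0 h1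
  have i1 : Integrable (fun x => -(dn m (a + b) x) ^ θ) m := by
    refine Integrable.mono' (ia.abs.add ib.abs) (hU.meas (a + b)).aestronglyMeasurable ?_
    filter_upwards [dn_add (m := m) a b] with x hx
    have n1 := dn_nonneg (m := m) a x
    have n2 := dn_nonneg (m := m) b x
    have := hU.sup n1 n2
    have n3 : 0 ≤ (dn m (a + b) x) ^ θ := Real.rpow_nonneg (dn_nonneg _ _) _
    have n4 : 0 ≤ (dn m a x) ^ θ := Real.rpow_nonneg (dn_nonneg _ _) _
    have n5 : 0 ≤ (dn m b x) ^ θ := Real.rpow_nonneg (dn_nonneg _ _) _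
    simp only [← hx] at this
    rw [Real.norm_eq_abs, abs_neg, abs_of_nonneg n3]
    simp only [Pi.add_apply, abs_neg, abs_of_nonneg n4, abs_of_nonneg n5]
    linarith
  have hle : ∀ᵐ x ∂m, 0 ≤ -(dn m a x) ^ θ - -(dn m (a + b) x) ^ θ := by
    filter_upwards [dn_add (m := m) a b] with x hx
    have n1 := dn_nonneg (m := m) a x
    have n2 := dn_nonneg (m := m) b x
    have : (dn m a x) ^ θ ≤ (dn m (a + b) x) ^ θ := Real.rpow_le_rpow n1 (by linarith) h0.le
    linarith
  refine ⟨i1, ?_, ?_⟩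
  · have := integral_nonneg_of_ae hle
    rw [integral_sub ia i1] at this
    unfold eU; linarith
  · intro he
    have h2 : ∫ x, (-(dn m a x) ^ θ - -(dn m (a + b) x) ^ θ) ∂m = 0 := by
      rw [integral_sub ia i1]; unfold eU at he; linarith
    rw [integral_eq_zero_iff_of_nonneg_ae hle (ia.sub i1)] at h2
    unfold eU
    rw [integral_eq_zero_of_ae]
    filter_upwards [h2, dn_add (m := m) a b] with x h3 hx
    have n1 := dn_nonneg (m := m) a x
    have n2 := dn_nonneg (m := m) b x
    simp only [Pi.zero_apply] at h3 ⊢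
    rcases eq_or_lt_of_le n2 with h | h
    · rw [← h, Real.zero_rpow h0.ne', neg_zero]
    · have := Real.rpow_lt_rpow n1 (show dn m a x < dn m (a + b) x by linarith) h0
      linarith

lemma pow_neg {θ : ℝ} (h0 : 0 < θ) (h1 : θ < 1) (a : Measure X) [IsFiniteMeasure a]
    (ia : UI (fun r => -r ^ θ) m a) (ha : a ≠ 0) : eU (fun r => -r ^ θ) m a < 0 := by
  have hn : ∀ᵐ x ∂m, 0 ≤ (dn m a x) ^ θ := Eventually.of_forall fun x => Real.rpow_nonneg (dn_nonneg _ _) _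
  have i2 : Integrable (fun x => (dn m a x) ^ θ) m := by simpa using ia.2.neg
  have e1 : eU (fun r => -r ^ θ) m a = - ∫ x, (dn m a x) ^ θ ∂m := integral_neg _
  have n1 := integral_nonneg_of_ae hn
  rcases eq_or_lt_of_le n1 with h | h
  · exfalso
    have h2 := h.symm
    rw [integral_eq_zero_iff_of_nonneg_ae hn i2] at h2
    have h3 : ∫ x, dn m a x ∂m = 0 := by
      rw [integral_eq_zero_of_ae]
      filter_upwards [h2] with x hx
      exact (Real.rpow_eq_zero (dn_nonneg _ _) h0.ne').1 hx
    rw [dn_integral ia.1, Measure.real, ENNReal.toReal_eq_zero_iff] at h3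
    rcases h3 with h3 | h3
    · exact ha (Measure.measure_univ_eq_zero.1 h3)
    · exact measure_ne_top _ _ h3
  · linarith

set_option maxHeartbeats 2000000 in
lemma keyP_pow [ProperSpace X] (hgeo : GeodesicSpace X) (hs : mmSupp m = univ) {θ : ℝ} (h0 : 0 < θ) (h1 : θ < 1) :
    KeyP (fun r => - r ^ θ) m 0 := by
  intro x0 y0 L hL hxy T0 T1 hF α β fa fb hM ua ub hA hB
  have hU := UProp_pow h0 h1
  have hneg : ∀ s > 0, (fun s : ℝ => -(θ * s ^ (θ - 1))) s ≤ 0 := fun s hs => by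
    simp only [Left.neg_nonpos_iff]; positivity
  have hUn : ∀ r : ℝ, 0 ≤ r → - r ^ θ ≤ 0 := fun r hr => by
    simp only [Left.neg_nonpos_iff]; positivity
  set U : ℝ → ℝ := fun r => - r ^ θ with hUd
  set F := Metric.closedBall x0 (0.85 * L) ∪ Metric.closedBall y0 (0.85 * L) with hFd
  have hFc : IsClosed F := Metric.isClosed_closedBall.union Metric.isClosed_closedBall
  have hFk : IsCompact F := (isCompact_closedBall _ _).union (isCompact_closedBall _ _)
  have htp := tight_proper U m
  have mc : ∀ (x : X) r, MeasurableSet (Metric.closedBall x r) := fun x r => Metric.isClosed_closedBall.measurableSet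
  have hfin : Wsq α β ≠ ∞ := (wr_bound hM (mc _ _) (mc _ _) hA hB (D := 2 * L) (by
    intro x hx y hy
    rw [Metric.mem_closedBall] at hx hy
    have h3 := dist_triangle4 x x0 y0 y
    rw [dist_comm y0] at h3
    linarith)).1
  set E := 1/3 * eU U m α + 2/3 * eU U m β - 0 / 9 * wr α β with hE
  set c1 := ENNReal.ofReal (4/9 * wr α β) with hc1
  set c2 := ENNReal.ofReal (wr α β / 9) with hc2
  let Q : Measure X → Prop := fun n => IsFiniteMeasure n ∧ n Fᶜ = 0 ∧ Integrable (fun x => U (dn m n x)) m ∧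
      Wsq α n ≤ c1 ∧ Wsq n β ≤ c2 ∧ eU U m n ≤ E
  obtain ⟨n0, q1, q2, q3, q4, q5, q6, -⟩ := key_lim hgeo hU htp hs hL hxy T0 T1 hFd hF hM ua ub hA hB
  have mQ : ∀ n, Q n → n univ = α univ := fun n hn =>
    (mass_of_fin (ne_top_of_le_ne_top ENNReal.ofReal_ne_top hn.2.2.2.1)).symm
  let S : Set ℝ := {e | ∃ n, Q n ∧ e = eU U m n}
  have hne : S.Nonempty := ⟨_, n0, ⟨q1, q2, q3, q4, q5, q6⟩, rfl⟩
  have hbd : BddBelow S := by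
    obtain ⟨C, hC, hlow⟩ := eU_low (m := m) hU 1 one_pos
    refine ⟨-1 * m.real F - C * α.real univ, ?_⟩
    rintro _ ⟨n, hn, rfl⟩
    obtain ⟨r1, r2, r3, r4, r5, r6⟩ := id hn
    obtain ⟨a, fa, ha, hac, had⟩ := ac_part (m := m) n
    have hle : a ≤ n := by conv_rhs => rw [← ha]
                           exact Measure.le_add_left le_rfl
    have ua : UI U m a := ⟨hac, r3.congr (had.mono fun x hx => by simp only [hx])⟩
    have ea : eU U m a = eU U m n := integral_congr_ae (had.mono fun x hx => by simp only [hx])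
    have := hlow a F hFc.measurableSet hF (measure_mono_null le_rfl (le_antisymm ((hle _).trans r2.le) bot_le)) ua
    have hm : a.real univ ≤ α.real univ := by
      refine ENNReal.toReal_mono (measure_ne_top _ _) ?_
      rw [← mQ n hn]; exact hle univ
    rw [ea] at this
    nlinarith
  obtain ⟨e, -, et, eS⟩ := exists_seq_tendsto_sInf hne hbd
  choose n hn hen using eS
  haveI : ∀ k, IsFiniteMeasure (n k) := fun k => (hn k).1
  have ht := tight_of_compact hFk n fun k => (hn k).2.1
  have hmn : ∀ k, n k univ = ((α univ).toNNReal : ℝ≥0∞) := fun k => by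
    rw [ENNReal.coe_toNNReal (measure_ne_top _ _)]; exact mQ _ (hn k)
  obtain ⟨n', fn', mn', hl⟩ := exists_wlim n _ hmn ht
  obtain ⟨o', i', e', -⟩ := lsc3 hU hFc hF hl (fun k => (hn k).2.1) (fun k => ⟨Or.inr hneg, (hn k).2.2.1⟩)
    (et.mono_left hyper_le_atTop) (fun k => (hen k).ge)
  have w1' : Wsq α n' ≤ c1 := 
    wsq_lim (μ := fun _ => α) (ν := n) (α univ).toNNReal (fun _ => (ENNReal.coe_toNNReal (measure_ne_top _ _)).symm)
      (fun k => (mQ _ (hn k)).symm) (by rw [range_const]; exact tight_single _) ht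
      (c := fun k : ℕ => c1) tendsto_const_nhds (fun k => (hn k).2.2.2.1) (WLim.const α) hl
  have w2' : Wsq n' β ≤ c2 := 
    wsq_lim (μ := n) (ν := fun _ => β) (α univ).toNNReal hmn
      (fun k => (mQ _ (hn k)).trans hM) ht (by rw [range_const]; exact tight_single _)
      (c := fun k : ℕ => c2) tendsto_const_nhds (fun k => (hn k).2.2.2.2.1) hl (WLim.const β)
  have hmin : ∀ ν, Q ν → eU U m n' ≤ eU U m ν := fun ν hν => e'.trans (csInf_le hbd ⟨ν, hν, rfl⟩)
  have hE' : eU U m n' ≤ E := (hmin _ ⟨q1, q2, q3, q4, q5, q6⟩).trans q6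
  refine ⟨n', fn', ⟨?_, i'⟩, w1', w2', hE'⟩
  obtain ⟨a, fa', ha, hac, had⟩ := ac_part (m := m) n'
  by_cases hsz : n'.singularPart m = 0
  · rw [hsz, zero_add] at ha
    rw [← ha]; exact hac
  exfalso
  have hc1' : c1 = ENNReal.ofReal (2/3) ^ 2 * Wsq α β := by
    rw [hc1, ← ENNReal.ofReal_toReal hfin, ← ENNReal.ofReal_pow (by norm_num), ← ENNReal.ofReal_mul (by norm_num), wr]
    norm_num
  have hc2' : c2 = ENNReal.ofReal (1 - 2/3) ^ 2 * Wsq α β := by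
    rw [hc2, ← ENNReal.ofReal_toReal hfin, ← ENNReal.ofReal_pow (by norm_num), ← ENNReal.ofReal_mul (by norm_num), wr]
    congr 1; ring
  obtain ⟨T, hT⟩ := exists_tplan (t := 2/3) (by norm_num) (by norm_num) hfin (hc1' ▸ w1') (hc2' ▸ w2')
  have f1 : Measurable (fun p : X × X × X => p.1) := by fun_prop
  have f2 : Measurable (fun p : X × X × X => p.2.1) := by fun_prop
  have f3 : Measurable (fun p : X × X × X => p.2.2) := by fun_prop
  haveI : IsFiniteMeasure T := ⟨by
    have := hT.m1
    have h : T.map (fun p : X × X × X => p.1) univ = α univ := by rw [this]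
    rw [Measure.map_apply f1 MeasurableSet.univ, preimage_univ] at h
    rw [h]; exact measure_lt_top _ _⟩
  obtain ⟨T', hT', hT's⟩ := sub_lift f2 T (σ := n'.singularPart m) (by rw [hT.m2]; exact Measure.singularPart_le _ _)
  haveI : IsFiniteMeasure T' := ⟨(hT' univ).trans_lt (measure_lt_top _ _)⟩
  obtain ⟨T'', fT'', hTT⟩ : ∃ T'' : Measure (X × X × X), IsFiniteMeasure T'' ∧ T'' + T' = T :=
    ⟨T - T', inferInstance, Measure.sub_add_cancel_of_le hT'⟩
  have hle'' : T'' ≤ T := by rw [← hTT]; exact Measure.le_add_right le_rfl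
  have hmap : ∀ {f : X × X × X → X}, Measurable f → T''.map f + T'.map f = T.map f := fun hf => by
    rw [← Measure.map_add _ _ hf, hTT]
  have h2a : T''.map (fun p => p.2.1) = a := by
    have := hmap f2
    rw [hT's, hT.m2] at this
    nth_rewrite 2 [← ha] at this
    rw [add_comm] at this
    ext s hs
    have h := congrArg (fun μ : Measure X => μ s) this
    simp only [Measure.add_apply] at h
    exact (ENNReal.add_right_inj (measure_ne_top _ _)).1 h
  have lea : T'.map (fun p => p.1) ≤ α := by rw [← hT.m1]; exact Measure.map_mono hT' f1
  have leb : T'.map (fun p => p.2.2) ≤ β := by rw [← hT.m3]; exact Measure.map_mono hT' f3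
  have mF := hFc.measurableSet
  have hAF : α Fᶜ = 0 := measure_mono_null (compl_subset_compl.2 (fun x hx => Or.inl (Metric.closedBall_subset_closedBall (by linarith) hx))) hA
  have hBF : β Fᶜ = 0 := measure_mono_null (compl_subset_compl.2 (fun x hx => Or.inr (Metric.closedBall_subset_closedBall (by linarith) hx))) hB
  have uas : UI U m (T'.map (fun p => p.1)) := ua.mono hU (LB.of_finite hU mF hF hAF) lea
  have ubs : UI U m (T'.map (fun p => p.2.2)) := ub.mono hU (LB.of_finite hU mF hF hBF) leb
  obtain ⟨ns, fns, ons, ins, ws1, ws2, es, -⟩ := key_lim hgeo hU htp hs hL hxy T0 T1 hFd hF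
    (α := T'.map (fun p => p.1)) (β := T'.map (fun p => p.2.2))
    (by rw [Measure.map_apply f1 MeasurableSet.univ, Measure.map_apply f3 MeasurableSet.univ]; rfl) uas ubs
    (le_antisymm ((lea _).trans hA.le) bot_le) (le_antisymm ((leb _).trans hB.le) bot_le)
  haveI : IsFiniteMeasure (T''.map (fun p => p.2.1)) := ⟨by rw [h2a]; exact measure_lt_top _ _⟩
  have ia : Integrable (fun x => U (dn m a x)) m := i'.congr (had.mono fun x hx => by simp only [hx])
  have ea : eU U m a = eU U m n' := integral_congr_ae (had.mono fun x hx => by simp only [hx])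
  obtain ⟨in1, in2, in3⟩ := pow_new h0 h1 a ns ia ins
  have hex' : ∀ᵐ p ∂T'', dist p.1 p.2.1 = (2/3) * dist p.1 p.2.2 ∧ dist p.2.1 p.2.2 = (1 - 2/3) * dist p.1 p.2.2 :=
    (Measure.absolutelyContinuous_of_le hle'') hT.ex
  have co : ∫⁻ p, edist p.1 p.2.2 ^ 2 ∂T'' + ∫⁻ p, edist p.1 p.2.2 ^ 2 ∂T' = Wsq α β := by
    rw [← lintegral_add_measure, hTT, hT.co]
  have v1 : Wsq (T''.map (fun p => p.1)) a ≤ ENNReal.ofReal (2/3) ^ 2 * ∫⁻ p, edist p.1 p.2.2 ^ 2 ∂T'' := by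
    rw [← h2a]
    refine (Wsq_map_le f1 f2).trans ?_
    rw [← lintegral_const_mul' _ _ (by simp)]
    refine lintegral_mono_ae (hex'.mono fun p hp => ?_)
    rw [edist_dist, hp.1, ENNReal.ofReal_mul (by norm_num), mul_pow, ← edist_dist]
  have v2 : Wsq a (T''.map (fun p => p.2.2)) ≤ ENNReal.ofReal (1-2/3) ^ 2 * ∫⁻ p, edist p.1 p.2.2 ^ 2 ∂T'' := by
    rw [← h2a]
    refine (Wsq_map_le f2 f3).trans ?_
    rw [← lintegral_const_mul' _ _ (by simp)]
    refine lintegral_mono_ae (hex'.mono fun p hp => ?_)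
    rw [edist_dist, hp.2, ENNReal.ofReal_mul (by norm_num), mul_pow, ← edist_dist]
  have wsf : Wsq (T'.map (fun p => p.1)) (T'.map (fun p => p.2.2)) ≤ ∫⁻ p, edist p.1 p.2.2 ^ 2 ∂T' := Wsq_map_le f1 f3
  have wsfin : Wsq (T'.map (fun p => p.1)) (T'.map (fun p => p.2.2)) ≠ ∞ :=
    ne_top_of_le_ne_top (ne_top_of_le_ne_top hfin (le_of_le_of_eq le_add_self co)) wsf
  have v3 : Wsq (T'.map (fun p => p.1)) ns ≤ ENNReal.ofReal (2/3) ^ 2 * ∫⁻ p, edist p.1 p.2.2 ^ 2 ∂T' := by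
    refine ws1.trans ?_
    rw [show (4/9 : ℝ) = (2/3)^2 by norm_num, ENNReal.ofReal_mul (by norm_num), ENNReal.ofReal_pow (by norm_num), wr, ENNReal.ofReal_toReal wsfin]
    gcongr
  have v4 : Wsq ns (T'.map (fun p => p.2.2)) ≤ ENNReal.ofReal (1-2/3) ^ 2 * ∫⁻ p, edist p.1 p.2.2 ^ 2 ∂T' := by
    refine ws2.trans ?_
    rw [show ∀ w : ℝ, w / 9 = (1-2/3)^2 * w from fun w => by ring, ENNReal.ofReal_mul (by norm_num), ENNReal.ofReal_pow (by norm_num), wr, ENNReal.ofReal_toReal wsfin]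
    gcongr
  have mm1 : ∀ {f g : X × X × X → X}, Measurable f → Measurable g → T''.map f univ = T''.map g univ := fun hf hg => by
    rw [Measure.map_apply hf MeasurableSet.univ, Measure.map_apply hg MeasurableSet.univ]; rfl
  have mm2 : (T'.map (fun p => p.1)) univ = ns univ := mass_of_fin (ne_top_of_le_ne_top ENNReal.ofReal_ne_top ws1)
  have mm3 : ns univ = (T'.map (fun p => p.2.2)) univ := mass_of_fin (ne_top_of_le_ne_top ENNReal.ofReal_ne_top ws2)
  have hQ : Q (a + ns) := by
    refine ⟨inferInstance, ?_, in1, ?_, ?_, in2.trans (ea.le.trans hE')⟩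
    · rw [Measure.add_apply, ons, add_zero]
      have hle : a ≤ n' := by conv_rhs => rw [← ha]
                              exact Measure.le_add_left le_rfl
      exact le_antisymm ((hle _).trans o'.le) bot_le
    · have := Wsq_add_le (μ := T''.map (fun p => p.1)) (ν := a) (μ' := T'.map (fun p => p.1)) (ν' := ns)
        (by rw [← h2a]; exact mm1 f1 f2) mm2
      rw [hmap f1, hT.m1] at this
      refine this.trans ((add_le_add v1 v3).trans ?_)
      rw [← mul_add, co, hc1']
    · have := Wsq_add_le (ν := T''.map (fun p => p.2.2)) (μ := a) (ν' := T'.map (fun p => p.2.2)) (μ' := ns)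
        (by rw [← h2a]; exact mm1 f2 f3) mm3
      rw [hmap f3, hT.m3] at this
      refine this.trans ((add_le_add v2 v4).trans ?_)
      rw [← mul_add, co, hc2']
  have z := in3 (le_antisymm in2 (ea.le.trans (hmin _ hQ)))
  have mz : ∀ {f : X × X × X → X}, Measurable f → T'.map f ≠ 0 := fun hf h => hsz (by
    rw [← hT's]
    have h4 := congrArg (fun μ : Measure X => μ univ) h
    simp only [Measure.coe_zero, Pi.zero_apply] at h4
    rw [Measure.map_apply hf MeasurableSet.univ, preimage_univ] at h4
    rw [Measure.measure_univ_eq_zero.1 h4, Measure.map_zero])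
  have p1 := pow_neg h0 h1 _ uas (mz f1)
  have p2 := pow_neg h0 h1 _ ubs (mz f3)
  have es' : eU (fun r => -r ^ θ) m ns ≤ 1/3 * eU (fun r => -r ^ θ) m (T'.map (fun p => p.1)) + 2/3 * eU (fun r => -r ^ θ) m (T'.map (fun p => p.2.2)) := by
    refine es.trans (le_of_eq ?_); ring
  linarith
end P16

section P17
variable {X : Type*} [MetricSpace X] [MeasurableSpace X] [SecondCountableTopology X] [BorelSpace X]
  [CompleteSpace X]
variable {m : Measure X} [SigmaFinite m] {U U' : ℝ → ℝ} {K : ℝ}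

/-- `ζ` is a good `t`-intermediate point -/
def CCt (U : ℝ → ℝ) (m : Measure X) (K t : ℝ) (ν₀ ν₁ ζ : Measure X) : Prop :=
  IsFiniteMeasure ζ ∧ UI U m ζ ∧ Wsq ν₀ ζ ≤ ENNReal.ofReal t ^ 2 * Wsq ν₀ ν₁ ∧
  Wsq ζ ν₁ ≤ ENNReal.ofReal (1 - t) ^ 2 * Wsq ν₀ ν₁ ∧ eU U m ζ ≤ (1 - t) * eU U m ν₀ + t * eU U m ν₁
      - K / 2 * (t * (1 - t)) * (Wsq ν₀ ν₁).toReal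

lemma CC.at {ν₀ ν₁ : Measure X} (h : CC U m K ν₀ ν₁) {t : ℝ} (h0 : 0 < t) (h1 : t < 1) : ∃ ζ, CCt U m K t ν₀ ν₁ ζ := by
  obtain ⟨μ, m0, m1, mf, mW, me⟩ := h
  have ht : t ∈ Icc (0:ℝ) 1 := ⟨h0.le, h1.le⟩
  have w1 := mW 0 (by simp) t ht
  have w2 := mW t ht 1 (by simp)
  rw [m0] at w1; rw [m1] at w2
  have a1 : |0 - t| = t := by rw [abs_sub_comm, sub_zero, abs_of_pos h0]
  have a2 : |t - 1| = 1 - t := by rw [abs_sub_comm, abs_of_pos (by linarith)]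
  rw [a1] at w1; rw [a2] at w2
  exact ⟨μ t, mf t ht, (me t ht).1, w1, w2, (me t ht).2⟩

lemma CCt.mass {ν₀ ν₁ ζ : Measure X} {t : ℝ} (h : CCt U m K t ν₀ ν₁ ζ) (hf : Wsq ν₀ ν₁ ≠ ∞) : ν₀ univ = ζ univ :=
  mass_of_fin (ne_top_of_le_ne_top (ENNReal.mul_ne_top (by finiteness) hf) h.2.2.1)

lemma CCt.off {ν₀ ν₁ ζ : Measure X} [IsFiniteMeasure ν₀] [IsFiniteMeasure ν₁] {t : ℝ} (h : CCt U m K t ν₀ ν₁ ζ)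
    (hf : Wsq ν₀ ν₁ ≠ ∞) (h0 : 0 < t) (h1 : t < 1) {x : X} {r R s : ℝ} (hA : ν₀ (Metric.closedBall x r)ᶜ = 0)
    (hB : ν₁ (Metric.closedBall x R)ᶜ = 0) (hs : r + t * (r + R) ≤ s) : ζ (Metric.closedBall x s)ᶜ = 0 := by
  haveI := h.1
  obtain ⟨T, hT⟩ := exists_tplan h0 h1 hf h.2.2.1 h.2.2.2.1
  refine hT.conc Metric.isClosed_closedBall.measurableSet Metric.isClosed_closedBall.measurableSet
    Metric.isClosed_closedBall.measurableSet hA hB ?_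
  intro a ha b hb y hy _
  rw [Metric.mem_closedBall] at ha hb ⊢
  have e1 := dist_triangle y a x
  have e2 := dist_triangle_right a b x
  rw [dist_comm y a] at e1
  nlinarith

lemma cc_glue_t (hgeo : GeodesicSpace X) (hnb : NonBranching X) (hU : UProp U U') (K : ℝ) {ι : Type*} [Countable ι]
    {q : Measure (X × X)} {ν₀ ν₁ : Measure X} [IsFiniteMeasure ν₀] [IsFiniteMeasure ν₁]
    (P : RPart ι q) (hq : IsCoupling q ν₀ ν₁)
    (ho : ∫⁻ p, edist p.1 p.2 ^ 2 ∂q = Wsq ν₀ ν₁) (hf : Wsq ν₀ ν₁ ≠ ∞)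
    (u0 : UI U m ν₀) (u1 : UI U m ν₁) (b0 : LB U m ν₀) (b1 : LB U m ν₁) {t : ℝ} (h0 : 0 < t) (h1 : t < 1)
    (hb : ∀ (β : Measure X) [IsFiniteMeasure β], (∃ T, IsTPlan t T ν₀ β ν₁) → LB U m β)
    (hcc : ∀ i, CC U m K (P.a i) (P.b i)) : ∃ ζ, CCt U m K t ν₀ ν₁ ζ := by
  haveI := hq.finite
  haveI := P.fin_a
  haveI := P.fin_b
  choose ζ hζ using fun i => (hcc i).at h0 h1
  haveI := fun i => (hζ i).1
  have hWi : ∀ i, Wsq (P.a i) (P.b i) ≠ ∞ := fun i =>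
    ENNReal.ne_top_of_tsum_ne_top (by rw [P.tsum_W hq ho hf]; exact hf) i
  have s0 : Measure.sum P.a = ν₀ := by rw [P.sum_a, hq.1]
  have s1 : Measure.sum P.b = ν₁ := by rw [P.sum_b, hq.2]
  have mass := fun i => (hζ i).mass (hWi i)
  haveI : IsFiniteMeasure (Measure.sum ζ) := by
    constructor
    rw [Measure.sum_apply _ MeasurableSet.univ]
    simp_rw [fun i => (mass i).symm]
    rw [← Measure.sum_apply _ MeasurableSet.univ, s0]
    exact measure_lt_top _ _
  have w1 : Wsq ν₀ (Measure.sum ζ) ≤ ENNReal.ofReal t ^ 2 * Wsq ν₀ ν₁ := by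
    conv_lhs => rw [← s0]
    refine (Wsq_sum_le mass).trans ?_
    rw [← P.tsum_W hq ho hf, ← ENNReal.tsum_mul_left]
    exact ENNReal.tsum_le_tsum fun i => (hζ i).2.2.1
  have w2 : Wsq (Measure.sum ζ) ν₁ ≤ ENNReal.ofReal (1 - t) ^ 2 * Wsq ν₀ ν₁ := by
    conv_lhs => rw [← s1]
    refine (Wsq_sum_le (fun i => (mass i).symm.trans (P.mass_eq i))).trans ?_
    rw [← P.tsum_W hq ho hf, ← ENNReal.tsum_mul_left]
    exact ENNReal.tsum_le_tsum fun i => (hζ i).2.2.2.1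
  obtain ⟨r1, r2⟩ := S_inf hgeo hnb hU K P hq ho hf h0 h1 (fun i => (hζ i).1) (fun i => (hζ i).2.2.1) (fun i => (hζ i).2.2.2.1)
    (fun i => (hζ i).2.1) (fun i => (hζ i).2.2.2.2) u0 u1 b0 b1 (hb _ (exists_tplan h0 h1 hf w1 w2))
  exact ⟨_, inferInstance, r1, w1, w2, r2⟩

lemma vol_fin (hU : UProp U U') (hV : Tendsto (fun v : ℝ => v * U (1 / v)) atTop atBot) {B : Set X} (mB : MeasurableSet B)
    {t C : ℝ} (ht : 0 < t) {G : Set X} (mG : MeasurableSet G) (hG : m G ≠ ∞)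
    (h : ∀ A ⊆ B, MeasurableSet A → m A ≠ 0 → m A ≠ ∞ → ∃ ζ : Measure X, IsFiniteMeasure ζ ∧ UI U m ζ ∧ ζ Gᶜ = 0 ∧
      ζ univ = 1 ∧ eU U m ζ ≤ C + t * (m.real A * U (1 / m.real A))) : m B ≠ ∞ := by
  obtain ⟨C', hC', hl⟩ := eU_low (m := m) hU 1 one_pos
  obtain ⟨v, hv⟩ := (hV.eventually (eventually_lt_atBot ((-m.real G - C' - C) / t))).exists_forall_of_atTop
  have key : ∀ A ⊆ B, MeasurableSet A → m A ≠ ∞ → m A ≤ ENNReal.ofReal (max v 0) := by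
    intro A hA mA fA
    by_contra hc
    push Not at hc
    have z : m A ≠ 0 := (bot_le.trans_lt hc).ne'
    obtain ⟨ζ, fζ, uζ, oζ, mζ, eζ⟩ := h A hA mA z fA
    have := hl ζ G mG hG oζ uζ
    have hr : ζ.real univ = 1 := by simp [Measure.real, mζ]
    rw [hr] at this
    have h3 : v ≤ m.real A := by
      have := ENNReal.toReal_mono fA hc.le
      rw [ENNReal.toReal_ofReal (le_max_right _ _)] at this
      exact (le_max_left _ _).trans this
    have h4 := hv _ h3
    rw [lt_div_iff₀ ht] at h4
    linarith
  have : m B ≤ ENNReal.ofReal (max v 0) := by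
    have h1 : m B = ⨆ n, m (B ∩ spanningSets m n) := by
      rw [← (monotone_const.inter (monotone_spanningSets m)).measure_iUnion, ← inter_iUnion, iUnion_spanningSets, inter_univ]
    rw [h1]
    refine iSup_le fun n => key _ inter_subset_left (mB.inter (measurableSet_spanningSets m n)) ?_
    exact ne_top_of_le_ne_top (measure_spanningSets_lt_top m n).ne (measure_mono inter_subset_right)
  exact ne_top_of_le_ne_top ENNReal.ofReal_ne_top this

end P17

section P18
variable {X : Type*} [MetricSpace X] [MeasurableSpace X] [SecondCountableTopology X] [BorelSpace X]
  [CompleteSpace X]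
variable {m : Measure X} [SigmaFinite m] {U U' : ℝ → ℝ} {K : ℝ}

set_option maxHeartbeats 1000000 in
lemma cc_concat {α β n : Measure X} [IsFiniteMeasure α] [IsFiniteMeasure β] [IsFiniteMeasure n] (hf : Wsq α β ≠ ∞)
    (w1 : Wsq α n ≤ ENNReal.ofReal (4/9 * wr α β)) (w2 : Wsq n β ≤ ENNReal.ofReal (wr α β / 9))
    (en : eU U m n ≤ 1/3 * eU U m α + 2/3 * eU U m β - K / 9 * wr α β)
    (c1 : CC U m K α n) (c2 : CC U m K n β) : CC U m K α β := by
  obtain ⟨μ, m0, m1, mf, mW, me⟩ := c1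
  obtain ⟨ν, n0, n1, nf, nW, ne⟩ := c2
  have w1' : Wsq α n ≤ ENNReal.ofReal (2/3) ^ 2 * Wsq α β := by
    refine w1.trans (le_of_eq ?_)
    rw [show (4/9 : ℝ) = (2/3)^2 by norm_num, ENNReal.ofReal_mul (by norm_num), ENNReal.ofReal_pow (by norm_num), wr, ENNReal.ofReal_toReal hf]
  have w2' : Wsq n β ≤ ENNReal.ofReal (1/3) ^ 2 * Wsq α β := by
    refine w2.trans (le_of_eq ?_)
    rw [show ∀ w : ℝ, w / 9 = (1/3)^2 * w from fun w => by ring, ENNReal.ofReal_mul (by norm_num), ENNReal.ofReal_pow (by norm_num), wr, ENNReal.ofReal_toReal hf]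
  rw [← W2_le_iff] at w1' w2'
  have f1 := ne_top_of_le_ne_top ENNReal.ofReal_ne_top w1
  have f2 := ne_top_of_le_ne_top ENNReal.ofReal_ne_top w2
  have g0 := wr_nonneg α β
  have g1 : wr α n ≤ 4/9 * wr α β := by
    have := ENNReal.toReal_mono ENNReal.ofReal_ne_top w1
    rwa [ENNReal.toReal_ofReal (by positivity)] at this
  have g2 : wr n β ≤ wr α β / 9 := by
    have := ENNReal.toReal_mono ENNReal.ofReal_ne_top w2
    rwa [ENNReal.toReal_ofReal (by positivity)] at this
  have tri := wr_tri f1 f2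
  obtain ⟨r1, r2⟩ : wr α n = 4/9 * wr α β ∧ wr n β = wr α β / 9 := by
    have p0 := Real.sqrt_nonneg (wr α β)
    have p1 := Real.sqrt_nonneg (wr α n)
    have p2 := Real.sqrt_nonneg (wr n β)
    have q0 := Real.sq_sqrt g0
    have q1 := Real.sq_sqrt (wr_nonneg α n)
    have q2 := Real.sq_sqrt (wr_nonneg n β)
    have s1 : √(wr α n) ≤ 2/3 * √(wr α β) := abs_le_of_sq_le_sq' (by nlinarith) (by positivity) |>.2
    have s2 : √(wr n β) ≤ 1/3 * √(wr α β) := abs_le_of_sq_le_sq' (by nlinarith) (by positivity) |>.2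
    have s3 : √(wr α n) = 2/3 * √(wr α β) := by linarith
    have s4 : √(wr n β) = 1/3 * √(wr α β) := by linarith
    constructor
    · rw [← q1, s3, ← q0]; simp only [Real.sqrt_sq p0]; ring
    · rw [← q2, s4, ← q0]; simp only [Real.sqrt_sq p0]; ring
  let c : ℝ → Measure X := fun t => if t ≤ 2/3 then μ (3/2 * t) else ν (3 * t - 2)
  have i1 : ∀ t, 0 ≤ t → t ≤ 2/3 → 3/2 * t ∈ Icc (0:ℝ) 1 := fun t h1 h2 => ⟨by linarith, by linarith⟩
  have i2 : ∀ t, 2/3 ≤ t → t ≤ 1 → 3 * t - 2 ∈ Icc (0:ℝ) 1 := fun t h1 h2 => ⟨by linarith, by linarith⟩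
  have A : ∀ s t, 0 ≤ s → s ≤ t → t ≤ 2/3 → W2 (μ (3/2 * s)) (μ (3/2 * t)) ≤ ENNReal.ofReal (t - s) * W2 α β := by
    intro s t h1 h2 h3
    have := mW _ (i1 s h1 (by linarith)) _ (i1 t (by linarith) h3)
    rw [← W2_le_iff] at this
    refine (this.trans (mul_le_mul_right w1' _)).trans ?_
    rw [← mul_assoc, ← ENNReal.ofReal_mul (abs_nonneg _)]
    apply le_of_eq; congr 2
    rw [abs_of_nonpos (by linarith)]; ring
  have B : ∀ s t, 2/3 ≤ s → s ≤ t → t ≤ 1 → W2 (ν (3 * s - 2)) (ν (3 * t - 2)) ≤ ENNReal.ofReal (t - s) * W2 α β := by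
    intro s t h1 h2 h3
    have := nW _ (i2 s h1 (by linarith)) _ (i2 t (by linarith) h3)
    rw [← W2_le_iff] at this
    refine (this.trans (mul_le_mul_right w2' _)).trans ?_
    rw [← mul_assoc, ← ENNReal.ofReal_mul (abs_nonneg _)]
    apply le_of_eq; congr 2
    rw [abs_of_nonpos (by linarith)]; ring
  have fc : ∀ t ∈ Icc (0:ℝ) 1, IsFiniteMeasure (c t) := by
    intro t ht
    by_cases h : t ≤ 2/3
    · simp only [c, if_pos h]; exact mf _ (i1 t ht.1 h)
    · simp only [c, if_neg h]; exact nf _ (i2 t (by linarith) ht.2)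
  have D : ∀ s t, 0 ≤ s → s ≤ t → t ≤ 1 → W2 (c s) (c t) ≤ ENNReal.ofReal (t - s) * W2 α β := by
    intro s t h1 h2 h3
    by_cases ht : t ≤ 2/3
    · have hs : s ≤ 2/3 := by linarith
      simp only [c, if_pos ht, if_pos hs]; exact A s t h1 h2 ht
    by_cases hs : s ≤ 2/3
    · haveI := fc s ⟨h1, by linarith⟩
      haveI := fc t ⟨by linarith, h3⟩
      refine (W2_triangle (c s) n (c t)).trans ?_
      have a := A s (2/3) h1 hs le_rfl
      have b := B (2/3) t le_rfl (by linarith) h3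
      norm_num at a b
      rw [m1] at a; rw [n0] at b
      simp only [c, if_neg ht, if_pos hs]
      refine (add_le_add a b).trans ?_
      rw [← add_mul, ← ENNReal.ofReal_add (by linarith) (by linarith)]
      apply le_of_eq; congr 2; ring
    · simp only [c, if_neg ht, if_neg hs]; exact B s t (by linarith) h2 h3
  refine ⟨c, by simp only [c]; rw [if_pos (by norm_num), mul_zero, m0], by simp [c]; norm_num [n1], fc, ?_, ?_⟩
  · intro s hs t ht
    rw [← W2_le_iff]
    rcases le_total s t with h | h
    · rw [abs_of_nonpos (by linarith), neg_sub]; exact D s t hs.1 h ht.2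
    · rw [abs_of_nonneg (by linarith), W2_symm (c s)]; exact D t s ht.1 h hs.2
  · intro t ht
    have r1' : (Wsq α n).toReal = 4/9 * (Wsq α β).toReal := r1
    have r2' : (Wsq n β).toReal = (Wsq α β).toReal / 9 := r2
    have en' : eU U m n ≤ 1/3 * eU U m α + 2/3 * eU U m β - K / 9 * (Wsq α β).toReal := en
    by_cases h : t ≤ 2/3
    · simp only [c, if_pos h]
      obtain ⟨k1, k2⟩ := me _ (i1 t ht.1 h)
      refine ⟨k1, k2.trans ?_⟩
      rw [r1']
      have := mul_le_mul_of_nonneg_left en' (show 0 ≤ 3/2 * t by linarith [ht.1])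
      linarith
    · simp only [c, if_neg h]
      obtain ⟨k1, k2⟩ := ne _ (i2 t (by linarith) ht.2)
      refine ⟨k1, k2.trans ?_⟩
      rw [r2']
      have := mul_le_mul_of_nonneg_left en' (show 0 ≤ 1 - (3 * t - 2) by linarith [ht.2])
      linarith

lemma wr_ball {ν₀ ν₁ : Measure X} [IsFiniteMeasure ν₀] [IsFiniteMeasure ν₁] (hM : ν₀ univ = ν₁ univ) {x y : X} {r R : ℝ}
    (hA : ν₀ (Metric.closedBall x r)ᶜ = 0) (hB : ν₁ (Metric.closedBall y R)ᶜ = 0) :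
    Wsq ν₀ ν₁ ≠ ∞ ∧ wr ν₀ ν₁ ≤ (r + dist x y + R) ^ 2 * ν₀.real univ := by
  refine wr_bound hM Metric.isClosed_closedBall.measurableSet Metric.isClosed_closedBall.measurableSet hA hB ?_
  intro a ha b hb
  rw [Metric.mem_closedBall] at ha hb
  have h3 := dist_triangle4 a x y b
  rw [dist_comm y b] at h3
  linarith

lemma ball_mono {ν : Measure X} {x y : X} {r R : ℝ} (h : ν (Metric.closedBall x r)ᶜ = 0) (hr : r + dist x y ≤ R) :
    ν (Metric.closedBall y R)ᶜ = 0 :=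
  measure_mono_null (compl_subset_compl.2 (Metric.closedBall_subset_closedBall' hr)) h

lemma tiny_cc (hkey : KeyP U m K) {x0 y0 : X} {L : ℝ} (hL : 0 < L) (hd : dist x0 y0 ≤ 1.07 * L)
    (T0 : TP U m K x0 (0.9 * L)) (T1 : TP U m K y0 (0.9 * L))
    (hm : m (Metric.closedBall x0 (0.85 * L) ∪ Metric.closedBall y0 (0.85 * L)) ≠ ∞)
    {α β : Measure X} [IsFiniteMeasure α] [IsFiniteMeasure β] (hM : α univ = β univ) (ua : UI U m α) (ub : UI U m β)
    (hA : α (Metric.closedBall x0 (L / 1000))ᶜ = 0) (hB : β (Metric.closedBall y0 (L / 1000))ᶜ = 0) :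
    CC U m K α β := by
  obtain ⟨n, fn, un, w1, w2, en⟩ := hkey x0 y0 L hL hd T0 T1 hm α β inferInstance inferInstance hM ua ub hA hB
  have hf := (wr_ball hM hA hB).1
  have w1' : Wsq α n ≤ ENNReal.ofReal (2/3) ^ 2 * Wsq α β := by
    refine w1.trans (le_of_eq ?_)
    rw [show (4/9 : ℝ) = (2/3)^2 by norm_num, ENNReal.ofReal_mul (by norm_num), ENNReal.ofReal_pow (by norm_num), wr, ENNReal.ofReal_toReal hf]
  have w2' : Wsq n β ≤ ENNReal.ofReal (1-2/3) ^ 2 * Wsq α β := by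
    refine w2.trans (le_of_eq ?_)
    rw [show ∀ w : ℝ, w / 9 = (1-2/3)^2 * w from fun w => by ring, ENNReal.ofReal_mul (by norm_num), ENNReal.ofReal_pow (by norm_num), wr, ENNReal.ofReal_toReal hf]
  obtain ⟨T, hT⟩ := exists_tplan (t := 2/3) (by norm_num) (by norm_num) hf w1' w2'
  have mc : ∀ (x : X) r, MeasurableSet (Metric.closedBall x r) := fun x r => Metric.isClosed_closedBall.measurableSet
  have hdd : ∀ a ∈ Metric.closedBall x0 (L / 1000), ∀ b ∈ Metric.closedBall y0 (L / 1000), dist a b ≤ 1.072 * L := by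
    intro a ha b hb
    rw [Metric.mem_closedBall] at ha hb
    have h3 := dist_triangle4 a x0 y0 b
    rw [dist_comm y0 b] at h3
    linarith
  have o1 : n (Metric.closedBall x0 (0.9 * L))ᶜ = 0 := by
    refine hT.conc (mc _ _) (mc _ _) (mc _ _) hA hB ?_
    intro a ha b hb y hy _
    have := hdd a ha b hb
    rw [Metric.mem_closedBall] at ha ⊢
    have e1 := dist_triangle y a x0
    rw [dist_comm y a] at e1
    linarith
  have o2 : n (Metric.closedBall y0 (0.9 * L))ᶜ = 0 := by
    refine hT.conc (mc _ _) (mc _ _) (mc _ _) hA hB ?_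
    intro a ha b hb y _ hy
    have := hdd a ha b hb
    rw [Metric.mem_closedBall] at hb ⊢
    have e1 := dist_triangle y b y0
    linarith
  have mm1 : α univ = n univ := mass_of_fin (ne_top_of_le_ne_top ENNReal.ofReal_ne_top w1)
  have c1 : CC U m K α n := T0 α n inferInstance inferInstance mm1 (ball_mono hA (by rw [dist_self]; linarith)) o1 ua un
  have c2 : CC U m K β n := T1 β n inferInstance inferInstance (hM.symm.trans mm1) (ball_mono hB (by rw [dist_self]; linarith)) o2 ub un
  exact cc_concat hf w1 w2 en c1 c2.swap

end P18

section P19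
variable {X : Type*} [MetricSpace X] [MeasurableSpace X] [SecondCountableTopology X] [BorelSpace X]
  [CompleteSpace X]
variable {m : Measure X} [SigmaFinite m] {U U' : ℝ → ℝ} {K : ℝ}

lemma cost_bd {K t w D : ℝ} (h0 : 0 < t) (h1 : t < 1) (hw : 0 ≤ w) (hD : w ≤ D) : - (K / 2 * (t * (1 - t)) * w) ≤ |K| * D := by
  have h2 : 0 ≤ t * (1 - t) := by nlinarith
  have h3 : t * (1 - t) ≤ 1 := by nlinarith
  have h4 : 0 ≤ t * (1 - t) * w := by positivity
  have h5 : t * (1 - t) * w ≤ D := by nlinarith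
  have h6 := neg_abs_le K
  have h7 := abs_nonneg K
  nlinarith

lemma exists_ball_fin [IsLocallyFiniteMeasure m] (x : X) {L : ℝ} (hL : 0 < L) :
    ∃ r, 0 < r ∧ r ≤ L ∧ m (Metric.closedBall x r) ≠ ∞ := by
  obtain ⟨V, hV, hV2⟩ := m.finiteAt_nhds x
  obtain ⟨r, r0, hr⟩ := Metric.nhds_basis_closedBall.mem_iff.1 hV
  refine ⟨min r L, lt_min r0 hL, min_le_right _ _, ?_⟩
  exact ne_top_of_le_ne_top hV2.ne (measure_mono ((Metric.closedBall_subset_closedBall (min_le_left _ _)).trans hr))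

lemma ball_ne_zero (hs : mmSupp m = univ) (x : X) {r : ℝ} (hr : 0 < r) : m (Metric.closedBall x r) ≠ 0 := fun h =>
  mmSupp_pos hs Metric.isOpen_ball (Metric.mem_ball_self hr) (measure_mono_null Metric.ball_subset_closedBall h)

lemma tp_vol [IsLocallyFiniteMeasure m] (hU : UProp U U') (hV : Tendsto (fun v : ℝ => v * U (1 / v)) atTop atBot)
    (hs : mmSupp m = univ) {x : X} {L : ℝ} (hL : 0 < L) (h : TP U m K x L) : m (Metric.closedBall x L) ≠ ∞ := by
  obtain ⟨r, r0, rL, hr⟩ := exists_ball_fin (m := m) x hL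
  have mc : ∀ (x : X) r, MeasurableSet (Metric.closedBall x r) := fun x r => Metric.isClosed_closedBall.measurableSet
  have h0 : 0 < r / (4 * L) := by positivity
  have h1 : r / (4 * L) < 1 := by rw [div_lt_one (by positivity)]; linarith
  have ht : r / (4 * L) * L = r / 4 := by field_simp
  set t := r / (4 * L)
  obtain ⟨ν₀, f0, m0, u0, o0, e0⟩ := unif_exists (m := m) hU (mc x (r / 100)) (ball_ne_zero hs x (by positivity))
    (ne_top_of_le_ne_top hr (measure_mono (Metric.closedBall_subset_closedBall (by linarith)))) 1 ENNReal.one_ne_top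
  refine vol_fin hU hV (mc x L) (t := t) (C := (1 - t) * eU U m ν₀ + |K| * (2 * L) ^ 2) h0 (mc x r) hr ?_
  intro A hA mA zA fA
  obtain ⟨ν₁, f1, m1, u1, o1, e1⟩ := unif_exists (m := m) hU mA zA fA 1 ENNReal.one_ne_top
  have o0' : ν₀ (Metric.closedBall x (L / 100))ᶜ = 0 := ball_mono o0 (by rw [dist_self]; linarith)
  have o1' : ν₁ (Metric.closedBall x L)ᶜ = 0 := measure_mono_null (compl_subset_compl.2 hA) o1
  have hM : ν₀ univ = ν₁ univ := by rw [m0, m1]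
  obtain ⟨hf, hw⟩ := wr_ball hM o0' o1'
  obtain ⟨ζ, hζ⟩ := (h ν₀ ν₁ f0 f1 hM o0' o1' u0 u1).at h0 h1
  have hoff := hζ.off hf h0 h1 (s := r) o0 o1' (by nlinarith)
  refine ⟨ζ, hζ.1, hζ.2.1, hoff, by rw [← hζ.mass hf, m0], ?_⟩
  have := hζ.2.2.2.2
  have hr1 : ν₀.real univ = 1 := by simp [Measure.real, m0]
  rw [hr1, dist_self] at hw
  have c := cost_bd (K := K) h0 h1 (wr_nonneg ν₀ ν₁) (hw.trans (show _ ≤ (2 * L) ^ 2 by nlinarith))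
  rw [wr] at c
  rw [e1, ENNReal.toReal_one] at this
  linarith

/-- partition of an optimal plan into rectangles where CC holds -/
lemma tp_part [IsLocallyFiniteMeasure m] (hU : UProp U U') (hV : Tendsto (fun v : ℝ => v * U (1 / v)) atTop atBot)
    (hs : mmSupp m = univ) (hkey : KeyP U m K) {x : X} {L : ℝ} (hL : 0 < L)
    (h : ∀ y ∈ Metric.closedBall x (2 * L), TP U m K y (0.9 * L)) {ν₀ ν₁ : Measure X} [IsFiniteMeasure ν₀] [IsFiniteMeasure ν₁]
    {q : Measure (X × X)} (hq : IsCoupling q ν₀ ν₁)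
    (o0 : ν₀ (Metric.closedBall x (L / 100))ᶜ = 0) (o1 : ν₁ (Metric.closedBall x (1.05 * L))ᶜ = 0)
    (u0 : UI U m ν₀) (u1 : UI U m ν₁) (b0 : LB U m ν₀) (b1 : LB U m ν₁) :
    ∃ P : RPart (ℕ × Finset ℕ × Finset ℕ) q, ∀ i, CC U m K (P.a i) (P.b i) := by
  have mc : ∀ (x : X) r, MeasurableSet (Metric.closedBall x r) := fun x r => Metric.isClosed_closedBall.measurableSet
  haveI := hq.finite
  obtain ⟨P, hP⟩ := exists_rpart' q (fun V W => (V = ∅ ∧ W = ∅) ∨ ∃ x0 ∈ Metric.closedBall x (L / 100),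
    ∃ y0 ∈ Metric.closedBall x (1.05 * L), V ⊆ Metric.closedBall x0 (L / 1000) ∧ W ⊆ Metric.closedBall y0 (L / 1000)) (Or.inl ⟨rfl, rfl⟩)
    (Metric.closedBall x (L / 100) ×ˢ Metric.closedBall x (1.05 * L)) (coupling_ae hq (mc _ _) (mc _ _) o0 o1) (by
      rintro ⟨a, b⟩ ⟨ha, hb⟩
      exact ⟨Metric.ball a (L / 1000), Metric.ball b (L / 1000), Metric.mem_ball_self (by positivity),
        Metric.mem_ball_self (by positivity), Metric.isOpen_ball, Metric.isOpen_ball,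
        Or.inr ⟨a, ha, b, hb, Metric.ball_subset_closedBall, Metric.ball_subset_closedBall⟩⟩)
  refine ⟨P, fun i => ?_⟩
  haveI := P.fin_a i
  haveI := P.fin_b i
  have ua : UI U m (P.a i) := u0.mono hU b0 (by have := P.a_le i; rwa [hq.1] at this)
  have ub : UI U m (P.b i) := u1.mono hU b1 (by have := P.b_le i; rwa [hq.2] at this)
  obtain ⟨V, W, hAV, hBW, hQ⟩ := hP i
  obtain ⟨x0, hx0, y0, hy0, hA, hB⟩ : ∃ x0 ∈ Metric.closedBall x (L / 100), ∃ y0 ∈ Metric.closedBall x (1.05 * L),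
      P.A i ⊆ Metric.closedBall x0 (L / 1000) ∧ P.B i ⊆ Metric.closedBall y0 (L / 1000) := by
    rcases hQ with ⟨rfl, rfl⟩ | ⟨x0, hx0, y0, hy0, h1, h2⟩
    · exact ⟨x, Metric.mem_closedBall_self (by positivity), x, Metric.mem_closedBall_self (by positivity),
        hAV.trans (empty_subset _), hBW.trans (empty_subset _)⟩
    · exact ⟨x0, hx0, y0, hy0, hAV.trans h1, hBW.trans h2⟩
  have T0 := h x0 (Metric.closedBall_subset_closedBall (by linarith) hx0)
  have T1 := h y0 (Metric.closedBall_subset_closedBall (by linarith) hy0)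
  refine tiny_cc hkey hL ?_ T0 T1 ?_ (P.mass_eq i) ua ub (measure_mono_null (compl_subset_compl.2 hA) (P.a_off i))
    (measure_mono_null (compl_subset_compl.2 hB) (P.b_off i))
  · rw [Metric.mem_closedBall] at hx0 hy0
    have := dist_triangle_right x0 y0 x
    linarith
  · have v0 := tp_vol hU hV hs (by positivity) T0
    have v1 := tp_vol hU hV hs (by positivity) T1
    refine ne_top_of_le_ne_top (ENNReal.add_ne_top.2 ⟨v0, v1⟩) ((measure_union_le _ _).trans (add_le_add ?_ ?_))
    · exact measure_mono (Metric.closedBall_subset_closedBall (by linarith))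
    · exact measure_mono (Metric.closedBall_subset_closedBall (by linarith))

lemma tp_step [IsLocallyFiniteMeasure m] (hgeo : GeodesicSpace X) (hnb : NonBranching X)
    (hU : UProp U U') (hV : Tendsto (fun v : ℝ => v * U (1 / v)) atTop atBot)
    (hs : mmSupp m = univ) (hkey : KeyP U m K) {x : X} {L : ℝ} (hL : 0 < L)
    (h : ∀ y ∈ Metric.closedBall x (2 * L), TP U m K y (0.9 * L)) : TP U m K x L := by
  have mc : ∀ (x : X) r, MeasurableSet (Metric.closedBall x r) := fun x r => Metric.isClosed_closedBall.measurableSet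
  have v9 := tp_vol hU hV hs (by positivity) (h x (Metric.mem_closedBall_self (by positivity)))
  have v1 : m (Metric.closedBall x (L / 100)) ≠ ∞ :=
    ne_top_of_le_ne_top v9 (measure_mono (Metric.closedBall_subset_closedBall (by linarith)))
  have hfin : m (Metric.closedBall x (1.05 * L)) ≠ ∞ := by
    obtain ⟨ν₀, f0, m0, u0, o0, e0⟩ := unif_exists (m := m) hU (mc x (L / 100)) (ball_ne_zero hs x (by positivity))
      v1 1 ENNReal.one_ne_top
    refine vol_fin hU hV (mc x (1.05 * L)) (t := 1/2) (C := 1/2 * eU U m ν₀ + |K| * (2 * L) ^ 2) (by norm_num) (mc x (0.9 * L)) v9 ?_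
    intro A hA mA zA fA
    obtain ⟨ν₁, f1, m1, u1, o1, e1⟩ := unif_exists (m := m) hU mA zA fA 1 ENNReal.one_ne_top
    have o1' : ν₁ (Metric.closedBall x (1.05 * L))ᶜ = 0 := measure_mono_null (compl_subset_compl.2 hA) o1
    have hM : ν₀ univ = ν₁ univ := by rw [m0, m1]
    obtain ⟨hf, hw⟩ := wr_ball hM o0 o1'
    obtain ⟨q, hq, ho⟩ := exists_opt hM
    have b0 := LB.of_finite (m := m) hU (mc _ _) v1 o0
    have b1 := LB.of_finite (m := m) hU mA fA o1
    obtain ⟨P, hP⟩ := tp_part hU hV hs hkey hL h hq o0 o1' u0 u1 b0 b1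
    obtain ⟨ζ, hζ⟩ := cc_glue_t hgeo hnb hU K P hq ho hf u0 u1 b0 b1 (t := 1/2) (by norm_num) (by norm_num)
      (fun β _ ⟨T, hT⟩ => LB.of_finite hU (mc x (0.9 * L)) v9 (hT.conc (mc _ _) (mc _ _) (mc _ _) o0 o1' (by
        intro a ha b hb y hy _
        rw [Metric.mem_closedBall] at ha hb ⊢
        have e1 := dist_triangle y a x
        have e2 := dist_triangle_right a b x
        rw [dist_comm y a] at e1
        linarith))) hP
    have hoff := hζ.off hf (by norm_num) (by norm_num) (s := 0.9 * L) o0 o1' (by linarith)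
    refine ⟨ζ, hζ.1, hζ.2.1, hoff, by rw [← hζ.mass hf, m0], ?_⟩
    have := hζ.2.2.2.2
    have hr1 : ν₀.real univ = 1 := by simp [Measure.real, m0]
    rw [hr1, dist_self] at hw
    have c := cost_bd (K := K) (t := 1/2) (by norm_num) (by norm_num) (wr_nonneg ν₀ ν₁) (hw.trans (show _ ≤ (2 * L) ^ 2 by nlinarith))
    rw [wr] at c
    rw [e1, ENNReal.toReal_one] at this
    linarith
  intro ν₀ ν₁ f0 f1 hM o0 o1 u0 u1
  have o1' : ν₁ (Metric.closedBall x (1.05 * L))ᶜ = 0 := ball_mono o1 (by rw [dist_self]; linarith)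
  obtain ⟨hf, -⟩ := wr_ball hM o0 o1
  obtain ⟨q, hq, ho⟩ := exists_opt hM
  have b0 := LB.of_finite (m := m) hU (mc _ _) v1 o0
  have b1 := LB.of_finite (m := m) hU (mc _ _) hfin o1'
  obtain ⟨P, hP⟩ := tp_part hU hV hs hkey hL h hq o0 o1' u0 u1 b0 b1
  refine cc_glue hgeo hnb hU K P hq ho hf u0 u1 b0 b1 ?_ hP
  rintro t ht β _ ⟨T, hT⟩
  refine LB.of_finite hU (mc x (1.05 * L)) hfin (hT.conc (mc _ _) (mc _ _) (mc _ _) o0 o1 ?_)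
  intro a ha b hb y hy _
  rw [Metric.mem_closedBall] at ha hb ⊢
  have e1 := dist_triangle y a x
  have e2 := dist_triangle_right a b x
  rw [dist_comm y a] at e1
  have e3 : t * dist a b ≤ dist a b := by nlinarith [ht.2, dist_nonneg (x := a) (y := b)]
  linarith

/-- base property: CC near each point -/
def BaseP (U : ℝ → ℝ) (m : Measure X) (K : ℝ) : Prop := ∀ x : X, ∃ ρ > 0, ∀ ν₀ ν₁ : Measure X, IsFiniteMeasure ν₀ →
  IsFiniteMeasure ν₁ → ν₀ univ = ν₁ univ → ν₀ (Metric.closedBall x ρ)ᶜ = 0 → ν₁ (Metric.closedBall x ρ)ᶜ = 0 →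
  UI U m ν₀ → UI U m ν₁ → CC U m K ν₀ ν₁

lemma tp_all [IsLocallyFiniteMeasure m] (hgeo : GeodesicSpace X) (hnb : NonBranching X)
    (hU : UProp U U') (hV : Tendsto (fun v : ℝ => v * U (1 / v)) atTop atBot)
    (hs : mmSupp m = univ) (hkey : KeyP U m K) (hB : BaseP U m K) (x : X) {L : ℝ} (hL : 0 < L) : TP U m K x L := by
  by_contra hc
  haveI : Nonempty X := ⟨x⟩
  have step : ∀ p : X × ℝ, 0 < p.2 → ¬ TP U m K p.1 p.2 → ∃ y, dist y p.1 ≤ 2 * p.2 ∧ ¬ TP U m K y (0.9 * p.2) := by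
    intro p hp h
    by_contra! hn
    exact h (tp_step hgeo hnb hU hV hs hkey hp fun y hy => hn y hy)
  choose! f hf1 hf2 using step
  let a : ℕ → X := fun n => Nat.rec x (fun n y => f (y, 0.9 ^ n * L)) n
  have a0 : a 0 = x := rfl
  have as : ∀ n, a (n + 1) = f (a n, 0.9 ^ n * L) := fun n => rfl
  have hp : ∀ n : ℕ, 0 < (0.9:ℝ) ^ n * L := fun n => by positivity
  have hn : ∀ n, ¬ TP U m K (a n) (0.9 ^ n * L) := by
    intro n
    induction n with
    | zero => simpa [a0] using hc
    | succ n ih =>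
      have := hf2 (a n, 0.9 ^ n * L) (hp n) ih
      rw [as, pow_succ]
      convert this using 1
      ring
  have hd : ∀ n, dist (a n) (a (n + 1)) ≤ (2 * L) * 0.9 ^ n := by
    intro n
    have := hf1 (a n, 0.9 ^ n * L) (hp n) (hn n)
    rw [as, dist_comm]
    simp only at this
    linarith
  have hcs := cauchySeq_of_le_geometric _ _ (by norm_num : (0.9:ℝ) < 1) hd
  obtain ⟨z, hz⟩ := cauchySeq_tendsto_of_complete hcs
  obtain ⟨ρ, ρ0, hρ⟩ := hB z
  have t1 : Tendsto (fun n : ℕ => (0.9:ℝ) ^ n * L) atTop (𝓝 0) := by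
    simpa using (tendsto_pow_atTop_nhds_zero_of_lt_one (by norm_num) (by norm_num : (0.9:ℝ) < 1)).mul_const L
  have t2 : Tendsto (fun n => dist (a n) z) atTop (𝓝 0) := tendsto_iff_dist_tendsto_zero.1 hz
  have t3 : Tendsto (fun n => (0.9:ℝ) ^ n * L + dist (a n) z) atTop (𝓝 0) := by simpa using t1.add t2
  obtain ⟨n, hn'⟩ := (t3.eventually (gt_mem_nhds ρ0)).exists
  refine hn n fun ν₀ ν₁ f0 f1 hM o0 o1 u0 u1 => hρ ν₀ ν₁ f0 f1 hM (ball_mono o0 ?_) (ball_mono o1 hn'.le) u0 u1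
  have := hp n
  linarith

end P19

section P20
variable {X : Type*} [MetricSpace X] [MeasurableSpace X] [SecondCountableTopology X] [BorelSpace X] [CompleteSpace X] {m : Measure X} [SigmaFinite m] {U U' : ℝ → ℝ} {K : ℝ}

/-- scaling structure of the functional -/
def ScP (U : ℝ → ℝ) (K : ℝ) : Prop := ∀ c : NNReal, ∃ A B : ℝ, 0 ≤ A ∧ K * A = K * c ∧
  ∀ r ≥ 0, U (c * r) = A * U r + B * r

lemma ScP_log (K : ℝ) : ScP (fun r => r * Real.log r) K := by
  intro c
  refine ⟨c, c * Real.log c, c.2, rfl, ?_⟩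
  intro r hr
  rcases eq_or_ne c 0 with rfl | hc
  · simp
  rcases eq_or_lt_of_le hr with rfl | hr
  · simp
  simp only
  rw [Real.log_mul (by exact_mod_cast hc) hr.ne']
  ring

lemma ScP_pow (θ : ℝ) : ScP (fun r => - r ^ θ) 0 := by
  intro c
  refine ⟨(c:ℝ) ^ θ, 0, by positivity, by simp, ?_⟩
  intro r hr
  simp only
  rw [Real.mul_rpow (NNReal.coe_nonneg c) hr]
  ring

lemma hV_log : Tendsto (fun v : ℝ => v * ((1 / v) * Real.log (1 / v))) atTop atBot := by
  have : Tendsto (fun v : ℝ => - Real.log v) atTop atBot := tendsto_neg_atTop_atBot.comp Real.tendsto_log_atTop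
  refine this.congr' ?_
  filter_upwards [eventually_gt_atTop 0] with v hv
  rw [one_div, Real.log_inv]
  field_simp

lemma hV_pow {θ : ℝ} (h0 : 0 < θ) (h1 : θ < 1) : Tendsto (fun v : ℝ => v * (-(1 / v) ^ θ)) atTop atBot := by
  have : Tendsto (fun v : ℝ => - v ^ (1 - θ)) atTop atBot :=
    tendsto_neg_atTop_atBot.comp (tendsto_rpow_atTop (by linarith))
  refine this.congr' ?_
  filter_upwards [eventually_gt_atTop 0] with v hv
  rw [Real.rpow_sub hv, one_div, Real.inv_rpow hv.le, Real.rpow_one]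
  ring

lemma Wsq_smul_le (μ ν : Measure X) {c : ℝ≥0∞} (hc : c ≠ ∞) : Wsq (c • μ) (c • ν) ≤ c * Wsq μ ν := by
  unfold Wsq
  rcases eq_or_ne c 0 with rfl | h0
  · have := Wsq_zero (X := X)
    unfold Wsq at this
    simp [this]
  rw [ENNReal.mul_iInf_of_ne h0 hc]
  refine le_iInf fun q => ?_
  rw [ENNReal.mul_iInf_of_ne h0 hc]
  refine le_iInf fun hq => ?_
  refine (iInf₂_le (c • q) (hq.smul c)).trans ?_
  rw [lintegral_smul_measure]; rfl

lemma Wsq_smul (μ ν : Measure X) {c : ℝ≥0∞} (h0 : c ≠ 0) (hc : c ≠ ∞) : Wsq (c • μ) (c • ν) = c * Wsq μ ν := by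
  refine le_antisymm (Wsq_smul_le μ ν hc) ?_
  have := Wsq_smul_le (c • μ) (c • ν) (c := c⁻¹) (by simpa using h0)
  rw [smul_smul, smul_smul, ENNReal.inv_mul_cancel h0 hc, one_smul, one_smul] at this
  calc c * Wsq μ ν ≤ c * (c⁻¹ * Wsq (c • μ) (c • ν)) := by gcongr
    _ = _ := by rw [← mul_assoc, ENNReal.mul_inv_cancel h0 hc, one_mul]

lemma ui_scale {c : NNReal} {A B : ℝ} (h : ∀ r ≥ 0, U (c * r) = A * U r + B * r) {ν : Measure X}
    [IsFiniteMeasure ν] (hu : UI U m ν) : UI U m (c • ν) ∧ eU U m (c • ν) = A * eU U m ν + B * ν.real univ := by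
  have key : (fun x => A * U (dn m ν x) + B * dn m ν x) =ᵐ[m] fun x => U (dn m (c • ν) x) := by
    filter_upwards [dn_smul (m := m) ν c] with x hx
    rw [hx, h _ (dn_nonneg _ _)]
  refine ⟨⟨hu.1.smul_left _, ((hu.2.const_mul A).add ((dn_int ν).const_mul B)).congr key⟩, ?_⟩
  rw [eU, ← integral_congr_ae key, integral_add (hu.2.const_mul A) ((dn_int ν).const_mul B),
    integral_const_mul, integral_const_mul, dn_integral hu.1]
  rfl

lemma cc_scale (hsc : ScP U K) {c : NNReal} (hc : c ≠ 0) {ν₀ ν₁ : Measure X} [IsFiniteMeasure ν₀]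
    [IsFiniteMeasure ν₁] (hf : Wsq ν₀ ν₁ ≠ ∞) (h : CC U m K ν₀ ν₁) : CC U m K (c • ν₀) (c • ν₁) := by
  obtain ⟨A, B, hA, hK, hs⟩ := hsc c
  obtain ⟨μ, m0, m1, mf, mW, me⟩ := h
  have z0 : (0:ℝ) ∈ Icc (0:ℝ) 1 := by simp
  have z1 : (1:ℝ) ∈ Icc (0:ℝ) 1 := by simp
  have mass : ∀ t ∈ Icc (0:ℝ) 1, μ t univ = ν₀ univ := by
    intro t ht
    by_contra h
    have := mW t ht 0 z0
    rw [m0, Wsq_eq_top_of_mass h, top_le_iff] at this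
    exact ENNReal.mul_ne_top (by finiteness) hf this
  have eq : ∀ μ ν : Measure X, Wsq (c • μ) (c • ν) = (c : ℝ≥0∞) * Wsq μ ν := fun μ ν =>
    Wsq_smul μ ν (c := (c : ℝ≥0∞)) (by exact_mod_cast hc) (by simp)
  refine ⟨fun t => c • μ t, by simp [m0], by simp [m1], fun t ht => ?_, ?_, ?_⟩
  · haveI := mf t ht
    infer_instance
  · intro s hs t ht
    rw [eq, eq, mul_left_comm]
    gcongr
    exact mW s hs t ht
  · intro t ht
    haveI := mf t ht
    obtain ⟨u, e⟩ := me t ht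
    have u0 : UI U m ν₀ := m0 ▸ (me 0 z0).1
    have u1 : UI U m ν₁ := m1 ▸ (me 1 z1).1
    obtain ⟨a1, a2⟩ := ui_scale hs u
    refine ⟨a1, ?_⟩
    rw [a2, (ui_scale hs u0).2, (ui_scale hs u1).2, eq, ENNReal.toReal_mul]
    have e1 : (μ t).real univ = ν₀.real univ := by rw [Measure.real, Measure.real, mass t ht]
    have e2 : ν₁.real univ = ν₀.real univ := by rw [Measure.real, Measure.real, ← m1, mass 1 z1]
    rw [e1, e2]
    have := mul_le_mul_of_nonneg_left e hA
    have k2 : K / 2 * (t * (1 - t)) * (((c : ℝ≥0∞).toReal) * (Wsq ν₀ ν₁).toReal) = A * (K / 2 * (t * (1 - t)) * (Wsq ν₀ ν₁).toReal) := by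
      have : ((c : ℝ≥0∞).toReal) = c := by simp
      rw [this]
      linear_combination (-(1:ℝ)/2 * t * (1-t) * (Wsq ν₀ ν₁).toReal) * hK
    rw [k2]
    nlinarith

lemma base_of_prob (hU : UProp U U') (hsc : ScP U K) (h : ∀ x : X, ∃ ρ > 0, ∀ ν₀ ν₁ : Measure X, IsProbabilityMeasure ν₀ →
  IsProbabilityMeasure ν₁ → ν₀ (Metric.closedBall x ρ)ᶜ = 0 → ν₁ (Metric.closedBall x ρ)ᶜ = 0 →
  UI U m ν₀ → UI U m ν₁ → CC U m K ν₀ ν₁) : BaseP U m K := by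
  intro x
  obtain ⟨ρ, h0, h⟩ := h x
  refine ⟨ρ, h0, ?_⟩
  intro ν₀ ν₁ f0 f1 hm o0 o1 u0 u1
  rcases eq_or_ne (ν₀ univ) 0 with hz | hz
  · have z0 : ν₀ = 0 := Measure.measure_univ_eq_zero.1 hz
    have z1 : ν₁ = 0 := Measure.measure_univ_eq_zero.1 (hm ▸ hz)
    subst z0 z1
    refine ⟨fun _ => 0, rfl, rfl, fun _ _ => inferInstance, ?_, ?_⟩
    · intro s _ t _; simp [Wsq_zero]
    · intro t _; exact ⟨u0, by simp [Wsq_zero, eU_zero hU]⟩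
  set c : NNReal := (ν₀ univ).toNNReal with hc
  have cc : (c : ℝ≥0∞) = ν₀ univ := ENNReal.coe_toNNReal (by finiteness)
  have c0 : c ≠ 0 := by intro h; rw [h] at cc; exact hz (by simpa using cc.symm)
  have ci : ((c⁻¹ : NNReal) : ℝ≥0∞) * c = 1 := by rw [← ENNReal.coe_mul, inv_mul_cancel₀ c0]; rfl
  have p0 : IsProbabilityMeasure (c⁻¹ • ν₀) := ⟨by
    rw [Measure.smul_apply, ENNReal.smul_def, smul_eq_mul, ← cc, ci]⟩
  have p1 : IsProbabilityMeasure (c⁻¹ • ν₁) := ⟨by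
    rw [Measure.smul_apply, ENNReal.smul_def, smul_eq_mul, ← hm, ← cc, ci]⟩
  obtain ⟨A, B, -, -, hs⟩ := hsc c⁻¹
  have := h (c⁻¹ • ν₀) (c⁻¹ • ν₁) p0 p1 (by rw [Measure.smul_apply, o0, smul_zero])
    (by rw [Measure.smul_apply, o1, smul_zero]) (ui_scale hs u0).1 (ui_scale hs u1).1
  have hf : Wsq (c⁻¹ • ν₀) (c⁻¹ • ν₁) ≠ ∞ := by
    refine (wr_ball (x := x) (y := x) (r := ρ) (R := ρ) (by simp [p0.measure_univ, p1.measure_univ]) ?_ ?_).1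
    · rw [Measure.smul_apply, o0, smul_zero]
    · rw [Measure.smul_apply, o1, smul_zero]
  have := cc_scale hsc c0 hf this
  rwa [smul_smul, smul_smul, mul_inv_cancel₀ c0, one_smul, one_smul] at this
end P20

section P21
variable {X : Type*} [MetricSpace X] [MeasurableSpace X] [SecondCountableTopology X] [BorelSpace X] [CompleteSpace X] {m : Measure X} [SigmaFinite m] {U U' : ℝ → ℝ} {K : ℝ}

lemma geo_props {μ : ℝ → Measure X} (h : IsW2Geodesic μ) (hf : Wsq (μ 0) (μ 1) ≠ ∞) [IsFiniteMeasure (μ 0)] :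
    (∀ t ∈ Icc (0:ℝ) 1, IsFiniteMeasure (μ t)) ∧ (∀ s ∈ Icc (0:ℝ) 1, ∀ t ∈ Icc (0:ℝ) 1,
      Wsq (μ s) (μ t) ≤ ENNReal.ofReal |s - t| ^ 2 * Wsq (μ 0) (μ 1)) := by
  have w : ∀ s ∈ Icc (0:ℝ) 1, ∀ t ∈ Icc (0:ℝ) 1,
      Wsq (μ s) (μ t) ≤ ENNReal.ofReal |s - t| ^ 2 * Wsq (μ 0) (μ 1) := fun s hs t ht =>
    W2_le_iff.1 (h s hs t ht).le
  refine ⟨fun t ht => ?_, w⟩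
  have : μ t univ = μ 0 univ := by
    by_contra h
    have := w t ht 0 (by simp)
    rw [Wsq_eq_top_of_mass h, top_le_iff] at this
    exact ENNReal.mul_ne_top (by finiteness) hf this
  exact ⟨by rw [this]; exact measure_lt_top _ _⟩

lemma geo_of_le {μ : ℝ → Measure X} (hf : Wsq (μ 0) (μ 1) ≠ ∞) (hfin : ∀ t ∈ Icc (0:ℝ) 1, IsFiniteMeasure (μ t))
    (w : ∀ s ∈ Icc (0:ℝ) 1, ∀ t ∈ Icc (0:ℝ) 1,
      Wsq (μ s) (μ t) ≤ ENNReal.ofReal |s - t| ^ 2 * Wsq (μ 0) (μ 1)) : IsW2Geodesic μ := by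
  have w2 : ∀ s ∈ Icc (0:ℝ) 1, ∀ t ∈ Icc (0:ℝ) 1, W2 (μ s) (μ t) ≤ ENNReal.ofReal |s - t| * W2 (μ 0) (μ 1) :=
    fun s hs t ht => W2_le_iff.2 (w s hs t ht)
  have hW : W2 (μ 0) (μ 1) ≠ ∞ := by
    intro h
    have := W2_sq (μ 0) (μ 1)
    rw [h] at this
    exact hf (by rw [← this]; simp)
  have z0 : (0:ℝ) ∈ Icc (0:ℝ) 1 := by simp
  have z1 : (1:ℝ) ∈ Icc (0:ℝ) 1 := by simp
  have key : ∀ s ∈ Icc (0:ℝ) 1, ∀ t ∈ Icc (0:ℝ) 1, s ≤ t → W2 (μ s) (μ t) = ENNReal.ofReal |s - t| * W2 (μ 0) (μ 1) := by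
    intro s hs t ht hst
    refine le_antisymm (w2 s hs t ht) ?_
    haveI := hfin 0 z0
    haveI := hfin 1 z1
    haveI := hfin s hs
    haveI := hfin t ht
    have tri := (W2_triangle (μ 0) (μ s) (μ 1)).trans (add_le_add_right (W2_triangle (μ s) (μ t) (μ 1)) _)
    have a := w2 0 z0 s hs
    have b := w2 t ht 1 z1
    have c := w2 s hs t ht
    set W := W2 (μ 0) (μ 1)
    lift W to NNReal using hW with W' 
    have fa : W2 (μ 0) (μ s) ≠ ∞ := ne_top_of_le_ne_top (by finiteness) a
    have fb : W2 (μ t) (μ 1) ≠ ∞ := ne_top_of_le_ne_top (by finiteness) b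
    have fc : W2 (μ s) (μ t) ≠ ∞ := ne_top_of_le_ne_top (by finiteness) c
    lift W2 (μ 0) (μ s) to NNReal using fa with A
    lift W2 (μ t) (μ 1) to NNReal using fb with B
    lift W2 (μ s) (μ t) to NNReal using fc with C
    rw [abs_sub_comm, abs_of_nonneg (by linarith [hs.1])] at a
    rw [abs_sub_comm, abs_of_nonneg (by linarith [ht.2])] at b
    rw [abs_sub_comm, abs_of_nonneg (by linarith)]
    have e : ∀ r : ℝ, 0 ≤ r → ENNReal.ofReal r * (W' : ℝ≥0∞) = ENNReal.ofReal (r * W') := fun r hr => by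
      rw [ENNReal.ofReal_mul hr]; simp
    have e' : ∀ A : NNReal, (A : ℝ≥0∞) = ENNReal.ofReal (A : ℝ) := fun A => by simp
    rw [e _ (by linarith [hs.1]), e', ENNReal.ofReal_le_ofReal_iff (by have := hs.1; simp; positivity)] at a
    rw [e _ (by linarith [ht.2]), e', ENNReal.ofReal_le_ofReal_iff (mul_nonneg (by linarith [ht.2]) (NNReal.coe_nonneg _))] at b
    rw [e _ (by linarith), e', ENNReal.ofReal_le_ofReal_iff (NNReal.coe_nonneg _)]
    have tri' : (W' : ℝ) ≤ A + (C + B) := by exact_mod_cast tri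
    linarith
  intro s hs t ht
  rcases le_total s t with h | h
  · exact key s hs t ht h
  · rw [W2_symm, abs_sub_comm]; exact key t ht s hs h

lemma memP2_wsq {μ ν : Measure X} (h : MemP2 μ) (h' : MemP2 ν) : Wsq μ ν ≠ ∞ := by
  obtain ⟨p, x0, hx⟩ := h
  obtain ⟨p', y0, hy⟩ := h'
  obtain ⟨q, hq⟩ := exists_coupling (μ := μ) (ν := ν) (by simp)
  haveI := hq.finite
  refine ne_top_of_le_ne_top ?_ (Wsq_le hq)
  have b : ∀ p : X × X, edist p.1 p.2 ^ 2 ≤ 3 * (edist p.1 x0 ^ 2 + edist x0 y0 ^ 2 + edist p.2 y0 ^ 2) := by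
    intro p
    have := dist_triangle4 p.1 x0 y0 p.2
    rw [dist_comm y0] at this
    simp only [edist_dist, ← ENNReal.ofReal_pow dist_nonneg]
    rw [← ENNReal.ofReal_add (by positivity) (by positivity), ← ENNReal.ofReal_add (by positivity) (by positivity),
      show (3:ℝ≥0∞) = ENNReal.ofReal 3 by simp, ← ENNReal.ofReal_mul (by norm_num)]
    refine ENNReal.ofReal_le_ofReal ?_
    have : dist p.1 p.2 ^ 2 ≤ (dist p.1 x0 + dist x0 y0 + dist p.2 y0) ^ 2 := by gcongr
    nlinarith [sq_nonneg (dist p.1 x0 - dist x0 y0), sq_nonneg (dist p.1 x0 - dist p.2 y0), sq_nonneg (dist x0 y0 - dist p.2 y0)]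
  refine ne_top_of_le_ne_top ?_ (lintegral_mono b)
  rw [lintegral_const_mul _ (by fun_prop), lintegral_add_right _ (by fun_prop), lintegral_add_right _ (by fun_prop)]
  have i1 : ∫⁻ p, edist p.1 x0 ^ 2 ∂q = ∫⁻ x, edist x x0 ^ 2 ∂μ := by
    rw [← hq.1, lintegral_map (by fun_prop) (by fun_prop)]
  have i2 : ∫⁻ p, edist p.2 y0 ^ 2 ∂q = ∫⁻ x, edist x y0 ^ 2 ∂ν := by
    rw [← hq.2, lintegral_map (by fun_prop) (by fun_prop)]
  rw [i1, i2, lintegral_const]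
  have : edist x0 y0 ≠ ∞ := edist_ne_top _ _
  finiteness

lemma memP2_ball {μ : Measure X} (h : IsProbabilityMeasure μ) {x : X} {r : ℝ} (hr : μ (Metric.closedBall x r)ᶜ = 0) :
    MemP2 μ := by
  refine ⟨h, x, ?_⟩
  have : ∀ᵐ y ∂μ, edist y x ^ 2 ≤ ENNReal.ofReal r ^ 2 := by
    have : ∀ᵐ y ∂μ, y ∈ Metric.closedBall x r := hr
    filter_upwards [this] with y hy
    rw [edist_dist]
    gcongr
    exact hy
  refine (lintegral_mono_ae this).trans_lt ?_
  rw [lintegral_const, measure_univ]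
  finiteness

lemma tp_off {ν₀ ν₁ ζ : Measure X} [IsFiniteMeasure ν₀] [IsFiniteMeasure ν₁] [IsFiniteMeasure ζ] {t : ℝ}
    (w1 : Wsq ν₀ ζ ≤ ENNReal.ofReal t ^ 2 * Wsq ν₀ ν₁) (w2 : Wsq ζ ν₁ ≤ ENNReal.ofReal (1 - t) ^ 2 * Wsq ν₀ ν₁)
    (hf : Wsq ν₀ ν₁ ≠ ∞) (h0 : 0 < t) (h1 : t < 1) {x : X} {r R s : ℝ} (hA : ν₀ (Metric.closedBall x r)ᶜ = 0)
    (hB : ν₁ (Metric.closedBall x R)ᶜ = 0) (hs : r + t * (r + R) ≤ s) : ζ (Metric.closedBall x s)ᶜ = 0 := by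
  obtain ⟨T, hT⟩ := exists_tplan h0 h1 hf w1 w2
  refine hT.conc Metric.isClosed_closedBall.measurableSet Metric.isClosed_closedBall.measurableSet
    Metric.isClosed_closedBall.measurableSet hA hB ?_
  intro a ha b hb y hy _
  rw [Metric.mem_closedBall] at ha hb ⊢
  have e1 := dist_triangle y a x
  have e2 := dist_triangle_right a b x
  rw [dist_comm y a] at e1
  nlinarith

/-- from a geodesic to a `CC` curve in a ball with finite volume -/
lemma cc_of_geo {μ : ℝ → Measure X} (h : IsW2Geodesic μ) [IsFiniteMeasure (μ 0)] [IsFiniteMeasure (μ 1)] (hU : UProp U U')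
    {x : X} {r : ℝ} (hr : 0 ≤ r) (hm : μ 0 univ = μ 1 univ) (hv : m (Metric.closedBall x (3 * r)) ≠ ∞) (h0 : μ 0 (Metric.closedBall x r)ᶜ = 0)
    (h1 : μ 1 (Metric.closedBall x r)ᶜ = 0) (u0 : UI U m (μ 0)) (u1 : UI U m (μ 1))
    (hcl : ∀ t ∈ Ioo (0:ℝ) 1, IsFiniteMeasure (μ t) → LB U m (μ t) → UI U m (μ t) ∧ eU U m (μ t) ≤ (1 - t) * eU U m (μ 0) + t * eU U m (μ 1)
      - K / 2 * (t * (1 - t)) * (Wsq (μ 0) (μ 1)).toReal) : CC U m K (μ 0) (μ 1) := by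
  have hf := (wr_ball hm h0 h1).1
  obtain ⟨fin, w⟩ := geo_props h hf
  refine ⟨μ, rfl, rfl, fin, w, ?_⟩
  intro t ht
  rcases eq_or_lt_of_le ht.1 with rfl | h0'
  · exact ⟨u0, by simp⟩
  rcases eq_or_lt_of_le ht.2 with rfl | h1'
  · exact ⟨u1, by simp⟩
  haveI := fin t ht
  have w1 := w 0 (by simp) t ht
  have w2 := w t ht 1 (by simp)
  rw [abs_sub_comm, sub_zero, abs_of_pos h0'] at w1
  rw [abs_sub_comm, abs_of_pos (by linarith)] at w2
  refine hcl t ⟨h0', h1'⟩ inferInstance (LB.of_finite hU Metric.isClosed_closedBall.measurableSet hv ?_)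
  exact tp_off w1 w2 hf h0' h1' h0 h1 (by nlinarith)

/-! entropy -/
lemma Ent_eq {ν : Measure X} (h : UI (fun r => r * Real.log r) m ν) :
    Ent ν m = ((eU (fun r => r * Real.log r) m ν : ℝ) : EReal) := by
  have hi : Integrable (entFun ν m) m := h.2
  rw [Ent, if_pos ⟨h.1, hi.pos_part⟩]
  have : ∫⁻ x, ENNReal.ofReal (-(entFun ν m x)) ∂m = ENNReal.ofReal (∫ x, max (-entFun ν m x) 0 ∂m) := by
    rw [ofReal_integral_eq_lintegral_ofReal hi.neg_part (ae_of_all _ fun x => le_max_right _ _)]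
    refine lintegral_congr fun x => ?_
    rcases le_total (-(entFun ν m x)) 0 with h | h
    · rw [max_eq_right h, ENNReal.ofReal_of_nonpos h]; simp
    · rw [max_eq_left h]
  rw [this]
  have n : 0 ≤ ∫ x, max (-entFun ν m x) 0 ∂m := integral_nonneg fun x => le_max_right _ _
  rw [EReal.coe_ennreal_ofReal, max_eq_left n, ← EReal.coe_sub, ← integral_sub hi.pos_part hi.neg_part]
  congr 1
  refine integral_congr_ae (ae_of_all _ fun x => ?_)
  show max (entFun ν m x) 0 - max (-entFun ν m x) 0 = entFun ν m x
  rcases le_total (entFun ν m x) 0 with h | h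
  · rw [max_eq_right h, max_eq_left (by linarith)]; ring
  · rw [max_eq_left h, max_eq_right (by linarith)]; ring

lemma UI_of_Ent {ν : Measure X} (h : Ent ν m ≠ ⊤) (hb : LB (fun r => r * Real.log r) m ν) :
    UI (fun r => r * Real.log r) m ν := by
  by_cases hc : ν ≪ m ∧ Integrable (fun x => max (entFun ν m x) 0) m
  · obtain ⟨g, gi, gb⟩ := hb
    refine ⟨hc.1, ?_⟩
    refine integrable_of_le_of_le (UProp_log.meas ν).aestronglyMeasurable ?_ ?_ gi.neg hc.2
    · filter_upwards [gb] with x hx using hx _ (dn_nonneg _ _) le_rfl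
    · exact ae_of_all _ fun x => le_max_left _ _
  · exact absurd (if_neg hc) h

lemma base_log [IsLocallyFiniteMeasure m] (h : CDinftyLoc K m) : BaseP (fun r => r * Real.log r) m K := by
  refine base_of_prob UProp_log (ScP_log K) ?_
  intro x
  obtain ⟨V, hV, hc⟩ := h x
  obtain ⟨r, r0, hr⟩ := Metric.nhds_basis_closedBall.mem_iff.1 hV
  obtain ⟨s, s0, sr, hs⟩ := exists_ball_fin (m := m) x r0
  refine ⟨s / 3, by positivity, ?_⟩
  intro ν₀ ν₁ p0 p1 o0 o1 u0 u1
  have sub : Metric.closedBall x (s/3) ⊆ V := (Metric.closedBall_subset_closedBall (by linarith)).trans hr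
  obtain ⟨μ, m0, m1, hg, he⟩ := hc ν₀ ν₁ (memP2_ball p0 o0) (memP2_ball p1 o1)
    (measure_mono_null (compl_subset_compl.2 sub) o0) (measure_mono_null (compl_subset_compl.2 sub) o1)
  subst m0 m1
  have hf := (wr_ball (by simp) o0 o1).1
  refine cc_of_geo hg UProp_log (x := x) (r := s / 3) (by positivity) (by simp)
    (by rwa [show 3 * (s / 3) = s by ring]) o0 o1 u0 u1 ?_
  intro t ht _ hb
  have := he t ⟨ht.1.le, ht.2.le⟩
  rw [Ent_eq u0, Ent_eq u1, ← ENNReal.ofReal_toReal hf, EReal.coe_ennreal_ofReal, max_eq_left ENNReal.toReal_nonneg,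
    ← EReal.coe_mul, ← EReal.coe_mul, ← EReal.coe_mul, ← EReal.coe_add, ← EReal.coe_sub] at this
  have u := UI_of_Ent (ne_top_of_le_ne_top (EReal.coe_ne_top _) this) hb
  rw [Ent_eq u] at this
  exact ⟨u, by exact_mod_cast this⟩
end P21

section P22
variable {X : Type*} [MetricSpace X] [MeasurableSpace X] [SecondCountableTopology X] [BorelSpace X] [CompleteSpace X] {m : Measure X} [SigmaFinite m] {U U' : ℝ → ℝ} {K : ℝ}

/-- Renyi functional -/
def JJ (θ : ℝ) (m ν : Measure X) : ℝ≥0∞ := ∫⁻ x, (ν.rnDeriv m x) ^ θ ∂m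

lemma JJ_q {N : ℝ} (hN : 1 < N) {μ : Measure X} [IsFiniteMeasure μ] (h : μ ≪ m) :
    ∫⁻ x, (μ.rnDeriv m x) ^ (-(1/N) : ℝ) ∂μ = JJ (1 - 1/N) m μ := by
  have e : μ = m.withDensity (μ.rnDeriv m) := (Measure.withDensity_rnDeriv_eq μ m h).symm
  have mm := Measure.measurable_rnDeriv μ m
  calc ∫⁻ x, (μ.rnDeriv m x) ^ (-(1/N) : ℝ) ∂μ
      = ∫⁻ x, (μ.rnDeriv m x) ^ (-(1/N) : ℝ) ∂(m.withDensity (μ.rnDeriv m)) := by rw [← e]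
    _ = ∫⁻ x, ((μ.rnDeriv m) * fun x => (μ.rnDeriv m x) ^ (-(1/N) : ℝ)) x ∂m :=
        lintegral_withDensity_eq_lintegral_mul _ mm (mm.pow_const _)
    _ = _ := by
      refine lintegral_congr_ae ?_
      filter_upwards [Measure.rnDeriv_lt_top μ m] with x hx
      simp only [Pi.mul_apply]
      have h0 : 0 < 1 / N := by positivity
      have h1 : 0 < 1 - 1 / N := by rw [sub_pos, div_lt_one (by linarith)]; exact hN
      rcases eq_or_ne (μ.rnDeriv m x) 0 with hz | hz
      · rw [hz, ENNReal.zero_rpow_of_pos h1, zero_mul]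
      · rw [sub_eq_add_neg, ENNReal.rpow_add _ _ hz hx.ne, ENNReal.rpow_one]

lemma JJ_rhs {N : ℝ} (hN : 1 < N) {μ ν : Measure X} [IsFiniteMeasure μ] [IsFiniteMeasure ν] (h : μ ≪ m) (h' : ν ≪ m)
    {q : Measure (X × X)} (hq : IsCoupling q μ ν) (t : ℝ) :
    ∫⁻ p, tauCoef 0 N (1-t) (dist p.1 p.2) * (μ.rnDeriv m p.1) ^ (-(1/N) : ℝ)
            + tauCoef 0 N t (dist p.1 p.2) * (ν.rnDeriv m p.2) ^ (-(1/N) : ℝ) ∂q =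
      ENNReal.ofReal (1 - t) * JJ (1 - 1/N) m μ + ENNReal.ofReal t * JJ (1 - 1/N) m ν := by
  have c : ∀ t θ, tauCoef 0 N t θ = ENNReal.ofReal t := fun t θ => by simp [tauCoef]
  simp only [c]
  have m1 : Measurable fun x => (μ.rnDeriv m x) ^ (-(1/N) : ℝ) := (Measure.measurable_rnDeriv μ m).pow_const _
  have m2 : Measurable fun x => (ν.rnDeriv m x) ^ (-(1/N) : ℝ) := (Measure.measurable_rnDeriv ν m).pow_const _
  have m1' : Measurable fun p : X × X => (μ.rnDeriv m p.1) ^ (-(1/N) : ℝ) := m1.comp measurable_fst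
  have m2' : Measurable fun p : X × X => (ν.rnDeriv m p.2) ^ (-(1/N) : ℝ) := m2.comp measurable_snd
  rw [lintegral_add_left (m1'.const_mul _), lintegral_const_mul _ m1', lintegral_const_mul _ m2',
    ← JJ_q hN h, ← JJ_q hN h']
  congr 2
  · conv_rhs => rw [← hq.1]
    rw [hq.1, ← lintegral_map (μ := q) (g := Prod.fst) m1 measurable_fst, hq.1]
  · rw [← lintegral_map (μ := q) (g := Prod.snd) m2 measurable_snd, hq.2]

lemma JJ_UI {θ : ℝ} (h0 : 0 < θ) {ν : Measure X} [IsFiniteMeasure ν] (h : ν ≪ m) (hJ : JJ θ m ν ≠ ∞) : UI (fun r => -r ^ θ) m ν := by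
  refine ⟨h, ?_⟩
  have := integrable_toReal_of_lintegral_ne_top (((Measure.measurable_rnDeriv ν m).pow_const θ).aemeasurable) hJ
  refine this.neg.congr (ae_of_all _ fun x => ?_)
  simp [dn, ENNReal.toReal_rpow]

lemma UI_JJ {θ : ℝ} (h0 : 0 < θ) {ν : Measure X} [IsFiniteMeasure ν] (h : UI (fun r => -r ^ θ) m ν) :
    JJ θ m ν ≠ ∞ ∧ eU (fun r => -r ^ θ) m ν = - (JJ θ m ν).toReal := by
  have e : ∀ᵐ x ∂m, (ν.rnDeriv m x) ^ θ < ∞ := by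
    filter_upwards [Measure.rnDeriv_lt_top ν m] with x hx
    exact ENNReal.rpow_lt_top_of_nonneg h0.le hx.ne
  have mm := (Measure.measurable_rnDeriv ν m).pow_const θ
  have hi : Integrable (fun x => ((ν.rnDeriv m x) ^ θ).toReal) m := by
    refine h.2.neg.congr (ae_of_all _ fun x => ?_)
    simp [dn, ENNReal.toReal_rpow]
  constructor
  · have := hi.2
    rw [hasFiniteIntegral_iff_ofReal (ae_of_all _ fun x => ENNReal.toReal_nonneg)] at this
    refine ne_of_lt (lt_of_eq_of_lt ?_ this)
    refine lintegral_congr_ae ?_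
    filter_upwards [e] with x hx
    rw [ENNReal.ofReal_toReal hx.ne]
  · rw [JJ, ← integral_toReal mm.aemeasurable e, eU, ← integral_neg]
    refine integral_congr_ae (ae_of_all _ fun x => ?_)
    simp [dn, ENNReal.toReal_rpow]

lemma UI_of_LB {θ : ℝ} (h0 : 0 < θ) (h1 : θ < 1) {ν : Measure X} (h : ν ≪ m) (hb : LB (fun r => -r ^ θ) m ν) : UI (fun r => -r ^ θ) m ν := by
  obtain ⟨g, gi, gb⟩ := hb
  refine ⟨h, integrable_of_le_of_le ((UProp_pow h0 h1).meas ν).aestronglyMeasurable ?_ ?_ gi.neg (integrable_zero _ _ _)⟩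
  · filter_upwards [gb] with x hx using hx _ (dn_nonneg _ _) le_rfl
  · exact ae_of_all _ fun x => by
      have := Real.rpow_nonneg (dn_nonneg (m := m) ν x) θ
      simpa using this

lemma base_pow [IsLocallyFiniteMeasure m] {N : ℝ} (hN : 1 < N) (h : CDloc 0 N m) : BaseP (fun r => - r ^ (1 - 1/N)) m 0 := by
  have h0 : 0 < 1 - 1 / N := by rw [sub_pos, div_lt_one (by linarith)]; exact hN
  have h1 : 1 - 1 / N < 1 := by have : 0 < 1 / N := by positivity
                                linarith
  refine base_of_prob (UProp_pow h0 h1) (ScP_pow _) ?_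
  intro x
  obtain ⟨V, hV, hc⟩ := h x
  obtain ⟨r, r0, hr⟩ := Metric.nhds_basis_closedBall.mem_iff.1 hV
  obtain ⟨s, s0, sr, hs⟩ := exists_ball_fin (m := m) x r0
  refine ⟨s / 3, by positivity, ?_⟩
  intro ν₀ ν₁ p0 p1 o0 o1 u0 u1
  have sub : Metric.closedBall x (s/3) ⊆ V := (Metric.closedBall_subset_closedBall (by linarith)).trans hr
  obtain ⟨μ, q, m0, m1, hg, hac, hq, -, he⟩ := hc ν₀ ν₁ (memP2_ball p0 o0) (memP2_ball p1 o1) u0.1 u1.1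
    (measure_mono_null (compl_subset_compl.2 sub) o0) (measure_mono_null (compl_subset_compl.2 sub) o1)
  subst m0 m1
  refine cc_of_geo hg (UProp_pow h0 h1) (x := x) (r := s / 3) (by positivity) (by simp)
    (by rwa [show 3 * (s / 3) = s by ring]) o0 o1 u0 u1 ?_
  intro t ht _ hb
  have ht' : t ∈ Icc (0:ℝ) 1 := ⟨ht.1.le, ht.2.le⟩
  have := he t ht'
  rw [JJ_rhs hN u0.1 u1.1 hq] at this
  have u := UI_of_LB h0 h1 (hac t ht') hb
  refine ⟨u, ?_⟩
  rw [(UI_JJ h0 u).2, (UI_JJ h0 u0).2, (UI_JJ h0 u1).2]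
  have j0 := (UI_JJ h0 u0).1
  have j1 := (UI_JJ h0 u1).1
  have := ENNReal.toReal_mono (UI_JJ h0 u).1 this
  rw [ENNReal.toReal_add (by finiteness) (by finiteness), ENNReal.toReal_mul, ENNReal.toReal_mul,
    ENNReal.toReal_ofReal ht.1.le, ENNReal.toReal_ofReal (by linarith [ht.2])] at this
  simp only [zero_div, zero_mul]
  linarith
end P22

section P23
variable {X : Type*} [MetricSpace X] [MeasurableSpace X] [SecondCountableTopology X] [BorelSpace X] [CompleteSpace X] {m : Measure X} [SigmaFinite m] {U U' : ℝ → ℝ} {K : ℝ}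

lemma jensen_U (hU : UProp U U') {ζ : Measure X} [IsFiniteMeasure ζ] (h1 : ζ univ = 1) {G : Set X} (mG : MeasurableSet G)
    (hm : m G ≠ ∞) (ho : ζ Gᶜ = 0) (u : UI U m ζ) : 0 < m.real G ∧ m.real G * U (1 / m.real G) ≤ eU U m ζ := by
  have pos : 0 < m.real G := by
    rw [Measure.real, ENNReal.toReal_pos_iff]
    refine ⟨?_, hm.lt_top⟩
    rw [pos_iff_ne_zero]
    intro hz
    have := u.1 hz
    have h2 := measure_union_le (μ := ζ) G Gᶜ
    rw [union_compl_self, h1, this, ho] at h2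
    simp at h2
  refine ⟨pos, ?_⟩
  set s := 1 / m.real G with hs
  have sp : 0 < s := by positivity
  have i1 : Integrable (fun x => G.indicator (fun _ => U s - U' s * s) x + U' s * dn m ζ x) m :=
    ((integrable_indicator_iff mG).2 (integrableOn_const hm)).add ((dn_int ζ).const_mul _)
  have : ∫ x, (G.indicator (fun _ => U s - U' s * s) x + U' s * dn m ζ x) ∂m ≤ eU U m ζ := by
    refine integral_mono_ae i1 u.2 ?_
    filter_upwards [dn_off (m := m) mG ho] with x hx
    by_cases hxG : x ∈ G
    · simp only [indicator_of_mem hxG]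
      have := hU.tang s sp _ (dn_nonneg (m := m) ζ x)
      linarith
    · simp [hxG, hx hxG, hU.zero]
  rw [integral_add ((integrable_indicator_iff mG).2 (integrableOn_const hm))
    ((dn_int ζ).const_mul _), integral_const_mul, dn_integral u.1, integral_indicator mG] at this
  have M1 : ζ.real univ = 1 := by simp [Measure.real, h1]
  rw [M1] at this
  simp only [integral_const, MeasurableSet.univ, measureReal_restrict_apply, univ_inter, smul_eq_mul] at this
  have e : m.real G * s = 1 := by rw [hs]; field_simp
  have e3 : m.real G * (U s - U' s * s) = m.real G * U s - U' s := by
    rw [mul_sub, mul_comm (U' s) s, ← mul_assoc, e, one_mul]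
  linarith

lemma loc_compact [IsLocallyFiniteMeasure m] {θ : ℝ} (h0 : 0 < θ) (h1 : θ < 1) (hs : mmSupp m = univ)
    (hB : BaseP (fun r => - r ^ θ) m 0) (x : X) : ∃ r > 0, IsCompact (Metric.closedBall x r) := by
  have hU := UProp_pow h0 h1
  have mc : ∀ (x : X) r, MeasurableSet (Metric.closedBall x r) := fun x r => Metric.isClosed_closedBall.measurableSet
  obtain ⟨ρ, ρ0, hB⟩ := hB x
  obtain ⟨r, r0, rr, hr⟩ := exists_ball_fin (m := m) x ρ0
  refine ⟨r / 4, by positivity, ?_⟩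
  refine TotallyBounded.isCompact_of_isClosed ?_ Metric.isClosed_closedBall
  have hr4 : m (Metric.closedBall x (r/4)) ≠ ∞ := ne_top_of_le_ne_top hr (measure_mono (Metric.closedBall_subset_closedBall (by linarith)))
  have lower : ∀ ε > 0, ε ≤ r / 4 → ∃ c > 0, ∀ y ∈ Metric.closedBall x (r/4), c ≤ m.real (Metric.closedBall y ε) := by
    intro ε e0 er
    have t0 : 0 < ε / (2 * r) := by positivity
    have t1 : ε / (2 * r) < 1 := by rw [div_lt_one (by positivity)]; linarith
    have tr : ε / (2 * r) * r = ε / 2 := by field_simp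
    set t := ε / (2 * r)
    set v := m.real (Metric.closedBall x (r/4)) with hv
    have vp : 0 < v := ENNReal.toReal_pos (ball_ne_zero hs x (by positivity)) hr4
    refine ⟨(t * v ^ (1 - θ)) ^ (1 / (1 - θ)), by positivity, ?_⟩
    intro y hy
    have sub : Metric.closedBall y ε ⊆ Metric.closedBall x r := Metric.closedBall_subset_closedBall' (by
      rw [Metric.mem_closedBall] at hy; linarith)
    have fe : m (Metric.closedBall y ε) ≠ ∞ := ne_top_of_le_ne_top hr (measure_mono sub)
    obtain ⟨ν₀, f0, m0, u0, o0, e0'⟩ := unif_exists (m := m) hU (mc y (ε / 4)) (ball_ne_zero hs y (by positivity))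
      (ne_top_of_le_ne_top fe (measure_mono (Metric.closedBall_subset_closedBall (by linarith)))) 1 ENNReal.one_ne_top
    obtain ⟨ν₁, f1, m1, u1, o1, e1⟩ := unif_exists (m := m) hU (mc x (r/4)) (ball_ne_zero hs x (by positivity)) hr4 1 ENNReal.one_ne_top
    rw [Metric.mem_closedBall] at hy
    have o0' : ν₀ (Metric.closedBall x ρ)ᶜ = 0 := ball_mono o0 (by linarith [dist_comm x y])
    have o1' : ν₁ (Metric.closedBall x ρ)ᶜ = 0 := ball_mono o1 (by rw [dist_self]; linarith)
    have o1'' : ν₁ (Metric.closedBall y (r/2))ᶜ = 0 := ball_mono o1 (by linarith [dist_comm x y])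
    have hM : ν₀ univ = ν₁ univ := by rw [m0, m1]
    obtain ⟨hf, hw⟩ := wr_ball hM o0 o1''
    obtain ⟨ζ, hζ⟩ := (hB ν₀ ν₁ f0 f1 hM o0' o1' u0 u1).at t0 t1
    have hoff := hζ.off hf t0 t1 (s := ε) o0 o1'' (by nlinarith)
    haveI := hζ.1
    obtain ⟨vp', hj⟩ := jensen_U hU (by rw [← hζ.mass hf, m0]) (mc y ε) fe hoff hζ.2.1
    have hfin := hζ.2.2.2.2
    set w := m.real (Metric.closedBall y ε)
    have ex : ∀ v : ℝ, 0 < v → v * (-(1 / v) ^ θ) = - v ^ (1 - θ) := by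
      intro v hv
      rw [Real.rpow_sub hv, one_div, Real.inv_rpow hv.le, Real.rpow_one]
      ring
    have e00 : eU (fun r => - r ^ θ) m ν₀ ≤ 0 := by
      rw [e0']
      have : 0 ≤ m.real (Metric.closedBall y (ε / 4)) * (ENNReal.toReal 1 / m.real (Metric.closedBall y (ε / 4))) ^ θ := by positivity
      linarith
    rw [e1, ENNReal.toReal_one] at hfin
    rw [ex _ vp'] at hj
    rw [ex _ vp] at hfin
    have key : t * v ^ (1 - θ) ≤ w ^ (1 - θ) := by nlinarith
    calc (t * v ^ (1 - θ)) ^ (1 / (1 - θ)) ≤ (w ^ (1 - θ)) ^ (1 / (1 - θ)) := by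
          refine Real.rpow_le_rpow (by positivity) key (by have : 0 < 1 - θ := by linarith
                                                           positivity)
      _ = w := by
        rw [← Real.rpow_mul vp'.le, mul_one_div_cancel (by linarith), Real.rpow_one]
  rw [Metric.totallyBounded_iff]
  intro ε e0
  by_contra hcon
  push Not at hcon
  obtain ⟨f, hf, hsep⟩ := exists_seq_of_forall_finset_exists (fun y => y ∈ Metric.closedBall x (r/4)) (fun a b => ε ≤ dist b a) (by
    intro s hs
    have := hcon s s.finite_toSet
    rw [not_subset] at this
    obtain ⟨y, hy, hy2⟩ := this
    refine ⟨y, hy, fun z hz => ?_⟩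
    simp only [mem_iUnion, not_exists] at hy2
    have := hy2 z hz
    rw [Metric.mem_ball] at this
    push Not at this
    exact this)
  set δ := min (ε / 3) (r / 4) with hδ
  have d0 : 0 < δ := lt_min (by positivity) (by positivity)
  obtain ⟨c, c0, hc⟩ := lower δ d0 (min_le_right _ _)
  have hd : Pairwise (fun i j => Disjoint (Metric.closedBall (f i) δ) (Metric.closedBall (f j) δ)) := by
    intro i j hij
    refine Metric.closedBall_disjoint_closedBall ?_
    have : δ ≤ ε / 3 := min_le_left _ _
    rcases lt_or_gt_of_ne hij with h | h
    · have := hsep i j h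
      rw [dist_comm (f i) (f j)]
      linarith
    · have := hsep j i h
      linarith
  have tot := tsum_meas_le_meas_iUnion_of_disjoint m (fun i => mc (f i) δ) hd
  have sub : (⋃ i, Metric.closedBall (f i) δ) ⊆ Metric.closedBall x r := by
    refine iUnion_subset fun i => Metric.closedBall_subset_closedBall' ?_
    have := hf i
    rw [Metric.mem_closedBall] at this
    have : δ ≤ r / 4 := min_le_right _ _
    linarith
  have low : ∑' _ : ℕ, ENNReal.ofReal c ≤ ∑' i, m (Metric.closedBall (f i) δ) := by
    refine ENNReal.tsum_le_tsum fun i => ?_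
    exact ENNReal.ofReal_le_of_le_toReal (hc (f i) (hf i))
  rw [ENNReal.tsum_const_eq_top_of_ne_zero (by simpa using c0)] at low
  exact hr (top_le_iff.1 (low.trans (tot.trans (measure_mono sub))))

lemma geo_between (hgeo : GeodesicSpace X) {x y : X} {R δ : ℝ} (hR : 0 ≤ R) (hδ : 0 ≤ δ) (h : dist x y ≤ R + δ) :
    ∃ z, dist x z ≤ R ∧ dist z y ≤ δ := by
  by_cases hd : dist x y ≤ R
  · exact ⟨y, hd, by simpa using hδ⟩
  push Not at hd
  obtain ⟨γ, g0, g1, hg⟩ := hgeo x y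
  have dp : 0 < dist x y := by linarith
  have s1 : R / dist x y ∈ Icc (0:ℝ) 1 := ⟨by positivity, by rw [div_le_one dp]; exact hd.le⟩
  have e : R / dist x y * dist x y = R := by field_simp
  refine ⟨γ (R / dist x y), ?_, ?_⟩
  · have := hg 0 (by simp) _ s1
    rw [g0, g1, zero_sub, abs_neg, abs_of_nonneg s1.1, e] at this
    exact this.le
  · have := hg _ s1 1 (by simp)
    rw [g0, g1, abs_sub_comm, abs_of_nonneg (by linarith [s1.2]), sub_mul, e] at this
    linarith

lemma hopf_rinow (hgeo : GeodesicSpace X) (h : ∀ x : X, ∃ r > 0, IsCompact (Metric.closedBall x r)) : ProperSpace X := by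
  haveI : LocallyCompactSpace X := by
    haveI : WeaklyLocallyCompactSpace X := ⟨fun x => by
      obtain ⟨r, r0, hr⟩ := h x
      exact ⟨_, hr, Metric.closedBall_mem_nhds x r0⟩⟩
    infer_instance
  refine ⟨fun x R0 => ?_⟩
  by_contra hR0
  set S : Set ℝ := {r | 0 ≤ r ∧ IsCompact (Metric.closedBall x r)} with hS
  have mono : ∀ r s, r ≤ s → IsCompact (Metric.closedBall x s) → IsCompact (Metric.closedBall x r) := fun r s hrs hc =>
    hc.of_isClosed_subset Metric.isClosed_closedBall (Metric.closedBall_subset_closedBall hrs)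
  have bdd : BddAbove S := ⟨R0, fun r hr => by
    by_contra hlt
    exact hR0 (mono _ _ (by linarith) hr.2)⟩
  have ne : (0:ℝ) ∈ S := ⟨le_rfl, by simp⟩
  set R := sSup S with hR
  have Rn : 0 ≤ R := le_csSup bdd ne
  have cR : IsCompact (Metric.closedBall x R) := by
    refine TotallyBounded.isCompact_of_isClosed ?_ Metric.isClosed_closedBall
    rcases eq_or_lt_of_le Rn with h0 | hpos
    · rw [← h0]; simpa using isCompact_singleton.totallyBounded
    rw [Metric.totallyBounded_iff]
    intro ε e0
    set δ := min (ε / 2) (R / 2) with hδ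
    have d0 : 0 < δ := lt_min (by positivity) (by positivity)
    have d1 : δ ≤ ε / 2 := min_le_left _ _
    have d2 : δ ≤ R / 2 := min_le_right _ _
    obtain ⟨s, hs, hs2⟩ := exists_lt_of_lt_csSup ⟨0, ne⟩ (show R - δ < sSup S by linarith)
    have c1 := mono (R - δ) s hs2.le hs.2
    obtain ⟨F, hF, hc⟩ := Metric.totallyBounded_iff.1 c1.totallyBounded (ε / 2) (by positivity)
    refine ⟨F, hF, ?_⟩
    intro y hy
    rw [Metric.mem_closedBall] at hy
    obtain ⟨z, z1, z2⟩ := geo_between hgeo (x := x) (y := y) (R := R - δ) (δ := δ) (by linarith) d0.le (by rw [dist_comm x y]; linarith)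
    have := hc (show z ∈ Metric.closedBall x (R - δ) by rw [Metric.mem_closedBall, dist_comm z x]; exact z1)
    simp only [mem_iUnion, Metric.mem_ball, exists_prop] at this ⊢
    obtain ⟨i, hi, hzi⟩ := this
    refine ⟨i, hi, ?_⟩
    have := dist_triangle y z i
    rw [dist_comm y z] at this
    linarith
  obtain ⟨δ, d0, hc⟩ := cR.exists_isCompact_cthickening
  have : IsCompact (Metric.closedBall x (R + δ)) := by
    refine hc.of_isClosed_subset Metric.isClosed_closedBall ?_
    intro y hy
    rw [Metric.mem_closedBall] at hy
    obtain ⟨z, z1, z2⟩ := geo_between hgeo (x := x) (y := y) (R := R) (δ := δ) Rn d0.le (by rw [dist_comm x y]; linarith)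
    exact Metric.mem_cthickening_of_dist_le y z δ _ (by rw [Metric.mem_closedBall, dist_comm z x]; exact z1) (by rw [dist_comm y z]; exact z2)
  have := le_csSup bdd (show R + δ ∈ S from ⟨by linarith, this⟩)
  linarith
end P23

section P24
variable {X : Type*} [MetricSpace X] [MeasurableSpace X] [SecondCountableTopology X] [BorelSpace X] [CompleteSpace X] {m : Measure X} [SigmaFinite m] {U U' : ℝ → ℝ} {K : ℝ}

lemma glob_part (hTP : ∀ (x : X) (L : ℝ), 0 < L → TP U m K x L) {ν₀ ν₁ : Measure X} [IsFiniteMeasure ν₀] [IsFiniteMeasure ν₁]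
    {q : Measure (X × X)} (hq : IsCoupling q ν₀ ν₁) : ∃ P : RPart (ℕ × Finset ℕ × Finset ℕ) q,
    ∀ i, ((∃ x R, P.a i (Metric.closedBall x R)ᶜ = 0) ∨ P.a i = 0) ∧ ((∃ x R, P.b i (Metric.closedBall x R)ᶜ = 0) ∨ P.b i = 0) ∧
      ((U 0 = 0) → UI U m (P.a i) → UI U m (P.b i) → CC U m K (P.a i) (P.b i)) := by
  haveI := hq.finite
  obtain ⟨P, hP⟩ := exists_rpart' q (fun V W => (V = ∅ ∧ W = ∅) ∨ ∃ x0 y0,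
    V ⊆ Metric.closedBall x0 1 ∧ W ⊆ Metric.closedBall y0 1) (Or.inl ⟨rfl, rfl⟩)
    univ (by simp) (by
      rintro ⟨a, b⟩ -
      exact ⟨Metric.ball a 1, Metric.ball b 1, Metric.mem_ball_self (by positivity),
        Metric.mem_ball_self (by positivity), Metric.isOpen_ball, Metric.isOpen_ball,
        Or.inr ⟨a, b, Metric.ball_subset_closedBall, Metric.ball_subset_closedBall⟩⟩)
  haveI := P.fin_a
  haveI := P.fin_b
  refine ⟨P, fun i => ?_⟩
  obtain ⟨V, W, hV, hW, hi⟩ := hP i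
  have oa : P.a i Vᶜ = 0 := measure_mono_null (compl_subset_compl.2 hV) (P.a_off i)
  have ob : P.b i Wᶜ = 0 := measure_mono_null (compl_subset_compl.2 hW) (P.b_off i)
  rcases hi with ⟨rfl, rfl⟩ | ⟨x0, y0, h1, h2⟩
  · have za : P.a i = 0 := Measure.measure_univ_eq_zero.1 (by simpa using oa)
    have zb : P.b i = 0 := Measure.measure_univ_eq_zero.1 (by simpa using ob)
    refine ⟨Or.inr za, Or.inr zb, ?_⟩
    intro h0 ua ub
    rw [za] at ua ⊢
    rw [zb]
    refine ⟨fun _ => 0, rfl, rfl, fun _ _ => inferInstance, ?_, ?_⟩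
    · intro s _ t _; simp [Wsq_zero]
    · intro t _; exact ⟨ua, by simp [Wsq_zero]; linarith⟩
  · have oa' := measure_mono_null (compl_subset_compl.2 h1) oa
    have ob' := measure_mono_null (compl_subset_compl.2 h2) ob
    refine ⟨Or.inl ⟨_, _, oa'⟩, Or.inl ⟨_, _, ob'⟩, ?_⟩
    intro _ ua ub
    refine hTP x0 (100 + (dist y0 x0 + 1)) (by positivity) _ _ inferInstance inferInstance (P.mass_eq i) ?_ ?_ ua ub
    · exact ball_mono oa' (by rw [dist_self]; linarith [dist_nonneg (x := y0) (y := x0)])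
    · exact ball_mono ob' (by linarith [dist_comm x0 y0])

lemma rpow_sum_le {ι : Type*} (f : ι → ℝ≥0∞) {θ : ℝ} (h0 : 0 < θ) (h1 : θ ≤ 1) : (∑' i, f i) ^ θ ≤ ∑' i, f i ^ θ := by
  have hfin : ∀ s : Finset ι, (∑ i ∈ s, f i) ^ θ ≤ ∑ i ∈ s, f i ^ θ := by
    intro s
    induction s using Finset.induction_on with
    | empty => simp [h0]
    | insert a s ha ih =>
      rw [Finset.sum_insert ha, Finset.sum_insert ha]
      exact (ENNReal.rpow_add_le_add_rpow _ _ h0.le h1).trans (by gcongr)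
  have t : Tendsto (fun s : Finset ι => (∑ i ∈ s, f i) ^ θ) atTop (𝓝 ((∑' i, f i) ^ θ)) :=
    ((ENNReal.continuous_rpow_const (y := θ)).tendsto _).comp ENNReal.summable.hasSum
  exact le_of_tendsto t (Eventually.of_forall fun s => (hfin s).trans (ENNReal.sum_le_tsum s))

lemma JJ_sub {ι : Type*} [Countable ι] {a : ι → Measure X} [IsFiniteMeasure (Measure.sum a)] (ha : ∀ i, a i ≪ m) {θ : ℝ} (h0 : 0 < θ) (h1 : θ ≤ 1) :
    JJ θ m (Measure.sum a) ≤ ∑' i, JJ θ m (a i) := by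
  unfold JJ
  rw [← lintegral_tsum fun i => ((Measure.measurable_rnDeriv (a i) m).pow_const θ).aemeasurable]
  refine lintegral_mono_ae ?_
  have fin : ∀ i, IsFiniteMeasure (a i) := fun i => isFiniteMeasure_of_le _ (Measure.le_sum a i)
  filter_upwards [dn_sum (m := m) a ha, Measure.rnDeriv_lt_top (Measure.sum a) m, ae_all_iff.2 fun i => Measure.rnDeriv_lt_top (a i) m] with x hx h3 h4
  have : (Measure.sum a).rnDeriv m x = ∑' i, (a i).rnDeriv m x := by
    rw [← ENNReal.ofReal_toReal h3.ne]
    have h5 := hx.tsum_eq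
    unfold dn at h5
    rw [← h5, ENNReal.ofReal_tsum_of_nonneg (fun i => ENNReal.toReal_nonneg) hx.summable]
    congr 1
    funext i
    rw [ENNReal.ofReal_toReal (h4 i).ne]
  rw [this]
  exact rpow_sum_le _ h0 h1

lemma JJ_sup {ι : Type*} [Countable ι] {a : ι → Measure X} [IsFiniteMeasure (Measure.sum a)]
    (hs : ∀ i j, i ≠ j → a i ⟂ₘ a j) {θ : ℝ} (h0 : 0 < θ) :
    ∑' i, JJ θ m (a i) ≤ JJ θ m (Measure.sum a) := by
  unfold JJ
  rw [← lintegral_tsum fun i => ((Measure.measurable_rnDeriv (a i) m).pow_const θ).aemeasurable]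
  refine lintegral_mono_ae ?_
  haveI fin : ∀ i, IsFiniteMeasure (a i) := fun i => isFiniteMeasure_of_le _ (Measure.le_sum a i)
  have dj : ∀ᵐ x ∂m, ∀ i j, i ≠ j → dn m (a i) x = 0 ∨ dn m (a j) x = 0 := by
    rw [ae_all_iff]; intro i
    rw [ae_all_iff]; intro j
    by_cases hij : i = j
    · exact ae_of_all _ fun x h => absurd hij h
    · filter_upwards [dn_sing (m := m) (hs i j hij)] with x hx _ using hx
  filter_upwards [dj, ae_all_iff.2 fun i => dn_le (m := m) (Measure.le_sum a i), Measure.rnDeriv_lt_top (Measure.sum a) m, ae_all_iff.2 fun i => Measure.rnDeriv_lt_top (a i) m] with x hx hl h3 h4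
  by_cases hz : ∃ i, (a i).rnDeriv m x ≠ 0
  · obtain ⟨i, hi⟩ := hz
    rw [tsum_eq_single i]
    · refine ENNReal.rpow_le_rpow ?_ h0.le
      exact (ENNReal.toReal_le_toReal (h4 i).ne h3.ne).1 (hl i)
    · intro j hj
      rcases hx j i hj with h | h
      · have : (a j).rnDeriv m x = 0 := ((ENNReal.toReal_eq_zero_iff _).1 h).resolve_right (h4 j).ne
        rw [this, ENNReal.zero_rpow_of_pos h0]
      · exact absurd (((ENNReal.toReal_eq_zero_iff _).1 h).resolve_right (h4 i).ne) hi
  · push Not at hz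
    simp [hz, h0]

set_option maxHeartbeats 2000000 in
lemma glob_pow [IsLocallyFiniteMeasure m] (hgeo : GeodesicSpace X) (hnb : NonBranching X) (hs : mmSupp m = univ) {N : ℝ} (hN : 1 < N)
    (h : CDloc 0 N m) : CD 0 N m := by
  have h0 : 0 < 1 - 1 / N := by rw [sub_pos, div_lt_one (by linarith)]; exact hN
  have h1 : 1 - 1 / N < 1 := by have : 0 < 1 / N := by positivity
                                linarith
  have hB := base_pow hN h
  set θ := 1 - 1 / N with hθ
  haveI := hopf_rinow hgeo (loc_compact h0 h1 hs hB)
  have hU := UProp_pow h0 h1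
  have hTP : ∀ (x : X) (L : ℝ), 0 < L → TP (fun r => - r ^ θ) m 0 x L := fun x L hL =>
    tp_all hgeo hnb hU (hV_pow h0 h1) hs (keyP_pow hgeo hs h0 h1) hB x hL
  intro ν₀ ν₁ hP0 hP1 ac0 ac1
  haveI := hP0.1
  haveI := hP1.1
  have hf := memP2_wsq hP0 hP1
  obtain ⟨q, hq, ho⟩ := exists_opt (μ := ν₀) (ν := ν₁) (by simp)
  haveI := hq.finite
  obtain ⟨P, hP⟩ := glob_part hTP hq
  haveI := P.fin_a
  haveI := P.fin_b
  have s0 : Measure.sum P.a = ν₀ := by rw [P.sum_a, hq.1]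
  have s1 : Measure.sum P.b = ν₁ := by rw [P.sum_b, hq.2]
  have ui : ∀ ν : Measure X, IsFiniteMeasure ν → ν ≪ m → ((∃ x R, ν (Metric.closedBall x R)ᶜ = 0) ∨ ν = 0) → UI (fun r => - r ^ θ) m ν := by
    intro ν _ hac hν
    rcases hν with ⟨x, R, hR⟩ | rfl
    · have hv := tp_vol hU (hV_pow h0 h1) hs (show 0 < max R 1 by positivity) (hTP x (max R 1) (by positivity))
      refine UI_of_LB h0 h1 hac (LB.of_finite hU Metric.isClosed_closedBall.measurableSet hv ?_)
      exact measure_mono_null (compl_subset_compl.2 (Metric.closedBall_subset_closedBall (le_max_left _ _))) hR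
    · exact UI.zero hU
  have aca : ∀ i, P.a i ≪ m := fun i => (Measure.absolutelyContinuous_of_le (by rw [← hq.1]; exact P.a_le i)).trans ac0
  have acb : ∀ i, P.b i ≪ m := fun i => (Measure.absolutelyContinuous_of_le (by rw [← hq.2]; exact P.b_le i)).trans ac1
  have ua := fun i => ui (P.a i) inferInstance (aca i) (hP i).1
  have ub := fun i => ui (P.b i) inferInstance (acb i) (hP i).2.1
  have hcc := fun i => (hP i).2.2 hU.zero (ua i) (ub i)
  choose μ m0 m1 mf mW me using hcc
  have hWi : ∀ i, Wsq (P.a i) (P.b i) ≠ ∞ := fun i =>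
    ENNReal.ne_top_of_tsum_ne_top (by rw [P.tsum_W hq ho hf]; exact hf) i
  have z0 : (0:ℝ) ∈ Icc (0:ℝ) 1 := by simp
  have z1 : (1:ℝ) ∈ Icc (0:ℝ) 1 := by simp
  have mass : ∀ i, ∀ s ∈ Icc (0:ℝ) 1, ∀ t ∈ Icc (0:ℝ) 1, μ i s univ = μ i t univ := by
    intro i s hs t ht
    by_contra h
    have := mW i s hs t ht
    rw [Wsq_eq_top_of_mass h, top_le_iff] at this
    exact ENNReal.mul_ne_top (by finiteness) (hWi i) this
  have e0 : Measure.sum (fun i => μ i 0) = ν₀ := by rw [← s0]; congr 1; funext i; exact m0 i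
  have e1 : Measure.sum (fun i => μ i 1) = ν₁ := by rw [← s1]; congr 1; funext i; exact m1 i
  have ff : ∀ t ∈ Icc (0:ℝ) 1, IsFiniteMeasure (Measure.sum fun i => μ i t) := by
    intro t ht
    constructor
    rw [Measure.sum_apply _ MeasurableSet.univ]
    simp_rw [fun i => mass i t ht 0 z0]
    rw [← Measure.sum_apply _ MeasurableSet.univ, e0]
    exact measure_lt_top _ _
  have wW : ∀ s ∈ Icc (0:ℝ) 1, ∀ t ∈ Icc (0:ℝ) 1,
      Wsq (Measure.sum fun i => μ i s) (Measure.sum fun i => μ i t) ≤ ENNReal.ofReal |s - t| ^ 2 * Wsq ν₀ ν₁ := by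
    intro s hs t ht
    haveI := fun i => mf i s hs
    haveI := fun i => mf i t ht
    refine (Wsq_sum_le (fun i => mass i s hs t ht)).trans ?_
    rw [← P.tsum_W hq ho hf, ← ENNReal.tsum_mul_left]
    exact ENNReal.tsum_le_tsum fun i => mW i s hs t ht
  refine ⟨fun t => Measure.sum fun i => μ i t, q, e0, e1, ?_, ?_, hq, ho, ?_⟩
  · refine geo_of_le ?_ ff ?_
    · simp only [e0, e1]; exact hf
    · simp only [e0, e1]; exact wW
  · intro t ht
    exact Measure.absolutelyContinuous_sum_left fun i => (me i t ht).1.1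
  intro t ht
  rw [JJ_rhs hN ac0 ac1 hq]
  show ENNReal.ofReal (1 - t) * JJ θ m ν₀ + ENNReal.ofReal t * JJ θ m ν₁ ≤ JJ θ m (Measure.sum fun i => μ i t)
  rcases eq_or_lt_of_le ht.1 with rfl | h0'
  · simp only [e0]; simp
  rcases eq_or_lt_of_le ht.2 with rfl | h1'
  · simp only [e1]; simp
  haveI := ff t ht
  haveI := fun i => mf i t ht
  have w1 : ∀ i, Wsq (P.a i) (μ i t) ≤ ENNReal.ofReal t ^ 2 * Wsq (P.a i) (P.b i) := by
    intro i
    have := mW i 0 z0 t ht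
    rwa [abs_sub_comm, sub_zero, abs_of_pos h0', m0] at this
  have w2 : ∀ i, Wsq (μ i t) (P.b i) ≤ ENNReal.ofReal (1 - t) ^ 2 * Wsq (P.a i) (P.b i) := by
    intro i
    have := mW i t ht 1 z1
    rwa [abs_sub_comm, abs_of_pos (by linarith), m1] at this
  choose T hT using fun i => exists_tplan h0' h1' (hWi i) (w1 i) (w2 i)
  have sing : ∀ i j, i ≠ j → μ i t ⟂ₘ μ j t := fun i j hij =>
    tplan_sing hgeo hnb h0' h1' (hT i) (hT j) (ENNReal.add_ne_top.2 ⟨hWi i, hWi j⟩)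
      (P.W_add hq ho hf hij).le (P.sing hij)
  refine le_trans ?_ (JJ_sup sing h0)
  have j0 : JJ θ m ν₀ ≤ ∑' i, JJ θ m (P.a i) := by
    haveI : IsFiniteMeasure (Measure.sum P.a) := by rw [s0]; infer_instance
    have := JJ_sub aca h0 h1.le
    rwa [s0] at this
  have j1 : JJ θ m ν₁ ≤ ∑' i, JJ θ m (P.b i) := by
    haveI : IsFiniteMeasure (Measure.sum P.b) := by rw [s1]; infer_instance
    have := JJ_sub acb h0 h1.le
    rwa [s1] at this
  calc ENNReal.ofReal (1 - t) * JJ θ m ν₀ + ENNReal.ofReal t * JJ θ m ν₁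
      ≤ ENNReal.ofReal (1 - t) * ∑' i, JJ θ m (P.a i) + ENNReal.ofReal t * ∑' i, JJ θ m (P.b i) := by gcongr
    _ = ∑' i, (ENNReal.ofReal (1 - t) * JJ θ m (P.a i) + ENNReal.ofReal t * JJ θ m (P.b i)) := by
      rw [ENNReal.tsum_add, ENNReal.tsum_mul_left, ENNReal.tsum_mul_left]
    _ ≤ _ := by
      refine ENNReal.tsum_le_tsum fun i => ?_
      obtain ⟨u, e⟩ := me i t ht
      obtain ⟨f0, g0⟩ := UI_JJ h0 (ua i)
      obtain ⟨f1, g1⟩ := UI_JJ h0 (ub i)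
      obtain ⟨ft, gt⟩ := UI_JJ h0 u
      rw [g0, g1, gt] at e
      refine (ENNReal.toReal_le_toReal (by finiteness) ft).1 ?_
      rw [ENNReal.toReal_add (by finiteness) (by finiteness), ENNReal.toReal_mul, ENNReal.toReal_mul,
        ENNReal.toReal_ofReal h0'.le, ENNReal.toReal_ofReal (by linarith)]
      simp only [zero_div, zero_mul] at e
      linarith
end P24

section P25
variable {X : Type*} [MetricSpace X] [MeasurableSpace X] [SecondCountableTopology X] [BorelSpace X]
  [CompleteSpace X]
variable {m : Measure X} [SigmaFinite m] {K : ℝ}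

lemma vlog {v : ℝ} (hv : 0 < v) : v * ((1 / v) * Real.log (1 / v)) = - Real.log v := by
  rw [one_div, Real.log_inv]
  field_simp

lemma vol_growth [IsLocallyFiniteMeasure m] (hs : mmSupp m = univ)
    (hTP : ∀ (x : X) (L : ℝ), 0 < L → TP (fun r => r * Real.log r) m K x L) (x : X) :
    ∃ C, 0 ≤ C ∧ ∀ L, 1 ≤ L → m (Metric.closedBall x L) ≤ ENNReal.ofReal (Real.exp (C * L ^ 2)) := by
  obtain ⟨r, r0, rL, hr⟩ := exists_ball_fin (m := m) x one_pos
  have mc : ∀ (x : X) r, MeasurableSet (Metric.closedBall x r) := fun x r => Metric.isClosed_closedBall.measurableSet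
  have z0 := ball_ne_zero hs x (show 0 < r / 100 by positivity)
  have fr : m (Metric.closedBall x (r / 100)) ≠ ∞ :=
    ne_top_of_le_ne_top hr (measure_mono (Metric.closedBall_subset_closedBall (by linarith)))
  obtain ⟨ν₀, f0, m0, u0, o0, e0⟩ := unif_exists (m := m) UProp_log (mc x (r / 100)) z0 fr 1 ENNReal.one_ne_top
  have pr : 0 < m.real (Metric.closedBall x (r / 100)) := ENNReal.toReal_pos z0 fr
  rw [ENNReal.toReal_one, vlog pr] at e0
  set A := |Real.log (m.real (Metric.closedBall x (r / 100)))| with hA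
  set B := |Real.log (m.real (Metric.closedBall x r))| with hB
  have hA0 : 0 ≤ A := abs_nonneg _
  have hB0 : 0 ≤ B := abs_nonneg _
  refine ⟨4 / r * (A + B) + 4 * |K|, by positivity, ?_⟩
  intro L hL
  have L0 : 0 < L := by linarith
  have fL := tp_vol UProp_log hV_log hs L0 (hTP x L L0)
  have zL := ball_ne_zero hs x L0
  have pL : 0 < m.real (Metric.closedBall x L) := ENNReal.toReal_pos zL fL
  obtain ⟨ν₁, f1, m1, u1, o1, e1⟩ := unif_exists (m := m) UProp_log (mc x L) zL fL 1 ENNReal.one_ne_top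
  rw [ENNReal.toReal_one, vlog pL] at e1
  have h0 : 0 < r / (4 * L) := by positivity
  have h1 : r / (4 * L) < 1 := by rw [div_lt_one (by positivity)]; linarith
  have ht : r / (4 * L) * L = r / 4 := by field_simp
  have ht' : (r / (4 * L)) * (4 / r * L) = 1 := by field_simp
  set t := r / (4 * L)
  have o0' : ν₀ (Metric.closedBall x (L / 100))ᶜ = 0 := ball_mono o0 (by rw [dist_self]; linarith)
  have hM : ν₀ univ = ν₁ univ := by rw [m0, m1]
  obtain ⟨hf, hw⟩ := wr_ball hM o0' o1
  obtain ⟨ζ, hζ⟩ := (hTP x L L0 ν₀ ν₁ f0 f1 hM o0' o1 u0 u1).at h0 h1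
  have hoff := hζ.off hf h0 h1 (s := r) o0 o1 (by nlinarith)
  haveI := hζ.1
  obtain ⟨pG, j⟩ := jensen_U UProp_log (by rw [← hζ.mass hf, m0]) (mc x r) hr hoff hζ.2.1
  have k := hζ.2.2.2.2
  have hr1 : ν₀.real univ = 1 := by simp [Measure.real, m0]
  rw [hr1, dist_self] at hw
  have hw2 : wr ν₀ ν₁ ≤ 4 * L ^ 2 := hw.trans (by nlinarith)
  have hw0 := wr_nonneg ν₀ ν₁
  rw [vlog pG] at j
  rw [wr] at hw2 hw0
  rw [e0, e1] at k
  have b1 : Real.log (m.real (Metric.closedBall x r)) ≤ B := le_abs_self _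
  have b2 : - Real.log (m.real (Metric.closedBall x (r/100))) ≤ A := neg_le_abs _
  have b3 : (1 - t) * - Real.log (m.real (Metric.closedBall x (r/100))) ≤ A := by nlinarith
  have b4 : - (K / 2 * (t * (1 - t)) * (Wsq ν₀ ν₁).toReal) ≤ t * (|K| * (4 * L ^ 2)) := by
    have h3 : 0 ≤ (1 - t) * (Wsq ν₀ ν₁).toReal := mul_nonneg (by linarith) hw0
    have h5 : (1 - t) * (Wsq ν₀ ν₁).toReal ≤ 4 * L ^ 2 := by nlinarith
    have h6 := neg_abs_le K
    have h7 := abs_nonneg K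
    have h8 : -(K / 2) * ((1 - t) * (Wsq ν₀ ν₁).toReal) ≤ |K| * (4 * L ^ 2) := by
      have : -(K / 2) ≤ |K| := by linarith
      calc _ ≤ |K| * ((1 - t) * (Wsq ν₀ ν₁).toReal) := by gcongr
        _ ≤ _ := by gcongr
    nlinarith
  have b5 : t * Real.log (m.real (Metric.closedBall x L)) ≤ t * (4 / r * L * (A + B) + 4 * |K| * L ^ 2) := by
    have : t * (4 / r * L * (A + B) + 4 * |K| * L ^ 2) = (t * (4 / r * L)) * (A + B) + t * (|K| * (4 * L ^ 2)) := by ring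
    rw [this, ht']
    linarith
  have b6 := le_of_mul_le_mul_left b5 h0
  have b7 : 4 / r * L * (A + B) ≤ 4 / r * L ^ 2 * (A + B) := by
    have : L ≤ L ^ 2 := by nlinarith
    gcongr
  rw [← ENNReal.ofReal_toReal fL]
  refine ENNReal.ofReal_le_ofReal ?_
  show m.real _ ≤ _
  rw [← Real.exp_log pL, Real.exp_le_exp]
  refine b6.trans ?_
  nlinarith

lemma exp_int {x : X} {C : ℝ} (C0 : 0 ≤ C)
    (h : ∀ L, 1 ≤ L → m (Metric.closedBall x L) ≤ ENNReal.ofReal (Real.exp (C * L ^ 2))) :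
    Integrable (fun y => Real.exp (- ((2 * C + 1) * dist y x ^ 2))) m := by
  have meas : Measurable (fun y => Real.exp (- ((2 * C + 1) * dist y x ^ 2))) :=
    (by fun_prop : Continuous (fun y => Real.exp (- ((2 * C + 1) * dist y x ^ 2)))).measurable
  refine ⟨meas.aestronglyMeasurable, ?_⟩
  rw [hasFiniteIntegral_iff_ofReal (Eventually.of_forall fun y => (Real.exp_pos _).le)]
  have mc : ∀ (x : X) r, MeasurableSet (Metric.closedBall x r) := fun x r => Metric.isClosed_closedBall.measurableSet
  have pt : ∀ y, ENNReal.ofReal (Real.exp (- ((2 * C + 1) * dist y x ^ 2))) ≤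
      ∑' n : ℕ, (Metric.closedBall x (n + 1)).indicator
        (fun _ => ENNReal.ofReal (Real.exp (- ((2 * C + 1) * (n:ℝ) ^ 2)))) y := by
    intro y
    refine le_trans ?_ (ENNReal.le_tsum ⌊dist y x⌋₊)
    rw [indicator_of_mem (by rw [Metric.mem_closedBall]; exact (Nat.lt_floor_add_one _).le)]
    refine ENNReal.ofReal_le_ofReal (Real.exp_le_exp.2 (neg_le_neg ?_))
    have := Nat.floor_le (dist_nonneg (x := y) (y := x))
    gcongr
  refine (lintegral_mono pt).trans_lt ?_
  rw [lintegral_tsum (fun n => (measurable_const.indicator (mc _ _)).aemeasurable)]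
  have b : ∀ n : ℕ, ∫⁻ y, (Metric.closedBall x (n + 1)).indicator
        (fun _ => ENNReal.ofReal (Real.exp (- ((2 * C + 1) * (n:ℝ) ^ 2)))) y ∂m ≤
        ENNReal.ofReal (Real.exp (2 * C) * Real.exp (-1 : ℝ) ^ n) := by
    intro n
    rw [lintegral_indicator_const (mc _ _)]
    refine (mul_le_mul_right (h (n + 1) (by simp)) _).trans ?_
    rw [← ENNReal.ofReal_mul (Real.exp_pos _).le, ← Real.exp_add, ← Real.exp_nat_mul, ← Real.exp_add]
    refine ENNReal.ofReal_le_ofReal (Real.exp_le_exp.2 ?_)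
    have : (n:ℝ) ≤ (n:ℝ) ^ 2 := by exact_mod_cast Nat.le_self_pow (by norm_num) n
    nlinarith [mul_nonneg C0 (sq_nonneg ((n:ℝ) - 1))]
  refine (ENNReal.tsum_le_tsum b).trans_lt ?_
  rw [← ENNReal.ofReal_tsum_of_nonneg]
  · exact ENNReal.ofReal_lt_top
  · intro n; positivity
  · exact (summable_geometric_of_lt_one (Real.exp_pos _).le (by rw [Real.exp_lt_one_iff]; norm_num)).mul_left _

lemma LB_log {x : X} {c : ℝ} (hc : 0 ≤ c) (hi : Integrable (fun y => Real.exp (- (c * dist y x ^ 2))) m)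
    {β : Measure X} [IsFiniteMeasure β] (h2 : ∫⁻ y, edist y x ^ 2 ∂β ≠ ∞) : LB (fun r => r * Real.log r) m β := by
  refine ⟨fun y => c * (dist y x ^ 2 * dn m β y) + Real.exp (- (c * dist y x ^ 2)), ?_, ?_⟩
  · refine Integrable.add (Integrable.const_mul ?_ c) hi
    have md : Measurable (fun y => dist y x ^ 2) := (by fun_prop : Continuous (fun y => dist y x ^ 2)).measurable
    refine ⟨(md.mul (dn_meas β)).aestronglyMeasurable, ?_⟩
    rw [hasFiniteIntegral_iff_ofReal (Eventually.of_forall fun y => mul_nonneg (sq_nonneg _) (dn_nonneg _ _))]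
    refine lt_of_le_of_lt ?_ h2.lt_top
    have me : Measurable (fun y => edist y x ^ 2) := (by fun_prop : Continuous (fun y => edist y x)).measurable.pow_const 2
    calc _ = ∫⁻ y, (β.rnDeriv m * fun y => edist y x ^ 2) y ∂m := by
          refine lintegral_congr_ae ?_
          filter_upwards [dn_ofReal (m := m) β] with y hy
          rw [ENNReal.ofReal_mul (sq_nonneg _), hy, Pi.mul_apply, edist_dist, ENNReal.ofReal_pow dist_nonneg, mul_comm]
      _ = ∫⁻ y, edist y x ^ 2 ∂(m.withDensity (β.rnDeriv m)) :=
          (lintegral_withDensity_eq_lintegral_mul _ (Measure.measurable_rnDeriv _ _) me).symm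
      _ ≤ _ := lintegral_mono' (Measure.withDensity_rnDeriv_le _ _) le_rfl
  · refine Eventually.of_forall fun y g g0 gd => ?_
    have a0 : 0 ≤ c * dist y x ^ 2 := by positivity
    have k : c * dist y x ^ 2 * g ≤ c * (dist y x ^ 2 * dn m β y) := by
      rw [← mul_assoc]; gcongr
    set a := c * dist y x ^ 2
    rcases eq_or_lt_of_le g0 with rfl | g0
    · have := Real.exp_pos (-a)
      simp only [zero_mul]; linarith
    have l := Real.add_one_le_exp (- a - Real.log g)
    rw [Real.exp_sub, Real.exp_log g0, le_div_iff₀ g0] at l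
    nlinarith

lemma mom_any {x y : X} {β : Measure X} [IsFiniteMeasure β] (h : ∫⁻ z, edist z x ^ 2 ∂β ≠ ∞) :
    ∫⁻ z, edist z y ^ 2 ∂β ≠ ∞ := by
  have : ∀ z, edist z y ^ 2 ≤ 2 * edist z x ^ 2 + 2 * edist x y ^ 2 := by
    intro z
    rw [edist_dist, edist_dist, edist_dist, ← ENNReal.ofReal_pow dist_nonneg, ← ENNReal.ofReal_pow dist_nonneg,
      ← ENNReal.ofReal_pow dist_nonneg, ← ENNReal.ofReal_ofNat 2, ← ENNReal.ofReal_mul (by norm_num),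
      ← ENNReal.ofReal_mul (by norm_num), ← ENNReal.ofReal_add (by positivity) (by positivity)]
    refine ENNReal.ofReal_le_ofReal ?_
    have h1 := dist_triangle z x y
    have h2 := dist_nonneg (x := z) (y := y)
    nlinarith [sq_nonneg (dist z x - dist x y)]
  refine ne_top_of_le_ne_top ?_ (lintegral_mono this)
  rw [lintegral_add_right _ measurable_const, lintegral_const_mul' _ _ (by norm_num), lintegral_const]
  finiteness

lemma mom_tplan {t : ℝ} {x : X} {ν₀ ν₁ β : Measure X} [IsFiniteMeasure ν₀] {T : Measure (X × X × X)} (h0 : 0 < t) (h1 : t < 1)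
    (hT : IsTPlan t T ν₀ β ν₁) (hf : Wsq ν₀ ν₁ ≠ ∞) (h : ∫⁻ z, edist z x ^ 2 ∂ν₀ ≠ ∞) :
    ∫⁻ z, edist z x ^ 2 ∂β ≠ ∞ := by
  have me : Measurable (fun y => edist y x ^ 2) := (by fun_prop : Continuous (fun y : X => edist y x)).measurable.pow_const 2
  rw [← hT.m2, lintegral_map me (by fun_prop)]
  rw [← hT.m1, lintegral_map me (by fun_prop)] at h
  have hc := hT.co
  have : ∀ᵐ p ∂T, edist p.2.1 x ^ 2 ≤ 2 * edist p.1 x ^ 2 + 2 * edist p.1 p.2.2 ^ 2 := by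
    filter_upwards [hT.ex] with p hp
    rw [edist_dist, edist_dist, edist_dist, ← ENNReal.ofReal_pow dist_nonneg, ← ENNReal.ofReal_pow dist_nonneg,
      ← ENNReal.ofReal_pow dist_nonneg, ← ENNReal.ofReal_ofNat 2, ← ENNReal.ofReal_mul (by norm_num),
      ← ENNReal.ofReal_mul (by norm_num), ← ENNReal.ofReal_add (by positivity) (by positivity)]
    refine ENNReal.ofReal_le_ofReal ?_
    have k1 := dist_triangle_left p.2.1 x p.1
    have k2 := dist_nonneg (x := p.2.1) (y := x)
    have k3 := dist_nonneg (x := p.1) (y := p.2.2)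
    have k4 : dist p.2.1 x ≤ dist p.1 x + dist p.1 p.2.2 := by nlinarith [hp.1]
    nlinarith [sq_nonneg (dist p.1 x - dist p.1 p.2.2)]
  refine ne_top_of_le_ne_top ?_ (lintegral_mono_ae this)
  have mm : Measurable (fun p : X × X × X => 2 * edist p.1 p.2.2 ^ 2) := by
    have : Measurable (fun p : X × X × X => edist p.1 p.2.2) := (by fun_prop : Continuous (fun p : X × X × X => edist p.1 p.2.2)).measurable
    exact (this.pow_const 2).const_mul 2
  rw [lintegral_add_right _ mm, lintegral_const_mul' _ _ (by norm_num), lintegral_const_mul' _ _ (by norm_num), hc]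
  finiteness

/-- finite-entropy case of the global statement -/
lemma glob_log_fin [IsLocallyFiniteMeasure m] (hgeo : GeodesicSpace X) (hnb : NonBranching X)
    (hTP : ∀ (x : X) (L : ℝ), 0 < L → TP (fun r => r * Real.log r) m K x L)
    (hLB : ∀ (β : Measure X) [IsFiniteMeasure β] (x : X), ∫⁻ y, edist y x ^ 2 ∂β ≠ ∞ → LB (fun r => r * Real.log r) m β)
    {ν₀ ν₁ : Measure X} (hP0 : MemP2 ν₀) (hP1 : MemP2 ν₁) (n0 : Ent ν₀ m ≠ ⊤) (n1 : Ent ν₁ m ≠ ⊤) :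
    CDinftyFor K m ν₀ ν₁ := by
  have hf := memP2_wsq hP0 hP1
  obtain ⟨_, x0, hx0⟩ := hP0
  obtain ⟨_, x1, hx1⟩ := hP1
  have b0 := hLB ν₀ x0 hx0.ne
  have b1 := hLB ν₁ x1 hx1.ne
  have u0 := UI_of_Ent n0 b0
  have u1 := UI_of_Ent n1 b1
  obtain ⟨q, hq, ho⟩ := exists_opt (μ := ν₀) (ν := ν₁) (by simp)
  haveI := hq.finite
  obtain ⟨P, hP⟩ := glob_part hTP hq
  haveI := P.fin_a
  haveI := P.fin_b
  have cc : CC (fun r => r * Real.log r) m K ν₀ ν₁ := by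
    refine cc_glue hgeo hnb UProp_log K P hq ho hf u0 u1 b0 b1 ?_ ?_
    · rintro t ht β hβ ⟨T, hT⟩
      exact hLB β x0 (mom_tplan ht.1 ht.2 hT hf hx0.ne)
    · intro i
      exact (hP i).2.2 (by simp) (u0.mono UProp_log b0 (by have := P.a_le i; rwa [hq.1] at this))
        (u1.mono UProp_log b1 (by have := P.b_le i; rwa [hq.2] at this))
  obtain ⟨μ, m0, m1, mf, mW, me⟩ := cc
  refine ⟨μ, m0, m1, geo_of_le (by rw [m0, m1]; exact hf) mf (by rw [m0, m1]; exact mW), ?_⟩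
  intro t ht
  obtain ⟨u, hu⟩ := me t ht
  rw [Ent_eq u, Ent_eq u0, Ent_eq u1, ← ENNReal.ofReal_toReal hf, EReal.coe_ennreal_ofReal, max_eq_left ENNReal.toReal_nonneg,
    ← EReal.coe_mul, ← EReal.coe_mul, ← EReal.coe_mul, ← EReal.coe_add, ← EReal.coe_sub]
  exact_mod_cast hu
end P25

section P26
variable {Z : Type*} [MetricSpace Z] [MeasurableSpace Z] [SecondCountableTopology Z] [BorelSpace Z]

/-- lifting a measure through a continuous map, compact case -/
lemma lift_compact {g : (ℕ → ℕ) → Z} (hg : Continuous g) {Q : Set (ℕ → ℕ)} (hQ : IsCompact Q) (ρ : Measure Z)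
    [IsFiniteMeasure ρ] (h : ρ (g '' Q)ᶜ = 0) : ∃ Pm : Measure (ℕ → ℕ), Pm.map g = ρ := by
  rcases Q.eq_empty_or_nonempty with rfl | hne
  · refine ⟨0, ?_⟩
    rw [Measure.map_zero]
    simp only [image_empty, compl_empty, Measure.measure_univ_eq_zero] at h
    exact h.symm
  haveI : Nonempty Q := hne.to_subtype
  obtain ⟨y, hy⟩ := TopologicalSpace.exists_dense_seq Q
  set e : ℕ → Z := fun n => g (y n) with he
  have cl : ∀ z ∈ g '' Q, z ∈ closure (range e) := by
    rintro z ⟨p, hp, rfl⟩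
    have c : Continuous (fun p : Q => g p) := hg.comp continuous_subtype_val
    have := c.range_subset_closure_image_dense hy (mem_range_self (⟨p, hp⟩ : Q))
    rwa [← range_comp] at this
  set s : ℕ → Z → (ℕ → ℕ) := fun n z => y (SimpleFunc.nearestPtInd e n z) with hs
  have ms : ∀ n, Measurable (s n) := fun n =>
    (measurable_of_countable (fun k : ℕ => ((y k : Q) : ℕ → ℕ))).comp (SimpleFunc.nearestPtInd e n).measurable
  have tight : IsTightMeasureSet (range fun n => ρ.map (s n)) := by
    rw [isTightMeasureSet_iff_exists_isCompact_measure_compl_le]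
    intro ε _
    refine ⟨Q, hQ, ?_⟩
    rintro _ ⟨n, rfl⟩
    rw [Measure.map_apply (ms n) hQ.isClosed.measurableSet.compl]
    have : s n ⁻¹' Qᶜ = ∅ := by
      ext z; simp [hs]
    rw [this]; simp
  obtain ⟨Pm, fPm, -, wPm⟩ := exists_wlim (fun n => ρ.map (s n)) (ρ univ).toNNReal
    (by intro k; rw [Measure.map_apply (ms k) MeasurableSet.univ, preimage_univ, ENNReal.coe_toNNReal (by finiteness)]) tight
  refine ⟨Pm, ?_⟩
  refine (wPm.map hg).eq ?_
  intro f
  refine Tendsto.mono_left ?_ hyper_le_atTop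
  have eq : ∀ n, ∫⁻ x, f x ∂((ρ.map (s n)).map g) = ∫⁻ z, f (SimpleFunc.nearestPt e n z) ∂ρ := by
    intro n
    have mf : Measurable (fun x => (f x : ℝ≥0∞)) := f.continuous.measurable.coe_nnreal_ennreal
    rw [lintegral_map mf hg.measurable, lintegral_map (show Measurable (fun a => (f (g a) : ℝ≥0∞)) from mf.comp hg.measurable) (ms n)]
    rfl
  simp only [eq]
  refine tendsto_lintegral_of_dominated_convergence (fun _ => (nndist f 0 : ℝ≥0∞)) ?_ ?_ ?_ ?_
  · intro n
    exact (f.continuous.measurable.comp (SimpleFunc.nearestPt e n).measurable).coe_nnreal_ennreal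
  · intro n
    refine Eventually.of_forall fun z => ?_
    exact ENNReal.coe_le_coe.2 (BoundedContinuousFunction.NNReal.upper_bound f _)
  · rw [lintegral_const]; finiteness
  · have : ∀ᵐ z ∂ρ, z ∈ g '' Q := by rw [ae_iff]; exact h
    filter_upwards [this] with z hz
    exact ENNReal.tendsto_coe.2 ((f.continuous.tendsto z).comp (SimpleFunc.tendsto_nearestPt (cl z hz)))

/-- approximating by compact boxes -/
lemma box_compact {g : (ℕ → ℕ) → Z} (hg : Continuous g) (q : Measure Z) [IsFiniteMeasure q] {c : ℝ≥0∞}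
    (hc : c < q (range g)) : ∃ Q : Set (ℕ → ℕ), IsCompact Q ∧ c ≤ q (g '' Q) := by
  have step : ∀ (A : Set (ℕ → ℕ)) (n : ℕ), c < q (g '' A) → ∃ j, c < q (g '' (A ∩ {y | y n ≤ j})) := by
    intro A n hA
    have mono : Monotone fun j : ℕ => g '' (A ∩ {y : ℕ → ℕ | y n ≤ j}) := by
      intro i j hij
      refine image_mono (inter_subset_inter_right _ ?_)
      intro y hy
      exact le_trans hy hij
    have un : ⋃ j : ℕ, g '' (A ∩ {y : ℕ → ℕ | y n ≤ j}) = g '' A := by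
      rw [← image_iUnion, ← inter_iUnion]
      congr 1
      refine inter_eq_left.2 fun y _ => mem_iUnion.2 ⟨y n, le_refl (y n)⟩
    rw [← un, mono.measure_iUnion] at hA
    exact lt_iSup_iff.1 hA
  choose! J hJ using step
  let A : ℕ → Set (ℕ → ℕ) := fun n => Nat.rec univ (fun n A => A ∩ {y | y n ≤ J A n}) n
  have As : ∀ n, A (n + 1) = A n ∩ {y | y n ≤ J (A n) n} := fun n => rfl
  have hA : ∀ n, c < q (g '' A n) := by
    intro n
    induction n with
    | zero => show c < q (g '' univ); rwa [image_univ]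
    | succ n ih => rw [As]; exact hJ _ _ ih
  set k : ℕ → ℕ := fun n => J (A n) n with hk
  have Am : ∀ n y, y ∈ A n ↔ ∀ i < n, y i ≤ k i := by
    intro n y
    induction n with
    | zero => exact ⟨fun _ i hi => absurd hi (by omega), fun _ => mem_univ _⟩
    | succ n ih =>
      rw [As, mem_inter_iff, ih]
      constructor
      · rintro ⟨h1, h2⟩ i hi
        rcases Nat.lt_succ_iff_lt_or_eq.1 hi with h | rfl
        · exact h1 i h
        · exact h2
      · intro h
        exact ⟨fun i hi => h i (by omega), h n (by omega)⟩
  have anti : Antitone A := by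
    intro a b hab y hy
    rw [Am] at hy ⊢
    exact fun i hi => hy i (by omega)
  refine ⟨Set.univ.pi fun i => Iic (k i), isCompact_univ_pi fun i => (finite_Iic _).isCompact, ?_⟩
  have sub : ⋂ n, closure (g '' A n) ⊆ g '' (Set.univ.pi fun i => Iic (k i)) := by
    intro z hz
    rw [mem_iInter] at hz
    have : ∀ n : ℕ, ∃ y ∈ A n, dist z (g y) < 1 / ((n:ℝ) + 1) := by
      intro n
      obtain ⟨_, ⟨y, hy, rfl⟩, hd⟩ := Metric.mem_closure_iff.1 (hz n) (1 / ((n:ℝ) + 1)) (by positivity)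
      exact ⟨y, hy, hd⟩
    choose y hy hd using this
    obtain ⟨w, hw, φ, hφ, hl⟩ := (isCompact_univ_pi (X := fun _ : ℕ => ℕ) (s := fun i => Iic (k i)) fun i => (finite_Iic _).isCompact).tendsto_subseq
      (x := fun n => fun i => min (y n i) (k i)) (fun n i _ => show min (y n i) (k i) ≤ k i from min_le_right _ _)
    refine ⟨w, hw, ?_⟩
    have hl2 : Tendsto (fun n => y (φ n)) atTop (𝓝 w) := by
      rw [tendsto_pi_nhds] at hl ⊢
      intro i
      refine (hl i).congr' ?_
      filter_upwards [eventually_gt_atTop i] with n hn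
      have := (Am _ _).1 (hy (φ n)) i (lt_of_lt_of_le hn hφ.le_apply)
      simp [this]
    have l1 := (hg.tendsto w).comp hl2
    have l2 : Tendsto (fun n => g (y n)) atTop (𝓝 z) := by
      rw [tendsto_iff_dist_tendsto_zero]
      refine squeeze_zero (fun _ => dist_nonneg) (fun n => ?_) tendsto_one_div_add_atTop_nhds_zero_nat
      rw [dist_comm (g (y n)) z]; exact (hd n).le
    exact tendsto_nhds_unique l1 (l2.comp hφ.tendsto_atTop)
  refine le_trans ?_ (measure_mono sub)
  have lim := tendsto_measure_iInter_atTop (μ := q) (s := fun n => closure (g '' A n))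
    (fun n => isClosed_closure.measurableSet.nullMeasurableSet) (fun a b hab => closure_mono (image_mono (anti hab)))
    ⟨0, by finiteness⟩
  exact ge_of_tendsto' lim fun n => (hA n).le.trans (measure_mono subset_closure)

lemma lift_meas {g : (ℕ → ℕ) → Z} (hg : Continuous g) (hsur : Function.Surjective g) (q : Measure Z) [IsFiniteMeasure q] :
    ∃ Pm : Measure (ℕ → ℕ), Pm.map g = q := by
  by_cases hq0 : q = 0
  · exact ⟨0, by rw [hq0, Measure.map_zero]⟩
  have q0 : q univ ≠ 0 := by rwa [Ne, Measure.measure_univ_eq_zero]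
  have : ∀ n : ℕ, ∃ Q : Set (ℕ → ℕ), IsCompact Q ∧ q univ - ((n:ℝ≥0∞) + 1)⁻¹ ≤ q (g '' Q) := by
    intro n
    refine box_compact hg q ?_
    rw [hsur.range_eq]
    exact ENNReal.sub_lt_self (by finiteness) q0 (ENNReal.inv_ne_zero.2 (by finiteness))
  choose Q hQ hq using this
  have mQ : ∀ n, MeasurableSet (g '' Q n) := fun n => ((hQ n).image hg).isClosed.measurableSet
  have md : ∀ n, MeasurableSet (disjointed (fun n => g '' Q n) n) := fun n => MeasurableSet.disjointed mQ n
  have null : q (⋃ n, g '' Q n)ᶜ = 0 := by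
    rw [measure_compl (MeasurableSet.iUnion mQ) (by finiteness), tsub_eq_zero_iff_le]
    have l : Tendsto (fun n : ℕ => q univ - ((n:ℝ≥0∞) + 1)⁻¹) atTop (𝓝 (q univ - 0)) := by
      refine ENNReal.Tendsto.sub tendsto_const_nhds ?_ (Or.inl (by finiteness))
      have := (tendsto_add_atTop_iff_nat 1).2 ENNReal.tendsto_inv_nat_nhds_zero
      simpa using this
    rw [tsub_zero] at l
    exact le_of_tendsto' l fun n => (hq n).trans (measure_mono (subset_iUnion (fun n => g '' Q n) n))
  have lift : ∀ n, ∃ Pm : Measure (ℕ → ℕ), Pm.map g = q.restrict (disjointed (fun n => g '' Q n) n) := by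
    intro n
    refine lift_compact hg (hQ n) _ ?_
    rw [Measure.restrict_apply (mQ n).compl]
    have : (g '' Q n)ᶜ ∩ disjointed (fun n => g '' Q n) n = ∅ := by
      rw [← disjoint_iff_inter_eq_empty]
      exact (disjoint_compl_left).mono_right (disjointed_subset _ _)
    rw [this, measure_empty]
  choose Pm hPm using lift
  refine ⟨Measure.sum Pm, ?_⟩
  rw [Measure.map_sum hg.measurable.aemeasurable]
  simp only [hPm]
  rw [← Measure.restrict_iUnion (disjoint_disjointed _) md, iUnion_disjointed]
  exact Measure.restrict_eq_self_of_ae_mem (by rw [ae_iff]; exact null)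
end P26

section P26b
variable {X : Type*} [MetricSpace X] [MeasurableSpace X] [SecondCountableTopology X] [BorelSpace X]
  [CompleteSpace X]

/-- geodesics as a closed subset of the path space -/
def GeoS (X : Type*) [MetricSpace X] : Set C(unitInterval, X) :=
  {γ | ∀ s t : unitInterval, dist (γ s) (γ t) = |(s:ℝ) - t| * dist (γ 0) (γ 1)}

lemma GeoS_closed : IsClosed (GeoS X) := by
  have : GeoS X = ⋂ s : unitInterval, ⋂ t : unitInterval,
      {γ : C(unitInterval, X) | dist (γ s) (γ t) = |(s:ℝ) - t| * dist (γ 0) (γ 1)} := by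
    ext γ; simp only [GeoS, mem_setOf_eq, mem_iInter]
  rw [this]
  refine isClosed_iInter fun s => isClosed_iInter fun t => isClosed_eq ?_ ?_
  · exact (continuous_eval_const s).dist (continuous_eval_const t)
  · exact continuous_const.mul ((continuous_eval_const 0).dist (continuous_eval_const 1))

lemma geo_path (hgeo : GeodesicSpace X) (x y : X) : ∃ γ : GeoS X, γ.1 0 = x ∧ γ.1 1 = y := by
  obtain ⟨γ, h0, h1, hγ⟩ := hgeo x y
  have c : Continuous (fun t : unitInterval => γ t) := by
    refine LipschitzWith.continuous (K := nndist (γ 0) (γ 1)) (LipschitzWith.of_dist_le_mul fun s t => ?_)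
    rw [hγ s s.2 t t.2, coe_nndist, mul_comm]
    rfl
  refine ⟨⟨⟨fun t => γ t, c⟩, ?_⟩, by simpa using h0, by simpa using h1⟩
  intro s t
  simpa using hγ s s.2 t t.2

lemma exists_geo (hgeo : GeodesicSpace X) {ν₀ ν₁ : Measure X} (hP0 : MemP2 ν₀) (hP1 : MemP2 ν₁) :
    ∃ μ : ℝ → Measure X, μ 0 = ν₀ ∧ μ 1 = ν₁ ∧ IsW2Geodesic μ := by
  have hf := memP2_wsq hP0 hP1
  haveI := hP0.1
  haveI := hP1.1
  obtain ⟨q, hq, ho⟩ := exists_opt (μ := ν₀) (ν := ν₁) (by simp)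
  haveI := hq.finite
  obtain ⟨x0, -⟩ := hP0.2
  haveI : Nonempty (GeoS X) := ⟨(geo_path hgeo x0 x0).choose⟩
  haveI : PolishSpace (GeoS X) := GeoS_closed.polishSpace
  obtain ⟨b, hb, bs⟩ := PolishSpace.exists_nat_nat_continuous_surjective (GeoS X)
  have ce : ∀ t : unitInterval, Continuous (fun w => (b w).1 t) := fun t =>
    (continuous_eval_const t).comp (continuous_subtype_val.comp hb)
  obtain ⟨Pm, hPm⟩ := lift_meas (g := fun w => ((b w).1 0, (b w).1 1)) ((ce 0).prodMk (ce 1)) (by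
    rintro ⟨x, y⟩
    obtain ⟨γ, h0, h1⟩ := geo_path hgeo x y
    obtain ⟨w, hw⟩ := bs γ
    exact ⟨w, by simp [hw, h0, h1]⟩) q
  have hfin : IsFiniteMeasure Pm := by
    constructor
    have : q univ < ∞ := measure_lt_top _ _
    rwa [← hPm, Measure.map_apply ((ce 0).prodMk (ce 1)).measurable MeasurableSet.univ, preimage_univ] at this
  set pr : ℝ → unitInterval := Set.projIcc 0 1 zero_le_one with hpr
  have p0 : pr 0 = 0 := Set.projIcc_left _
  have p1 : pr 1 = 1 := Set.projIcc_right _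
  have E0 : Pm.map (fun w => (b w).1 0) = ν₀ := by
    rw [← hq.1, ← hPm, Measure.map_map measurable_fst ((ce 0).prodMk (ce 1)).measurable]; rfl
  have E1 : Pm.map (fun w => (b w).1 1) = ν₁ := by
    rw [← hq.2, ← hPm, Measure.map_map measurable_snd ((ce 0).prodMk (ce 1)).measurable]; rfl
  have e0 : Pm.map (fun w => (b w).1 (pr 0)) = ν₀ := by rw [p0]; exact E0
  have e1 : Pm.map (fun w => (b w).1 (pr 1)) = ν₁ := by rw [p1]; exact E1
  have med : Measurable (fun p : X × X => edist p.1 p.2 ^ 2) := (by fun_prop : Continuous (fun p : X × X => edist p.1 p.2)).measurable.pow_const 2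
  refine ⟨fun t => Pm.map (fun w => (b w).1 (pr t)), e0, e1, ?_⟩
  refine geo_of_le ?_ ?_ ?_
  · simp only [e0, e1]; exact hf
  · intro t _; infer_instance
  simp only [e0, e1]
  intro s hs t ht
  have cp : IsCoupling (Pm.map (fun w => ((b w).1 (pr s), (b w).1 (pr t)))) (Pm.map (fun w => (b w).1 (pr s))) (Pm.map (fun w => (b w).1 (pr t))) := by
    constructor
    · rw [Measure.map_map measurable_fst ((ce _).prodMk (ce _)).measurable]; rfl
    · rw [Measure.map_map measurable_snd ((ce _).prodMk (ce _)).measurable]; rfl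
  refine (Wsq_le cp).trans ?_
  rw [lintegral_map med ((ce _).prodMk (ce _)).measurable, ← ho, ← hPm, lintegral_map med ((ce _).prodMk (ce _)).measurable,
    ← lintegral_const_mul' _ _ (by finiteness)]
  refine lintegral_mono fun w => le_of_eq ?_
  have := (b w).2 (pr s) (pr t)
  have ps : ((pr s : unitInterval) : ℝ) = s := by rw [hpr, Set.projIcc_of_mem _ hs]
  have pt : ((pr t : unitInterval) : ℝ) = t := by rw [hpr, Set.projIcc_of_mem _ ht]
  rw [ps, pt] at this
  simp only
  rw [edist_dist, edist_dist, this, ENNReal.ofReal_mul (abs_nonneg _), mul_pow]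
end P26b

section P27
variable {X : Type*} [MetricSpace X] [MeasurableSpace X] [SecondCountableTopology X] [BorelSpace X]
  [CompleteSpace X]
variable {m : Measure X} [SigmaFinite m] {K : ℝ}

lemma Ent_ne_bot {ν : Measure X} (hb : LB (fun r => r * Real.log r) m ν) : Ent ν m ≠ ⊥ := by
  by_cases h : Ent ν m = ⊤
  · rw [h]; exact top_ne_bot
  · rw [Ent_eq (UI_of_Ent h hb)]; exact EReal.coe_ne_bot _

lemma ereal_top {a b c : EReal} (s t k : ℝ) (hs : 0 < s) (ht : 0 < t) (ha : a ≠ ⊥) (hb : b ≠ ⊥)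
    (h : a = ⊤ ∨ b = ⊤) {w : ℝ} (hc : c = (w : EReal)) :
    (s : EReal) * a + (t : EReal) * b - (k : EReal) * c = ⊤ := by
  have mul_nb : ∀ (s : ℝ) (a : EReal), 0 < s → a ≠ ⊥ → (s : EReal) * a ≠ ⊥ := by
    intro s a hs ha
    induction a with
    | bot => exact absurd rfl ha
    | coe x => rw [← EReal.coe_mul]; exact EReal.coe_ne_bot _
    | top => rw [EReal.coe_mul_top_of_pos hs]; exact top_ne_bot
  rw [hc, ← EReal.coe_mul]
  have : (s : EReal) * a + (t : EReal) * b = ⊤ := by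
    rcases h with rfl | rfl
    · rw [EReal.coe_mul_top_of_pos hs, EReal.top_add_of_ne_bot (mul_nb t b ht hb)]
    · rw [EReal.coe_mul_top_of_pos ht, EReal.add_top_of_ne_bot (mul_nb s a hs ha)]
  rw [this, EReal.top_sub_coe]

lemma glob_log [IsLocallyFiniteMeasure m] (hgeo : GeodesicSpace X) (hnb : NonBranching X) (hs : mmSupp m = univ)
    (h : CDinftyLoc K m) : CDinfty K m := by
  have hTP : ∀ (x : X) (L : ℝ), 0 < L → TP (fun r => r * Real.log r) m K x L := fun x L hL =>
    tp_all hgeo hnb UProp_log hV_log hs (keyP_log hgeo hs K) (base_log h) x hL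
  have hLB : ∀ (β : Measure X) [IsFiniteMeasure β] (x : X), ∫⁻ y, edist y x ^ 2 ∂β ≠ ∞ → LB (fun r => r * Real.log r) m β := by
    intro β _ x hx
    obtain ⟨C, C0, hC⟩ := vol_growth hs hTP x
    exact LB_log (by positivity) (exp_int C0 hC) hx
  intro ν₀ ν₁ hP0 hP1
  by_cases hE : Ent ν₀ m = ⊤ ∨ Ent ν₁ m = ⊤
  swap
  · push Not at hE
    exact glob_log_fin hgeo hnb hTP hLB hP0 hP1 hE.1 hE.2
  have hf := memP2_wsq hP0 hP1
  obtain ⟨μ, m0, m1, hg⟩ := exists_geo hgeo hP0 hP1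
  refine ⟨μ, m0, m1, hg, ?_⟩
  have wr : ((Wsq ν₀ ν₁ : ℝ≥0∞) : EReal) = (((Wsq ν₀ ν₁).toReal : ℝ) : EReal) := by
    conv_lhs => rw [← ENNReal.ofReal_toReal hf]
    rw [EReal.coe_ennreal_ofReal, max_eq_left ENNReal.toReal_nonneg]
  haveI := hP0.1
  haveI := hP1.1
  obtain ⟨x0, hx0⟩ := hP0.2
  obtain ⟨x1, hx1⟩ := hP1.2
  have n0 := Ent_ne_bot (hLB ν₀ x0 hx0.ne)
  have n1 := Ent_ne_bot (hLB ν₁ x1 hx1.ne)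
  intro t ht
  rcases eq_or_lt_of_le ht.1 with rfl | h0
  · rw [m0]; simp
  rcases eq_or_lt_of_le ht.2 with rfl | h1
  · rw [m1]; simp
  rw [ereal_top (1 - t) t _ (by linarith) h0 n0 n1 hE wr]
  exact le_top
end P27

/-- **Globalization in the decoupled cases `K = 0` and `N = ∞`:** on a non-branching
geodesic mm-space, local CD(0,N) (resp. CD(K,∞)) is equivalent to global CD(0,N)
(resp. CD(K,∞)). -/
theorem local_to_global_decoupled
    {X : Type*} [MetricSpace X] [CompleteSpace X] [TopologicalSpace.SeparableSpace X]
    [MeasurableSpace X] [BorelSpace X] (m : Measure X) [IsLocallyFiniteMeasure m]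
    (hsupp : mmSupp m = Set.univ) (hgeo : GeodesicSpace X) (hnb : NonBranching X) :
    (∀ N : ℝ, 1 < N → CDloc 0 N m → CD 0 N m) ∧
    (∀ K : ℝ, CDinftyLoc K m → CDinfty K m) := by
  haveI : SecondCountableTopology X := UniformSpace.secondCountable_of_separable X
  exact ⟨fun N hN h => glob_pow hgeo hnb hsupp hN h, fun K h => glob_log hgeo hnb hsupp h⟩

end
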